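/- Let χ (mod 𝔮) be a Hecke character with χ(H)=1, induced by the primitive character χ* (mod 𝔣_χ), and set F(s) = (L′/L)(s,χ*) and ξ = 1+r+iτ. Let T ≥ 1, let R ≥ 1 be sufficiently large, let 0 < r₀ < 1/16, and suppose R/ℒ ≤ r < r₀, |τ| ≤ T, and L(s,χ) has a non-trivial zero ρ with |1+iτ−ρ| ≤ r. If ε ∈ (0,1/4) and r₀ < ε/3.8, then δ(χ)·1_{|τ|<4r} + | ((−1)^k r^{k+1}/k!) · F^{(k)}(ξ) | ≫ e^{−16.6·φ·r·ℒ} / 2^{k+1}, where φ = 1 + (4/π)ε + 16ε², for some integer k satisfying 25.0·φ·r·ℒ ≤ k ≤ 28.8·φ·r·ℒ. -/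

import Mathlib

open scoped BigOperators
open Complex NumberField Filter Topology

noncomputable section

namespace RTZ

/-- The degree `n_K = [K : ℚ]` of a number field. -/
def nK (K : Type*) [Field K] [NumberField K] : ℕ := Module.finrank ℚ K

/-- The absolute value `D_K` of the discriminant of `K`. -/
def DK (K : Type*) [Field K] [NumberField K] : ℕ := (NumberField.discr K).natAbs

/-- An algebraic integer is totally positive if it is positive under every real embedding. -/
def TotPos (K : Type*) [Field K] [NumberField K] (α : 𝓞 K) : Prop :=
  ∀ φ : K →+* ℝ, 0 < φ (algebraMap (𝓞 K) K α)

/-- A Hecke (narrow ray class) character modulo `𝔮`, regarded as a function on integral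
ideals extended by zero: it is completely multiplicative, vanishes on ideals not coprime
to `𝔮`, has modulus one on ideals coprime to `𝔮`, and is trivial on principal ideals
generated by totally positive elements `α ≡ 1 (mod 𝔮)`. -/
structure HeckeChar (K : Type*) [Field K] [NumberField K] (𝔮 : Ideal (𝓞 K)) where
  toFun : Ideal (𝓞 K) → ℂ
  map_mul' : ∀ 𝔞 𝔟 : Ideal (𝓞 K), toFun (𝔞 * 𝔟) = toFun 𝔞 * toFun 𝔟
  eq_zero' : ∀ 𝔞 : Ideal (𝓞 K), ¬ IsCoprime 𝔞 𝔮 → toFun 𝔞 = 0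
  norm_one' : ∀ 𝔞 : Ideal (𝓞 K), IsCoprime 𝔞 𝔮 → ‖toFun 𝔞‖ = 1
  ray_one' : ∀ α : 𝓞 K, TotPos K α → α - 1 ∈ 𝔮 → toFun (Ideal.span {α}) = 1

variable {K : Type*} [Field K] [NumberField K]

/-- The trivial (principal) Hecke character condition. -/
def IsTrivialChar {𝔮 : Ideal (𝓞 K)} (χ : HeckeChar K 𝔮) : Prop :=
  ∀ 𝔞, IsCoprime 𝔞 𝔮 → χ.toFun 𝔞 = 1

open scoped Classical in
/-- `δ(χ)`: the indicator of the trivial character. -/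
def delta {𝔮 : Ideal (𝓞 K)} (χ : HeckeChar K 𝔮) : ℝ :=
  if IsTrivialChar χ then 1 else 0

/-- `χ' (mod 𝔣)` induces `χ (mod 𝔮)`: `𝔣 ∣ 𝔮` and the two characters agree on ideals
coprime to `𝔮`. -/
def Induces {𝔣 𝔮 : Ideal (𝓞 K)} (χ' : HeckeChar K 𝔣) (χ : HeckeChar K 𝔮) : Prop :=
  𝔮 ≤ 𝔣 ∧ ∀ 𝔞, IsCoprime 𝔞 𝔮 → χ.toFun 𝔞 = χ'.toFun 𝔞

/-- `𝔣` is the conductor `𝔣_χ` of `χ`: `χ` is induced from a character mod `𝔣`, and `𝔣`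
divides every modulus from which `χ` is induced. -/
def IsConductor {𝔮 : Ideal (𝓞 K)} (χ : HeckeChar K 𝔮) (𝔣 : Ideal (𝓞 K)) : Prop :=
  (∃ χ' : HeckeChar K 𝔣, Induces χ' χ) ∧
    ∀ 𝔣' : Ideal (𝓞 K), (∃ χ' : HeckeChar K 𝔣', Induces χ' χ) → 𝔣' ≤ 𝔣

/-- A Hecke character is primitive if its conductor equals its modulus. -/
def IsPrimitiveChar {𝔮 : Ideal (𝓞 K)} (χ : HeckeChar K 𝔮) : Prop := IsConductor χ 𝔮

/-- Two integral ideals lie in the same narrow ray class mod `𝔮`: `(α)𝔞 = (β)𝔟` for some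
totally positive `α, β ≡ 1 (mod 𝔮)`. -/
def rayEquiv (𝔮 𝔞 𝔟 : Ideal (𝓞 K)) : Prop :=
  ∃ α β : 𝓞 K, TotPos K α ∧ TotPos K β ∧ α - 1 ∈ 𝔮 ∧ β - 1 ∈ 𝔮 ∧
    Ideal.span {α} * 𝔞 = Ideal.span {β} * 𝔟

/-- A congruence class group `H (mod 𝔮)`: a subgroup of `I(𝔮)` containing `P_𝔮`, described
by the set of integral ideals whose narrow ray class lies in the subgroup. -/
structure CongClassGroup (K : Type*) [Field K] [NumberField K] (𝔮 : Ideal (𝓞 K)) where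
  mem : Ideal (𝓞 K) → Prop
  coprime' : ∀ 𝔞, mem 𝔞 → IsCoprime 𝔞 𝔮
  princ_mem' : ∀ α : 𝓞 K, TotPos K α → α - 1 ∈ 𝔮 → mem (Ideal.span {α})
  mul_mem' : ∀ 𝔞 𝔟, mem 𝔞 → mem 𝔟 → mem (𝔞 * 𝔟)
  class_mem' : ∀ 𝔞 𝔟, IsCoprime 𝔟 𝔮 → rayEquiv 𝔮 𝔞 𝔟 → mem 𝔞 → mem 𝔟

/-- `χ(H) = 1`: the character is trivial on the congruence class group `H`. -/
def CharTrivOn {𝔮 : Ideal (𝓞 K)} (χ : HeckeChar K 𝔮) (H : CongClassGroup K 𝔮) : Prop :=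
  ∀ 𝔞, H.mem 𝔞 → χ.toFun 𝔞 = 1

/-- The coset of `H` in `I(𝔮)` determined by an integral ideal `𝔞₀`. -/
def coset {𝔮 : Ideal (𝓞 K)} (H : CongClassGroup K 𝔮) (𝔞₀ : Ideal (𝓞 K)) :
    Set (Ideal (𝓞 K)) :=
  {𝔞 | ∃ 𝔥, H.mem 𝔥 ∧ rayEquiv 𝔮 (𝔞₀ * 𝔥) 𝔞}

/-- `h_H = [I(𝔮) : H]`, the number of cosets of `H`. -/
def hH {𝔮 : Ideal (𝓞 K)} (H : CongClassGroup K 𝔮) : ℕ :=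
  Nat.card {C : Set (Ideal (𝓞 K)) // ∃ 𝔞₀, IsCoprime 𝔞₀ 𝔮 ∧ C = coset H 𝔞₀}

/-- `Q = Q_H = max { N𝔣_χ : χ (mod 𝔮), χ(H) = 1 }`. -/
def QH {𝔮 : Ideal (𝓞 K)} (H : CongClassGroup K 𝔮) : ℕ :=
  sSup {n | ∃ (χ : HeckeChar K 𝔮) (𝔣 : Ideal (𝓞 K)),
    CharTrivOn χ H ∧ IsConductor χ 𝔣 ∧ n = Ideal.absNorm 𝔣}

/-- `𝔣_H = lcm { 𝔣_χ : χ(H) = 1 }` (the lcm of ideals is their infimum). -/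
def fH {𝔮 : Ideal (𝓞 K)} (H : CongClassGroup K 𝔮) : Ideal (𝓞 K) :=
  sInf {𝔣 | ∃ χ : HeckeChar K 𝔮, CharTrivOn χ H ∧ IsConductor χ 𝔣}

/-- A congruence class group `H (mod 𝔮)` is primitive if `𝔮 = 𝔣_H`. -/
def IsPrimitiveCCG {𝔮 : Ideal (𝓞 K)} (H : CongClassGroup K 𝔮) : Prop := 𝔮 = fH H

/-- The Dirichlet series `Σ_𝔫 χ(𝔫) N𝔫^{-s}` of a Hecke character. -/
def LSer {𝔮 : Ideal (𝓞 K)} (χ : HeckeChar K 𝔮) (s : ℂ) : ℂ :=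
  ∑' 𝔞 : {I : Ideal (𝓞 K) // I ≠ ⊥}, χ.toFun 𝔞.1 * (Ideal.absNorm 𝔞.1 : ℂ) ^ (-s)

/-- `L` is "the" Hecke `L`-function of `χ`: analytic away from `s = 1` and given by the
Dirichlet series on `Re s > 1` (this determines `L` away from `s = 1`). -/
def IsLFun {𝔮 : Ideal (𝓞 K)} (χ : HeckeChar K 𝔮) (L : ℂ → ℂ) : Prop :=
  (∀ s : ℂ, s ≠ 1 → DifferentiableAt ℂ L s) ∧ ∀ s : ℂ, 1 < s.re → L s = LSer χ s

/-- The Dedekind zeta series of `K`. -/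
def zetaSer (K : Type*) [Field K] [NumberField K] (s : ℂ) : ℂ :=
  ∑' 𝔞 : {I : Ideal (𝓞 K) // I ≠ ⊥}, (Ideal.absNorm 𝔞.1 : ℂ) ^ (-s)

/-- `Z` is "the" Dedekind zeta function of `K`. -/
def IsZetaFun (K : Type*) [Field K] [NumberField K] (Z : ℂ → ℂ) : Prop :=
  (∀ s : ℂ, s ≠ 1 → DifferentiableAt ℂ Z s) ∧ ∀ s : ℂ, 1 < s.re → Z s = zetaSer K s

/-- `L` vanishes at `ρ` to order at least `m`. -/
def ZeroOrderAtLeast (L : ℂ → ℂ) (ρ : ℂ) (m : ℕ) : Prop :=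
  ∃ g : ℂ → ℂ, AnalyticAt ℂ g ρ ∧ ∀ᶠ z in nhds ρ, L z = (z - ρ) ^ m * g z

/-- `L` vanishes at `ρ` to order exactly `m`. -/
def ZeroOrderExact (L : ℂ → ℂ) (ρ : ℂ) (m : ℕ) : Prop :=
  ∃ g : ℂ → ℂ, AnalyticAt ℂ g ρ ∧ g ρ ≠ 0 ∧ ∀ᶠ z in nhds ρ, L z = (z - ρ) ^ m * g z

open scoped Classical in
/-- The von Mangoldt function `Λ_K` of the field `K`. -/
def ΛK (K : Type*) [Field K] [NumberField K] (𝔫 : Ideal (𝓞 K)) : ℝ :=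
  if h : ∃ (𝔭 : Ideal (𝓞 K)) (k : ℕ), 𝔭.IsPrime ∧ 𝔭 ≠ ⊥ ∧ 1 ≤ k ∧ 𝔫 = 𝔭 ^ k
  then Real.log (Ideal.absNorm h.choose) else 0

/-- The residue `κ_K` of `ζ_K` at `s = 1`, characterized as a limit of the real Dirichlet
series. -/
def IsResidue (K : Type*) [Field K] [NumberField K] (κ : ℝ) : Prop :=
  Filter.Tendsto (fun σ : ℝ => (σ - 1) *
      ∑' 𝔞 : {I : Ideal (𝓞 K) // I ≠ ⊥}, (Ideal.absNorm 𝔞.1 : ℝ) ^ (-σ))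
    (nhdsWithin 1 (Set.Ioi 1)) (nhds κ)

/-- `γ_K`, the Euler–Kronecker constant: `ζ_K(s) - κ_K/(s-1) → κ_K γ_K` as `s → 1⁺`. -/
def IsEulerKronecker (K : Type*) [Field K] [NumberField K] (κ γK : ℝ) : Prop :=
  Filter.Tendsto (fun σ : ℝ =>
      (∑' 𝔞 : {I : Ideal (𝓞 K) // I ≠ ⊥}, (Ideal.absNorm 𝔞.1 : ℝ) ^ (-σ)) - κ / (σ - 1))
    (nhdsWithin 1 (Set.Ioi 1)) (nhds (κ * γK))

set_option linter.unusedSectionVars false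

section PoissonSummation

variable {d : Type*} [Fintype d]

lemma summable_pi_prod {g : d → ℤ → ℝ} (hg0 : ∀ i n, 0 ≤ g i n) (hg : ∀ i, Summable (g i)) :
    Summable fun m : d → ℤ => ∏ i, g i (m i) := by
  classical
  refine summable_of_sum_le (c := ∏ i, ∑' n, g i n)
    (fun m => Finset.prod_nonneg fun i _ => hg0 i _) fun s => ?_
  calc ∑ m ∈ s, ∏ i, g i (m i)
      ≤ ∑ m ∈ Fintype.piFinset fun i => s.image fun m => m i, ∏ i, g i (m i) := by
        refine Finset.sum_le_sum_of_subset_of_nonneg (fun m hm => ?_)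
          fun m _ _ => Finset.prod_nonneg fun i _ => hg0 i _
        rw [Fintype.mem_piFinset]
        exact fun i => Finset.mem_image_of_mem _ hm
    _ = ∏ i, ∑ n ∈ s.image fun m => m i, g i n := by rw [Finset.prod_univ_sum]
    _ ≤ ∏ i, ∑' n, g i n := Finset.prod_le_prod
        (fun i _ => Finset.sum_nonneg fun n _ => hg0 i n)
        fun i _ => (hg i).sum_le_tsum _ fun n _ => hg0 i n

lemma summable_exp_neg_int_sq {c : ℝ} (hc : 0 < c) :
    Summable fun n : ℤ => Real.exp (-c * (n : ℝ) ^ 2) := by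
  have h := (summable_pow_mul_jacobiTheta₂_term_bound 0 (T := c / Real.pi) (by positivity) 0)
  refine h.congr fun n => ?_
  simp only [pow_zero, one_mul]
  congr 1
  field_simp
  simp

lemma gaussian_shift_le {c : ℝ} (hc : 0 < c) (x m : ℝ) :
    Real.exp (-c * (x + m) ^ 2) ≤ Real.exp (c * x ^ 2) * Real.exp (-(c / 2) * m ^ 2) := by
  rw [← Real.exp_add, Real.exp_le_exp]
  nlinarith [mul_nonneg hc.le (sq_nonneg (2 * x + m))]

/-- A function on `ℝᵈ` with Gaussian decay. -/
structure GaussDecay (f : (d → ℝ) → ℂ) : Prop where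
  cont : Continuous f
  bound : ∃ C c : ℝ, 0 ≤ C ∧ 0 < c ∧ ∀ x, ‖f x‖ ≤ C * ∏ i, Real.exp (-c * x i ^ 2)

lemma GaussDecay.shift_bound {f : (d → ℝ) → ℂ} (hf : GaussDecay f) (B : ℝ) :
    ∃ u : (d → ℤ) → ℝ, Summable u ∧ ∀ x : d → ℝ, (∀ i, |x i| ≤ B) → ∀ m : d → ℤ,
      ‖f (x + fun i => (m i : ℝ))‖ ≤ u m := by
  obtain ⟨C, c, hC, hc, hb⟩ := hf.bound
  refine ⟨fun m => C * ((∏ i : d, Real.exp (c * B ^ 2)) *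
    ∏ i, Real.exp (-(c / 2) * (m i : ℝ) ^ 2)), ?_, ?_⟩
  · refine ((summable_pi_prod (fun _ _ => (Real.exp_pos _).le)
      fun i => summable_exp_neg_int_sq (half_pos hc)).mul_left _).mul_left _
  · intro x hx m
    refine (hb _).trans (mul_le_mul_of_nonneg_left ?_ hC)
    rw [← Finset.prod_mul_distrib]
    refine Finset.prod_le_prod (fun i _ => (Real.exp_pos _).le) fun i _ => ?_
    refine (gaussian_shift_le hc _ _).trans ?_
    gcongr ?_ * _
    refine Real.exp_le_exp.2 (mul_le_mul_of_nonneg_left ?_ hc.le)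
    exact sq_le_sq' (abs_le.1 (hx i)).1 (abs_le.1 (hx i)).2

lemma GaussDecay.integrable {f : (d → ℝ) → ℂ} (hf : GaussDecay f) :
    MeasureTheory.Integrable f := by
  obtain ⟨C, c, hC, hc, hb⟩ := hf.bound
  have h1 : MeasureTheory.Integrable fun x : d → ℝ => C * ∏ i, Real.exp (-c * x i ^ 2) :=
    (MeasureTheory.Integrable.fintype_prod
      (f := fun _ : d => fun t : ℝ => Real.exp (-c * t ^ 2))
      fun i => integrable_exp_neg_mul_sq hc).const_mul C
  exact h1.mono' hf.cont.aestronglyMeasurable (MeasureTheory.ae_of_all _ hb)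

/-- Periodization. -/
def perSum (f : (d → ℝ) → ℂ) (x : d → ℝ) : ℂ := ∑' m : d → ℤ, f (x + fun i => (m i : ℝ))

lemma perSum_continuous {f : (d → ℝ) → ℂ} (hf : GaussDecay f) : Continuous (perSum f) := by
  rw [continuous_iff_continuousAt]
  intro x
  obtain ⟨u, hu, hb⟩ := hf.shift_bound (‖x‖ + 1)
  have : ContinuousOn (perSum f) (Metric.ball x 1) := by
    refine continuousOn_tsum (fun m => ?_) hu fun m y hy => hb y (fun i => ?_) m
    · exact (hf.cont.comp (by fun_prop)).continuousOn
    · have h1 : ‖y‖ ≤ ‖x‖ + 1 := by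
        have := norm_sub_norm_le y x
        have h2 := mem_ball_iff_norm.1 hy
        linarith
      exact (norm_le_pi_norm y i).trans h1
  exact this.continuousAt (Metric.ball_mem_nhds x one_pos)

lemma perSum_add_int (f : (d → ℝ) → ℂ) (x : d → ℝ) (k : d → ℤ) :
    perSum f (x + fun i => (k i : ℝ)) = perSum f x := by
  unfold perSum
  rw [← (Equiv.addLeft k).tsum_eq fun m : d → ℤ => f (x + fun i => (m i : ℝ))]
  refine tsum_congr fun m => congrArg f ?_
  ext i
  simp [add_assoc]

/-- The periodization, as a function on the torus. -/
def perTorus (f : (d → ℝ) → ℂ) (y : UnitAddTorus d) : ℂ :=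
  perSum f fun i => (AddCircle.equivIco (1 : ℝ) 0 (y i)).1

lemma perTorus_coe (f : (d → ℝ) → ℂ) (x : d → ℝ) :
    perTorus f (fun i => (x i : UnitAddCircle)) = perSum f x := by
  unfold perTorus
  have h : ∀ i, ∃ n : ℤ, ((AddCircle.equivIco (1 : ℝ) 0 (x i : UnitAddCircle)).1 : ℝ) =
      x i + n := by
    intro i
    rw [AddCircle.coe_equivIco_mk_apply]
    refine ⟨-⌊x i⌋, ?_⟩
    simp [Int.fract, sub_eq_add_neg]
  choose n hn using h
  rw [← perSum_add_int f x n]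
  congr 1
  ext i
  exact hn i

lemma perTorus_continuous {f : (d → ℝ) → ℂ} (hf : GaussDecay f) : Continuous (perTorus f) := by
  have hq : IsOpenQuotientMap (Pi.map fun _ : d => ((↑) : ℝ → UnitAddCircle)) :=
    IsOpenQuotientMap.piMap fun _ => QuotientAddGroup.isOpenQuotientMap_mk
  rw [hq.isQuotientMap.continuous_iff]
  have : perTorus f ∘ (Pi.map fun _ : d => ((↑) : ℝ → UnitAddCircle)) = perSum f := by
    ext x
    exact perTorus_coe f x
  rw [this]
  exact perSum_continuous hf

/-- The additive character `e(k · x)`. -/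
def eChar (k : d → ℤ) (x : d → ℝ) : ℂ :=
  Complex.exp (2 * Real.pi * Complex.I * ((∑ i, (k i : ℝ) * x i : ℝ) : ℂ))

lemma eChar_norm (k : d → ℤ) (x : d → ℝ) : ‖eChar k x‖ = 1 := by
  unfold eChar
  rw [show 2 * (Real.pi : ℂ) * Complex.I * ((∑ i, (k i : ℝ) * x i : ℝ) : ℂ) =
    ((2 * Real.pi * ∑ i, (k i : ℝ) * x i : ℝ) : ℂ) * Complex.I by push_cast; ring]
  exact Complex.norm_exp_ofReal_mul_I _

lemma eChar_continuous (k : d → ℤ) : Continuous (eChar k) := by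
  unfold eChar
  fun_prop

lemma eChar_add_int (k : d → ℤ) (x : d → ℝ) (m : d → ℤ) :
    eChar k (x + fun i => (m i : ℝ)) = eChar k x := by
  unfold eChar
  rw [Complex.exp_eq_exp_iff_exists_int]
  refine ⟨∑ i, k i * m i, ?_⟩
  simp only [Pi.add_apply, mul_add, Finset.sum_add_distrib]
  push_cast
  ring

lemma mFourier_coe (k : d → ℤ) (x : d → ℝ) :
    UnitAddTorus.mFourier k (fun i => (x i : UnitAddCircle)) = eChar k x := by
  simp only [UnitAddTorus.mFourier, ContinuousMap.coe_mk, fourier_coe_apply, eChar]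
  rw [← Complex.exp_sum]
  congr 1
  push_cast
  rw [Finset.mul_sum]
  refine Finset.sum_congr rfl fun i _ => ?_
  simp
  ring

lemma integral_eq_tsum_cube {g : (d → ℝ) → ℂ} (hg : MeasureTheory.Integrable g) :
    ∫ x, g x = ∫ x in {x : d → ℝ | ∀ i, x i ∈ Set.Ioc (0 : ℝ) (0 + 1)},
      ∑' m : d → ℤ, g (x + fun i => (m i : ℝ)) := by
  set Q : Set (d → ℝ) := {x : d → ℝ | ∀ i, x i ∈ Set.Ioc (0 : ℝ) (0 + 1)} with hQ
  have hQm : MeasurableSet Q := by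
    have : Q = Set.univ.pi fun _ => Set.Ioc (0 : ℝ) (0 + 1) := by
      ext x; simp [hQ]
    rw [this]
    exact MeasurableSet.univ_pi fun _ => measurableSet_Ioc
  set s : (d → ℤ) → Set (d → ℝ) := fun m => (fun x => x - fun i => (m i : ℝ)) ⁻¹' Q with hs
  have hsm : ∀ m, MeasurableSet (s m) := fun m => by
    exact (measurable_id.sub_const (fun i : d => (m i : ℝ))) hQm
  have hU : ⋃ m, s m = Set.univ := by
    refine Set.eq_univ_of_forall fun x => Set.mem_iUnion.2 ⟨fun i => ⌈x i⌉ - 1, fun i => ?_⟩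
    simp only [Pi.sub_apply, Set.mem_Ioc]
    push_cast
    constructor <;> linarith [Int.le_ceil (x i), Int.ceil_lt_add_one (x i)]
  have hd : Pairwise (Function.onFun Disjoint s) := by
    intro m m' hmm
    refine Set.disjoint_left.2 fun x hx hx' => hmm (funext fun i => ?_)
    have h1 := hx i
    have h2 := hx' i
    simp only [Pi.sub_apply, Set.mem_Ioc] at h1 h2
    have h3 : (m i : ℝ) < m' i + 1 := by linarith
    have h4 : (m' i : ℝ) < m i + 1 := by linarith
    have h5 : m i < m' i + 1 := by exact_mod_cast h3
    have h6 : m' i < m i + 1 := by exact_mod_cast h4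
    omega
  have htr : ∀ (E : Type) [NormedAddCommGroup E] [NormedSpace ℝ E] (h : (d → ℝ) → E) (m : d → ℤ),
      ∫ x in s m, h x = ∫ x in Q, h (x + fun i => (m i : ℝ)) := by
    intro E _ _ h m
    have := (MeasureTheory.measurePreserving_sub_right
      (MeasureTheory.volume : MeasureTheory.Measure (d → ℝ))
      (fun i => (m i : ℝ))).setIntegral_preimage_emb
      (MeasurableEquiv.subRight (fun i : d => (m i : ℝ))).measurableEmbedding
      (fun x => h (x + fun i => (m i : ℝ))) Q
    simpa using this
  have h1 := MeasureTheory.hasSum_integral_iUnion hsm hd (f := g) (μ := MeasureTheory.volume)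
    hg.integrableOn
  have h2 := MeasureTheory.hasSum_integral_iUnion hsm hd (f := fun x => ‖g x‖)
    (μ := MeasureTheory.volume) hg.norm.integrableOn
  rw [hU, MeasureTheory.setIntegral_univ] at h1
  have h3 := MeasureTheory.hasSum_integral_of_summable_integral_norm
    (μ := MeasureTheory.volume.restrict Q)
    (F := fun (m : d → ℤ) x => g (x + fun i => (m i : ℝ)))
    (fun m => (hg.comp_add_right _).integrableOn)
    (by simpa only [← htr ℝ (fun x => ‖g x‖)] using h2.summable)
  rw [← h1.tsum_eq, ← h3.tsum_eq]
  exact tsum_congr fun m => htr ℂ g m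

lemma mFourierCoeff_perTorus {f : (d → ℝ) → ℂ} (hf : GaussDecay f) (n : d → ℤ) :
    UnitAddTorus.mFourierCoeff (perTorus f) n = ∫ x, eChar (-n) x * f x := by
  rw [UnitAddTorus.mFourierCoeff_eq_integral _ _ (fun _ => 0)]
  rw [integral_eq_tsum_cube]
  · refine MeasureTheory.integral_congr_ae (MeasureTheory.ae_of_all _ fun x => ?_)
    simp only [perTorus_coe, mFourier_coe, eChar_add_int, tsum_mul_left, smul_eq_mul]
    rfl
  · refine hf.integrable.bdd_mul (c := 1) (eChar_continuous _).aestronglyMeasurable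
      (MeasureTheory.ae_of_all _ fun x => (eChar_norm _ _).le)

/-- Poisson summation on `ℤᵈ`. -/
theorem poisson_summation {f : (d → ℝ) → ℂ} (hf : GaussDecay f)
    (hs : Summable fun n : d → ℤ => ∫ x, eChar (-n) x * f x) (a : d → ℝ) :
    HasSum (fun n : d → ℤ => (∫ x, eChar (-n) x * f x) * eChar n a) (perSum f a) := by
  have := UnitAddTorus.hasSum_mFourier_series_apply_of_summable
    (f := ⟨perTorus f, perTorus_continuous hf⟩)
    (hs.congr fun n => (mFourierCoeff_perTorus hf n).symm)
    (fun i => (a i : UnitAddCircle))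
  simpa only [ContinuousMap.coe_mk, mFourierCoeff_perTorus hf, mFourier_coe, smul_eq_mul,
    perTorus_coe] using this

end PoissonSummation

section LocalFourier

lemma fourier_gauss_even {g : ℝ} (hg : 0 < g) (w : ℝ) :
    ∫ x : ℝ, cexp (-Real.pi * (g * x) ^ 2) * cexp (2 * Real.pi * I * (-(w * x) : ℝ)) =
      (g : ℂ)⁻¹ * cexp (-Real.pi * (w / g) ^ 2) := by
  have hb : ((-(Real.pi * g ^ 2) : ℝ) : ℂ).re < 0 := by
    rw [ofReal_re]
    have := Real.pi_pos
    have : 0 < Real.pi * g ^ 2 := by positivity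
    linarith
  have h := integral_cexp_quadratic hb (-(2 * Real.pi * I * w)) 0
  have hg' : (g : ℂ) ≠ 0 := by exact_mod_cast hg.ne'
  have hpi : (Real.pi : ℂ) ≠ 0 := by exact_mod_cast Real.pi_ne_zero
  calc _ = ∫ x : ℝ, cexp (((-(Real.pi * g ^ 2) : ℝ) : ℂ) * x ^ 2 + -(2 * Real.pi * I * w) * x + 0) := by
        congr 1
        ext x
        rw [← Complex.exp_add]
        congr 1
        push_cast
        ring
    _ = _ := by
        rw [h]
        congr 1
        · rw [show (Real.pi : ℂ) / -((-(Real.pi * g ^ 2) : ℝ) : ℂ) = ((g⁻¹ ^ 2 : ℝ) : ℂ) by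
            push_cast; field_simp]
          rw [show (1 / 2 : ℂ) = ((1 / 2 : ℝ) : ℂ) by push_cast; ring,
            ← Complex.ofReal_cpow (by positivity), ← Real.sqrt_eq_rpow,
            Real.sqrt_sq (by positivity)]
          push_cast
          rfl
        · congr 1
          push_cast
          field_simp
          ring_nf
          simp only [I_sq]
          ring

lemma integrable_gauss_twist {g : ℝ} (hg : 0 < g) (w : ℝ) :
    MeasureTheory.Integrable fun x : ℝ =>
      cexp (-Real.pi * (g * x) ^ 2) * cexp (2 * Real.pi * I * (-(w * x) : ℝ)) := by
  have hb : 0 < ((Real.pi * g ^ 2 : ℝ) : ℂ).re := by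
    rw [ofReal_re]
    have := Real.pi_pos
    positivity
  refine (integrable_cexp_quadratic hb (-(2 * Real.pi * I * w)) 0).congr
    (MeasureTheory.ae_of_all _ fun x => ?_)
  simp only
  rw [← Complex.exp_add]
  congr 1
  push_cast
  ring

lemma integrable_mul_gauss_twist {g : ℝ} (hg : 0 < g) (w : ℝ) :
    MeasureTheory.Integrable fun x : ℝ =>
      (g * x : ℂ) * cexp (-Real.pi * (g * x) ^ 2) * cexp (2 * Real.pi * I * (-(w * x) : ℝ)) := by
  have h1 : MeasureTheory.Integrable fun x : ℝ => g * (x * Real.exp (-(Real.pi * g ^ 2) * x ^ 2)) :=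
    (integrable_mul_exp_neg_mul_sq (by have := Real.pi_pos; positivity)).const_mul g
  refine h1.norm.mono' (by fun_prop) (MeasureTheory.ae_of_all _ fun x => le_of_eq ?_)
  rw [norm_mul, norm_mul,
    show 2 * (Real.pi : ℂ) * I * (-(w * x) : ℝ) = ((2 * Real.pi * -(w * x) : ℝ) : ℂ) * I by
      push_cast; ring, Complex.norm_exp_ofReal_mul_I, mul_one,
    show (-(Real.pi : ℂ) * (g * x) ^ 2) = ((-(Real.pi * g ^ 2) * x ^ 2 : ℝ) : ℂ) by push_cast; ring,
    ← Complex.ofReal_exp, ← Complex.ofReal_mul, ← norm_mul, ← Complex.ofReal_mul,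
    Complex.norm_real, mul_assoc]

lemma fourier_gauss_odd {g : ℝ} (hg : 0 < g) (w : ℝ) :
    ∫ x : ℝ, (g * x : ℂ) * cexp (-Real.pi * (g * x) ^ 2) * cexp (2 * Real.pi * I * (-(w * x) : ℝ)) =
      -I * ((g : ℂ)⁻¹ * ((w / g) * cexp (-Real.pi * (w / g) ^ 2))) := by
  have hg' : (g : ℂ) ≠ 0 := by exact_mod_cast hg.ne'
  have hpi : (Real.pi : ℂ) ≠ 0 := by exact_mod_cast Real.pi_ne_zero
  set E : ℝ → ℂ := fun x =>
    cexp (-Real.pi * (g * x) ^ 2) * cexp (2 * Real.pi * I * (-(w * x) : ℝ)) with hE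
  have hi := integrable_gauss_twist hg w
  have hi2 := integrable_mul_gauss_twist hg w
  have hder : ∀ x : ℝ, HasDerivAt E ((-(2 * Real.pi * g)) * ((g * x : ℂ) *
      cexp (-Real.pi * (g * x) ^ 2) * cexp (2 * Real.pi * I * (-(w * x) : ℝ))) +
      (-(2 * Real.pi * I * w)) * E x) x := by
    intro x
    have h1 : HasDerivAt (fun z : ℂ => cexp (-Real.pi * (g * z) ^ 2) *
        cexp (2 * Real.pi * I * (-(w * z)))) (cexp (-Real.pi * (g * x) ^ 2) *
        (-Real.pi * (2 * (g * x) * g)) * cexp (2 * Real.pi * I * (-(w * x))) +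
        cexp (-Real.pi * (g * x) ^ 2) * (cexp (2 * Real.pi * I * (-(w * x))) *
        (2 * Real.pi * I * (-w)))) x := by
      refine HasDerivAt.mul (HasDerivAt.cexp ?_) (HasDerivAt.cexp ?_)
      · refine HasDerivAt.const_mul _ ?_
        have := ((hasDerivAt_id (x : ℂ)).const_mul (g : ℂ)).pow 2
        simpa using! this
      · refine HasDerivAt.const_mul _ ?_
        have := ((hasDerivAt_id (x : ℂ)).const_mul (w : ℂ)).neg
        simpa using! this
    have h2 := h1.comp_ofReal
    have h3 : E = fun y : ℝ => cexp (-Real.pi * (g * y) ^ 2) *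
        cexp (2 * Real.pi * I * (-(w * y))) := by
      ext y; simp [hE]
    rw [h3]
    convert h2 using 1
    push_cast
    ring
  have h0 := MeasureTheory.integral_eq_zero_of_hasDerivAt_of_integrable hder
    ((hi2.const_mul _).add (hi.const_mul _)) hi
  rw [MeasureTheory.integral_add (hi2.const_mul _) (hi.const_mul _),
    MeasureTheory.integral_const_mul, MeasureTheory.integral_const_mul,
    fourier_gauss_even hg w] at h0
  have h4 : (-(2 * Real.pi * g) : ℂ) ≠ 0 := by simp [hpi, hg']
  apply mul_left_cancel₀ h4
  rw [eq_neg_of_add_eq_zero_left h0]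
  field_simp

lemma fourier_gauss_complex {g : ℝ} (hg : 0 < g) (w : ℂ) :
    ∫ z : ℂ, cexp (-(2 * Real.pi) * ((g * ‖z‖ : ℝ) : ℂ) ^ 2) *
        cexp (2 * Real.pi * I * (-(2 * (w * z).re) : ℝ)) =
      (2 * (g : ℂ) ^ 2)⁻¹ * cexp (-(2 * Real.pi) * ((‖w‖ / g : ℝ) : ℂ) ^ 2) := by
  have hg' : (g : ℂ) ≠ 0 := by exact_mod_cast hg.ne'
  have hpi : (Real.pi : ℂ) ≠ 0 := by exact_mod_cast Real.pi_ne_zero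
  have hb : 0 < ((2 * Real.pi * g ^ 2 : ℝ) : ℂ).re := by
    rw [ofReal_re]
    have := Real.pi_pos
    positivity
  have h := GaussianFourier.integral_cexp_neg_mul_sq_norm_add (V := ℂ) hb (-(4 * Real.pi * I))
    ((starRingEnd ℂ) w)
  have hin : ∀ z : ℂ, inner ℝ ((starRingEnd ℂ) w) z = (w * z).re := by
    intro z
    rw [Complex.inner]
    simp [mul_comm]
  calc _ = ∫ z : ℂ, cexp (-((2 * Real.pi * g ^ 2 : ℝ) : ℂ) * ‖z‖ ^ 2 +
        -(4 * Real.pi * I) * (inner ℝ ((starRingEnd ℂ) w) z : ℝ)) := by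
        congr 1
        ext z
        rw [← Complex.exp_add, hin]
        congr 1
        push_cast
        ring
    _ = _ := by
        rw [h, Complex.finrank_real_complex]
        congr 1
        · norm_num
          field_simp
        · congr 1
          rw [RCLike.norm_conj]
          push_cast
          field_simp
          ring_nf
          simp only [I_sq]
          ring

end LocalFourier

section MixedFourier

open NumberField.InfinitePlace NumberField.mixedEmbedding
section
open scoped Classical

variable {K : Type*} [Field K] [NumberField K]

/-- The test function on the mixed space: a scaled Gaussian, multiplied by the coordinates at the
real places in `S`. -/
def testF (S : Finset {w : InfinitePlace K // IsReal w}) (g : InfinitePlace K → ℝ)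
    (z : mixedSpace K) : ℂ :=
  (∏ v : {w : InfinitePlace K // IsReal w},
    (if v ∈ S then ((g v * z.1 v : ℝ) : ℂ) else 1) * cexp (-Real.pi * ((g v * z.1 v : ℝ) : ℂ) ^ 2)) *
  ∏ v : {w : InfinitePlace K // IsComplex w},
    cexp (-(2 * Real.pi) * ((g v * ‖z.2 v‖ : ℝ) : ℂ) ^ 2)

/-- The trace pairing on the mixed space. -/
def trPair (w z : mixedSpace K) : ℝ :=
  ∑ v, w.1 v * z.1 v + ∑ v, 2 * (w.2 v * z.2 v).re

/-- The norm of a vector of scalings. -/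
def scNorm (g : InfinitePlace K → ℝ) : ℝ := ∏ v, g v ^ v.mult

lemma prod_mult_split {M : Type*} [CommMonoid M] (f : InfinitePlace K → M) :
    ∏ v, f v = (∏ v : {w : InfinitePlace K // IsReal w}, f v) *
      ∏ v : {w : InfinitePlace K // IsComplex w}, f v := by
  rw [← Fintype.prod_subtype_mul_prod_subtype (fun w : InfinitePlace K => IsReal w) f]
  congr 1
  exact Fintype.prod_equiv (Equiv.subtypeEquivRight fun w => not_isReal_iff_isComplex) _ _
    fun _ => rfl

lemma scNorm_split (g : InfinitePlace K → ℝ) :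
    scNorm g = (∏ v : {w : InfinitePlace K // IsReal w}, g v) *
      ∏ v : {w : InfinitePlace K // IsComplex w}, g v ^ 2 := by
  unfold scNorm
  rw [prod_mult_split]
  congr 1
  · exact Finset.prod_congr rfl fun v _ => by rw [mult_isReal, pow_one]
  · exact Finset.prod_congr rfl fun v _ => by rw [mult_isComplex]

lemma fourier_testF (S : Finset {w : InfinitePlace K // IsReal w}) {g : InfinitePlace K → ℝ}
    (hg : ∀ v, 0 < g v) (w : mixedSpace K) :
    ∫ z, testF S g z * cexp (2 * Real.pi * I * (-(trPair w z) : ℝ)) =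
      (-I) ^ S.card * ((scNorm g : ℂ) * 2 ^ nrComplexPlaces K)⁻¹ *
        testF S (fun v => (g v)⁻¹) w := by
  set A : {w : InfinitePlace K // IsReal w} → ℝ → ℂ := fun v x =>
    ((if v ∈ S then ((g v * x : ℝ) : ℂ) else 1) * cexp (-Real.pi * ((g v * x : ℝ) : ℂ) ^ 2)) *
      cexp (2 * Real.pi * I * (-(w.1 v * x) : ℝ)) with hA
  set B : {w : InfinitePlace K // IsComplex w} → ℂ → ℂ := fun v z =>
    cexp (-(2 * Real.pi) * ((g v * ‖z‖ : ℝ) : ℂ) ^ 2) *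
      cexp (2 * Real.pi * I * (-(2 * (w.2 v * z).re) : ℝ)) with hB
  have h1 : ∀ z : mixedSpace K, testF S g z * cexp (2 * Real.pi * I * (-(trPair w z) : ℝ)) =
      (∏ v, A v (z.1 v)) * ∏ v, B v (z.2 v) := by
    intro z
    simp only [hA, hB, testF]
    have e1 : ∏ v : {w : InfinitePlace K // IsReal w},
        cexp (2 * Real.pi * I * (-(w.1 v * z.1 v) : ℝ)) =
        cexp (∑ v : {w : InfinitePlace K // IsReal w},
          2 * Real.pi * I * (-(w.1 v * z.1 v) : ℝ)) := (Complex.exp_sum _ _).symm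
    have e2 : ∏ v : {w : InfinitePlace K // IsComplex w},
        cexp (2 * Real.pi * I * (-(2 * (w.2 v * z.2 v).re) : ℝ)) =
        cexp (∑ v : {w : InfinitePlace K // IsComplex w},
          2 * Real.pi * I * (-(2 * (w.2 v * z.2 v).re) : ℝ)) := (Complex.exp_sum _ _).symm
    rw [Finset.prod_mul_distrib (f := fun v : {w : InfinitePlace K // IsReal w} =>
        (if v ∈ S then ((g v * z.1 v : ℝ) : ℂ) else 1) *
          cexp (-Real.pi * ((g v * z.1 v : ℝ) : ℂ) ^ 2)),
      Finset.prod_mul_distrib (f := fun v : {w : InfinitePlace K // IsComplex w} =>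
        cexp (-(2 * Real.pi) * ((g v * ‖z.2 v‖ : ℝ) : ℂ) ^ 2)), e1, e2]
    rw [mul_mul_mul_comm, ← Complex.exp_add]
    congr 2
    rw [← Finset.mul_sum, ← Finset.mul_sum, ← mul_add]
    congr 1
    unfold trPair
    push_cast
    rw [Finset.sum_neg_distrib, Finset.sum_neg_distrib]
    ring
  simp_rw [h1]
  have h2 : ∫ z : mixedSpace K, (∏ v, A v (z.1 v)) * ∏ v, B v (z.2 v) =
      (∏ v, ∫ x, A v x) * ∏ v, ∫ x, B v x := by
    rw [← MeasureTheory.integral_fintype_prod_volume_eq_prod,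
      ← MeasureTheory.integral_fintype_prod_volume_eq_prod]
    exact MeasureTheory.integral_prod_mul (fun x : {w : InfinitePlace K // IsReal w} → ℝ =>
      ∏ v, A v (x v)) (fun y : {w : InfinitePlace K // IsComplex w} → ℂ => ∏ v, B v (y v))
  rw [h2]
  have h3 : ∀ v, ∫ x, A v x = (if v ∈ S then -I else 1) * ((g v : ℂ)⁻¹ *
      ((if v ∈ S then (((g v)⁻¹ * w.1 v : ℝ) : ℂ) else 1) *
        cexp (-Real.pi * (((g v)⁻¹ * w.1 v : ℝ) : ℂ) ^ 2))) := by
    intro v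
    by_cases hv : v ∈ S
    · simp only [hA, hv, if_true]
      have := fourier_gauss_odd (hg v) (w.1 v)
      push_cast at this ⊢
      rw [this, div_eq_inv_mul]
    · simp only [hA, hv, if_false]
      have := fourier_gauss_even (hg v) (w.1 v)
      push_cast at this ⊢
      rw [one_mul, one_mul]
      simp only [one_mul]
      rw [this, div_eq_inv_mul]
  have h4 : ∀ v, ∫ x, B v x = ((2 * (g v : ℂ) ^ 2)⁻¹ *
      cexp (-(2 * Real.pi) * (((g v)⁻¹ * ‖w.2 v‖ : ℝ) : ℂ) ^ 2)) := by
    intro v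
    simp only [hB]
    rw [fourier_gauss_complex (hg v) (w.2 v), div_eq_inv_mul]
  simp_rw [h3, h4]
  rw [Finset.prod_mul_distrib, Finset.prod_mul_distrib (f := fun v => (g _ : ℂ)⁻¹),
    Finset.prod_mul_distrib (f := fun v => (2 * (g _ : ℂ) ^ 2)⁻¹)]
  have h5 : ∏ v : {w : InfinitePlace K // IsReal w}, (if v ∈ S then -I else 1) =
      (-I) ^ S.card := by
    rw [Finset.prod_ite_mem, Finset.univ_inter, Finset.prod_const]
  rw [h5, scNorm_split]
  unfold testF
  push_cast
  rw [Finset.prod_inv_distrib, Finset.prod_inv_distrib, Finset.prod_mul_distrib (f := fun _ => (2:ℂ)),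
    Finset.prod_const, Finset.card_univ, show Fintype.card {w : InfinitePlace K // IsComplex w} =
      nrComplexPlaces K from rfl]
  rw [mul_inv, mul_inv, mul_inv]
  ring

lemma trPair_mixedEmbedding (α β : K) :
    trPair (mixedEmbedding K α) (mixedEmbedding K β) = (Algebra.trace ℚ K (α * β) : ℝ) := by
  have h := trace_eq_sum_embeddings (K := ℚ) (L := K) ℂ (x := α * β)
  have h2 : ∑ σ : K →ₐ[ℚ] ℂ, σ (α * β) = ∑ σ : K →+* ℂ, σ (α * β) :=
    (Fintype.sum_equiv (RingHom.equivRatAlgHom (R := K) (S := ℂ)) _ _ fun _ => rfl).symm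
  rw [h2, ← (indexEquiv K).sum_comp, Fintype.sum_sum_type] at h
  have h3 := congrArg Complex.re h
  have h4 : ((algebraMap ℚ ℂ) (Algebra.trace ℚ K (α * β))).re =
      (Algebra.trace ℚ K (α * β) : ℝ) := by simp
  rw [h4] at h3
  rw [h3, Complex.add_re, Complex.re_sum, Complex.re_sum]
  unfold trPair
  congr 1
  · refine Finset.sum_congr rfl fun v _ => ?_
    rw [mixedEmbedding_apply_isReal, mixedEmbedding_apply_isReal, indexEquiv_apply_isReal,
      ← map_mul]
    have := congrArg Complex.re (embedding_of_isReal_apply v.2 (α * β))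
    rw [Complex.ofReal_re] at this
    rw [this]
  · rw [Fintype.sum_prod_type]
    refine Finset.sum_congr rfl fun v _ => ?_
    rw [Fin.sum_univ_two, indexEquiv_apply_isComplex_fst, indexEquiv_apply_isComplex_snd,
      mixedEmbedding_apply_isComplex, mixedEmbedding_apply_isComplex, ← map_mul]
    rw [ComplexEmbedding.conjugate_coe_eq, Complex.conj_re]
    ring

end
end MixedFourier

section
open NumberField.InfinitePlace NumberField.mixedEmbedding
open scoped Classical

variable {K : Type*} [Field K] [NumberField K]

lemma abs_le_exp_sq (x : ℝ) : |x| ≤ Real.exp (x ^ 2) := by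
  have h := Real.add_one_le_exp (x ^ 2)
  have h1 : |x| ≤ x ^ 2 + 1 := by
    rw [← sq_abs]; nlinarith [sq_nonneg (|x| - 1), abs_nonneg x]
  linarith

variable (S : Finset {w : InfinitePlace K // IsReal w})

lemma testF_norm_le {g : InfinitePlace K → ℝ}
    (z : mixedSpace K) :
    ‖testF S g z‖ ≤ (∏ v : {w : InfinitePlace K // IsReal w}, Real.exp (-(g v * z.1 v) ^ 2)) *
      ∏ v : {w : InfinitePlace K // IsComplex w}, Real.exp (-(g v * ‖z.2 v‖) ^ 2) := by
  unfold testF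
  rw [norm_mul, norm_prod, norm_prod]
  have hpi := Real.pi_gt_three
  gcongr with v _ v _
  · rw [norm_mul, Complex.norm_exp]
    have e : (-(Real.pi : ℂ) * ((g v * z.1 v : ℝ) : ℂ) ^ 2).re = -Real.pi * (g v * z.1 v) ^ 2 := by
      rw [← Complex.ofReal_pow, ← Complex.ofReal_neg, ← Complex.ofReal_mul, Complex.ofReal_re]
    rw [e]
    have h1 : ‖(if v ∈ S then ((g v * z.1 v : ℝ) : ℂ) else 1)‖ ≤ Real.exp ((g v * z.1 v) ^ 2) := by
      split_ifs
      · rw [Complex.norm_real]; exact abs_le_exp_sq _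
      · rw [norm_one]; exact Real.one_le_exp (sq_nonneg _)
    calc _ ≤ Real.exp ((g v * z.1 v) ^ 2) * Real.exp (-Real.pi * (g v * z.1 v) ^ 2) := by gcongr
      _ ≤ _ := by
        rw [← Real.exp_add]
        apply Real.exp_le_exp.mpr
        nlinarith [sq_nonneg (g v * z.1 v)]
  · rw [Complex.norm_exp]
    have e : (-(2 * (Real.pi : ℂ)) * ((g v * ‖z.2 v‖ : ℝ) : ℂ) ^ 2).re =
        -(2 * Real.pi) * (g v * ‖z.2 v‖) ^ 2 := by
      rw [← Complex.ofReal_pow, ← Complex.ofReal_ofNat, ← Complex.ofReal_mul, ← Complex.ofReal_neg,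
        ← Complex.ofReal_mul, Complex.ofReal_re]
    rw [e]
    apply Real.exp_le_exp.mpr
    nlinarith [sq_nonneg (g v * ‖z.2 v‖)]

/-- The quadratic form `∑_v |z|_v^2` on the mixed space. -/
def qForm (z : mixedSpace K) : ℝ :=
  (∑ v : {w : InfinitePlace K // IsReal w}, z.1 v ^ 2) +
    ∑ v : {w : InfinitePlace K // IsComplex w}, ‖z.2 v‖ ^ 2

lemma testF_norm_le_qForm {g : InfinitePlace K → ℝ}
    {δ : ℝ} (hδ : 0 ≤ δ) (hg : ∀ v, δ ≤ g v) (z : mixedSpace K) :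
    ‖testF S g z‖ ≤ Real.exp (-(δ ^ 2 * qForm z)) := by
  refine (testF_norm_le S z).trans ?_
  rw [← Real.exp_sum, ← Real.exp_sum, ← Real.exp_add]
  apply Real.exp_le_exp.mpr
  unfold qForm
  rw [mul_add, neg_add, Finset.mul_sum, Finset.mul_sum, ← Finset.sum_neg_distrib,
    ← Finset.sum_neg_distrib]
  have h : ∀ v, δ ^ 2 ≤ g v ^ 2 := fun v => by gcongr; exact hg v
  gcongr with v _ v _
  · rw [mul_pow]; exact mul_le_mul_of_nonneg_right (h _) (sq_nonneg _)
  · rw [mul_pow]; exact mul_le_mul_of_nonneg_right (h _) (sq_nonneg _)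

lemma sq_norm_le_qForm (z : mixedSpace K) : ‖z‖ ^ 2 ≤ qForm z := by
  have hq1 : ∀ v : {w : InfinitePlace K // IsReal w}, ‖z.1 v‖ ^ 2 ≤ qForm z := by
    intro v
    have := Finset.single_le_sum (f := fun v : {w : InfinitePlace K // IsReal w} => z.1 v ^ 2)
      (fun i _ => sq_nonneg _) (Finset.mem_univ v)
    have h2 : 0 ≤ ∑ v : {w : InfinitePlace K // IsComplex w}, ‖z.2 v‖ ^ 2 := by positivity
    unfold qForm
    rw [Real.norm_eq_abs, sq_abs]
    convert! le_add_of_le_of_nonneg this h2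
  have hq2 : ∀ v : {w : InfinitePlace K // IsComplex w}, ‖z.2 v‖ ^ 2 ≤ qForm z := by
    intro v
    have := Finset.single_le_sum (f := fun v : {w : InfinitePlace K // IsComplex w} =>
      ‖z.2 v‖ ^ 2) (fun i _ => sq_nonneg _) (Finset.mem_univ v)
    have h2 : 0 ≤ ∑ v : {w : InfinitePlace K // IsReal w}, z.1 v ^ 2 := by positivity
    unfold qForm
    convert! le_add_of_nonneg_of_le h2 this
  have hq0 : 0 ≤ qForm z := by unfold qForm; positivity
  have : ‖z‖ ≤ Real.sqrt (qForm z) := by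
    rw [Prod.norm_def]
    refine max_le ?_ ?_
    · exact (pi_norm_le_iff_of_nonneg (Real.sqrt_nonneg _)).mpr
        fun v => Real.le_sqrt_of_sq_le (hq1 v)
    · exact (pi_norm_le_iff_of_nonneg (Real.sqrt_nonneg _)).mpr
        fun v => Real.le_sqrt_of_sq_le (hq2 v)
  calc ‖z‖ ^ 2 ≤ Real.sqrt (qForm z) ^ 2 := by gcongr
    _ = _ := Real.sq_sqrt hq0

lemma testF_continuous (g : InfinitePlace K → ℝ) :
    Continuous (testF S g) := by
  unfold testF
  refine Continuous.mul ?_ ?_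
  · refine continuous_finsetProd _ fun v _ => ?_
    by_cases h : v ∈ S
    · simp only [h, if_true]; fun_prop
    · simp only [h, if_false]; fun_prop
  · fun_prop

/-- A quadratic lower bound for the quadratic form on a lattice basis. -/
lemma exists_qForm_basis_ge {ι : Type*} [Fintype ι] (b : Module.Basis ι ℝ (mixedSpace K)) :
    ∃ c : ℝ, 0 < c ∧ ∀ x : ι → ℝ, c * ∑ i, x i ^ 2 ≤ qForm (b.equivFun.symm x) := by
  obtain ⟨C, hC0, hC⟩ :=
    (b.equivFun.toContinuousLinearEquiv : mixedSpace K ≃L[ℝ] (ι → ℝ)).toContinuousLinearMap.bound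
  refine ⟨(C ^ 2 * (Fintype.card ι + 1))⁻¹, by positivity, fun x => ?_⟩
  rw [inv_mul_le_iff₀ (by positivity)]
  have h1 := hC (b.equivFun.symm x)
  have h2 : (b.equivFun.toContinuousLinearEquiv : mixedSpace K ≃L[ℝ] (ι → ℝ)).toContinuousLinearMap
    (b.equivFun.symm x) = x := b.equivFun.apply_symm_apply x
  rw [h2] at h1
  have h3 := sq_norm_le_qForm (b.equivFun.symm x)
  calc ∑ i, x i ^ 2 ≤ ∑ _i : ι, ‖x‖ ^ 2 := by
        refine Finset.sum_le_sum fun i _ => ?_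
        rw [← sq_abs, ← Real.norm_eq_abs]
        exact pow_le_pow_left₀ (norm_nonneg _) (norm_le_pi_norm x i) 2
    _ = Fintype.card ι * ‖x‖ ^ 2 := by simp
    _ ≤ (Fintype.card ι + 1) * (C * ‖b.equivFun.symm x‖) ^ 2 := by gcongr; linarith
    _ = C ^ 2 * (Fintype.card ι + 1) * ‖b.equivFun.symm x‖ ^ 2 := by ring
    _ ≤ _ := by gcongr

lemma gaussDecay_testF {ι : Type*} [Fintype ι] (b : Module.Basis ι ℝ (mixedSpace K))
    (S : Finset {w : InfinitePlace K // IsReal w}) {g : InfinitePlace K → ℝ} (hg : ∀ v, 0 < g v) :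
    GaussDecay (fun x : ι → ℝ => testF S g (b.equivFun.symm x)) := by
  refine ⟨(testF_continuous S g).comp
    (b.equivFun.symm : (ι → ℝ) →ₗ[ℝ] mixedSpace K).continuous_of_finiteDimensional, ?_⟩
  obtain ⟨c, hc, h⟩ := exists_qForm_basis_ge b
  obtain ⟨δ, hδ, hδg⟩ : ∃ δ > 0, ∀ v, δ ≤ g v := by
    obtain ⟨v, hv⟩ := Finite.exists_min g
    exact ⟨g v, hg v, hv⟩
  refine ⟨1, δ ^ 2 * c, zero_le_one, by positivity, fun x => ?_⟩
  refine (testF_norm_le_qForm S hδ.le hδg _).trans ?_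
  rw [one_mul, ← Real.exp_sum, ← Finset.mul_sum]
  apply Real.exp_le_exp.mpr
  have := mul_le_mul_of_nonneg_left (h x) (sq_nonneg δ)
  linarith

end

section FractionalIdealPoisson
open NumberField.InfinitePlace NumberField.mixedEmbedding MeasureTheory
open scoped Classical nonZeroDivisors

variable {K : Type*} [Field K] [NumberField K]

lemma integral_comp_basis {ι : Type*} [Fintype ι] (b : Module.Basis ι ℝ (mixedSpace K))
    (F : mixedSpace K → ℂ) :
    ∫ x, F (b.equivFun.symm x) = ((volume (ZSpan.fundamentalDomain b)).toReal⁻¹ : ℂ) * ∫ z, F z := by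
  set e := b.equivFun.toContinuousLinearEquiv with he
  have hμ : (volume : Measure (mixedSpace K)).map e =
      (volume (ZSpan.fundamentalDomain b)) • (volume : Measure (ι → ℝ)) := by
    have : Measure.IsAddHaarMeasure ((volume : Measure (mixedSpace K)).map e) :=
      e.isAddHaarMeasure_map volume
    have h1 := Measure.isAddLeftInvariant_eq_smul ((volume : Measure (mixedSpace K)).map e)
      (volume : Measure (ι → ℝ))
    have hcube : (volume : Measure (ι → ℝ)) (Set.univ.pi fun _ => Set.Ico (0:ℝ) 1) = 1 := by
      rw [Real.volume_pi_Ico]; simp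
    have hcube2 : ((volume : Measure (mixedSpace K)).map e)
        (Set.univ.pi fun _ => Set.Ico (0:ℝ) 1) = volume (ZSpan.fundamentalDomain b) := by
      rw [Measure.map_apply e.continuous.measurable
        (MeasurableSet.univ_pi fun _ => measurableSet_Ico)]
      congr 1
      ext z
      simp [ZSpan.mem_fundamentalDomain, he]
    have h2 := congrArg (fun μ : Measure (ι → ℝ) => μ (Set.univ.pi fun _ => Set.Ico (0:ℝ) 1)) h1
    simp only [hcube2] at h2
    rw [Measure.smul_apply, hcube] at h2
    generalize (Measure.addHaarScalarFactor (Measure.map (⇑e) volume) volume) = c at h1 h2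
    rw [h1, h2]
    have h3 : (c • (1 : ENNReal)) = (c : ENNReal) := by rw [ENNReal.smul_def, smul_eq_mul, mul_one]
    rw [h3]
    rfl
  have h4 : ∫ z, F z = ∫ x, F (b.equivFun.symm x) ∂((volume : Measure (mixedSpace K)).map e) := by
    have := e.toHomeomorph.measurableEmbedding.integral_map (μ := volume)
      (fun x => F (b.equivFun.symm x))
    refine Eq.trans ?_ this.symm
    refine integral_congr_ae (Eventually.of_forall fun z => ?_)
    exact congrArg F (b.equivFun.symm_apply_apply z).symm
  rw [h4, hμ, integral_smul_measure]
  have hne : (volume (ZSpan.fundamentalDomain b)).toReal ≠ 0 := by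
    rw [ENNReal.toReal_ne_zero]
    exact ⟨ZSpan.measure_fundamentalDomain_ne_zero b,
      (ZSpan.fundamentalDomain_isBounded b).measure_lt_top.ne⟩
  rw [Complex.real_smul, ← mul_assoc, ← Complex.ofReal_inv, ← Complex.ofReal_mul,
    inv_mul_cancel₀ hne, Complex.ofReal_one, one_mul]

/-- The additive character `e(Tr a)` on `K`. -/
def eTr (a : K) : ℂ := cexp (2 * Real.pi * I * ((Algebra.trace ℚ K a : ℝ) : ℂ))

variable (J : (FractionalIdeal (𝓞 K)⁰ K)ˣ)

lemma volume_fundamentalDomain_ideal :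
    (volume (ZSpan.fundamentalDomain (fractionalIdealLatticeBasis K J))).toReal =
      (FractionalIdeal.absNorm J.1 : ℝ) * ((2 : ℝ)⁻¹ ^ nrComplexPlaces K * √(DK K)) := by
  rw [volume_fundamentalDomain_fractionalIdealLatticeBasis, volume_fundamentalDomain_latticeBasis,
    ENNReal.toReal_mul, ENNReal.toReal_ofReal (by
      exact_mod_cast FractionalIdeal.absNorm_nonneg J.1)]
  congr 1
  simp only [ENNReal.toReal_mul, ENNReal.toReal_pow, ENNReal.toReal_inv, ENNReal.toReal_ofNat,
    ENNReal.coe_toReal, Real.coe_sqrt, coe_nnnorm, Int.norm_eq_abs, DK]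
  congr 2
  rw [Nat.cast_natAbs]; simp

/-- Integer coordinates on a fractional ideal. -/
def coordEquiv : (Module.Free.ChooseBasisIndex ℤ J → ℤ) ≃ {x : K // x ∈ (J : FractionalIdeal (𝓞 K)⁰ K)} :=
  Equiv.ofBijective (fun m => ⟨∑ i, (m i : ℚ) • basisOfFractionalIdeal K J i, by
    rw [← FractionalIdeal.mem_coe, ← SetLike.mem_coe]
    have := (mem_span_basisOfFractionalIdeal K (I := J) (x := ∑ i, (m i : ℚ) • basisOfFractionalIdeal K J i)).mp (Submodule.sum_mem _ fun i _ => by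
        rw [Int.cast_smul_eq_zsmul]
        exact Submodule.smul_mem _ _ (Submodule.subset_span ⟨i, rfl⟩))
    exact this⟩) (by
    constructor
    · intro m m' h
      have h1 := congrArg Subtype.val h
      simp only at h1
      rw [← Module.Basis.equivFun_symm_apply, ← Module.Basis.equivFun_symm_apply] at h1
      have h2 := (basisOfFractionalIdeal K J).equivFun.symm.injective h1
      ext i
      exact_mod_cast congrFun h2 i
    · rintro ⟨x, hx⟩
      have h1 : x ∈ Submodule.span ℤ (Set.range (basisOfFractionalIdeal K J)) :=
        (mem_span_basisOfFractionalIdeal K).mpr hx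
      rw [Module.Basis.mem_span_iff_repr_mem] at h1
      choose m hm using h1
      refine ⟨m, Subtype.ext ?_⟩
      simp only
      conv_rhs => rw [← (basisOfFractionalIdeal K J).sum_repr x]
      refine Finset.sum_congr rfl fun i _ => ?_
      rw [← hm i]; simp)

lemma coordEquiv_coe (m : Module.Free.ChooseBasisIndex ℤ J → ℤ) :
    (coordEquiv J m : K) = ∑ i, (m i : ℚ) • basisOfFractionalIdeal K J i := rfl

lemma mixedEmbedding_ratSmul (q : ℚ) (x : K) :
    mixedEmbedding K (q • x) = (q : ℝ) • mixedEmbedding K x := by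
  rw [Algebra.smul_def, map_mul]
  have : mixedEmbedding K (algebraMap ℚ K q) = algebraMap ℝ (mixedSpace K) (q : ℝ) := by
    have h := RingHom.ext_rat ((mixedEmbedding K).comp (algebraMap ℚ K))
      ((algebraMap ℝ (mixedSpace K)).comp (algebraMap ℚ ℝ))
    simpa using congrArg (fun f : ℚ →+* mixedSpace K => f q) h
  rw [this, Algebra.smul_def]

lemma mixedEmbedding_coordEquiv (m : Module.Free.ChooseBasisIndex ℤ J → ℤ) :
    mixedEmbedding K (coordEquiv J m) =
      (fractionalIdealLatticeBasis K J).equivFun.symm (fun i => (m i : ℝ)) := by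
  rw [coordEquiv_coe, map_sum, Module.Basis.equivFun_symm_apply]
  refine Finset.sum_congr rfl fun i _ => ?_
  rw [mixedEmbedding_ratSmul, fractionalIdealLatticeBasis_apply]; simp

/-- Integer coordinates on the dual ideal, with respect to the dual basis. -/
def dualCoordEquiv : (Module.Free.ChooseBasisIndex ℤ J → ℤ) ≃
    {x : K // x ∈ FractionalIdeal.dual ℤ ℚ (J : FractionalIdeal (𝓞 K)⁰ K)} :=
  Equiv.ofBijective (fun m => ⟨∑ i, (m i : ℚ) •
      (Algebra.traceForm ℚ K).dualBasis (traceForm_nondegenerate ℚ K) (basisOfFractionalIdeal K J) i, by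
    rw [FractionalIdeal.mem_dual J.ne_zero]
    intro a ha
    obtain ⟨k, hk⟩ := (coordEquiv J).surjective ⟨a, ha⟩
    have hk' : a = ∑ i, (k i : ℚ) • basisOfFractionalIdeal K J i := by
      rw [← coordEquiv_coe, hk]
    rw [hk']
    refine ⟨∑ i, m i * k i, ?_⟩
    simp only [map_sum, map_smul, LinearMap.sum_apply, LinearMap.smul_apply,
      LinearMap.BilinForm.apply_dualBasis_left]
    simp [mul_comm]⟩) (by
    constructor
    · intro m m' h
      have h1 := congrArg Subtype.val h
      simp only at h1
      rw [← Module.Basis.equivFun_symm_apply, ← Module.Basis.equivFun_symm_apply] at h1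
      have h2 := (LinearEquiv.injective _) h1
      ext i
      exact_mod_cast congrFun h2 i
    · rintro ⟨x, hx⟩
      rw [FractionalIdeal.mem_dual J.ne_zero] at hx
      have h1 : ∀ i, ∃ m : ℤ, (m : ℚ) = Algebra.traceForm ℚ K x (basisOfFractionalIdeal K J i) := by
        intro i
        obtain ⟨m, hm⟩ := hx (basisOfFractionalIdeal K J i)
          ((mem_span_basisOfFractionalIdeal K).mp (Submodule.subset_span ⟨i, rfl⟩))
        exact ⟨m, by rw [← hm]; simp⟩
      choose m hm using h1
      refine ⟨m, Subtype.ext ?_⟩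
      simp only
      conv_rhs => rw [← ((Algebra.traceForm ℚ K).dualBasis (traceForm_nondegenerate ℚ K) (basisOfFractionalIdeal K J)).sum_repr x]
      refine Finset.sum_congr rfl fun i _ => ?_
      rw [LinearMap.BilinForm.dualBasis_repr_apply, hm i])

lemma trace_dualCoord (n : Module.Free.ChooseBasisIndex ℤ J → ℤ) (i) :
    Algebra.trace ℚ K (dualCoordEquiv J n * basisOfFractionalIdeal K J i) = n i := by
  change Algebra.traceForm ℚ K (∑ i, (n i : ℚ) •
      (Algebra.traceForm ℚ K).dualBasis (traceForm_nondegenerate ℚ K) (basisOfFractionalIdeal K J) i) _ = _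
  simp only [map_sum, map_smul, LinearMap.sum_apply, LinearMap.smul_apply,
      LinearMap.BilinForm.apply_dualBasis_left]
  simp

lemma coord_add (a : K) (m : Module.Free.ChooseBasisIndex ℤ J → ℤ) :
    mixedEmbedding K (a + coordEquiv J m) = (fractionalIdealLatticeBasis K J).equivFun.symm
      ((fractionalIdealLatticeBasis K J).equivFun (mixedEmbedding K a) + fun i => (m i : ℝ)) := by
  rw [map_add, map_add, LinearEquiv.symm_apply_apply, mixedEmbedding_coordEquiv]

lemma summable_testF (S : Finset {w : InfinitePlace K // IsReal w}) {g : InfinitePlace K → ℝ}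
    (hg : ∀ v, 0 < g v) (a : K) :
    Summable fun α : {x : K // x ∈ (J : FractionalIdeal (𝓞 K)⁰ K)} =>
      testF S g (mixedEmbedding K (a + α)) := by
  rw [← (coordEquiv J).summable_iff]
  have h := gaussDecay_testF (fractionalIdealLatticeBasis K J) S hg
  set x := (fractionalIdealLatticeBasis K J).equivFun (mixedEmbedding K a) with hx
  obtain ⟨u, hu, hb⟩ := h.shift_bound ‖x‖
  refine Summable.of_norm_bounded hu fun m => ?_
  have := hb x (fun i => norm_le_pi_norm x i) m
  simpa only [Function.comp_apply, coord_add] using this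

lemma trPair_sum_smul {ι : Type*} [Fintype ι] (w : mixedSpace K) (b : ι → mixedSpace K)
    (x : ι → ℝ) : trPair w (∑ i, x i • b i) = ∑ i, x i * trPair w (b i) := by
  have h : IsLinearMap ℝ (trPair w) := by
    constructor
    · intro y z
      simp only [trPair, Prod.fst_add, Prod.snd_add, Pi.add_apply, mul_add, Finset.sum_add_distrib,
        Complex.add_re]
      ring
    · intro c z
      simp only [trPair, Prod.smul_fst, Prod.smul_snd, Pi.smul_apply, smul_eq_mul, mul_add,
        Finset.mul_sum]
      congr 1
      · exact Finset.sum_congr rfl fun i _ => by ring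
      · refine Finset.sum_congr rfl fun i _ => ?_
        rw [Complex.real_smul, mul_left_comm, Complex.re_ofReal_mul]; ring
  have h2 : ∀ z, trPair w z = IsLinearMap.mk' _ h z := fun _ => rfl
  simp only [h2, map_sum, map_smul, smul_eq_mul]

lemma trPair_dualCoord (n : Module.Free.ChooseBasisIndex ℤ J → ℤ)
    (x : Module.Free.ChooseBasisIndex ℤ J → ℝ) :
    trPair (mixedEmbedding K (dualCoordEquiv J n))
      ((fractionalIdealLatticeBasis K J).equivFun.symm x) = ∑ i, (n i : ℝ) * x i := by
  rw [Module.Basis.equivFun_symm_apply, trPair_sum_smul]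
  refine Finset.sum_congr rfl fun i _ => ?_
  rw [fractionalIdealLatticeBasis_apply, trPair_mixedEmbedding, trace_dualCoord]
  push_cast; ring

set_option maxHeartbeats 1000000 in
/-- Poisson summation for a fractional ideal. -/
theorem poisson_ideal (S : Finset {w : InfinitePlace K // IsReal w}) {g : InfinitePlace K → ℝ}
    (hg : ∀ v, 0 < g v) (a : K) :
    HasSum (fun β : {x : K // x ∈ FractionalIdeal.dual ℤ ℚ (J : FractionalIdeal (𝓞 K)⁰ K)} =>
      (-I) ^ S.card * ((scNorm g * (FractionalIdeal.absNorm J.1 : ℝ) * √(DK K) : ℝ) : ℂ)⁻¹ *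
        testF S (fun v => (g v)⁻¹) (mixedEmbedding K β) * eTr (β * a))
      (∑' α : {x : K // x ∈ (J : FractionalIdeal (𝓞 K)⁰ K)},
        testF S g (mixedEmbedding K (a + α))) := by
  set b := fractionalIdealLatticeBasis K J with hb
  have hf := gaussDecay_testF b S hg
  have hIntg : ∀ n : Module.Free.ChooseBasisIndex ℤ J → ℤ,
      ∫ x, eChar (-n) x * testF S g (b.equivFun.symm x) =
      (-I) ^ S.card * ((scNorm g * (FractionalIdeal.absNorm J.1 : ℝ) * √(DK K) : ℝ) : ℂ)⁻¹ *
        testF S (fun v => (g v)⁻¹) (mixedEmbedding K (dualCoordEquiv J n)) := by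
    intro n
    have h1 : ∀ x, eChar (-n) x * testF S g (b.equivFun.symm x) =
        (fun z => testF S g z * cexp (2 * Real.pi * I *
          (-(trPair (mixedEmbedding K (dualCoordEquiv J n)) z) : ℝ))) (b.equivFun.symm x) := by
      intro x
      simp only
      rw [mul_comm, hb, trPair_dualCoord]
      unfold eChar
      simp [Finset.sum_neg_distrib]
    simp_rw [h1]
    rw [integral_comp_basis b (fun z => testF S g z * cexp (2 * Real.pi * I *
          (-(trPair (mixedEmbedding K (dualCoordEquiv J n)) z) : ℝ))), fourier_testF S hg, hb,
      volume_fundamentalDomain_ideal]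
    push_cast
    rw [mul_inv, mul_inv, mul_inv, mul_inv, mul_inv, inv_pow, inv_inv]
    have h2 : (2 : ℂ) ^ nrComplexPlaces K ≠ 0 := pow_ne_zero _ two_ne_zero
    field_simp
  have hs : Summable fun n : Module.Free.ChooseBasisIndex ℤ J → ℤ =>
      ∫ x, eChar (-n) x * testF S g (b.equivFun.symm x) := by
    simp_rw [hIntg]
    refine Summable.mul_left _ ?_
    have h : Summable fun β : {x : K //
        x ∈ FractionalIdeal.dual ℤ ℚ (J : FractionalIdeal (𝓞 K)⁰ K)} =>
        testF S (fun v => (g v)⁻¹) (mixedEmbedding K (0 + β)) :=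
      summable_testF (Units.mk0 _ (FractionalIdeal.dual_ne_zero ℤ ℚ J.ne_zero)) S
      (g := fun v => (g v)⁻¹) (fun v => inv_pos.mpr (hg v)) 0
    simp only [zero_add] at h
    have h' := (Equiv.summable_iff (dualCoordEquiv J)).mpr h
    simpa only [Function.comp_def] using h'
  have h := poisson_summation hf hs (b.equivFun (mixedEmbedding K a))
  rw [← (dualCoordEquiv J).hasSum_iff, ← (coordEquiv J).tsum_eq]
  convert! h using 1
  · ext n
    rw [hIntg]
    simp only [Function.comp_apply]
    congr 1
    unfold eTr eChar
    rw [← trPair_mixedEmbedding, ← trPair_dualCoord J n, ← hb, LinearEquiv.symm_apply_apply]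
  · unfold perSum
    refine tsum_congr fun m => ?_
    rw [coord_add]

end FractionalIdealPoisson

section LogCoordinates
open NumberField.InfinitePlace NumberField.mixedEmbedding MeasureTheory NumberField.Units
open scoped Classical nonZeroDivisors

variable {K : Type*} [Field K] [NumberField K]

variable (K) in
/-- The linear parametrization of the logarithmic space by the logarithm of the norm and the
exponents of the fundamental units. -/
def logLin : (ℝ × (Fin (rank K) → ℝ)) →ₗ[ℝ] (InfinitePlace K → ℝ) where
  toFun p v := p.1 / (Module.finrank ℚ K : ℝ) + ∑ i, p.2 i * Real.log (v (fundSystem K i : K))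
  map_add' p q := by
    ext v
    simp only [Prod.fst_add, Prod.snd_add, Pi.add_apply, add_mul, Finset.sum_add_distrib]
    ring
  map_smul' a p := by
    ext v
    simp only [Prod.smul_fst, Prod.smul_snd, Pi.smul_apply, smul_eq_mul, RingHom.id_apply, mul_add,
      Finset.mul_sum]
    congr 1
    · ring
    · exact Finset.sum_congr rfl fun i _ => by ring

lemma logLin_apply (p : ℝ × (Fin (rank K) → ℝ)) (v : InfinitePlace K) :
    logLin K p v = p.1 / (Module.finrank ℚ K : ℝ) +
      ∑ i, p.2 i * Real.log (v (fundSystem K i : K)) := rfl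

lemma sum_mult_logLin (p : ℝ × (Fin (rank K) → ℝ)) :
    ∑ v, (mult v : ℝ) * logLin K p v = p.1 := by
  have hn : (Module.finrank ℚ K : ℝ) ≠ 0 := by
    exact_mod_cast (Module.finrank_pos (R := ℚ) (M := K)).ne'
  have h1 : ∑ v : InfinitePlace K, (mult v : ℝ) = Module.finrank ℚ K := by
    exact_mod_cast sum_mult_eq (K := K)
  have h2 : ∀ i, ∑ v : InfinitePlace K, (mult v : ℝ) * Real.log (v (fundSystem K i : K)) = 0 :=
    fun i => sum_mult_mul_log (fundSystem K i)
  simp only [logLin_apply, mul_add, Finset.sum_add_distrib, Finset.mul_sum]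
  rw [← Finset.sum_mul, h1, Finset.sum_comm]
  have : ∀ i, ∑ v : InfinitePlace K, (mult v : ℝ) * (p.2 i * Real.log (v (fundSystem K i : K))) = 0 := by
    intro i
    rw [← mul_zero (p.2 i), ← h2 i, Finset.mul_sum]
    exact Finset.sum_congr rfl fun v _ => by ring
  simp only [this, Finset.sum_const_zero, add_zero]
  field_simp

lemma scNorm_exp (l : InfinitePlace K → ℝ) :
    scNorm (fun v => Real.exp (l v)) = Real.exp (∑ v, (mult v : ℝ) * l v) := by
  rw [scNorm, Real.exp_sum]
  exact Finset.prod_congr rfl fun v _ => by rw [← Real.exp_nat_mul]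

lemma logLin_injective : Function.Injective (logLin K) := by
  rw [← LinearMap.ker_eq_bot, LinearMap.ker_eq_bot']
  rintro ⟨t, y⟩ h
  have ht : t = 0 := by
    have := sum_mult_logLin (K := K) (t, y)
    rw [h] at this
    simpa using this.symm
  subst ht
  have hli := ((basisUnitLattice K).ofZLatticeBasis ℝ (unitLattice K)).linearIndependent
  rw [Fintype.linearIndependent_iff] at hli
  have hy : ∀ i, y i = 0 := by
    apply hli y
    ext w
    have := congrFun h w.1
    rw [logLin_apply] at this
    simp only [zero_div, zero_add, Pi.zero_apply] at this
    simp only [Module.Basis.ofZLatticeBasis_apply, Finset.sum_apply, Pi.smul_apply, smul_eq_mul,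
      Pi.zero_apply, ← logEmbedding_fundSystem, dirichletUnitTheorem.logEmbedding_component]
    rw [← mul_zero (mult w.1 : ℝ), ← this, Finset.mul_sum]
    exact Finset.sum_congr rfl fun i _ => by ring
  rw [show y = 0 from funext hy]
  rfl

variable (K) in
/-- The parametrization `logLin` as a continuous linear equivalence. -/
def logEquiv : (ℝ × (Fin (rank K) → ℝ)) ≃L[ℝ] (InfinitePlace K → ℝ) :=
  (LinearEquiv.ofInjectiveOfFinrankEq (logLin K) logLin_injective (by
    have : 0 < Fintype.card (InfinitePlace K) := Fintype.card_pos
    rw [Module.finrank_prod, Module.finrank_self, Module.finrank_fintype_fun_eq_card,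
      Module.finrank_fintype_fun_eq_card, Fintype.card_fin, rank]
    omega)).toContinuousLinearEquiv

lemma logEquiv_apply (p : ℝ × (Fin (rank K) → ℝ)) : logEquiv K p = logLin K p := rfl

/-- The vector of logarithms of the absolute values of a field element. -/
def logAbs (β : K) (v : InfinitePlace K) : ℝ := Real.log (v β)

lemma logAbs_mul {a b : K} (ha : a ≠ 0) (hb : b ≠ 0) : logAbs (a * b) = logAbs a + logAbs b := by
  ext v
  rw [logAbs, map_mul, Real.log_mul ((map_ne_zero v).2 ha) ((map_ne_zero v).2 hb)]
  rfl

lemma sum_mult_logAbs {β : K} (hβ : β ≠ 0) :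
    ∑ v : InfinitePlace K, (mult v : ℝ) * logAbs β v = Real.log |(Algebra.norm ℚ β : ℚ)| := by
  have := prod_eq_abs_norm β
  rw [← Rat.cast_abs, ← this, Real.log_prod (fun v _ => pow_ne_zero _ ((map_ne_zero v).2 hβ))]
  exact Finset.sum_congr rfl fun v _ => by rw [Real.log_pow]; rfl

lemma exists_logAbs_eq {β : K} (hβ : β ≠ 0) : ∃ y : Fin (rank K) → ℝ,
    logAbs β = logLin K (Real.log |(Algebra.norm ℚ β : ℚ)|, y) := by
  obtain ⟨⟨t, y⟩, h⟩ := (logEquiv K).surjective (logAbs β)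
  rw [logEquiv_apply] at h
  refine ⟨y, ?_⟩
  rw [← sum_mult_logAbs hβ, ← h, sum_mult_logLin]

/-- The unit with given exponents. -/
def unitOf (q : torsion K × (Fin (rank K) → ℤ)) : (𝓞 K)ˣ :=
  q.1 * ∏ i, (fundSystem K i) ^ (q.2 i)

variable (K) in
lemma unitOf_bijective : Function.Bijective (unitOf (K := K)) := by
  rw [Function.bijective_iff_existsUnique]
  intro x
  obtain ⟨q, hq, hu⟩ := exist_unique_eq_mul_prod K x
  exact ⟨q, hq.symm, fun q' h => hu q' h.symm⟩

lemma logAbs_unitOf (q : torsion K × (Fin (rank K) → ℤ)) :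
    logAbs ((unitOf q : (𝓞 K)ˣ) : K) = logLin K (0, fun i => (q.2 i : ℝ)) := by
  ext v
  have ht : v ((q.1 : (𝓞 K)ˣ) : K) = 1 := (mem_torsion K).1 q.1.2 v
  rw [logAbs, logLin_apply, unitOf, Units.coe_mul, map_mul, ht, one_mul, zero_div, zero_add]
  rw [show ((∏ i, (fundSystem K i) ^ (q.2 i) : (𝓞 K)ˣ) : K) =
    ∏ i, ((fundSystem K i : (𝓞 K)ˣ) : K) ^ (q.2 i) by
      rw [Units.coe_prod, map_prod]; 
        exact Finset.prod_congr rfl fun i _ => NumberField.Units.coe_zpow (K := K) _ _]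
  rw [map_prod, Real.log_prod (fun i _ => by
    rw [map_zpow₀]
    exact zpow_ne_zero _ ((map_ne_zero v).2 (NumberField.Units.coe_ne_zero (K := K) _)))]
  exact Finset.sum_congr rfl fun i _ => by rw [map_zpow₀, Real.log_zpow]

variable (S : Finset {w : InfinitePlace K // IsReal w})

/-- The sign of a field element at a set of real places. -/
def sgnS (β : K) : ℂ :=
  ∏ v ∈ S, ((SignType.sign ((mixedEmbedding K β).1 v) : ℝ) : ℂ)

lemma sgnS_mul (a b : K) :
    sgnS S (a * b) = sgnS S a * sgnS S b := by
  rw [sgnS, sgnS, sgnS, ← Finset.prod_mul_distrib]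
  refine Finset.prod_congr rfl fun v _ => ?_
  rw [map_mul, Prod.fst_mul, Pi.mul_apply, sign_mul]
  push_cast
  rfl

lemma sgnS_mul_self {β : K} (hβ : β ≠ 0) :
    sgnS S β * sgnS S β = 1 := by
  rw [sgnS, ← Finset.prod_mul_distrib]
  refine Finset.prod_eq_one fun v _ => ?_
  have h : (mixedEmbedding K β).1 v ≠ 0 := by
    rw [mixedEmbedding_apply_isReal]
    exact (map_ne_zero _).2 hβ
  rcases lt_or_gt_of_ne h with h | h
  · rw [sign_neg h]; simp
  · rw [sign_pos h]; simp

lemma norm_sgnS_le (β : K) : ‖sgnS S β‖ ≤ 1 := by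
  rw [sgnS, norm_prod]
  refine Finset.prod_le_one (fun _ _ => norm_nonneg _) fun v _ => ?_
  rw [Complex.norm_real]
  rcases lt_trichotomy ((mixedEmbedding K β).1 v) 0 with h | h | h
  · rw [sign_neg h]; simp
  · rw [h]; simp
  · rw [sign_pos h]; simp

/-- The test function in logarithmic coordinates. -/
def hLog (l : InfinitePlace K → ℝ) : ℝ :=
  (∏ v : {w : InfinitePlace K // IsReal w},
    (if v ∈ S then Real.exp (l v) else 1) * Real.exp (-Real.pi * Real.exp (l v) ^ 2)) *
  ∏ v : {w : InfinitePlace K // IsComplex w}, Real.exp (-(2 * Real.pi) * Real.exp (l v) ^ 2)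

lemma continuous_hLog : Continuous (hLog S) := by
  unfold hLog
  refine (continuous_finsetProd _ fun v _ => ?_).mul (continuous_finsetProd _ fun v _ => by fun_prop)
  split_ifs <;> fun_prop

lemma testF_log (l : InfinitePlace K → ℝ)
    {β : K} (hβ : β ≠ 0) :
    testF S (fun v => Real.exp (l v)) (mixedEmbedding K β) =
      sgnS S β * (hLog S (l + logAbs β) : ℂ) := by
  have hpos : ∀ v : InfinitePlace K, 0 < v β := fun v => pos_iff.2 hβ
  have he : ∀ v : InfinitePlace K, Real.exp ((l + logAbs β) v) = Real.exp (l v) * v β := by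
    intro v
    rw [Pi.add_apply, Real.exp_add, logAbs, Real.exp_log (hpos v)]
  have hS : sgnS S β = ∏ v : {w : InfinitePlace K // IsReal w},
      if v ∈ S then ((SignType.sign ((mixedEmbedding K β).1 v) : ℝ) : ℂ) else 1 := by
    rw [sgnS, Finset.prod_ite_mem, Finset.univ_inter]
  rw [testF, hLog, hS]
  push_cast
  rw [← mul_assoc, ← Finset.prod_mul_distrib]
  congr 1
  · refine Finset.prod_congr rfl fun v _ => ?_
    have heC : cexp (((l + logAbs β) v : ℝ) : ℂ) = (Real.exp (l v) : ℂ) * (v.1 β : ℂ) := by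
      rw [← Complex.ofReal_exp, he v, Complex.ofReal_mul]
    rw [heC]
    set x := (mixedEmbedding K β).1 v with hx
    have hv : v.1 β = |x| := by
      rw [hx, mixedEmbedding_apply_isReal, ← norm_embedding_of_isReal v.2, Real.norm_eq_abs]
    have hsx : ((SignType.sign x : ℝ) : ℂ) * ((|x| : ℝ) : ℂ) = (x : ℂ) := by
      rw [← Complex.ofReal_mul, sign_mul_abs]
    rw [hv]
    have hsq : ((Real.exp (l v) : ℝ) * (|x| : ℝ) : ℂ) ^ 2 = ((Real.exp (l v) : ℝ) * (x : ℝ) : ℂ) ^ 2 := by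
      rw [mul_pow, mul_pow, ← Complex.ofReal_pow |x|, sq_abs, Complex.ofReal_pow]
    rw [← mul_assoc, hsq]
    by_cases h : v ∈ S
    · simp only [h, if_true]
      rw [he v, hv, Complex.ofReal_mul, ← hsx]
      push_cast
      ring
    · simp only [h, if_false]
      push_cast
      ring
  · refine Finset.prod_congr rfl fun v _ => ?_
    rw [show cexp (((l + logAbs β) v : ℝ) : ℂ) = (Real.exp (l v) : ℂ) * (v.1 β : ℂ) by
      rw [← Complex.ofReal_exp, he v, Complex.ofReal_mul], mixedEmbedding_apply_isComplex,
      norm_embedding_eq]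
    push_cast
    rfl

end LogCoordinates

section GammaFactor
open MeasureTheory

lemma image_exp_two_mul : (fun l : ℝ => Real.exp (2 * l)) '' Set.univ = Set.Ioi 0 := by
  ext x
  simp only [Set.image_univ, Set.mem_range, Set.mem_Ioi]
  constructor
  · rintro ⟨y, rfl⟩
    exact Real.exp_pos _
  · intro hx
    exact ⟨Real.log x / 2, by rw [mul_div_cancel₀ _ two_ne_zero, Real.exp_log hx]⟩

lemma gamma_exp_aux {a : ℝ} (w : ℂ) (l : ℝ) :
    |2 * Real.exp (2 * l)| • (((Real.exp (2 * l) : ℝ) : ℂ) ^ (w - 1) *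
      cexp (-(a * ((Real.exp (2 * l) : ℝ) : ℂ)))) =
      2 * (cexp (2 * w * l) * ((Real.exp (-a * Real.exp l ^ 2) : ℝ) : ℂ)) := by
  have h0 : ((Real.exp (2 * l) : ℝ) : ℂ) = cexp (2 * l) := by push_cast; rfl
  have h1 : (Real.exp l : ℝ) ^ 2 = Real.exp (2 * l) := by
    rw [← Real.exp_nat_mul]; norm_num
  have h2 : ((Real.exp (2 * l) : ℝ) : ℂ) ^ (w - 1) = cexp (2 * l * (w - 1)) := by
    rw [Complex.cpow_def_of_ne_zero (by rw [h0]; exact Complex.exp_ne_zero _), ← Complex.ofReal_log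
      (Real.exp_pos _).le, Real.log_exp]
    push_cast
    rfl
  rw [abs_of_pos (by positivity), h1, h2, Complex.real_smul]
  push_cast
  rw [show (2 : ℂ) * w * l = 2 * l + 2 * l * (w - 1) by ring, Complex.exp_add, neg_mul]
  ring

lemma integral_gamma_exp {a : ℝ} (ha : 0 < a) {w : ℂ} (hw : 0 < w.re) :
    ∫ l : ℝ, cexp (2 * w * l) * ((Real.exp (-a * Real.exp l ^ 2) : ℝ) : ℂ) =
      1 / 2 * (1 / (a : ℂ)) ^ w * Gamma w := by
  have h := integral_image_eq_integral_abs_deriv_smul (s := Set.univ) MeasurableSet.univ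
    (f := fun l : ℝ => Real.exp (2 * l)) (f' := fun l => 2 * Real.exp (2 * l))
    (fun x _ => by
      have := ((hasDerivAt_id x).const_mul 2).exp
      simp only [id, mul_one] at this
      rw [mul_comm]
      exact this.hasDerivWithinAt)
    (fun x _ y _ hxy => by simpa using hxy)
    (fun t : ℝ => ((t : ℂ) ^ (w - 1) * cexp (-(a * t))))
  rw [image_exp_two_mul, integral_cpow_mul_exp_neg_mul_Ioi hw (by simpa using ha)] at h
  simp only [gamma_exp_aux, Measure.restrict_univ] at h
  rw [integral_const_mul] at h
  linear_combination (-1 / 2) * h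

lemma integrable_gamma_exp {a : ℝ} (ha : 0 < a) {w : ℂ} (hw : 0 < w.re) :
    Integrable fun l : ℝ => cexp (2 * w * l) * ((Real.exp (-a * Real.exp l ^ 2) : ℝ) : ℂ) := by
  have h := integrableOn_image_iff_integrableOn_abs_deriv_smul (s := Set.univ) MeasurableSet.univ
    (f := fun l : ℝ => Real.exp (2 * l)) (f' := fun l => 2 * Real.exp (2 * l))
    (fun x _ => by
      have := ((hasDerivAt_id x).const_mul 2).exp
      simp only [id, mul_one] at this
      rw [mul_comm]
      exact this.hasDerivWithinAt)
    (fun x _ y _ hxy => by simpa using hxy)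
    (fun t : ℝ => ((t : ℂ) ^ (w - 1) * cexp (-(a * t))))
  rw [image_exp_two_mul] at h
  simp only [gamma_exp_aux, integrableOn_univ] at h
  have h2 : IntegrableOn (fun t : ℝ => ((t : ℂ) ^ (w - 1) * cexp (-(a * t)))) (Set.Ioi 0) := by
    have hr := (Real.GammaIntegral_convergent hw)
    have hr2 : IntegrableOn (fun x : ℝ => Real.exp (-(a * x)) * (a * x) ^ (w.re - 1)) (Set.Ioi 0) := by
      have := (integrableOn_Ioi_comp_mul_left_iff
        (fun x : ℝ => Real.exp (-x) * x ^ (w.re - 1)) 0 ha).2 (by simpa using hr)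
      simpa using this
    have hr3 := hr2.const_mul (a ^ (-(w.re - 1)))
    refine Integrable.mono' hr3 ?_ ?_
    · refine ContinuousOn.aestronglyMeasurable (fun x hx => ?_) measurableSet_Ioi
      refine ContinuousAt.continuousWithinAt ?_
      refine ContinuousAt.mul ?_ (by fun_prop)
      exact (continuousAt_ofReal_cpow_const x _ (Or.inr (ne_of_gt hx)))
    · refine (ae_restrict_iff' measurableSet_Ioi).2 (ae_of_all _ fun x hx => le_of_eq ?_)
      have hx : 0 < x := hx
      rw [norm_mul, Complex.norm_cpow_eq_rpow_re_of_pos hx, Complex.norm_exp,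
        Real.mul_rpow ha.le hx.le, Real.rpow_neg ha.le]
      have : (a ^ (w.re - 1)) ≠ 0 := (Real.rpow_pos_of_pos ha _).ne'
      simp only [sub_re, one_re, neg_re, mul_re, ofReal_re, ofReal_im, zero_mul, sub_zero]
      field_simp
  have h3 := (h.1 h2).const_mul (1 / 2)
  refine h3.congr (ae_of_all _ fun l => ?_)
  show 1 / 2 * (2 * (_ : ℂ)) = _
  ring

open NumberField.InfinitePlace NumberField.mixedEmbedding NumberField.Units
open scoped Classical nonZeroDivisors

variable {K : Type*} [Field K] [NumberField K]

variable (S : Finset {w : InfinitePlace K // IsReal w})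

/-- The indicator function of a set of real places, on all places. -/
def bInd (v : InfinitePlace K) : ℕ :=
  if h : IsReal v then (if ⟨v, h⟩ ∈ S then 1 else 0) else 0

lemma hLog_eq_prod (l : InfinitePlace K → ℝ) :
    hLog S l = ∏ v : InfinitePlace K,
      Real.exp (bInd S v * l v) * Real.exp (-(mult v * Real.pi) * Real.exp (l v) ^ 2) := by
  rw [hLog, prod_mult_split]
  congr 1
  · refine Finset.prod_congr rfl fun v _ => ?_
    have : bInd S v.1 = if v ∈ S then 1 else 0 := by
      rw [bInd, dif_pos v.2]
    rw [this, mult_isReal]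
    split_ifs <;> simp
  · refine Finset.prod_congr rfl fun v _ => ?_
    rw [bInd, dif_neg (not_isReal_iff_isComplex.2 v.2), mult_isComplex]
    simp

/-- The argument of the Gamma factor at a place. -/
def wArg (s : ℂ) (v : InfinitePlace K) : ℂ :=
  (mult v * s + bInd S v) / 2

lemma wArg_re_pos {s : ℂ} (hs : 0 < s.re)
    (v : InfinitePlace K) : 0 < (wArg S s v).re := by
  have h : (wArg S s v).re = (mult v * s.re + bInd S v) / 2 := by
    rw [wArg]
    simp
  rw [h]
  have : 0 < (mult v : ℝ) := by exact_mod_cast mult_pos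
  positivity

lemma exp_mul_hLog (s : ℂ)
    (l : InfinitePlace K → ℝ) :
    cexp (s * ((∑ v, (mult v : ℝ) * l v : ℝ) : ℂ)) * (hLog S l : ℂ) =
      ∏ v, cexp (2 * wArg S s v * (l v : ℂ)) *
        ((Real.exp (-(mult v * Real.pi) * Real.exp (l v) ^ 2) : ℝ) : ℂ) := by
  rw [hLog_eq_prod]
  push_cast
  rw [Finset.mul_sum, Complex.exp_sum, ← Finset.prod_mul_distrib]
  refine Finset.prod_congr rfl fun v _ => ?_
  rw [← mul_assoc, ← Complex.exp_add]
  congr 2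
  rw [wArg]
  ring

/-- The Gamma factor, as an integral over the logarithmic space. -/
def gamS (s : ℂ) : ℂ :=
  ∫ p : ℝ × (Fin (rank K) → ℝ), cexp (s * (p.1 : ℂ)) * (hLog S (logLin K p) : ℂ)

/-- The product of the one-dimensional Gamma factors. -/
def gamP (s : ℂ) : ℂ :=
  ∏ v : InfinitePlace K, (1 / 2 * (1 / ((mult v * Real.pi : ℝ) : ℂ)) ^ wArg S s v * Gamma (wArg S s v))

lemma mult_mul_pi_pos (v : InfinitePlace K) : 0 < (mult v * Real.pi : ℝ) := by
  have : 0 < (mult v : ℝ) := by exact_mod_cast mult_pos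
  positivity

variable (K) in
lemma exists_map_logEquiv : ∃ κ : NNReal, κ ≠ 0 ∧
    (volume : Measure (ℝ × (Fin (rank K) → ℝ))) =
      κ • (volume : Measure (InfinitePlace K → ℝ)).map (logEquiv K).symm := by
  have : ((volume : Measure (InfinitePlace K → ℝ)).map (logEquiv K).symm).IsAddHaarMeasure :=
    (logEquiv K).symm.isAddHaarMeasure_map _
  have : (volume : Measure (ℝ × (Fin (rank K) → ℝ))).IsAddHaarMeasure :=
    Measure.prod.instIsAddHaarMeasure (volume : Measure ℝ) (volume : Measure (Fin (rank K) → ℝ))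
  refine ⟨_, ?_, Measure.isAddLeftInvariant_eq_smul _ _⟩
  exact (Measure.addHaarScalarFactor_pos_of_isAddHaarMeasure _ _).ne'

variable (K) in
lemma exists_gamS_eq : ∃ κ : ℝ, 0 < κ ∧
    ∀ (S : Finset {w : InfinitePlace K // IsReal w}) (s : ℂ), 0 < s.re →
      Integrable (fun p : ℝ × (Fin (rank K) → ℝ) =>
        cexp (s * (p.1 : ℂ)) * (hLog S (logLin K p) : ℂ)) ∧ gamS S s = κ * gamP S s := by
  obtain ⟨κ, hκ, hμ⟩ := exists_map_logEquiv K
  refine ⟨κ, by positivity, fun S s hs => ?_⟩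
  set F : (InfinitePlace K → ℝ) → ℂ := fun l => ∏ v, cexp (2 * wArg S s v * (l v : ℂ)) *
        ((Real.exp (-(mult v * Real.pi) * Real.exp (l v) ^ 2) : ℝ) : ℂ) with hF
  have e : ∀ p : ℝ × (Fin (rank K) → ℝ),
      cexp (s * (p.1 : ℂ)) * (hLog S (logLin K p) : ℂ) = F (logEquiv K p) := by
    intro p
    rw [hF, logEquiv_apply]
    simp only
    rw [← exp_mul_hLog, sum_mult_logLin]
  have hIntg : Integrable F := by
    apply Integrable.fintype_prod (f := fun v (x : ℝ) => cexp (2 * wArg S s v * (x : ℂ)) *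
        ((Real.exp (-(mult v * Real.pi) * Real.exp x ^ 2) : ℝ) : ℂ))
    exact fun v => integrable_gamma_exp (mult_mul_pi_pos v) (wArg_re_pos S hs v)
  have hemb : MeasurableEmbedding (logEquiv K).symm :=
    (logEquiv K).symm.toHomeomorph.measurableEmbedding
  constructor
  · simp only [e]
    rw [hμ]
    refine Integrable.smul_measure_nnreal ?_
    rw [hemb.integrable_map_iff]
    refine hIntg.congr (ae_of_all _ fun l => ?_)
    simp
  · rw [gamS, hμ]
    simp only [e]
    rw [integral_smul_nnreal_measure, hemb.integral_map]
    simp only [ContinuousLinearEquiv.apply_symm_apply]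
    rw [hF, integral_fintype_prod_volume_eq_prod (f := fun v (x : ℝ) => cexp (2 * wArg S s v * (x : ℂ)) *
        ((Real.exp (-(mult v * Real.pi) * Real.exp x ^ 2) : ℝ) : ℂ)), gamP, NNReal.smul_def,
        Complex.real_smul]
    congr 1
    refine Finset.prod_congr rfl fun v _ => ?_
    exact integral_gamma_exp (mult_mul_pi_pos v) (wArg_re_pos S hs v)

end GammaFactor

section Unfolding
open MeasureTheory

variable {d : Type} [Fintype d]

variable (d) in
/-- The closed unit cube times the line. -/
def strip : Set (ℝ × (d → ℝ)) := Set.univ ×ˢ Set.Icc 0 1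

variable (d) in
/-- The half-open unit cube times the line. -/
def stripIoc : Set (ℝ × (d → ℝ)) := Set.univ ×ˢ Set.univ.pi fun _ => Set.Ioc (0 : ℝ) 1

lemma strip_ae_eq : (stripIoc d : Set (ℝ × (d → ℝ))) =ᵐ[volume] strip d := by
  refine Measure.set_prod_ae_eq (ae_eq_refl _) ?_
  exact Measure.univ_pi_Ioc_ae_eq_Icc (μ := fun _ : d => (volume : Measure ℝ))

lemma measurableSet_stripIoc : MeasurableSet (stripIoc d) :=
  MeasurableSet.univ.prod (MeasurableSet.univ_pi fun _ => measurableSet_Ioc)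

/-- Translation by an integral vector in the second variable. -/
def shiftZ (m : d → ℤ) (p : ℝ × (d → ℝ)) : ℝ × (d → ℝ) := (p.1, p.2 + fun i => (m i : ℝ))

lemma shiftZ_eq (m : d → ℤ) (p : ℝ × (d → ℝ)) :
    shiftZ m p = p + ((0, fun i => (m i : ℝ)) : ℝ × (d → ℝ)) := by
  rw [shiftZ, Prod.ext_iff]
  simp

lemma hasSum_strip {E : Type*} [NormedAddCommGroup E] [NormedSpace ℝ E] {H : ℝ × (d → ℝ) → E}
    (hH : Integrable H) :
    HasSum (fun m : d → ℤ => ∫ p in strip d, H (shiftZ m p)) (∫ p, H p) := by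
  set s : (d → ℤ) → Set (ℝ × (d → ℝ)) := fun m =>
    (fun x => x - ((0, fun i => (m i : ℝ)) : ℝ × (d → ℝ))) ⁻¹' stripIoc d with hs
  have hsm : ∀ m, MeasurableSet (s m) := fun m =>
    (measurable_id.sub_const ((0, fun i => (m i : ℝ)) : ℝ × (d → ℝ))) measurableSet_stripIoc
  have hmem : ∀ m x, x ∈ s m ↔ ∀ i, x.2 i - m i ∈ Set.Ioc (0 : ℝ) 1 := by
    intro m x
    simp [hs, stripIoc]
  have hU : ⋃ m, s m = Set.univ := by
    refine Set.eq_univ_of_forall fun x => Set.mem_iUnion.2 ⟨fun i => ⌈x.2 i⌉ - 1, ?_⟩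
    rw [hmem]
    intro i
    simp only [Set.mem_Ioc]
    push_cast
    constructor <;> linarith [Int.le_ceil (x.2 i), Int.ceil_lt_add_one (x.2 i)]
  have hd : Pairwise (Function.onFun Disjoint s) := by
    intro m m' hmm
    refine Set.disjoint_left.2 fun x hx hx' => hmm (funext fun i => ?_)
    have h1 := (hmem m x).1 hx i
    have h2 := (hmem m' x).1 hx' i
    simp only [Set.mem_Ioc] at h1 h2
    have h3 : (m i : ℝ) < m' i + 1 := by linarith
    have h4 : (m' i : ℝ) < m i + 1 := by linarith
    have h5 : m i < m' i + 1 := by exact_mod_cast h3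
    have h6 : m' i < m i + 1 := by exact_mod_cast h4
    omega
  have h1 := hasSum_integral_iUnion hsm hd (f := H) (μ := volume) hH.integrableOn
  rw [hU, Measure.restrict_univ] at h1
  convert h1 using 2 with m
  rw [← setIntegral_congr_set strip_ae_eq]
  have hi : (volume : Measure (ℝ × (d → ℝ))).IsAddRightInvariant := by
    have : (volume : Measure (ℝ × (d → ℝ))).IsAddHaarMeasure :=
      Measure.prod.instIsAddHaarMeasure (volume : Measure ℝ) (volume : Measure (d → ℝ))
    infer_instance
  have := (measurePreserving_sub_right (volume : Measure (ℝ × (d → ℝ)))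
      ((0, fun i => (m i : ℝ)) : ℝ × (d → ℝ))).setIntegral_preimage_emb
      (MeasurableEquiv.subRight ((0, fun i => (m i : ℝ)) : ℝ × (d → ℝ))).measurableEmbedding
      (fun x => H (shiftZ m x)) (stripIoc d)
  simp only [shiftZ_eq, sub_add_cancel] at this
  simp only [shiftZ_eq]
  exact this.symm

/-- Multiplication by a sign in the second variable. -/
def flip2 (e : ℤˣ) (p : ℝ × (d → ℝ)) : ℝ × (d → ℝ) := (p.1, ((e : ℤ) : ℝ) • p.2)

lemma flip2_flip2 (e : ℤˣ) (p : ℝ × (d → ℝ)) : flip2 e (flip2 e p) = p := by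
  rw [flip2, flip2, smul_smul, ← Int.cast_mul, ← Units.val_mul, Int.units_mul_self]
  simp

lemma continuous_flip2 (e : ℤˣ) : Continuous (flip2 (d := d) e) := by
  unfold flip2; fun_prop

lemma measurePreserving_flip2 (e : ℤˣ) :
    MeasurePreserving (flip2 (d := d) e) volume volume := by
  have : MeasurePreserving (fun y : d → ℝ => ((e : ℤ) : ℝ) • y) volume volume := by
    rcases Int.units_eq_one_or e with rfl | rfl
    · simp only [Units.val_one, Int.cast_one, one_smul]
      exact MeasurePreserving.id (volume : Measure (d → ℝ))
    · simpa using Measure.measurePreserving_neg (volume : Measure (d → ℝ))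
  exact (MeasurePreserving.id (volume : Measure ℝ)).prod this

/-- The involution `flip2` as a measurable equivalence. -/
def flipEquiv (e : ℤˣ) : (ℝ × (d → ℝ)) ≃ᵐ (ℝ × (d → ℝ)) where
  toFun := flip2 e
  invFun := flip2 e
  left_inv := flip2_flip2 e
  right_inv := flip2_flip2 e
  measurable_toFun := (continuous_flip2 e).measurable
  measurable_invFun := (continuous_flip2 e).measurable

lemma flip2_shiftZ (e : ℤˣ) (m : d → ℤ) (p : ℝ × (d → ℝ)) :
    flip2 e (shiftZ ((e : ℤ) • m) p) = shiftZ m (flip2 e p) := by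
  rw [shiftZ, flip2, shiftZ, flip2, Prod.ext_iff]
  refine ⟨rfl, ?_⟩
  ext i
  have : ((e : ℤ) : ℝ) * ((e : ℤ) : ℝ) = 1 := by
    rw [← Int.cast_mul, ← Units.val_mul, Int.units_mul_self]; simp
  simp only [Pi.smul_apply, Pi.add_apply, smul_eq_mul, mul_add]
  push_cast
  rw [← mul_assoc, this, one_mul]

lemma hasSum_strip_flip {E : Type*} [NormedAddCommGroup E] [NormedSpace ℝ E] {H : ℝ × (d → ℝ) → E}
    (hH : Integrable H) (e : ℤˣ) :
    HasSum (fun m : d → ℤ => ∫ p in strip d, H (shiftZ m (flip2 e p))) (∫ p, H p) := by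
  have hH' : Integrable (fun p => H (flip2 e p)) :=
    (measurePreserving_flip2 e).integrable_comp_of_integrable hH
  have h := hasSum_strip hH'
  have hI : ∫ p, H (flip2 e p) = ∫ p : ℝ × (d → ℝ), H p :=
    (measurePreserving_flip2 (d := d) e).integral_comp (flipEquiv e).measurableEmbedding H
  rw [hI] at h
  have hinv : Function.Involutive fun m : d → ℤ => (e : ℤ) • m := fun m => by
    simp only [smul_smul, ← Units.val_mul, Int.units_mul_self, Units.val_one, one_smul]
  have h2 := hinv.toPerm.hasSum_iff.2 h
  convert h2 using 2 with m
  simp only [Function.comp, Function.Involutive.coe_toPerm, flip2_shiftZ]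

lemma integrable_of_hasSum {α ι : Type*} [MeasurableSpace α] {μ : Measure α} [Countable ι]
    {F : ι → α → ℂ} {f : α → ℂ} (hF : ∀ i, Integrable (F i) μ)
    (hs : Summable fun i => ∫ a, ‖F i a‖ ∂μ) (hf : AEStronglyMeasurable f μ)
    (h : ∀ a, HasSum (fun i => F i a) (f a)) : Integrable f μ := by
  refine ⟨hf, ?_⟩
  have h1 : ∀ a, ‖f a‖ₑ ≤ ∑' i, ‖F i a‖ₑ := fun a => by
    rw [← (h a).tsum_eq]
    exact enorm_tsum_le_tsum_enorm
  refine lt_of_le_of_lt (lintegral_mono h1) ?_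
  rw [lintegral_tsum fun i => (hF i).aestronglyMeasurable.enorm]
  have h2 : ∀ i, ∫⁻ a, ‖F i a‖ₑ ∂μ = ENNReal.ofReal (∫ a, ‖F i a‖ ∂μ) := fun i =>
    (ofReal_integral_norm_eq_lintegral_enorm (hF i)).symm
  simp only [h2]
  exact hs.tsum_ofReal_lt_top

lemma unfold_integral_aux {ι : Type*} [Countable ι] (e : ℤˣ)
    {H : ι → ℝ × (d → ℝ) → ℂ} (hH : ∀ i, Integrable (H i))
    (hs : Summable fun i => ∫ p, ‖H i p‖) {f : ℝ × (d → ℝ) → ℂ} (hf : Continuous f)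
    (hsum : ∀ p, HasSum (fun x : ι × (d → ℤ) => H x.1 (shiftZ x.2 (flip2 e p))) (f p)) :
    IntegrableOn f (strip d) ∧ HasSum (fun i => ∫ p, H i p) (∫ p in strip d, f p) := by
  have hIntg : ∀ x : ι × (d → ℤ), Integrable (fun p => H x.1 (shiftZ x.2 (flip2 e p)))
      (volume.restrict (strip d)) := by
    intro x
    refine Integrable.restrict ?_
    have hi : (volume : Measure (ℝ × (d → ℝ))).IsAddRightInvariant := by
      have : (volume : Measure (ℝ × (d → ℝ))).IsAddHaarMeasure :=
        Measure.prod.instIsAddHaarMeasure (volume : Measure ℝ) (volume : Measure (d → ℝ))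
      infer_instance
    simp only [shiftZ_eq]
    exact (measurePreserving_flip2 e).integrable_comp_of_integrable
      ((hH x.1).comp_add_right ((0, fun i => (x.2 i : ℝ)) : ℝ × (d → ℝ)))
  have hfib := fun i => hasSum_strip_flip (hH i) e
  have hfibn := fun i => hasSum_strip_flip (hH i).norm e
  have hS : Summable fun x : ι × (d → ℤ) =>
      ∫ p in strip d, ‖H x.1 (shiftZ x.2 (flip2 e p))‖ := by
    rw [summable_prod_of_nonneg (fun x => integral_nonneg fun p => norm_nonneg _)]
    refine ⟨fun i => (hfibn i).summable, ?_⟩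
    simp only [fun i => (hfibn i).tsum_eq]
    exact hs
  refine ⟨integrable_of_hasSum hIntg hS hf.aestronglyMeasurable hsum, ?_⟩
  have h := hasSum_integral_of_summable_integral_norm hIntg hS
  simp only [fun p => (hsum p).tsum_eq] at h
  exact h.prod_fiberwise hfib

/-- The unfolding identity: summing a family of translates over the strip. -/
lemma unfold_integral {ι W : Type*} [Countable ι] [Fintype W] (e : ℤˣ)
    {H : ι → ℝ × (d → ℝ) → ℂ} (hH : ∀ i, Integrable (H i))
    (hs : Summable fun i => ∫ p, ‖H i p‖) {f : ℝ × (d → ℝ) → ℂ} (hf : Continuous f)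
    (hsum : ∀ p, HasSum (fun x : ι × (W × (d → ℤ)) => H x.1 (shiftZ x.2.2 (flip2 e p))) (f p)) :
    IntegrableOn f (strip d) ∧
      HasSum (fun i => (Fintype.card W : ℂ) * ∫ p, H i p) (∫ p in strip d, f p) := by
  have h := unfold_integral_aux (ι := ι × W) e (H := fun x => H x.1) (fun x => hH x.1) (by
    rw [summable_prod_of_nonneg (fun x => integral_nonneg fun p => norm_nonneg _)]
    refine ⟨fun i => Summable.of_finite, ?_⟩
    simp only [tsum_fintype, Finset.sum_const, nsmul_eq_mul]
    exact hs.mul_left _) hf (fun p => by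
      rw [← (Equiv.prodAssoc ι W (d → ℤ)).symm.hasSum_iff]
      exact hsum p)
  refine ⟨h.1, ?_⟩
  refine h.2.prod_fiberwise fun i => ?_
  simpa [Finset.sum_const] using hasSum_fintype fun _ : W => ∫ p, H i p

end Unfolding

section Theta
open NumberField.InfinitePlace NumberField.mixedEmbedding MeasureTheory NumberField.Units
open scoped Classical nonZeroDivisors

variable {K : Type*} [Field K] [NumberField K] (J : (FractionalIdeal (𝓞 K)⁰ K)ˣ)

section ThetaSeries

lemma summable_exp_qForm {δ : ℝ} (hδ : 0 < δ) :
    Summable fun β : {x : K // x ∈ (J : FractionalIdeal (𝓞 K)⁰ K)} =>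
      Real.exp (-(δ ^ 2 * qForm (mixedEmbedding K β))) := by
  rw [← (coordEquiv J).summable_iff]
  obtain ⟨c, hc, h⟩ := exists_qForm_basis_ge (fractionalIdealLatticeBasis K J)
  refine Summable.of_nonneg_of_le (fun _ => (Real.exp_pos _).le) (fun m => ?_)
    (summable_pi_prod (d := Module.Free.ChooseBasisIndex ℤ J)
      (g := fun _ (n : ℤ) => Real.exp (-(δ ^ 2 * c) * (n : ℝ) ^ 2))
      (fun _ _ => (Real.exp_pos _).le) fun i => summable_exp_neg_int_sq (by positivity))
  rw [← Real.exp_sum, ← Finset.mul_sum]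
  apply Real.exp_le_exp.mpr
  have := mul_le_mul_of_nonneg_left (h fun i => (m i : ℝ)) (sq_nonneg δ)
  rw [mixedEmbedding_coordEquiv]
  linarith

lemma exists_qForm_ge : ∃ q₀ : ℝ, 0 < q₀ ∧ ∀ β : {x : K // x ∈ (J : FractionalIdeal (𝓞 K)⁰ K)},
    (β : K) ≠ 0 → q₀ ≤ qForm (mixedEmbedding K β) := by
  obtain ⟨c, hc, h⟩ := exists_qForm_basis_ge (fractionalIdealLatticeBasis K J)
  refine ⟨c, hc, fun β hβ => ?_⟩
  obtain ⟨m, rfl⟩ := (coordEquiv J).surjective β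
  rw [mixedEmbedding_coordEquiv]
  refine le_trans ?_ (h _)
  have hm : ∃ i, m i ≠ 0 := by
    by_contra! hcon
    exact hβ (by rw [coordEquiv_coe]; simp [hcon])
  obtain ⟨i, hi⟩ := hm
  have h1 : (1 : ℝ) ≤ (m i : ℝ) ^ 2 := by
    have : (1 : ℤ) ≤ (m i) ^ 2 := Int.add_one_le_iff.2 (sq_pos_of_ne_zero hi)
    exact_mod_cast this
  have h2 : (m i : ℝ) ^ 2 ≤ ∑ i, (m i : ℝ) ^ 2 :=
    Finset.single_le_sum (f := fun i => (m i : ℝ) ^ 2) (fun _ _ => sq_nonneg _) (Finset.mem_univ i)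
  nlinarith

variable (S : Finset {w : InfinitePlace K // IsReal w}) (c : K → ℂ)

/-- The theta series of a fractional ideal with coefficients, in logarithmic coordinates. -/
def thetaC (p : ℝ × (Fin (rank K) → ℝ)) : ℂ :=
  ∑' β : {x : K // x ∈ (J : FractionalIdeal (𝓞 K)⁰ K)},
    c β * testF S (fun v => Real.exp (logLin K p v)) (mixedEmbedding K β)

lemma continuous_logLin (v : InfinitePlace K) : Continuous fun p => logLin K p v :=
  (continuous_apply v).comp (logEquiv K).continuous

lemma testF_zero (g : InfinitePlace K → ℝ) :
    testF S g (0 : mixedSpace K) = if S = ∅ then 1 else 0 := by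
  rw [testF]
  split_ifs with h
  · subst h; simp
  · obtain ⟨v, hv⟩ := Finset.nonempty_iff_ne_empty.2 h
    rw [Finset.prod_eq_zero (Finset.mem_univ v) (by simp [hv]), zero_mul]

lemma continuous_testF_log (β : K) :
    Continuous fun p => testF S (fun v => Real.exp (logLin K p v)) (mixedEmbedding K β) := by
  by_cases hβ : β = 0
  · simp only [hβ, map_zero, testF_zero]
    exact continuous_const
  · simp only [testF_log S _ hβ]
    have : Continuous fun p => logLin K p + logAbs β :=
      (logEquiv K).continuous.add continuous_const
    exact continuous_const.mul (Complex.continuous_ofReal.comp ((continuous_hLog S).comp this))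

variable {c}

lemma norm_theta_term_le (hc : ∀ x, ‖c x‖ ≤ 1) {δ : ℝ} (hδ : 0 ≤ δ) {g : InfinitePlace K → ℝ}
    (hg : ∀ v, δ ≤ g v) (β : K) :
    ‖c β * testF S g (mixedEmbedding K β)‖ ≤ Real.exp (-(δ ^ 2 * qForm (mixedEmbedding K β))) := by
  rw [norm_mul]
  calc _ ≤ 1 * Real.exp (-(δ ^ 2 * qForm (mixedEmbedding K β))) :=
        mul_le_mul (hc β) (testF_norm_le_qForm S hδ hg _) (norm_nonneg _) zero_le_one
    _ = _ := one_mul _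

lemma summable_theta (hc : ∀ x, ‖c x‖ ≤ 1) (l : InfinitePlace K → ℝ) :
    Summable fun β : {x : K // x ∈ (J : FractionalIdeal (𝓞 K)⁰ K)} =>
      c β * testF S (fun v => Real.exp (l v)) (mixedEmbedding K β) := by
  obtain ⟨v, hv⟩ := Finite.exists_min fun v : InfinitePlace K => Real.exp (l v)
  exact Summable.of_norm_bounded (summable_exp_qForm J (Real.exp_pos (l v)))
    fun β => norm_theta_term_le S hc (Real.exp_pos _).le hv β

lemma continuous_thetaC (hc : ∀ x, ‖c x‖ ≤ 1) : Continuous (thetaC J S c) := by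
  rw [continuous_iff_continuousAt]
  intro p₀
  obtain ⟨v₀, hv₀⟩ := Finite.exists_min fun v : InfinitePlace K => logLin K p₀ v
  set U : Set (ℝ × (Fin (rank K) → ℝ)) := ⋂ v, {p | logLin K p₀ v₀ - 1 < logLin K p v} with hU
  have hUo : IsOpen U := isOpen_iInter_of_finite fun v =>
    isOpen_lt continuous_const (continuous_logLin v)
  have hp : p₀ ∈ U := by
    rw [hU, Set.mem_iInter]
    intro v
    have := hv₀ v
    rw [Set.mem_ofPred_eq]
    linarith
  refine ContinuousOn.continuousAt ?_ (hUo.mem_nhds hp)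
  refine continuousOn_tsum (fun β => (continuous_const.mul (continuous_testF_log S _)).continuousOn)
    (summable_exp_qForm J (Real.exp_pos (logLin K p₀ v₀ - 1))) fun β p hpU => ?_
  refine norm_theta_term_le S hc (Real.exp_pos _).le (fun v => ?_) β
  exact Real.exp_le_exp.2 (Set.mem_iInter.1 hpU v).le

lemma exists_logLin_ge : ∃ M : ℝ, ∀ (t : ℝ) (y : Fin (rank K) → ℝ), (∀ i, |y i| ≤ 1) →
    ∀ v, t / (Module.finrank ℚ K : ℝ) - M ≤ logLin K (t, y) v := by
  refine ⟨∑ v : InfinitePlace K, ∑ i, |Real.log (v (fundSystem K i : K))|, fun t y hy v => ?_⟩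
  rw [logLin_apply]
  have h1 : ∑ i, |Real.log (v (fundSystem K i : K))| ≤
      ∑ v : InfinitePlace K, ∑ i, |Real.log (v (fundSystem K i : K))| :=
    Finset.single_le_sum (f := fun v : InfinitePlace K => ∑ i, |Real.log (v (fundSystem K i : K))|)
      (fun _ _ => Finset.sum_nonneg fun _ _ => abs_nonneg _) (Finset.mem_univ v)
  have h2 : -∑ i, |Real.log (v (fundSystem K i : K))| ≤
      ∑ i, y i * Real.log (v (fundSystem K i : K)) := by
    rw [← Finset.sum_neg_distrib]
    refine Finset.sum_le_sum fun i _ => ?_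
    refine (neg_le_neg ?_).trans (neg_abs_le _)
    rw [abs_mul]
    exact mul_le_of_le_one_left (abs_nonneg _) (hy i)
  simp only
  linarith

lemma exists_thetaC_decay (hc : ∀ x, ‖c x‖ ≤ 1) (hc0 : c 0 = 0) :
    ∃ A b : ℝ, 0 < b ∧ ∀ t : ℝ, 0 ≤ t → ∀ y : Fin (rank K) → ℝ, (∀ i, |y i| ≤ 1) →
      ‖thetaC J S c (t, y)‖ ≤
        A * Real.exp (-(b * Real.exp (2 * t / (Module.finrank ℚ K : ℝ)))) := by
  obtain ⟨M, hM⟩ := exists_logLin_ge (K := K)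
  obtain ⟨q₀, hq₀, hq⟩ := exists_qForm_ge J
  set δ := Real.exp (-M) with hδ
  have hδ0 : 0 < δ := Real.exp_pos _
  have hs := summable_exp_qForm J hδ0
  refine ⟨Real.exp (δ ^ 2 * q₀) * ∑' β : {x : K // x ∈ (J : FractionalIdeal (𝓞 K)⁰ K)},
      Real.exp (-(δ ^ 2 * qForm (mixedEmbedding K β))), δ ^ 2 * q₀, by positivity,
      fun t ht y hy => ?_⟩
  have hE : 1 ≤ Real.exp (2 * t / (Module.finrank ℚ K : ℝ)) := Real.one_le_exp (by positivity)
  set E := Real.exp (2 * t / (Module.finrank ℚ K : ℝ)) with hEdef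
  have hb : ∀ β : {x : K // x ∈ (J : FractionalIdeal (𝓞 K)⁰ K)},
      ‖c β * testF S (fun v => Real.exp (logLin K (t, y) v)) (mixedEmbedding K β)‖ ≤
      Real.exp (δ ^ 2 * q₀) * Real.exp (-(δ ^ 2 * q₀ * E)) *
        Real.exp (-(δ ^ 2 * qForm (mixedEmbedding K β))) := by
    intro β
    by_cases hβ : (β : K) = 0
    · rw [hβ, hc0, zero_mul, norm_zero]; positivity
    · refine (norm_theta_term_le S hc (Real.exp_pos (t / (Module.finrank ℚ K : ℝ) - M)).le
        (fun v => Real.exp_le_exp.2 (hM t y hy v)) β).trans ?_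
      rw [← Real.exp_add, ← Real.exp_add]
      apply Real.exp_le_exp.2
      have e1 : Real.exp (t / (Module.finrank ℚ K : ℝ) - M) ^ 2 = δ ^ 2 * E := by
        rw [hδ, hEdef, ← Real.exp_nat_mul, ← Real.exp_nat_mul, ← Real.exp_add]
        congr 1; push_cast; ring
      rw [e1]
      have h3 := mul_nonneg (mul_nonneg (sq_nonneg δ) (sub_nonneg.2 hE)) (sub_nonneg.2 (hq β hβ))
      nlinarith
  refine (tsum_of_norm_bounded ((hs.hasSum).mul_left _) hb).trans (le_of_eq ?_)
  ring

end ThetaSeries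

section MellinTheta

variable (S : Finset {w : InfinitePlace K // IsReal w}) {c : K → ℂ}

lemma unit_mul_mem (u : (𝓞 K)ˣ) {x : K} (hx : x ∈ (J : FractionalIdeal (𝓞 K)⁰ K)) :
    (u : K) * x ∈ (J : FractionalIdeal (𝓞 K)⁰ K) := by
  have := Submodule.smul_mem (J : FractionalIdeal (𝓞 K)⁰ K).coeToSubmodule (u : 𝓞 K)
    ((FractionalIdeal.mem_coe).2 hx)
  rw [Algebra.smul_def] at this
  exact FractionalIdeal.mem_coe.1 this

theorem mellin_theta {ι : Type*} [Countable ι] (hc : ∀ x, ‖c x‖ ≤ 1) (hc0 : c 0 = 0)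
    (hcu : ∀ (u : (𝓞 K)ˣ) (β : K), c (u * β) = sgnS S (u : K) * c β) (e : ℤˣ)
    {gen : ι → K} (hgen0 : ∀ i, gen i ≠ 0) (hgenJ : ∀ i, gen i ∈ (J : FractionalIdeal (𝓞 K)⁰ K))
    (hex : ∀ β ∈ (J : FractionalIdeal (𝓞 K)⁰ K), β ≠ 0 → ∃ (i : ι) (u : (𝓞 K)ˣ), β = u * gen i)
    (hinj : ∀ (i j : ι) (u v : (𝓞 K)ˣ), (u : K) * gen i = v * gen j → i = j)
    {s : ℂ} (hs : 0 < s.re)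
    (hsum : Summable fun i => Real.exp (-s.re * Real.log |(Algebra.norm ℚ (gen i) : ℚ)|)) :
    IntegrableOn (fun p => cexp (s * (p.1 : ℂ)) * thetaC J S c (flip2 e p)) (strip _) ∧
    HasSum (fun i => (Nat.card (torsion K) : ℂ) * (c (gen i) * sgnS S (gen i) *
      cexp (-s * Real.log |(Algebra.norm ℚ (gen i) : ℚ)|) * gamS S s))
      (∫ p in strip _, cexp (s * (p.1 : ℂ)) * thetaC J S c (flip2 e p)) := by
  have : Fintype (torsion K) := Fintype.ofFinite _
  rw [Nat.card_eq_fintype_card]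
  obtain ⟨κ, hκ, hgam⟩ := exists_gamS_eq K
  have hIntg := (hgam S s hs).1
  set h : ℝ × (Fin (rank K) → ℝ) → ℂ := fun p => cexp (s * (p.1 : ℂ)) * (hLog S (logLin K p) : ℂ)
    with hh
  choose y hy using fun i => exists_logAbs_eq (hgen0 i)
  set ν : ι → ℝ := fun i => Real.log |(Algebra.norm ℚ (gen i) : ℚ)| with hν
  set a : ι → ℂ := fun i => c (gen i) * sgnS S (gen i) * cexp (-s * ν i) with ha
  have hna : ∀ i, ‖a i‖ ≤ Real.exp (-s.re * ν i) := by
    intro i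
    rw [ha]
    simp only [norm_mul, Complex.norm_exp]
    have h1 : (-s * (ν i : ℂ)).re = -s.re * ν i := by simp
    rw [h1]
    refine mul_le_of_le_one_left (Real.exp_pos _).le ?_
    exact mul_le_one₀ (hc _) (norm_nonneg _) (norm_sgnS_le S _)
  have hinv : (volume : Measure (ℝ × (Fin (rank K) → ℝ))).IsAddRightInvariant := by
    have : (volume : Measure (ℝ × (Fin (rank K) → ℝ))).IsAddHaarMeasure :=
      Measure.prod.instIsAddHaarMeasure (volume : Measure ℝ) (volume : Measure (Fin (rank K) → ℝ))
    infer_instance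
  set H : ι → ℝ × (Fin (rank K) → ℝ) → ℂ := fun i p => a i * h (p + (ν i, y i)) with hH
  have hHint : ∀ i, Integrable (H i) := fun i => (hIntg.comp_add_right (ν i, y i)).const_mul _
  have hHs : Summable fun i => ∫ p, ‖H i p‖ := by
    have h1 : ∀ i, ∫ p, ‖H i p‖ = ‖a i‖ * ∫ p, ‖h p‖ := by
      intro i
      simp only [hH, norm_mul]
      rw [integral_const_mul, integral_add_right_eq_self (fun p => ‖h p‖)]
    simp only [h1]
    exact (Summable.of_nonneg_of_le (fun _ => norm_nonneg _) hna hsum).mul_right _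
  have hf : Continuous fun p => cexp (s * (p.1 : ℂ)) * thetaC J S c (flip2 e p) :=
    (by fun_prop : Continuous fun p : ℝ × (Fin (rank K) → ℝ) => cexp (s * (p.1 : ℂ))).mul
      ((continuous_thetaC J S hc).comp (continuous_flip2 e))
  have key := unfold_integral (W := torsion K) e hHint hHs hf (fun p => ?_)
  · refine ⟨key.1, ?_⟩
    have h2 : ∀ i, ∫ p, H i p = a i * gamS S s := by
      intro i
      simp only [hH]
      rw [integral_const_mul, integral_add_right_eq_self h, gamS]
    simp only [h2] at key
    exact key.2
  · set l := flip2 e p with hl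
    have hl1 : l.1 = p.1 := rfl
    have hth := (summable_theta J S hc (logLin K l)).hasSum.mul_left (cexp (s * (p.1 : ℂ)))
    set Φ : ι × (torsion K × (Fin (rank K) → ℤ)) →
        {x : K // x ∈ (J : FractionalIdeal (𝓞 K)⁰ K)} :=
      fun x => ⟨(unitOf x.2 : K) * gen x.1, unit_mul_mem J _ (hgenJ _)⟩ with hΦ
    have hΦi : Function.Injective Φ := by
      rintro ⟨i, q⟩ ⟨j, q'⟩ hx
      have hx' := congrArg Subtype.val hx
      simp only [hΦ] at hx'
      obtain rfl := hinj _ _ _ _ hx'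
      have := mul_right_cancel₀ (hgen0 i) hx'
      have : unitOf q = unitOf q' := by
        ext; exact this
      rw [(unitOf_bijective K).1 this]
    rw [← hΦi.hasSum_iff] at hth
    · refine Eq.subst (motive := fun F => HasSum F _) (funext fun x => ?_) hth
      obtain ⟨i, q⟩ := x
      have hu0 : ((unitOf q : (𝓞 K)ˣ) : K) ≠ 0 :=
        coe_ne_zero _
      have hne : ((unitOf q : (𝓞 K)ˣ) : K) * gen i ≠ 0 := mul_ne_zero hu0 (hgen0 i)
      have e1 : logLin K (shiftZ q.2 l + (ν i, y i)) =
          logLin K l + logAbs (((unitOf q : (𝓞 K)ˣ) : K) * gen i) := by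
        rw [logAbs_mul hu0 (hgen0 i), logAbs_unitOf, hy, shiftZ_eq, map_add, map_add, add_assoc]
      simp only [Function.comp_apply, hΦ, hH, hh]
      rw [testF_log S _ hne, hcu, sgnS_mul, e1]
      have e2 : (shiftZ q.2 l + (ν i, y i)).1 = p.1 + ν i := rfl
      rw [e2, ha]
      have e3 : cexp (s * ((p.1 + ν i : ℝ) : ℂ)) = cexp (s * (p.1 : ℂ)) * cexp (s * ν i) := by
        rw [← Complex.exp_add]; congr 1; push_cast; ring
      have e4 : cexp (-s * ν i) * cexp (s * ν i) = 1 := by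
        rw [← Complex.exp_add]; simp
      rw [e3]
      simp only
      linear_combination (cexp (s * (p.1 : ℂ)) * c (gen i) * sgnS S (gen i) *
        (hLog S (logLin K l + logAbs (((unitOf q : (𝓞 K)ˣ) : K) * gen i)) : ℂ)) *
        (sgnS_mul_self S hu0 - e4)
    · intro β hβ
      have : (β : K) = 0 := by
        by_contra hne
        obtain ⟨i, u, hiu⟩ := hex β β.2 hne
        obtain ⟨q, hq⟩ := (unitOf_bijective K).2 u
        exact hβ ⟨(i, q), Subtype.ext (by simp only [hΦ, hq]; exact hiu.symm)⟩
      rw [this, hc0]; simp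

end MellinTheta

section AvgTheta

lemma mellin_eq_integral_exp (f : ℝ → ℂ) (s : ℂ) :
    mellin f s = ∫ t : ℝ, cexp (s * t) * f (Real.exp t) := by
  have h := integral_image_eq_integral_abs_deriv_smul (s := Set.univ) MeasurableSet.univ
    (f := fun l : ℝ => Real.exp l) (f' := fun l => Real.exp l)
    (fun x _ => (Real.hasDerivAt_exp x).hasDerivWithinAt)
    (Real.exp_injective.injOn) (fun x : ℝ => (x : ℂ) ^ (s - 1) • f x)
  rw [Set.image_univ, Real.range_exp, setIntegral_univ] at h
  rw [mellin, h]
  refine integral_congr_ae (Eventually.of_forall fun t => ?_)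
  simp only [smul_eq_mul, abs_of_pos (Real.exp_pos t), Complex.real_smul]
  have h0 : (Real.exp t : ℂ) ≠ 0 := by exact_mod_cast (Real.exp_pos t).ne'
  have h1 : (Real.exp t : ℂ) ^ s = cexp (s * t) := by
    rw [Complex.cpow_def_of_ne_zero h0, ← Complex.ofReal_log (Real.exp_pos t).le, Real.log_exp]
    rw [mul_comm]
  rw [Complex.cpow_sub _ _ h0, Complex.cpow_one, h1]
  field_simp

variable (S : Finset {w : InfinitePlace K // IsReal w}) (c : K → ℂ) (e : ℤˣ)

/-- The theta series averaged over a fundamental domain for the unit group. -/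
def avgTheta (y : ℝ) : ℂ := ∫ x in Set.Icc (0 : Fin (rank K) → ℝ) 1,
  thetaC J S c (flip2 e (Real.log y, x))

variable {c}

lemma continuousOn_avgTheta (hc : ∀ x, ‖c x‖ ≤ 1) : ContinuousOn (avgTheta J S c e) (Set.Ioi 0) := by
  have h : Continuous fun t : ℝ => ∫ x in Set.Icc (0 : Fin (rank K) → ℝ) 1,
      thetaC J S c (flip2 e (t, x)) :=
    continuous_parametric_integral_of_continuous
      (f := fun t x => thetaC J S c (flip2 e (t, x)))
      (((continuous_thetaC J S hc).comp (continuous_flip2 e))) isCompact_Icc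
  exact h.comp_continuousOn (Real.continuousOn_log.mono fun x hx => (Set.mem_Ioi.1 hx).ne')

lemma volume_real_unitCube (d : Type*) [Fintype d] :
    volume.real (Set.Icc (0 : d → ℝ) 1) = 1 := by
  rw [Measure.real, Real.volume_Icc_pi_toReal (by intro i; simp)]
  simp

lemma avgTheta_eq_add (hc : ∀ x, ‖c x‖ ≤ 1) (y : ℝ) :
    avgTheta J S c e y = c 0 * (if S = ∅ then 1 else 0) +
      avgTheta J S (Function.update c 0 0) e y := by
  have hc' : ∀ x, ‖Function.update c 0 0 x‖ ≤ 1 := by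
    intro x
    rw [Function.update_apply]
    split_ifs
    · simp
    · exact hc x
  have h1 : ∀ p, thetaC J S c p = c 0 * (if S = ∅ then 1 else 0) +
      thetaC J S (Function.update c 0 0) p := by
    intro p
    set z : {x : K // x ∈ (J : FractionalIdeal (𝓞 K)⁰ K)} := ⟨0, FractionalIdeal.zero_mem _⟩ with hz
    rw [thetaC, thetaC, (summable_theta J S hc _).tsum_eq_add_tsum_ite z]
    congr 1
    · simp only [hz, map_zero, testF_zero]
    · refine tsum_congr fun β => ?_
      by_cases hβ : β = z
      · simp [hβ, hz]
      · have : (β : K) ≠ 0 := fun h => hβ (Subtype.ext h)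
        simp [hβ, this]
  have hcont : IntegrableOn (fun x => thetaC J S (Function.update c 0 0) (flip2 e (Real.log y, x)))
      (Set.Icc (0 : Fin (rank K) → ℝ) 1) := by
    refine ContinuousOn.integrableOn_compact isCompact_Icc (Continuous.continuousOn ?_)
    exact (continuous_thetaC J S hc').comp ((continuous_flip2 e).comp (by fun_prop))
  simp only [avgTheta, h1]
  have hfin : IsFiniteMeasure ((volume : Measure (Fin (rank K) → ℝ)).restrict (Set.Icc 0 1)) :=
    ⟨by rw [Measure.restrict_apply_univ]; exact isCompact_Icc.measure_lt_top⟩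
  rw [integral_add (integrable_const _) hcont, setIntegral_const, volume_real_unitCube, one_smul]

lemma flip2_snd_abs_le {p : ℝ × (Fin (rank K) → ℝ)} (hp : p.2 ∈ Set.Icc (0 : Fin (rank K) → ℝ) 1)
    (i : Fin (rank K)) : |(flip2 e p).2 i| ≤ 1 := by
  have h1 := hp.1 i
  have h2 := hp.2 i
  simp only [Pi.zero_apply, Pi.one_apply] at h1 h2
  rcases Int.units_eq_one_or e with rfl | rfl
  · simp [flip2, abs_of_nonneg h1, h2]
  · simp [flip2, abs_of_nonneg h1, h2]

lemma avgTheta_isBigO (hc : ∀ x, ‖c x‖ ≤ 1) (hc0 : c 0 = 0) (r : ℝ) :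
    avgTheta J S c e =O[atTop] fun y => y ^ r := by
  obtain ⟨A, b, hb, h⟩ := exists_thetaC_decay J S hc hc0
  set n : ℝ := (Module.finrank ℚ K : ℝ) with hn
  have hn0 : 0 < n := by rw [hn]; exact_mod_cast Module.finrank_pos (R := ℚ) (M := K)
  have h1 : avgTheta J S c e =O[atTop] fun y => Real.exp (-b * y ^ (2 / n)) := by
    refine Asymptotics.IsBigO.of_bound A ?_
    filter_upwards [eventually_ge_atTop (1 : ℝ)] with y hy
    have hy0 : 0 < y := by linarith
    have hexp : Real.exp (2 * Real.log y / n) = y ^ (2 / n) := by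
      rw [Real.rpow_def_of_pos hy0]; congr 1; ring
    have h2 := norm_setIntegral_le_of_norm_le_const (μ := volume)
      (s := Set.Icc (0 : Fin (rank K) → ℝ) 1)
      (f := fun x => thetaC J S c (flip2 e (Real.log y, x)))
      (C := A * Real.exp (-(b * Real.exp (2 * Real.log y / n)))) isCompact_Icc.measure_lt_top
      (fun x hx => h (Real.log y) (Real.log_nonneg hy) _
        (flip2_snd_abs_le e (p := (Real.log y, x)) hx))
    rw [volume_real_unitCube, mul_one, hexp] at h2
    rw [Real.norm_of_nonneg (Real.exp_pos _).le, neg_mul]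
    exact h2
  refine h1.trans ?_
  have h3 := (isLittleO_exp_neg_mul_rpow_atTop hb (r * (n / 2))).isBigO.comp_tendsto
    (tendsto_rpow_atTop (show 0 < 2 / n by positivity))
  refine h3.congr' (Eventually.of_forall fun y => rfl) ?_
  filter_upwards [eventually_gt_atTop (0 : ℝ)] with y hy
  rw [Function.comp_apply, ← Real.rpow_mul hy.le]
  congr 1
  field_simp

lemma mellin_avgTheta {s : ℂ}
    (h : IntegrableOn (fun p => cexp (s * (p.1 : ℂ)) * thetaC J S c (flip2 e p)) (strip _)) :
    mellin (avgTheta J S c e) s =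
      ∫ p in strip _, cexp (s * (p.1 : ℂ)) * thetaC J S c (flip2 e p) := by
  rw [mellin_eq_integral_exp]
  rw [strip] at h ⊢
  rw [Measure.volume_eq_prod] at h ⊢
  rw [setIntegral_prod _ h, setIntegral_univ]
  refine integral_congr_ae (Eventually.of_forall fun t => ?_)
  simp only [avgTheta, Real.log_exp]
  rw [integral_const_mul]

end AvgTheta

end Theta

section SignCharacter
open NumberField.InfinitePlace NumberField.mixedEmbedding
open scoped Classical nonZeroDivisors

variable {K : Type*} [Field K] [NumberField K]

/-- The value of a field element at a real place. -/
def reVal (x : K) (v : {w : InfinitePlace K // IsReal w}) : ℝ := (mixedEmbedding K x).1 v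

lemma reVal_mul (x y : K) (v : {w : InfinitePlace K // IsReal w}) :
    reVal (x * y) v = reVal x v * reVal y v := by
  simp [reVal]

lemma reVal_coe_mul (α β : 𝓞 K) (v : {w : InfinitePlace K // IsReal w}) :
    reVal ((α * β : 𝓞 K) : K) v = reVal (α : K) v * reVal (β : K) v := by
  rw [← reVal_mul]
  congr 1

lemma reVal_ne_zero {x : K} (hx : x ≠ 0) (v : {w : InfinitePlace K // IsReal w}) :
    reVal x v ≠ 0 := by
  rw [reVal, mixedEmbedding_apply_isReal]
  exact (map_ne_zero _).2 hx

lemma totPos_iff (α : 𝓞 K) : TotPos K α ↔ ∀ v, 0 < reVal (α : K) v := by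
  constructor
  · intro h v
    rw [reVal, mixedEmbedding_apply_isReal]
    exact h _
  · intro h φ
    set ψ : K →+* ℂ := Complex.ofRealHom.comp φ with hψ
    have hr : ComplexEmbedding.IsReal ψ := by
      rw [ComplexEmbedding.isReal_iff]
      ext x
      simp [hψ, ComplexEmbedding.conjugate_coe_eq]
    have h1 := h ⟨InfinitePlace.mk ψ, isReal_mk_iff.2 hr⟩
    rw [reVal, mixedEmbedding_apply_isReal] at h1
    have h2 := embedding_of_isReal_apply (isReal_mk_iff.2 hr) (α : K)
    rw [embedding_mk_eq_of_isReal hr] at h2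
    have h3 : embedding_of_isReal (isReal_mk_iff.2 hr) (α : K) = φ α := by
      exact Complex.ofReal_injective (h2.trans rfl)
    rw [← h3]; exact h1

/-- Integers congruent to `1` with exactly one prescribed negative real place. -/
lemma exists_sign_integer {𝔣 : Ideal (𝓞 K)} (h𝔣 : 𝔣 ≠ ⊥) (v : {w : InfinitePlace K // IsReal w}) :
    ∃ α : 𝓞 K, α - 1 ∈ 𝔣 ∧ reVal (α : K) v < 0 ∧ ∀ w, w ≠ v → 0 < reVal (α : K) w := by
  set C : ℝ := ∑ i, ‖latticeBasis K i‖ with hC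
  have hC0 : 0 ≤ C := Finset.sum_nonneg fun _ _ => norm_nonneg _
  set z : mixedSpace K := (fun w => if w = v then -(C + 2) else C + 2, 0) with hz
  obtain ⟨x, hx⟩ := (mem_span_latticeBasis K).1 (ZSpan.floor (latticeBasis K) z).2
  have hfr : ‖z - mixedEmbedding K (x : K)‖ ≤ C := by
    have h := ZSpan.norm_fract_le (latticeBasis K) z
    rw [ZSpan.fract_apply] at h
    have : (mixedEmbedding K (x : K)) = ((ZSpan.floor (latticeBasis K) z : mixedSpace K)) := hx
    rw [this]; exact h
  have hw : ∀ w, |z.1 w - reVal (x : K) w| ≤ C := by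
    intro w
    calc |z.1 w - reVal (x : K) w| = ‖(z - mixedEmbedding K (x : K)).1 w‖ := rfl
      _ ≤ ‖(z - mixedEmbedding K (x : K)).1‖ := norm_le_pi_norm _ _
      _ ≤ _ := (norm_fst_le _).trans hfr
  set m := Ideal.absNorm 𝔣 with hm
  have hm1 : 1 ≤ m := by
    rw [Nat.one_le_iff_ne_zero, hm, Ne, Ideal.absNorm_eq_zero_iff]; exact h𝔣
  have hm1' : (1 : ℝ) ≤ m := by exact_mod_cast hm1
  have hval : ∀ w, reVal ((1 + (m : 𝓞 K) * x : 𝓞 K) : K) w = 1 + m * reVal (x : K) w := by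
    intro w
    simp [reVal]
  refine ⟨1 + (m : 𝓞 K) * x, ?_, ?_, fun w hwv => ?_⟩
  · rw [add_sub_cancel_left]
    exact 𝔣.mul_mem_right _ (Ideal.absNorm_mem 𝔣)
  · rw [hval]
    have h1 := hw v
    have h2 : z.1 v = -(C + 2) := by simp [hz]
    rw [h2, abs_le] at h1
    nlinarith [h1.1]
  · rw [hval]
    have h1 := hw w
    have h2 : z.1 w = C + 2 := by simp [hz, hwv]
    rw [h2, abs_le] at h1
    nlinarith [h1.2]

lemma sgnS_eq_prod (S : Finset {w : InfinitePlace K // IsReal w}) (x : K) :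
    sgnS S x = ∏ v ∈ S, ((SignType.sign (reVal x v) : ℝ) : ℂ) := rfl

namespace HeckeChar

variable {𝔣 : Ideal (𝓞 K)} (χ : HeckeChar K 𝔣)

lemma apply_top : χ.toFun ⊤ = 1 := by
  have h := χ.ray_one' 1 (fun φ => by simp) (by simp)
  rwa [Ideal.span_singleton_one] at h

lemma norm_le_one (𝔞 : Ideal (𝓞 K)) : ‖χ.toFun 𝔞‖ ≤ 1 := by
  by_cases h : IsCoprime 𝔞 𝔣
  · exact (χ.norm_one' 𝔞 h).le
  · rw [χ.eq_zero' 𝔞 h]; simp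

lemma apply_bot (h : 𝔣 ≠ ⊤) : χ.toFun ⊥ = 0 := by
  apply χ.eq_zero'
  intro hc
  rw [Ideal.isCoprime_iff_sup_eq, bot_sup_eq] at hc
  exact h hc

lemma apply_of_top (h : 𝔣 = ⊤) (𝔞 : Ideal (𝓞 K)) : χ.toFun 𝔞 = 1 := by
  have h1 : ‖χ.toFun ⊥‖ = 1 := χ.norm_one' ⊥ (by rw [h, Ideal.isCoprime_iff_sup_eq]; simp)
  have h2 := χ.map_mul' ⊥ 𝔞
  rw [Ideal.bot_mul] at h2
  have h3 : χ.toFun ⊥ ≠ 0 := by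
    intro h0; rw [h0] at h1; simp at h1
  exact (mul_left_cancel₀ h3 (by rw [mul_one]; exact h2)).symm

lemma span_mul (α β : 𝓞 K) :
    χ.toFun (Ideal.span {α * β}) = χ.toFun (Ideal.span {α}) * χ.toFun (Ideal.span {β}) := by
  rw [← Ideal.span_singleton_mul_span_singleton, χ.map_mul']

lemma exists_signSet (h𝔣 : 𝔣 ≠ ⊥) : ∃ S : Finset {w : InfinitePlace K // IsReal w},
    (𝔣 = ⊤ → S = ∅) ∧ ∀ α : 𝓞 K, α - 1 ∈ 𝔣 → χ.toFun (Ideal.span {α}) = sgnS S (α : K) := by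
  by_cases htop : 𝔣 = ⊤
  · exact ⟨∅, fun _ => rfl, fun α _ => by rw [χ.apply_of_top htop]; simp [sgnS]⟩
  have hne : ∀ α : 𝓞 K, α - 1 ∈ 𝔣 → (α : K) ≠ 0 := by
    intro α hα h0
    have : α = 0 := by exact_mod_cast h0
    rw [this, zero_sub, neg_mem_iff] at hα
    exact htop ((Ideal.eq_top_iff_one _).2 hα)
  have hmul : ∀ α β : 𝓞 K, α - 1 ∈ 𝔣 → β - 1 ∈ 𝔣 → α * β - 1 ∈ 𝔣 := by
    intro α β ha hb
    have : α * β - 1 = α * (β - 1) + (α - 1) := by ring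
    rw [this]
    exact 𝔣.add_mem (𝔣.mul_mem_left _ hb) ha
  have hsq : ∀ α : 𝓞 K, α - 1 ∈ 𝔣 → χ.toFun (Ideal.span {α}) * χ.toFun (Ideal.span {α}) = 1 := by
    intro α ha
    rw [← χ.span_mul]
    refine χ.ray_one' _ ((totPos_iff _).2 fun v => ?_) (hmul _ _ ha ha)
    rw [reVal_coe_mul]
    exact mul_self_pos.2 (reVal_ne_zero (hne α ha) v)
  have hsame : ∀ α β : 𝓞 K, α - 1 ∈ 𝔣 → β - 1 ∈ 𝔣 →
      (∀ v, 0 < reVal (α : K) v * reVal (β : K) v) →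
      χ.toFun (Ideal.span {α}) = χ.toFun (Ideal.span {β}) := by
    intro α β ha hb h
    have h1 : χ.toFun (Ideal.span {α}) * χ.toFun (Ideal.span {β}) = 1 := by
      rw [← χ.span_mul]
      refine χ.ray_one' _ ((totPos_iff _).2 fun v => ?_) (hmul _ _ ha hb)
      rw [reVal_coe_mul]
      exact h v
    have h2 := hsq β hb
    have h3 : χ.toFun (Ideal.span {β}) ≠ 0 := by
      intro h0; rw [h0] at h2; simp at h2
    exact mul_right_cancel₀ h3 (h1.trans h2.symm)
  choose A hA hAv hAw using fun v => exists_sign_integer h𝔣 v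
  set S : Finset {w : InfinitePlace K // IsReal w} :=
    Finset.univ.filter fun v => χ.toFun (Ideal.span {A v}) = -1 with hS
  refine ⟨S, fun h => absurd h htop, fun α hα => ?_⟩
  set N : Finset {w : InfinitePlace K // IsReal w} :=
    Finset.univ.filter fun v => reVal (α : K) v < 0 with hN
  have hprod : ∀ M : Finset {w : InfinitePlace K // IsReal w}, (∏ v ∈ M, A v) - 1 ∈ 𝔣 ∧
      χ.toFun (Ideal.span {∏ v ∈ M, A v}) = ∏ v ∈ M, χ.toFun (Ideal.span {A v}) ∧
      ∀ w, (w ∈ M → reVal ((∏ v ∈ M, A v : 𝓞 K) : K) w < 0) ∧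
        (w ∉ M → 0 < reVal ((∏ v ∈ M, A v : 𝓞 K) : K) w) := by
    intro M
    induction M using Finset.induction_on with
    | empty =>
      refine ⟨by simp, by simp [Ideal.span_singleton_one, χ.apply_top], fun w => ⟨by simp, fun _ => ?_⟩⟩
      simp [reVal]
    | insert v M hv ih =>
      obtain ⟨h1, h2, h3⟩ := ih
      rw [Finset.prod_insert hv, Finset.prod_insert hv]
      refine ⟨hmul _ _ (hA v) h1, by rw [χ.span_mul, h2], fun w => ?_⟩
      rw [reVal_coe_mul]
      by_cases hwv : w = v
      · subst hwv
        refine ⟨fun _ => mul_neg_of_neg_of_pos (hAv w) ((h3 w).2 hv), fun h => ?_⟩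
        exact absurd (Finset.mem_insert_self _ _) h
      · refine ⟨fun h => mul_neg_of_pos_of_neg (hAw v w hwv) ((h3 w).1 ?_),
          fun h => mul_pos (hAw v w hwv) ((h3 w).2 ?_)⟩
        · exact Finset.mem_of_mem_insert_of_ne h hwv
        · exact fun h' => h (Finset.mem_insert_of_mem h')
  obtain ⟨h1, h2, h3⟩ := hprod N
  rw [hsame α (∏ v ∈ N, A v) hα h1 fun w => ?_, h2, sgnS_eq_prod]
  · have e1 : ∀ v, χ.toFun (Ideal.span {A v}) = if v ∈ S then -1 else 1 := by
      intro v
      rcases mul_self_eq_one_iff.1 (hsq _ (hA v)) with h | h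
      · have : v ∉ S := by rw [hS]; simp [h]; norm_num
        rw [h, if_neg this]
      · have : v ∈ S := by rw [hS]; simp [h]
        rw [h, if_pos this]
    have e2 : ∀ v, ((SignType.sign (reVal (α : K) v) : ℝ) : ℂ) = if v ∈ N then -1 else 1 := by
      intro v
      rcases lt_or_gt_of_ne (reVal_ne_zero (hne α hα) v) with h | h
      · rw [sign_neg h, if_pos (by rw [hN]; simp [h])]; simp
      · rw [sign_pos h, if_neg (by rw [hN]; simp [h.le])]; simp
    simp only [e1, e2]
    rw [Finset.prod_ite_mem, Finset.prod_ite_mem, Finset.inter_comm]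
  · by_cases hw : w ∈ N
    · exact mul_pos_of_neg_of_neg (by simpa [hN] using hw) ((h3 w).1 hw)
    · refine mul_pos ?_ ((h3 w).2 hw)
      have : 0 ≤ reVal (α : K) w := by simpa [hN] using hw
      exact lt_of_le_of_ne this (reVal_ne_zero (hne α hα) w).symm

end HeckeChar

end SignCharacter

section DirichletSeries
open IsDedekindDomain
open scoped Classical nonZeroDivisors

variable (K : Type*) [Field K] [NumberField K]

/-- Nonzero integral ideals. -/
abbrev NzI := {I : Ideal (𝓞 K) // I ≠ ⊥}

variable {K}

lemma one_le_absNorm (a : NzI K) : (1 : ℝ) ≤ Ideal.absNorm a.1 := by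
  have : Ideal.absNorm a.1 ≠ 0 := by rw [Ne, Ideal.absNorm_eq_zero_iff]; exact a.2
  exact_mod_cast Nat.one_le_iff_ne_zero.2 this

lemma absNorm_pos' (a : NzI K) : (0 : ℝ) < Ideal.absNorm a.1 :=
  lt_of_lt_of_le one_pos (one_le_absNorm a)

lemma two_le_absNorm (p : HeightOneSpectrum (𝓞 K)) : 2 ≤ Ideal.absNorm p.asIdeal := by
  have h0 : Ideal.absNorm p.asIdeal ≠ 0 := by rw [Ne, Ideal.absNorm_eq_zero_iff]; exact p.ne_bot
  have h1 : Ideal.absNorm p.asIdeal ≠ 1 := by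
    rw [Ne, Ideal.absNorm_eq_one_iff]; exact p.isPrime.ne_top
  omega

variable (K) in
lemma summable_card_fiber {σ : ℝ} (hσ : 1 < σ) :
    Summable fun n : ℕ => (Nat.card {I : NzI K // Ideal.absNorm I.1 = n} : ℝ) * (n : ℝ) ^ (-σ) := by
  have h1 : LSeriesSummable (fun n : ℕ => ((Nat.card {I : NzI K // Ideal.absNorm I.1 = n} : ℝ) : ℂ)) σ := by
    refine LSeriesSummable_of_sum_norm_bigO_and_nonneg (r := 1) ?_ (fun _ => Nat.cast_nonneg _)
      zero_le_one (by simpa using hσ)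
    have h := (Ideal.tendsto_norm_le_div_atTop₀ K).comp tendsto_natCast_atTop_atTop
    have h2 := h.isBigO_one ℝ
    have h3 : (fun n : ℕ => ∑ k ∈ Finset.Icc 1 n, (Nat.card {I : NzI K // Ideal.absNorm I.1 = k} : ℝ)) =O[atTop]
        fun n : ℕ => (1 : ℝ) * (n : ℝ) := by
      refine (h2.mul (Asymptotics.isBigO_refl (fun n : ℕ => (n : ℝ)) atTop)).congr' ?_
        EventuallyEq.rfl
      filter_upwards [eventually_ge_atTop 1] with n hn
      have hn0 : (n : ℝ) ≠ 0 := by positivity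
      simp only [Function.comp_apply]
      rw [div_mul_cancel₀ _ hn0, ← Nat.cast_sum]
      norm_cast
      have hc : ∀ k, Nat.card {I : NzI K // Ideal.absNorm I.1 = k} =
          Nat.card {I : (Ideal (𝓞 K))⁰ // Ideal.absNorm (I : Ideal (𝓞 K)) = k} := by
        intro k
        refine Nat.card_congr (Equiv.subtypeEquiv (Equiv.subtypeEquivRight fun I => ?_) fun a => ?_)
        · rw [mem_nonZeroDivisors_iff_ne_zero]; rfl
        · rfl
      have hfin : Set.Finite {I : (Ideal (𝓞 K))⁰ | Ideal.absNorm (I : Ideal (𝓞 K)) ≤ n} :=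
        Ideal.finite_setOfPred_absNorm_le₀ n
      have hff : Finite {I : (Ideal (𝓞 K))⁰ // Ideal.absNorm (I : Ideal (𝓞 K)) ≤ n} := hfin
      have : Fintype {I : (Ideal (𝓞 K))⁰ // Ideal.absNorm (I : Ideal (𝓞 K)) ≤ n} := Fintype.ofFinite _
      rw [Nat.card_eq_fintype_card, ← Finset.card_univ]
      rw [Finset.card_eq_sum_card_fiberwise (f := fun I => Ideal.absNorm (I.1 : Ideal (𝓞 K)))
        (t := Finset.Icc 1 n)]
      · refine Finset.sum_congr rfl fun k hk => ?_
        rw [hc, ← Fintype.card_subtype, ← Nat.card_eq_fintype_card]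
        refine Nat.card_congr ⟨fun a => ⟨a.1.1, a.2⟩, fun a => ⟨⟨a.1, by rw [a.2]; exact (Finset.mem_Icc.1 hk).2⟩, a.2⟩,
          fun a => rfl, fun a => rfl⟩
      · intro I _
        rw [Finset.mem_coe, Finset.mem_Icc]
        refine ⟨?_, I.2⟩
        rw [Nat.one_le_iff_ne_zero, Ne, Ideal.absNorm_eq_zero_iff]
        exact nonZeroDivisors.coe_ne_zero I.1
    simpa using h3
  have h2 := h1.norm
  refine h2.congr fun n => ?_
  rw [LSeries.norm_term_eq]
  split_ifs with hn
  · subst hn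
    have : (0 : ℝ) ^ (-σ) = 0 := Real.zero_rpow (by linarith)
    simp [this]
  · rw [Real.rpow_neg (Nat.cast_nonneg _)]
    simp [div_eq_mul_inv]

variable (K) in
lemma finite_fiber (n : ℕ) : Finite {I : NzI K // Ideal.absNorm I.1 = n} := by
  by_cases hn : 0 < n
  · have h := Ideal.finite_setOfPred_absNorm_eq (S := 𝓞 K) (n := n)
    have hf : Finite {I : Ideal (𝓞 K) // Ideal.absNorm I = n} := h
    exact Finite.of_injective (β := {I : Ideal (𝓞 K) // Ideal.absNorm I = n})
      (fun I => ⟨I.1.1, I.2⟩) fun a b hab => by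
        have := congrArg Subtype.val hab
        exact Subtype.ext (Subtype.ext this)
  · have h0 : n = 0 := by omega
    subst h0
    have : IsEmpty {I : NzI K // Ideal.absNorm I.1 = 0} :=
      ⟨fun I => I.1.2 (Ideal.absNorm_eq_zero_iff.1 I.2)⟩
    infer_instance

variable (K) in
instance countable_nzI : Countable (NzI K) := by
  have : Countable (Σ n : ℕ, {I : NzI K // Ideal.absNorm I.1 = n}) := by
    have := fun n => finite_fiber K n
    infer_instance
  exact (Equiv.sigmaFiberEquiv fun I : NzI K => Ideal.absNorm I.1).symm.injective.countable

variable (K) in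
lemma summable_absNorm {σ : ℝ} (hσ : 1 < σ) :
    Summable fun a : NzI K => (Ideal.absNorm a.1 : ℝ) ^ (-σ) := by
  rw [← (Equiv.sigmaFiberEquiv fun I : NzI K => Ideal.absNorm I.1).summable_iff,
    summable_sigma_of_nonneg (fun x => by simp only [Function.comp_apply]; positivity)]
  have e : ∀ (n : ℕ) (y : {I : NzI K // Ideal.absNorm I.1 = n}),
      ((fun a : NzI K => (Ideal.absNorm a.1 : ℝ) ^ (-σ)) ∘
        (Equiv.sigmaFiberEquiv fun I : NzI K => Ideal.absNorm I.1)) ⟨n, y⟩ = (n : ℝ) ^ (-σ) := by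
    intro n y
    simp only [Function.comp_apply, Equiv.sigmaFiberEquiv_apply]
    rw [y.2]
  simp only [e]
  refine ⟨fun n => ?_, ?_⟩
  · have := finite_fiber K n
    exact Summable.of_finite
  · refine (summable_card_fiber K hσ).congr fun n => ?_
    have := finite_fiber K n
    rw [tsum_const, nsmul_eq_mul]

/-- The sieve identity for completely multiplicative functions on ideals. -/
lemma tsum_sieve {h : Ideal (𝓞 K) → ℂ} (hmul : ∀ a b, h (a * b) = h a * h b)
    (hsum : Summable fun a : NzI K => h a.1) (P : Finset (HeightOneSpectrum (𝓞 K))) :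
    (∏ p ∈ P, (1 - h p.asIdeal)) * ∑' a : NzI K, h a.1 =
      ∑' a : NzI K, if ∀ p ∈ P, ¬ p.asIdeal ∣ a.1 then h a.1 else 0 := by
  induction P using Finset.induction_on with
  | empty => simp
  | insert p P hp ih =>
    rw [Finset.prod_insert hp, mul_assoc, ih]
    set f : NzI K → ℂ := fun a => if ∀ q ∈ P, ¬ q.asIdeal ∣ a.1 then h a.1 else 0 with hf
    have hfs : Summable f := by
      refine Summable.of_norm_bounded hsum.norm fun a => ?_
      rw [hf]; dsimp only
      split_ifs <;> simp
    set g : NzI K → NzI K := fun b => ⟨p.asIdeal * b.1, mul_ne_zero p.ne_bot b.2⟩ with hg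
    have hginj : Function.Injective g := by
      intro a b hab
      have := congrArg Subtype.val hab
      exact Subtype.ext (mul_left_cancel₀ p.ne_bot this)
    have hfg : ∀ b, f (g b) = h p.asIdeal * f b := by
      intro b
      rw [hf, hg]; dsimp only
      have : (∀ q ∈ P, ¬ q.asIdeal ∣ p.asIdeal * b.1) ↔ ∀ q ∈ P, ¬ q.asIdeal ∣ b.1 := by
        refine forall₂_congr fun q hq => not_congr ⟨fun hd => ?_, fun hd => hd.mul_left _⟩
        rcases (q.prime.dvd_or_dvd hd) with h1 | h1
        · exfalso
          apply hp
          have h2 := (q.isMaximal.eq_of_le p.isPrime.ne_top)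
          have h3 : p.asIdeal ≤ q.asIdeal := Ideal.dvd_iff_le.1 h1
          have h4 := p.isMaximal.eq_of_le q.isPrime.ne_top h3
          have : p = q := HeightOneSpectrum.ext h4
          rw [this]; exact hq
        · exact h1
      simp only [this, hmul]
      split_ifs <;> simp
    have hsplit : ∀ a : NzI K, (if ∀ q ∈ insert p P, ¬ q.asIdeal ∣ a.1 then h a.1 else 0) =
        f a - if p.asIdeal ∣ a.1 then f a else 0 := by
      intro a
      rw [hf]; dsimp only
      by_cases h1 : p.asIdeal ∣ a.1 <;> by_cases h2 : ∀ q ∈ P, ¬ q.asIdeal ∣ a.1 <;>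
        simp [h1, h2]
    have hs2 : Summable fun a : NzI K => if p.asIdeal ∣ a.1 then f a else 0 := by
      refine Summable.of_norm_bounded hfs.norm fun a => ?_
      split_ifs <;> simp
    have h3 : ∑' a : NzI K, (if p.asIdeal ∣ a.1 then f a else 0) = h p.asIdeal * ∑' a, f a := by
      rw [← hginj.tsum_eq, ← tsum_mul_left]
      · refine tsum_congr fun b => ?_
        rw [← hfg, if_pos]
        exact dvd_mul_right _ _
      · intro a ha
        rw [Function.mem_support] at ha
        have hd : p.asIdeal ∣ a.1 := by
          by_contra hd
          rw [if_neg hd] at ha; exact ha rfl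
        obtain ⟨b, hb⟩ := hd
        refine ⟨⟨b, fun hb0 => a.2 ?_⟩, Subtype.ext hb.symm⟩
        rw [hb, hb0]; exact mul_zero _
    simp only [hsplit]
    rw [hfs.tsum_sub hs2, h3]
    ring

/-- The Euler product in the form `L * ∏ (1 - h p) → 1`. -/
lemma tendsto_euler {h : Ideal (𝓞 K) → ℂ} (hmul : ∀ a b, h (a * b) = h a * h b) (h1 : h ⊤ = 1)
    (hsum : Summable fun a : NzI K => h a.1) :
    Tendsto (fun P : Finset (HeightOneSpectrum (𝓞 K)) =>
      (∏ p ∈ P, (1 - h p.asIdeal)) * ∑' a : NzI K, h a.1) atTop (𝓝 1) := by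
  have e : (1 : ℂ) = ∑' a : NzI K, if a.1 = ⊤ then h a.1 else 0 := by
    rw [tsum_eq_single ⟨⊤, top_ne_bot⟩]
    · simp [h1]
    · intro b hb
      rw [if_neg]
      intro hb'
      exact hb (Subtype.ext hb')
  simp only [tsum_sieve hmul hsum]
  rw [e]
  refine tendsto_tsum_of_dominated_convergence hsum.norm (fun a => ?_)
    (Eventually.of_forall fun P a => ?_)
  · by_cases ha : a.1 = ⊤
    · refine tendsto_const_nhds.congr fun P => ?_
      rw [if_pos ha, if_pos]
      intro p _ hd
      rw [ha, Ideal.dvd_iff_le, top_le_iff] at hd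
      exact p.isPrime.ne_top hd
    · obtain ⟨M, hM, haM⟩ := Ideal.exists_le_maximal a.1 ha
      have hMb : M ≠ ⊥ := by
        rintro rfl
        exact a.2 (le_bot_iff.1 haM)
      refine tendsto_const_nhds.congr' ?_
      filter_upwards [eventually_ge_atTop {(⟨M, hM.isPrime, hMb⟩ : HeightOneSpectrum (𝓞 K))}] with P hP
      rw [if_neg ha, if_neg]
      intro hall
      exact hall _ (Finset.singleton_subset_iff.1 hP) (Ideal.dvd_iff_le.2 haM)
  · split_ifs <;> simp

variable (K) in
/-- The Dedekind zeta series at a real point. -/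
def zetaR (σ : ℝ) : ℝ := ∑' a : NzI K, (Ideal.absNorm a.1 : ℝ) ^ (-σ)

lemma absNorm_cpow_mul (a b : Ideal (𝓞 K)) (s : ℂ) :
    (Ideal.absNorm (a * b) : ℂ) ^ s = (Ideal.absNorm a : ℂ) ^ s * (Ideal.absNorm b : ℂ) ^ s := by
  rw [map_mul, Nat.cast_mul, Complex.natCast_mul_natCast_cpow]

lemma norm_absNorm_cpow (a : NzI K) (s : ℂ) :
    ‖(Ideal.absNorm a.1 : ℂ) ^ (-s)‖ = (Ideal.absNorm a.1 : ℝ) ^ (-s.re) := by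
  have h : 0 < Ideal.absNorm a.1 := by exact_mod_cast absNorm_pos' a
  rw [Complex.norm_natCast_cpow_of_pos h, Complex.neg_re]

lemma one_le_zetaR {σ : ℝ} (hσ : 1 < σ) : 1 ≤ zetaR K σ := by
  have h := (summable_absNorm K hσ).le_tsum (⟨⊤, top_ne_bot⟩ : NzI K) fun a _ => by positivity
  simpa [zetaR] using h

/-- The Euler factor `1 - N𝔭 ^ (-σ)`. -/
def eulR (σ : ℝ) (p : HeightOneSpectrum (𝓞 K)) : ℝ := 1 - (Ideal.absNorm p.asIdeal : ℝ) ^ (-σ)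

lemma absNorm_rpow_le {σ : ℝ} (hσ : 1 < σ) (p : HeightOneSpectrum (𝓞 K)) :
    (Ideal.absNorm p.asIdeal : ℝ) ^ (-σ) ≤ 1 / 2 := by
  have h2 : (2 : ℝ) ≤ Ideal.absNorm p.asIdeal := by exact_mod_cast two_le_absNorm p
  calc (Ideal.absNorm p.asIdeal : ℝ) ^ (-σ) ≤ (Ideal.absNorm p.asIdeal : ℝ) ^ (-1 : ℝ) :=
        Real.rpow_le_rpow_of_exponent_le (by linarith) (by linarith)
    _ = (Ideal.absNorm p.asIdeal : ℝ)⁻¹ := Real.rpow_neg_one _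
    _ ≤ 1 / 2 := by rw [one_div]; exact inv_anti₀ two_pos h2

lemma eulR_pos {σ : ℝ} (hσ : 1 < σ) (p : HeightOneSpectrum (𝓞 K)) : 0 < eulR σ p := by
  have := absNorm_rpow_le hσ p
  rw [eulR]; linarith

lemma tendsto_zetaR {σ : ℝ} (hσ : 1 < σ) :
    Tendsto (fun P : Finset (HeightOneSpectrum (𝓞 K)) => (∏ p ∈ P, eulR σ p) * zetaR K σ)
      atTop (𝓝 1) := by
  have h := tendsto_euler (K := K) (h := fun a => ((Ideal.absNorm a : ℝ) ^ (-σ) : ℝ))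
    (fun a b => by
      rw [map_mul, Nat.cast_mul, Real.mul_rpow (Nat.cast_nonneg _) (Nat.cast_nonneg _)]
      push_cast; rfl) (by simp) (Complex.hasSum_ofReal.2 (summable_absNorm K hσ).hasSum).summable
  have h2 := (Complex.continuous_re.tendsto _).comp h
  refine (h2.congr fun P => ?_)
  simp only [Function.comp_apply]
  have : (∏ p ∈ P, (1 - (((Ideal.absNorm p.asIdeal : ℝ) ^ (-σ) : ℝ) : ℂ))) *
      ∑' a : NzI K, (((Ideal.absNorm a.1 : ℝ) ^ (-σ) : ℝ) : ℂ) =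
      (((∏ p ∈ P, eulR σ p) * zetaR K σ : ℝ) : ℂ) := by
    rw [zetaR]
    push_cast [eulR]
    rfl
  rw [this, Complex.ofReal_re]

variable {𝔣 : Ideal (𝓞 K)} (χ : HeckeChar K 𝔣)

lemma norm_LSer_term_le (a : NzI K) (s : ℂ) :
    ‖χ.toFun a.1 * (Ideal.absNorm a.1 : ℂ) ^ (-s)‖ ≤ (Ideal.absNorm a.1 : ℝ) ^ (-s.re) := by
  rw [norm_mul, norm_absNorm_cpow]
  exact mul_le_of_le_one_left (by positivity) (χ.norm_le_one _)

lemma summable_LSer {s : ℂ} (hs : 1 < s.re) :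
    Summable fun a : NzI K => χ.toFun a.1 * (Ideal.absNorm a.1 : ℂ) ^ (-s) :=
  Summable.of_norm_bounded (summable_absNorm K hs) fun a => norm_LSer_term_le χ a s

lemma norm_LSer_le {s : ℂ} (hs : 1 < s.re) : ‖LSer χ s‖ ≤ zetaR K s.re :=
  tsum_of_norm_bounded (summable_absNorm K hs).hasSum fun a => norm_LSer_term_le χ a s

lemma LSer_term_mul (s : ℂ) (a b : Ideal (𝓞 K)) :
    χ.toFun (a * b) * (Ideal.absNorm (a * b) : ℂ) ^ (-s) =
      (χ.toFun a * (Ideal.absNorm a : ℂ) ^ (-s)) * (χ.toFun b * (Ideal.absNorm b : ℂ) ^ (-s)) := by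
  rw [χ.map_mul', absNorm_cpow_mul]; ring

lemma tendsto_LSer {s : ℂ} (hs : 1 < s.re) :
    Tendsto (fun P : Finset (HeightOneSpectrum (𝓞 K)) =>
      (∏ p ∈ P, ‖1 - χ.toFun p.asIdeal * (Ideal.absNorm p.asIdeal : ℂ) ^ (-s)‖) * ‖LSer χ s‖)
      atTop (𝓝 1) := by
  have h := (tendsto_euler (K := K) (h := fun a => χ.toFun a * (Ideal.absNorm a : ℂ) ^ (-s))
    (LSer_term_mul χ s) (by simp [χ.apply_top]) (summable_LSer χ hs)).norm
  rw [norm_one] at h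
  refine h.congr fun P => ?_
  rw [norm_mul, norm_prod]
  rfl

lemma one_le_norm_LSer_mul {s : ℂ} (hs : 1 < s.re) : 1 ≤ ‖LSer χ s‖ * zetaR K s.re := by
  have h1 := tendsto_LSer χ hs
  have h2 := tendsto_zetaR (K := K) hs
  have h3 := (h1.mul h2)
  rw [mul_one] at h3
  refine le_of_tendsto h3 (Eventually.of_forall fun P => ?_)
  have hz : 0 ≤ zetaR K s.re := zero_le_one.trans (one_le_zetaR hs)
  have key : (∏ p ∈ P, ‖1 - χ.toFun p.asIdeal * (Ideal.absNorm p.asIdeal : ℂ) ^ (-s)‖) *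
      ∏ p ∈ P, eulR s.re p ≤ 1 := by
    rw [← Finset.prod_mul_distrib]
    refine Finset.prod_le_one (fun p _ => mul_nonneg (norm_nonneg _) (eulR_pos hs p).le) fun p _ => ?_
    set x := (Ideal.absNorm p.asIdeal : ℝ) ^ (-s.re) with hx
    have hx0 : 0 ≤ x := by positivity
    have h4 : ‖1 - χ.toFun p.asIdeal * (Ideal.absNorm p.asIdeal : ℂ) ^ (-s)‖ ≤ 1 + x :=
      (norm_sub_le _ _).trans (by rw [norm_one]; exact add_le_add_right (norm_LSer_term_le χ ⟨_, p.ne_bot⟩ s) _)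
    calc _ ≤ (1 + x) * (1 - x) := mul_le_mul_of_nonneg_right h4 (eulR_pos hs p).le
      _ ≤ 1 := by nlinarith
  calc _ = ((∏ p ∈ P, ‖1 - χ.toFun p.asIdeal * (Ideal.absNorm p.asIdeal : ℂ) ^ (-s)‖) *
      ∏ p ∈ P, eulR s.re p) * (‖LSer χ s‖ * zetaR K s.re) := by ring
    _ ≤ 1 * (‖LSer χ s‖ * zetaR K s.re) :=
        mul_le_mul_of_nonneg_right key (mul_nonneg (norm_nonneg _) hz)
    _ = _ := one_mul _

lemma LSer_ne_zero {s : ℂ} (hs : 1 < s.re) : LSer χ s ≠ 0 := by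
  intro h
  have := one_le_norm_LSer_mul χ hs
  rw [h, norm_zero, zero_mul] at this
  linarith

lemma norm_LSer_mul_zetaR_anti {s s' : ℂ} (hs : 1 < s.re) (hle : s.re ≤ s'.re) (him : s'.im = s.im) :
    ‖LSer χ s'‖ * zetaR K s'.re ≤ ‖LSer χ s‖ * zetaR K s.re := by
  have hs' : 1 < s'.re := hs.trans_le hle
  have hpos : ∀ s : ℂ, 1 < s.re → 0 < ‖LSer χ s‖ * zetaR K s.re := fun s hs =>
    lt_of_lt_of_le one_pos (one_le_norm_LSer_mul χ hs)
  set A : ℂ → Finset (HeightOneSpectrum (𝓞 K)) → ℝ := fun s P =>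
    (∏ p ∈ P, ‖1 - χ.toFun p.asIdeal * (Ideal.absNorm p.asIdeal : ℂ) ^ (-s)‖) *
      ∏ p ∈ P, eulR s.re p with hA
  have lim : ∀ s : ℂ, 1 < s.re → Tendsto (A s) atTop (𝓝 (‖LSer χ s‖ * zetaR K s.re)⁻¹) := by
    intro s hs
    have h3 := ((tendsto_LSer χ hs).mul (tendsto_zetaR (K := K) hs)).mul_const
      (‖LSer χ s‖ * zetaR K s.re)⁻¹
    rw [mul_one, one_mul] at h3
    refine h3.congr fun P => ?_
    have := (hpos s hs).ne'
    rw [hA]; dsimp only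
    rw [show ∀ a b c d : ℝ, a * b * (c * d) = a * c * (b * d) by intros; ring]
    exact mul_inv_cancel_right₀ this _
  have hle : A s ≤ A s' := by
    intro P
    rw [hA]; dsimp only
    rw [← Finset.prod_mul_distrib, ← Finset.prod_mul_distrib]
    refine Finset.prod_le_prod (fun p _ => mul_nonneg (norm_nonneg _) (eulR_pos hs p).le) fun p _ => ?_
    set q : ℝ := (Ideal.absNorm p.asIdeal : ℝ) with hq
    have hq2 : (2 : ℝ) ≤ q := by rw [hq]; exact_mod_cast two_le_absNorm p
    set x := q ^ (-s.re) with hx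
    set y := q ^ (-s'.re) with hy
    have hyx : y ≤ x := Real.rpow_le_rpow_of_exponent_le (by linarith) (by linarith)
    have hy0 : 0 ≤ y := by positivity
    have hx1 : x ≤ 1 / 2 := absNorm_rpow_le hs p
    set w : ℂ := χ.toFun p.asIdeal * (q : ℂ) ^ (-(s.im * I)) with hw
    have hw1 : ‖w‖ ≤ 1 := by
      rw [hw, norm_mul, Complex.norm_cpow_eq_rpow_re_of_pos (by linarith)]
      simpa using χ.norm_le_one _
    have e : ∀ t : ℂ, t.im = s.im →
        χ.toFun p.asIdeal * (Ideal.absNorm p.asIdeal : ℂ) ^ (-t) = (q ^ (-t.re) : ℝ) * w := by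
      intro t ht
      have hqc : (q : ℂ) ≠ 0 := by
        have : q ≠ 0 := by linarith
        exact_mod_cast this
      have h1 : -t = ((-t.re : ℝ) : ℂ) + -(s.im * I) := by
        apply Complex.ext <;> simp [ht]
      have h2 : (Ideal.absNorm p.asIdeal : ℂ) = (q : ℂ) := by rw [hq]; simp
      rw [h2, h1, Complex.cpow_add _ _ hqc, Complex.ofReal_cpow (by linarith), hw]
      ring
    rw [e s rfl, e s' him]
    change ‖1 - (x : ℂ) * w‖ * (1 - x) ≤ ‖1 - (y : ℂ) * w‖ * (1 - y)
    have t1 : ‖1 - (x : ℂ) * w‖ ≤ ‖1 - (y : ℂ) * w‖ + (x - y) := by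
      have : 1 - (x : ℂ) * w = (1 - (y : ℂ) * w) - ((x - y : ℝ) : ℂ) * w := by push_cast; ring
      rw [this]
      refine (norm_sub_le _ _).trans (add_le_add_right ?_ _)
      rw [norm_mul, Complex.norm_real, Real.norm_of_nonneg (by linarith)]
      exact mul_le_of_le_one_right (by linarith) hw1
    have t2 : 1 - y ≤ ‖1 - (y : ℂ) * w‖ := by
      have h := norm_sub_norm_le (1 : ℂ) ((y : ℂ) * w)
      rw [norm_one, norm_mul, Complex.norm_real, Real.norm_of_nonneg hy0] at h
      have : y * ‖w‖ ≤ y := mul_le_of_le_one_right hy0 hw1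
      linarith
    nlinarith [mul_nonneg (sub_nonneg.2 hyx) (sub_nonneg.2 (show 1 - x ≤ ‖1 - (y : ℂ) * w‖ by linarith))]
  have h4 := le_of_tendsto_of_tendsto' (lim s hs) (lim s' hs') hle
  exact (inv_le_inv₀ (hpos s hs) (hpos s' hs')).1 h4

end DirichletSeries

section ZetaBound
open IsDedekindDomain
open scoped Classical nonZeroDivisors

lemma sum_rpow_le {σ : ℝ} (hσ : 1 < σ) : ∑' n : ℕ, (n : ℝ) ^ (-σ) ≤ σ / (σ - 1) := by
  refine Real.tsum_le_of_sum_range_le (fun n => by positivity) fun N => ?_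
  have h1 : ∀ N : ℕ, ∑ n ∈ Finset.range (N + 2), (n : ℝ) ^ (-σ) ≤
      σ / (σ - 1) - 1 / (σ - 1) * (N + 1 : ℝ) ^ (1 - σ) := by
    intro N
    induction N with
    | zero =>
      rw [Finset.sum_range_succ, Finset.sum_range_one]
      have : (0 : ℝ) ^ (-σ) = 0 := Real.zero_rpow (by linarith)
      have h2 : σ - 1 ≠ 0 := by linarith
      simp only [Nat.cast_zero, zero_add, Nat.cast_one, Real.one_rpow, this]
      field_simp
      linarith
    | succ N ih =>
      rw [Finset.sum_range_succ]
      have hc : AntitoneOn (fun x : ℝ => x ^ (-σ)) (Set.Icc ((N : ℝ) + 1) ((N : ℝ) + 1 + (1 : ℕ))) := by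
        intro a ha b hb hab
        have : (0 : ℝ) ≤ N := Nat.cast_nonneg _
        exact Real.rpow_le_rpow_of_nonpos (by linarith [ha.1]) hab (by linarith)
      have h3 := hc.sum_le_integral
      rw [Finset.sum_range_one, integral_rpow (Or.inr ⟨by linarith, by
        rw [Set.uIcc_of_le (by simp)]
        intro h
        have : (0 : ℝ) ≤ N := Nat.cast_nonneg _
        linarith [h.1]⟩)] at h3
      have h4 : (-σ + 1) = -(σ - 1) := by ring
      rw [h4, div_neg] at h3
      push_cast at h3 ih ⊢
      have h5 : (1 - σ) = -(σ - 1) := by ring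
      rw [h5] at ih ⊢
      have e1 : (N : ℝ) + 1 + 1 = N + 2 := by ring
      rw [e1] at h3 ⊢
      have e2 : ∀ x y : ℝ, -((x - y) / (σ - 1)) = 1 / (σ - 1) * y - 1 / (σ - 1) * x := by
        intro x y; ring
      rw [e2] at h3
      linarith
  calc _ ≤ ∑ n ∈ Finset.range (N + 2), (n : ℝ) ^ (-σ) :=
        Finset.sum_le_sum_of_subset_of_nonneg (Finset.range_mono (by omega)) fun _ _ _ => by positivity
    _ ≤ _ := h1 N
    _ ≤ _ := by
      have : 0 ≤ 1 / (σ - 1) * (N + 1 : ℝ) ^ (1 - σ) := by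
        have : 0 < σ - 1 := by linarith
        positivity
      linarith

lemma prod_primes_ge {σ : ℝ} (hσ : 1 < σ) (Q : Finset ℕ) (hQ : ∀ p ∈ Q, p.Prime) :
    (σ - 1) / σ ≤ ∏ p ∈ Q, (1 - (p : ℝ) ^ (-σ)) := by
  have hs : Summable fun n : ℕ => (n : ℝ) ^ (-σ) := Real.summable_nat_rpow.2 (by linarith)
  let f : ℕ →*₀ ℝ :=
    { toFun := fun n => (n : ℝ) ^ (-σ)
      map_zero' := by simpa using Real.zero_rpow (by linarith : -σ ≠ 0)
      map_one' := by simp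
      map_mul' := fun a b => by
        rw [Nat.cast_mul, Real.mul_rpow (Nat.cast_nonneg _) (Nat.cast_nonneg _)] }
  have hf1 : ∀ {p : ℕ}, p.Prime → ‖f p‖ < 1 := by
    intro p hp
    have h2 : (1 : ℝ) < p := by exact_mod_cast hp.one_lt
    change ‖(p : ℝ) ^ (-σ)‖ < 1
    rw [Real.norm_of_nonneg (by positivity)]
    exact Real.rpow_lt_one_of_one_lt_of_neg h2 (by linarith)
  obtain ⟨-, h⟩ := EulerProduct.summable_and_hasSum_factoredNumbers_prod_filter_prime_geometric
    (f := f.toMonoidHom) hf1 Q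
  rw [Finset.filter_true_of_mem hQ] at h
  have h2 : (∏ p ∈ Q, (1 - (p : ℝ) ^ (-σ))⁻¹) ≤ ∑' n : ℕ, (n : ℝ) ^ (-σ) := by
    have h3 : ∏ p ∈ Q, (1 - (p : ℝ) ^ (-σ))⁻¹ = ∑' m : Nat.factoredNumbers Q, ((m : ℕ) : ℝ) ^ (-σ) :=
      h.tsum_eq.symm
    rw [h3]
    exact hs.tsum_subtype_le _ _ fun n => by positivity
  have h3 := h2.trans (sum_rpow_le hσ)
  rw [Finset.prod_inv_distrib] at h3
  have h5 : 0 < ∏ p ∈ Q, (1 - (p : ℝ) ^ (-σ)) := Finset.prod_pos fun p hp => by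
    have := hf1 (hQ p hp)
    have h6 : (p : ℝ) ^ (-σ) < 1 := lt_of_abs_lt this
    linarith
  have h4 := inv_anti₀ (inv_pos.2 h5) h3
  rwa [inv_inv, inv_div] at h4

variable {K : Type*} [Field K] [NumberField K]

lemma exists_prime_mem (p : HeightOneSpectrum (𝓞 K)) (n : ℕ) (hn : n ≠ 0)
    (hm : (n : 𝓞 K) ∈ p.asIdeal) : ∃ q : ℕ, q.Prime ∧ q ∣ n ∧ (q : 𝓞 K) ∈ p.asIdeal := by
  induction n using induction_on_primes with
  | zero => exact absurd rfl hn
  | one => exact absurd ((Ideal.eq_top_iff_one _).2 (by simpa using hm)) p.isPrime.ne_top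
  | prime_mul q a hq ih =>
    rw [Nat.cast_mul] at hm
    rcases p.isPrime.mem_or_mem hm with h | h
    · exact ⟨q, hq, dvd_mul_right _ _, h⟩
    · obtain ⟨q', h1, h2, h3⟩ := ih (right_ne_zero_of_mul hn) h
      exact ⟨q', h1, h2.mul_left _, h3⟩

/-- The rational prime below a prime ideal. -/
lemma exists_prime_below (p : HeightOneSpectrum (𝓞 K)) :
    ∃ q : ℕ, q.Prime ∧ (q : 𝓞 K) ∈ p.asIdeal ∧ q ≤ Ideal.absNorm p.asIdeal := by
  have h0 : Ideal.absNorm p.asIdeal ≠ 0 := by have := two_le_absNorm p; omega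
  obtain ⟨q, hq, hd, hm⟩ := exists_prime_mem p _ h0 (Ideal.absNorm_mem p.asIdeal)
  exact ⟨q, hq, hm, Nat.le_of_dvd (Nat.pos_of_ne_zero h0) hd⟩

lemma card_primes_above_le (q : ℕ) (hq : q.Prime) (P : Finset (HeightOneSpectrum (𝓞 K)))
    (hP : ∀ p ∈ P, (q : 𝓞 K) ∈ p.asIdeal ∧ q ≤ Ideal.absNorm p.asIdeal) : P.card ≤ nK K := by
  have hinj : Function.Injective fun p : HeightOneSpectrum (𝓞 K) => p.asIdeal :=
    fun a b h => HeightOneSpectrum.ext h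
  have hd : ∏ I ∈ P.image (fun p => p.asIdeal), I ∣ Ideal.span {(q : 𝓞 K)} := by
    refine Finset.prod_primes_dvd _ (fun I hI => ?_) (fun I hI => ?_)
    · obtain ⟨p, -, rfl⟩ := Finset.mem_image.1 hI
      exact p.prime
    · obtain ⟨p, hp, rfl⟩ := Finset.mem_image.1 hI
      rw [Ideal.dvd_span_singleton]
      exact (hP p hp).1
  rw [Finset.prod_image hinj.injOn] at hd
  have h2 := map_dvd Ideal.absNorm hd
  rw [Ideal.absNorm_span_natCast, map_prod] at h2
  have h3 := Nat.le_of_dvd (pow_pos hq.pos _) h2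
  have h4 : q ^ P.card ≤ ∏ p ∈ P, Ideal.absNorm p.asIdeal := by
    rw [← Finset.prod_const]
    exact Finset.prod_le_prod' fun p hp => (hP p hp).2
  have h5 := (Nat.pow_le_pow_iff_right hq.one_lt).1 (h4.trans h3)
  rwa [RingOfIntegers.rank] at h5

lemma zetaR_le {σ : ℝ} (hσ : 1 < σ) : zetaR K σ ≤ (σ / (σ - 1)) ^ nK K := by
  have h0 : 0 < (σ - 1) / σ := div_pos (by linarith) (by linarith)
  have key : ((σ - 1) / σ) ^ nK K * zetaR K σ ≤ 1 := by
    refine ge_of_tendsto (tendsto_zetaR (K := K) hσ) (Eventually.of_forall fun P => ?_)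
    refine mul_le_mul_of_nonneg_right ?_ (zero_le_one.trans (one_le_zetaR hσ))
    choose q hq hqm hqn using fun p : HeightOneSpectrum (𝓞 K) => exists_prime_below p
    have hx : ∀ p ∈ P.image q, 0 ≤ 1 - (p : ℝ) ^ (-σ) ∧ 1 - (p : ℝ) ^ (-σ) ≤ 1 := by
      intro p hp
      obtain ⟨p, -, rfl⟩ := Finset.mem_image.1 hp
      have h2 : (1 : ℝ) < q p := by exact_mod_cast (hq p).one_lt
      have := Real.rpow_lt_one_of_one_lt_of_neg h2 (by linarith : -σ < 0)
      have : (0 : ℝ) ≤ (q p : ℝ) ^ (-σ) := by positivity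
      constructor <;> linarith
    calc ((σ - 1) / σ) ^ nK K ≤ (∏ p ∈ P.image q, (1 - (p : ℝ) ^ (-σ))) ^ nK K :=
          pow_le_pow_left₀ h0.le (prod_primes_ge hσ _ fun p hp => by
            obtain ⟨p, -, rfl⟩ := Finset.mem_image.1 hp
            exact hq p) _
      _ = ∏ p ∈ P.image q, (1 - (p : ℝ) ^ (-σ)) ^ nK K := (Finset.prod_pow _ _ _).symm
      _ ≤ ∏ p ∈ P.image q, (1 - (p : ℝ) ^ (-σ)) ^ (P.filter fun 𝔭 => q 𝔭 = p).card := by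
          refine Finset.prod_le_prod (fun p hp => pow_nonneg (hx p hp).1 _) fun p hp => ?_
          refine pow_le_pow_of_le_one (hx p hp).1 (hx p hp).2 ?_
          obtain ⟨𝔭, -, h⟩ := Finset.mem_image.1 hp
          refine card_primes_above_le p (h ▸ hq 𝔭) _ fun 𝔮 h𝔮 => ?_
          rw [← (Finset.mem_filter.1 h𝔮).2]
          exact ⟨hqm _, hqn _⟩
      _ = ∏ 𝔭 ∈ P, (1 - (q 𝔭 : ℝ) ^ (-σ)) := by
          rw [← Finset.prod_fiberwise_of_maps_to (g := q) (t := P.image q)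
            (fun x hx => Finset.mem_image_of_mem q hx)]
          refine Finset.prod_congr rfl fun p hp => ?_
          rw [← Finset.prod_const]
          refine Finset.prod_congr rfl fun 𝔭 h𝔭 => ?_
          rw [(Finset.mem_filter.1 h𝔭).2]
      _ ≤ _ := by
          refine Finset.prod_le_prod (fun p hp => (hx _ (Finset.mem_image_of_mem q hp)).1) fun p hp => ?_
          rw [eulR]
          have h1 : (0 : ℝ) < q p := by exact_mod_cast (hq p).pos
          have := Real.rpow_le_rpow_of_nonpos h1 (by exact_mod_cast hqn p :
            (q p : ℝ) ≤ Ideal.absNorm p.asIdeal) (by linarith : -σ ≤ 0)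
          linarith
  have h1 : (σ / (σ - 1)) = ((σ - 1) / σ)⁻¹ := (inv_div _ _).symm
  rw [h1, inv_pow, ← one_div, le_div_iff₀ (by positivity), mul_comm]
  exact key

end ZetaBound

section Generators
open FractionalIdeal
open scoped Classical nonZeroDivisors

variable {K : Type*} [Field K] [NumberField K] (J : (FractionalIdeal (𝓞 K)⁰ K)ˣ)

/-- The ideals `𝔟` for which `J𝔟` is principal. -/
abbrev PrincIdx := {𝔟 : NzI K // ∃ β : K, spanSingleton (𝓞 K)⁰ β =
  (J : FractionalIdeal (𝓞 K)⁰ K) * (𝔟.1 : FractionalIdeal (𝓞 K)⁰ K)}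

/-- A generator of `J𝔟`. -/
def idxGen (i : PrincIdx J) : K := i.2.choose

lemma idxGen_spec (i : PrincIdx J) : spanSingleton (𝓞 K)⁰ (idxGen J i) =
    (J : FractionalIdeal (𝓞 K)⁰ K) * (i.1.1 : FractionalIdeal (𝓞 K)⁰ K) := i.2.choose_spec

lemma idxGen_ne_zero (i : PrincIdx J) : idxGen J i ≠ 0 := by
  intro h
  have h1 := idxGen_spec J i
  rw [h, spanSingleton_zero] at h1
  have := mul_ne_zero J.ne_zero (coeIdeal_ne_zero (K := K).2 i.1.2)
  exact this h1.symm

lemma idxGen_mem (i : PrincIdx J) : idxGen J i ∈ (J : FractionalIdeal (𝓞 K)⁰ K) := by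
  rw [← spanSingleton_le_iff_mem, idxGen_spec]
  calc (J : FractionalIdeal (𝓞 K)⁰ K) * (i.1.1 : FractionalIdeal (𝓞 K)⁰ K) ≤ J * 1 :=
        mul_le_mul_right coeIdeal_le_one _
    _ = J := mul_one _

lemma exists_unit_of_span_eq {x y : K}
    (h : spanSingleton (𝓞 K)⁰ x = spanSingleton (𝓞 K)⁰ y) : ∃ u : (𝓞 K)ˣ, x = u * y := by
  have h1 := mem_spanSingleton_self (𝓞 K)⁰ x
  have h2 := mem_spanSingleton_self (𝓞 K)⁰ y
  rw [h, mem_spanSingleton] at h1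
  rw [← h, mem_spanSingleton] at h2
  obtain ⟨a, ha⟩ := h1
  obtain ⟨b, hb⟩ := h2
  rw [Algebra.smul_def] at ha hb
  by_cases hy : y = 0
  · refine ⟨1, ?_⟩
    rw [← ha, hy]; simp
  · have hab : b * a = 1 := by
      have : algebraMap (𝓞 K) K (b * a) * y = 1 * y := by
        rw [map_mul, mul_assoc, ha, hb, one_mul]
      have := mul_right_cancel₀ hy this
      exact FaithfulSMul.algebraMap_injective (𝓞 K) K (by rw [this, map_one])
    refine ⟨⟨a, b, by rw [mul_comm]; exact hab, hab⟩, ha.symm⟩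

lemma exists_idx (β : K) (hβ : β ∈ (J : FractionalIdeal (𝓞 K)⁰ K)) (h0 : β ≠ 0) :
    ∃ (i : PrincIdx J) (u : (𝓞 K)ˣ), β = u * idxGen J i := by
  have h1 : spanSingleton (𝓞 K)⁰ β * (J⁻¹ : (FractionalIdeal (𝓞 K)⁰ K)ˣ) ≤ 1 := by
    calc spanSingleton (𝓞 K)⁰ β * (J⁻¹ : (FractionalIdeal (𝓞 K)⁰ K)ˣ) ≤ J * (J⁻¹ : (FractionalIdeal (𝓞 K)⁰ K)ˣ) :=
          mul_le_mul_left (spanSingleton_le_iff_mem.2 hβ) _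
      _ = 1 := J.mul_inv
  obtain ⟨𝔟, h𝔟⟩ := le_one_iff_exists_coeIdeal.1 h1
  have h2 : spanSingleton (𝓞 K)⁰ β = (J : FractionalIdeal (𝓞 K)⁰ K) * (𝔟 : FractionalIdeal (𝓞 K)⁰ K) := by
    rw [h𝔟, mul_comm (spanSingleton (𝓞 K)⁰ β), ← mul_assoc, J.mul_inv, one_mul]
  have hb0 : 𝔟 ≠ ⊥ := by
    rintro rfl
    rw [coeIdeal_bot, mul_zero, spanSingleton_eq_zero_iff] at h2
    exact h0 h2
  refine ⟨⟨⟨𝔟, hb0⟩, β, h2⟩, ?_⟩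
  exact exists_unit_of_span_eq (h2.trans (idxGen_spec J ⟨⟨𝔟, hb0⟩, β, h2⟩).symm)

lemma spanSingleton_unit_mul (u : (𝓞 K)ˣ) (x : K) :
    spanSingleton (𝓞 K)⁰ ((u : K) * x) = spanSingleton (𝓞 K)⁰ x := by
  apply le_antisymm
  · rw [spanSingleton_le_iff_mem, mem_spanSingleton]
    exact ⟨u, by rw [Algebra.smul_def]⟩
  · rw [spanSingleton_le_iff_mem, mem_spanSingleton]
    refine ⟨(u⁻¹ : (𝓞 K)ˣ), ?_⟩
    rw [Algebra.smul_def, ← mul_assoc]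
    have : algebraMap (𝓞 K) K ((u⁻¹ : (𝓞 K)ˣ) : 𝓞 K) * (u : K) = 1 := by
      have := congrArg (algebraMap (𝓞 K) K) (u.inv_mul)
      rwa [map_mul, map_one] at this
    rw [this, one_mul]

lemma idx_inj (i j : PrincIdx J) (u v : (𝓞 K)ˣ) (h : (u : K) * idxGen J i = v * idxGen J j) :
    i = j := by
  have h1 := congrArg (spanSingleton (𝓞 K)⁰) h
  rw [spanSingleton_unit_mul, spanSingleton_unit_mul, idxGen_spec, idxGen_spec] at h1
  exact Subtype.ext (Subtype.ext (coeIdeal_injective (K := K) (mul_left_cancel₀ J.ne_zero h1)))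

lemma norm_idxGen (i : PrincIdx J) : (|Algebra.norm ℚ (idxGen J i)| : ℚ) =
    absNorm J.1 * Ideal.absNorm i.1.1 := by
  rw [← absNorm_span_singleton (R := 𝓞 K), idxGen_spec, map_mul, coeIdeal_absNorm]

lemma absNorm_unit_pos : 0 < absNorm J.1 :=
  lt_of_le_of_ne (absNorm_nonneg _) (by
    rw [ne_comm, Ne, absNorm_eq_zero_iff]; exact J.ne_zero)

lemma norm_idxGen_pos (i : PrincIdx J) : (0 : ℝ) < (absNorm J.1 : ℝ) * Ideal.absNorm i.1.1 :=
  mul_pos (by exact_mod_cast absNorm_unit_pos J) (absNorm_pos' _)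

lemma exp_log_norm_idxGen (i : PrincIdx J) (s : ℂ) :
    cexp (-s * Real.log |(Algebra.norm ℚ (idxGen J i) : ℚ)|) =
      ((absNorm J.1 : ℝ) : ℂ) ^ (-s) * (Ideal.absNorm i.1.1 : ℂ) ^ (-s) := by
  have h : (|(Algebra.norm ℚ (idxGen J i) : ℝ)| : ℝ) = (absNorm J.1 : ℝ) * Ideal.absNorm i.1.1 := by
    have := congrArg (Rat.cast : ℚ → ℝ) (norm_idxGen J i)
    push_cast at this
    exact this
  have hp := norm_idxGen_pos J i
  rw [h]
  have h2 : (((absNorm J.1 : ℝ) : ℂ) * (Ideal.absNorm i.1.1 : ℂ)) =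
      (((absNorm J.1 : ℝ) * Ideal.absNorm i.1.1 : ℝ) : ℂ) := by push_cast; rfl
  have h3 := Complex.mul_cpow_ofReal_nonneg (a := (absNorm J.1 : ℝ)) (b := (Ideal.absNorm i.1.1 : ℝ))
    (by exact_mod_cast absNorm_nonneg _) (Nat.cast_nonneg _) (-s)
  rw [Complex.ofReal_natCast] at h3
  rw [← h3, h2, Complex.cpow_def_of_ne_zero (by exact_mod_cast hp.ne'), ← Complex.ofReal_log hp.le,
    mul_comm]

lemma summable_idx {σ : ℝ} (hσ : 1 < σ) :
    Summable fun i : PrincIdx J => Real.exp (-σ * Real.log |(Algebra.norm ℚ (idxGen J i) : ℚ)|) := by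
  have h := ((summable_absNorm K hσ).comp_injective (Subtype.val_injective (p := fun 𝔟 : NzI K =>
    ∃ β : K, spanSingleton (𝓞 K)⁰ β = (J : FractionalIdeal (𝓞 K)⁰ K) * (𝔟.1 : FractionalIdeal (𝓞 K)⁰ K)))).mul_left
      ((absNorm J.1 : ℝ) ^ (-σ))
  refine h.congr fun i => ?_
  have h2 := congrArg (fun z : ℂ => ‖z‖) (exp_log_norm_idxGen J i σ)
  simp only [Complex.norm_exp, norm_mul] at h2
  have h3 : (-(σ : ℂ) * ((Real.log |(Algebra.norm ℚ (idxGen J i) : ℝ)| : ℝ) : ℂ)).re =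
      -σ * Real.log |(Algebra.norm ℚ (idxGen J i) : ℝ)| := by
    rw [← Complex.ofReal_neg, ← Complex.ofReal_mul, Complex.ofReal_re]
  rw [h3] at h2
  rw [h2, norm_absNorm_cpow, Complex.norm_cpow_eq_rpow_re_of_pos (by exact_mod_cast absNorm_unit_pos J)]
  simp

end Generators

section HeckeCoefficients
open NumberField.InfinitePlace NumberField.mixedEmbedding
open scoped Classical nonZeroDivisors

variable {K : Type*} [Field K] [NumberField K]

/-- `S` is the set of real places at which the infinity type of `χ` is odd. -/
def IsSignSet {𝔣 : Ideal (𝓞 K)} (χ : HeckeChar K 𝔣) (S : Finset {w : InfinitePlace K // IsReal w}) :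
    Prop :=
  (𝔣 = ⊤ → S = ∅) ∧ ∀ α : 𝓞 K, α - 1 ∈ 𝔣 → χ.toFun (Ideal.span {α}) = sgnS S (α : K)

/-- The coefficients `χ(αI⁻¹) sgn(α)` on `I`, extended by zero. -/
def hCoef {𝔣 : Ideal (𝓞 K)} (χ : HeckeChar K 𝔣) (S : Finset {w : InfinitePlace K // IsReal w})
    (I : Ideal (𝓞 K)) (x : K) : ℂ :=
  if h : ∃ 𝔠 : Ideal (𝓞 K), ∃ α : 𝓞 K, (α : K) = x ∧ Ideal.span {α} = I * 𝔠 then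
    χ.toFun h.choose * sgnS S x else 0

variable {𝔣 : Ideal (𝓞 K)} (χ : HeckeChar K 𝔣) (S : Finset {w : InfinitePlace K // IsReal w})
variable {I : Ideal (𝓞 K)}

lemma exists_quot {α : 𝓞 K} (hα : α ∈ I) : ∃ 𝔠 : Ideal (𝓞 K), Ideal.span {α} = I * 𝔠 :=
  Ideal.dvd_iff_le.2 ((Ideal.span_singleton_le_iff_mem _).2 hα)

lemma mem_of_span_eq {α : 𝓞 K} {𝔠 : Ideal (𝓞 K)} (h : Ideal.span {α} = I * 𝔠) : α ∈ I :=
  (Ideal.span_singleton_le_iff_mem _).1 (h.trans_le Ideal.mul_le_left)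

lemma hCoef_eq (hI : I ≠ ⊥) {α : 𝓞 K} {𝔠 : Ideal (𝓞 K)} (h : Ideal.span {α} = I * 𝔠) :
    hCoef χ S I (α : K) = χ.toFun 𝔠 * sgnS S (α : K) := by
  have hex : ∃ 𝔠 : Ideal (𝓞 K), ∃ β : 𝓞 K, (β : K) = (α : K) ∧ Ideal.span {β} = I * 𝔠 :=
    ⟨𝔠, α, rfl, h⟩
  rw [hCoef, dif_pos hex]
  obtain ⟨β, hβ, h2⟩ := hex.choose_spec
  have : β = α := by exact_mod_cast hβ
  rw [this, h] at h2
  rw [← mul_left_cancel₀ (by simpa using hI) h2]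

lemma hCoef_of_not_mem {x : K} (h : ∀ α ∈ I, (α : K) ≠ x) : hCoef χ S I x = 0 := by
  rw [hCoef, dif_neg]
  rintro ⟨𝔠, α, h1, h2⟩
  exact h α (mem_of_span_eq h2) h1

lemma norm_hCoef_le (x : K) : ‖hCoef χ S I x‖ ≤ 1 := by
  rw [hCoef]
  split_ifs with h
  · rw [norm_mul]
    exact mul_le_one₀ (χ.norm_le_one _) (norm_nonneg _) (norm_sgnS_le _ _)
  · simp

lemma hCoef_unit_mul (hI : I ≠ ⊥) (u : (𝓞 K)ˣ) (x : K) :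
    hCoef χ S I ((u : K) * x) = sgnS S (u : K) * hCoef χ S I x := by
  by_cases h : ∃ α ∈ I, (α : K) = x
  · obtain ⟨α, hα, rfl⟩ := h
    obtain ⟨𝔠, h𝔠⟩ := exists_quot hα
    have h1 : Ideal.span {(u : 𝓞 K) * α} = I * 𝔠 := by
      rw [Ideal.span_singleton_mul_left_unit u.isUnit, h𝔠]
    have h2 := hCoef_eq χ S hI h1
    have h3 : ((((u : 𝓞 K) * α : 𝓞 K)) : K) = (u : K) * (α : K) := rfl
    rw [h3, sgnS_mul] at h2
    rw [h2, hCoef_eq χ S hI h𝔠]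
    ring
  · push Not at h
    rw [hCoef_of_not_mem χ S h, hCoef_of_not_mem χ S (I := I), mul_zero]
    intro α hα h1
    refine h (((u⁻¹ : (𝓞 K)ˣ) : 𝓞 K) * α) (I.mul_mem_left _ hα) ?_
    have h3 : (((((u⁻¹ : (𝓞 K)ˣ) : 𝓞 K) * α : 𝓞 K)) : K) =
      (((u⁻¹ : (𝓞 K)ˣ) : 𝓞 K) : K) * (α : K) := rfl
    have h4 : (((u⁻¹ : (𝓞 K)ˣ) : 𝓞 K) : K) * ((u : 𝓞 K) : K) = 1 := by
      have : ((u⁻¹ : (𝓞 K)ˣ) : 𝓞 K) * (u : 𝓞 K) = 1 := by simp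
      exact_mod_cast congrArg (algebraMap (𝓞 K) K) this
    rw [h3, h1, ← mul_assoc, h4, one_mul]

variable {χ S}

lemma hCoef_periodic_aux (hS : IsSignSet χ S) (h𝔣 : 𝔣 ≠ ⊤) (hI : I ≠ ⊥) {α α' : 𝓞 K}
    (h : α' - α ∈ 𝔣 * I) {𝔞 𝔞' : Ideal (𝓞 K)} (h𝔞 : Ideal.span {α} = I * 𝔞)
    (h𝔞' : Ideal.span {α'} = I * 𝔞') (hc : IsCoprime 𝔞 𝔣) :
    hCoef χ S I (α' : K) = hCoef χ S I (α : K) := by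
  obtain ⟨μ, hμ, ν, hν, hμν⟩ := Ideal.isCoprime_iff_exists.1 hc
  have hμ1 : μ - 1 ∈ 𝔣 := by
    have : μ - 1 = -ν := by rw [← hμν]; ring
    rw [this]; exact 𝔣.neg_mem hν
  have hne : ∀ x : 𝓞 K, x - 1 ∈ 𝔣 → x ≠ 0 := by
    rintro x hx rfl
    rw [zero_sub, neg_mem_iff] at hx
    exact h𝔣 ((Ideal.eq_top_iff_one _).2 hx)
  have hα : α ≠ 0 := by
    rintro rfl
    have h1 : I * 𝔞 = 0 := by rw [← h𝔞]; simp
    rcases mul_eq_zero.1 h1 with h2 | h2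
    · exact hI h2
    · rw [h2, Ideal.isCoprime_iff_sup_eq] at hc
      exact h𝔣 (by simpa using hc)
  obtain ⟨𝔠, h𝔠⟩ := exists_quot hμ
  have h1 : Ideal.span {μ * α'} = Ideal.span {α} * (𝔠 * 𝔞') := by
    rw [← Ideal.span_singleton_mul_span_singleton, h𝔠, h𝔞, h𝔞']
    ring
  obtain ⟨μ', hμ'⟩ := Ideal.mem_span_singleton'.1 (mem_of_span_eq h1)
  have h2 : Ideal.span {μ'} = 𝔠 * 𝔞' := by
    rw [← hμ', mul_comm, ← Ideal.span_singleton_mul_span_singleton] at h1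
    exact mul_left_cancel₀ (by simpa using hα) h1
  have h3 : μ' - 1 ∈ 𝔣 := by
    have h4 : (μ' - 1) * α ∈ 𝔣 * Ideal.span {α} := by
      have h5 : (μ' - 1) * α = μ * (α' - α) + (μ - 1) * α := by
        rw [sub_mul, hμ']; ring
      rw [h5]
      refine Ideal.add_mem _ ?_ (Ideal.mul_mem_mul hμ1 (Ideal.mem_span_singleton_self α))
      have h6 : 𝔣 * Ideal.span {α} = 𝔞 * (𝔣 * I) := by rw [h𝔞]; ring
      rw [h6]
      exact Ideal.mul_mem_mul hμ h
    rw [mul_comm 𝔣, Ideal.mem_span_singleton_mul] at h4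
    obtain ⟨z, hz, hz2⟩ := h4
    have : z = μ' - 1 := mul_left_cancel₀ hα (by rw [hz2]; ring)
    rwa [← this]
  have hα' : α' ≠ 0 := by
    rintro rfl
    rw [mul_zero] at hμ'
    exact (mul_ne_zero (hne _ h3) hα) hμ'
  have e1 := hS.2 μ hμ1
  have e2 := hS.2 μ' h3
  rw [h𝔠, χ.map_mul'] at e1
  rw [h2, χ.map_mul'] at e2
  have n0 : ∀ x : 𝓞 K, x ≠ 0 → (x : K) ≠ 0 := fun x hx h0 => hx (by exact_mod_cast h0)
  have n1 := sgnS_mul_self S (n0 _ (hne _ hμ1))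
  have n2 := sgnS_mul_self S (n0 _ hα)
  have n3 := sgnS_mul_self S (n0 _ hα')
  have e3 : sgnS S (μ' : K) * sgnS S (α : K) = sgnS S (μ : K) * sgnS S (α' : K) := by
    rw [← sgnS_mul, ← sgnS_mul]
    exact congrArg (sgnS S) (congrArg (algebraMap (𝓞 K) K) hμ')
  have hc0 : χ.toFun 𝔠 ≠ 0 := by
    intro h0
    rw [h0, mul_zero] at e1
    rw [← e1] at n1
    simp at n1
  rw [hCoef_eq χ S hI h𝔞, hCoef_eq χ S hI h𝔞']
  refine mul_left_cancel₀ hc0 ?_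
  rw [← mul_assoc, e2, ← mul_assoc, mul_comm (χ.toFun 𝔠), e1]
  linear_combination (sgnS S (α' : K) * sgnS S (α : K)) * e3 -
    (sgnS S (μ' : K) * sgnS S (α' : K)) * n2 + (sgnS S (μ : K) * sgnS S (α : K)) * n3

lemma hCoef_of_top (hS : IsSignSet χ S) (h𝔣 : 𝔣 = ⊤) (hI : I ≠ ⊥) {α : 𝓞 K} (hα : α ∈ I) :
    hCoef χ S I (α : K) = 1 := by
  obtain ⟨𝔠, h𝔠⟩ := exists_quot hα
  rw [hCoef_eq χ S hI h𝔠, χ.apply_of_top h𝔣, hS.1 h𝔣]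
  simp [sgnS]

lemma hCoef_periodic (hS : IsSignSet χ S) (hI : I ≠ ⊥) {α α' : 𝓞 K} (hα : α ∈ I)
    (h : α' - α ∈ 𝔣 * I) : hCoef χ S I (α' : K) = hCoef χ S I (α : K) := by
  have hα' : α' ∈ I := by
    have := I.add_mem (Ideal.mul_le_right h) hα
    rwa [sub_add_cancel] at this
  by_cases h𝔣 : 𝔣 = ⊤
  · rw [hCoef_of_top hS h𝔣 hI hα, hCoef_of_top hS h𝔣 hI hα']
  obtain ⟨𝔞, h𝔞⟩ := exists_quot hα
  obtain ⟨𝔞', h𝔞'⟩ := exists_quot hα'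
  by_cases hc : IsCoprime 𝔞 𝔣
  · exact hCoef_periodic_aux hS h𝔣 hI h h𝔞 h𝔞' hc
  by_cases hc' : IsCoprime 𝔞' 𝔣
  · refine (hCoef_periodic_aux hS h𝔣 hI ?_ h𝔞' h𝔞 hc').symm
    rw [← neg_sub]
    exact (𝔣 * I).neg_mem h
  · rw [hCoef_eq χ S hI h𝔞, hCoef_eq χ S hI h𝔞', χ.eq_zero' _ hc, χ.eq_zero' _ hc']
    simp

lemma hCoef_zero (h𝔣 : 𝔣 ≠ ⊤) (hI : I ≠ ⊥) : hCoef χ S I 0 = 0 := by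
  have h : Ideal.span {(0 : 𝓞 K)} = I * ⊥ := by simp
  have := hCoef_eq χ S hI h
  rw [χ.apply_bot h𝔣, zero_mul] at this
  simpa using this

end HeckeCoefficients

section HeckeTheta
open NumberField.InfinitePlace NumberField.mixedEmbedding MeasureTheory NumberField.Units
open scoped Classical nonZeroDivisors

variable {K : Type*} [Field K] [NumberField K]

section ResidueSums

/-- The finite group `I / 𝔣I`. -/
abbrev ResQ (𝔣 I : Ideal (𝓞 K)) : Type _ :=
  I.toAddSubgroup ⧸ (𝔣 * I).toAddSubgroup.addSubgroupOf I.toAddSubgroup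

/-- A representative of a class in `I / 𝔣I`. -/
def resOut {𝔣 I : Ideal (𝓞 K)} (q : ResQ 𝔣 I) : 𝓞 K := (Quotient.out q : I.toAddSubgroup)

lemma resOut_mem {𝔣 I : Ideal (𝓞 K)} (q : ResQ 𝔣 I) : resOut q ∈ I :=
  (Quotient.out q : I.toAddSubgroup).2

/-- The class of an element of `I` in `I / 𝔣I`. -/
def resMk (𝔣 : Ideal (𝓞 K)) {I : Ideal (𝓞 K)} {x : 𝓞 K} (hx : x ∈ I) : ResQ 𝔣 I :=
  QuotientAddGroup.mk (⟨x, hx⟩ : I.toAddSubgroup)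

lemma resMk_eq_iff {𝔣 I : Ideal (𝓞 K)} {x y : 𝓞 K} (hx : x ∈ I) (hy : y ∈ I) :
    resMk 𝔣 hx = resMk 𝔣 hy ↔ y - x ∈ 𝔣 * I := by
  rw [resMk, resMk, QuotientAddGroup.eq, AddSubgroup.mem_addSubgroupOf]
  have : ((-(⟨x, hx⟩ : I.toAddSubgroup) + (⟨y, hy⟩ : I.toAddSubgroup) : I.toAddSubgroup) : 𝓞 K) =
      y - x := by
    push_cast
    ring
  rw [this]
  rfl

lemma resMk_resOut {𝔣 I : Ideal (𝓞 K)} (q : ResQ 𝔣 I) : resMk 𝔣 (resOut_mem q) = q :=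
  Quotient.out_eq q

lemma card_resQ {𝔣 I : Ideal (𝓞 K)} (hI : I ≠ ⊥) : Nat.card (ResQ 𝔣 I) = Ideal.absNorm 𝔣 := by
  have h1 : (𝔣 * I).toAddSubgroup ≤ I.toAddSubgroup := Ideal.mul_le_right
  have h2 := AddSubgroup.relIndex_mul_index h1
  have h3 : ∀ L : Ideal (𝓞 K), L.toAddSubgroup.index = Ideal.absNorm L := fun L => rfl
  rw [h3, h3, map_mul] at h2
  exact Nat.eq_of_mul_eq_mul_right (Nat.pos_of_ne_zero (by simpa [Ideal.absNorm_eq_zero_iff] using hI)) h2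

lemma finite_resQ {𝔣 I : Ideal (𝓞 K)} (h𝔣 : 𝔣 ≠ ⊥) (hI : I ≠ ⊥) : Finite (ResQ 𝔣 I) := by
  apply Nat.finite_of_card_ne_zero
  rw [card_resQ hI]
  simpa [Ideal.absNorm_eq_zero_iff] using h𝔣

/-- The sum of `h` over representatives of `I / 𝔣I`. -/
def resSum (𝔣 I : Ideal (𝓞 K)) (h : K → ℂ) : ℂ := ∑' q : ResQ 𝔣 I, h (resOut q : K)

lemma resSum_transfer {𝔣 I I' : Ideal (𝓞 K)} (h𝔣 : 𝔣 ≠ ⊥) (hI : I ≠ ⊥) (hI' : I' ≠ ⊥) (α : 𝓞 K)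
    (hα : ∀ x ∈ I, α * x ∈ I')
    (hα3 : ∀ x ∈ I, α * x ∈ 𝔣 * I' → x ∈ 𝔣 * I)
    {h h' : K → ℂ} {k : ℂ} (hh : ∀ x ∈ I, h' ((α * x : 𝓞 K) : K) = k * h (x : K))
    (hp : ∀ x ∈ I', ∀ y ∈ I', y - x ∈ 𝔣 * I' → h' (y : K) = h' (x : K)) :
    resSum 𝔣 I' h' = k * resSum 𝔣 I h := by
  have hf := finite_resQ h𝔣 hI
  have hf' := finite_resQ h𝔣 hI'
  set F : ResQ 𝔣 I → ResQ 𝔣 I' := fun q => resMk 𝔣 (hα _ (resOut_mem q)) with hF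
  have hinj : Function.Injective F := by
    intro p q hpq
    rw [hF] at hpq
    simp only [resMk_eq_iff, ← mul_sub] at hpq
    have := hα3 _ (I.sub_mem (resOut_mem q) (resOut_mem p)) hpq
    rw [← resMk_eq_iff (resOut_mem p) (resOut_mem q), resMk_resOut, resMk_resOut] at this
    exact this
  have hbij : Function.Bijective F :=
    (Nat.bijective_iff_injective_and_card F).2 ⟨hinj, by rw [card_resQ hI, card_resQ hI']⟩
  rw [resSum, resSum, ← tsum_mul_left, ← (Equiv.ofBijective F hbij).tsum_eq]
  refine tsum_congr fun q => ?_
  rw [← hh _ (resOut_mem q)]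
  refine hp _ (hα _ (resOut_mem q)) _ (resOut_mem _) ?_
  rw [← resMk_eq_iff (hα _ (resOut_mem q)) (resOut_mem _), resMk_resOut]
  rfl

lemma norm_resSum_le {𝔣 I : Ideal (𝓞 K)} (h𝔣 : 𝔣 ≠ ⊥) (hI : I ≠ ⊥) {h : K → ℂ}
    (hh : ∀ x, ‖h x‖ ≤ 1) : ‖resSum 𝔣 I h‖ ≤ Ideal.absNorm 𝔣 := by
  have hf := finite_resQ h𝔣 hI
  have := Fintype.ofFinite (ResQ 𝔣 I)
  rw [resSum, tsum_fintype]
  refine (norm_sum_le_of_le _ fun q _ => hh _).trans ?_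
  rw [Finset.sum_const, nsmul_eq_mul, mul_one, Finset.card_univ, ← Nat.card_eq_fintype_card,
    card_resQ hI]

lemma eTr_add (a b : K) : eTr (a + b) = eTr a * eTr b := by
  rw [eTr, eTr, eTr, ← Complex.exp_add, map_add]
  push_cast
  ring_nf

lemma eTr_zero : eTr (0 : K) = 1 := by simp [eTr]

lemma norm_eTr (a : K) : ‖eTr a‖ = 1 := by
  rw [eTr, show (2 * Real.pi * I * ((Algebra.trace ℚ K a : ℝ) : ℂ) : ℂ) =
    ((2 * Real.pi * (Algebra.trace ℚ K a : ℝ) : ℝ) : ℂ) * I by push_cast; ring]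
  exact Complex.norm_exp_ofReal_mul_I _

/-- A nonzero integral ideal as a unit in the group of fractional ideals. -/
def idealUnit {I : Ideal (𝓞 K)} (hI : I ≠ ⊥) : (FractionalIdeal (𝓞 K)⁰ K)ˣ :=
  Units.mk0 (I : FractionalIdeal (𝓞 K)⁰ K) (FractionalIdeal.coeIdeal_ne_zero.2 hI)

/-- The trace dual of an invertible fractional ideal. -/
def dualUnit (J : (FractionalIdeal (𝓞 K)⁰ K)ˣ) : (FractionalIdeal (𝓞 K)⁰ K)ˣ :=
  Units.mk0 (FractionalIdeal.dual ℤ ℚ (J : FractionalIdeal (𝓞 K)⁰ K))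
    (FractionalIdeal.dual_ne_zero ℤ ℚ J.ne_zero)

lemma mem_idealUnit {I : Ideal (𝓞 K)} (hI : I ≠ ⊥) {x : K} :
    x ∈ (idealUnit hI : FractionalIdeal (𝓞 K)⁰ K) ↔ ∃ α ∈ I, (α : K) = x :=
  FractionalIdeal.mem_coeIdeal _

lemma eTr_mul_eq_one {J : (FractionalIdeal (𝓞 K)⁰ K)ˣ} {β m : K}
    (hβ : β ∈ (dualUnit J : FractionalIdeal (𝓞 K)⁰ K))
    (hm : m ∈ (J : FractionalIdeal (𝓞 K)⁰ K)) : eTr (β * m) = 1 := by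
  obtain ⟨n, hn⟩ := (FractionalIdeal.mem_dual J.ne_zero).1 hβ m hm
  rw [Algebra.traceForm_apply] at hn
  rw [eTr, ← hn, Complex.exp_eq_one_iff]
  refine ⟨n, ?_⟩
  simp
  ring

variable {𝔣 : Ideal (𝓞 K)} (χ : HeckeChar K 𝔣) (S : Finset {w : InfinitePlace K // IsReal w})
variable {I : Ideal (𝓞 K)}

lemma mul_ne_bot {I J : Ideal (𝓞 K)} (hI : I ≠ ⊥) (hJ : J ≠ ⊥) : I * J ≠ ⊥ :=
  mul_ne_zero hI hJ

/-- The finite Fourier transform of `hCoef`. -/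
def hHat (h𝔣 : 𝔣 ≠ ⊥) (hI : I ≠ ⊥) (β : K) : ℂ :=
  if β ∈ (dualUnit (idealUnit (mul_ne_bot h𝔣 hI)) : FractionalIdeal (𝓞 K)⁰ K) then
    (Ideal.absNorm 𝔣 : ℂ)⁻¹ * resSum 𝔣 I (fun x => hCoef χ S I x * eTr (β * x)) else 0

lemma norm_hHat_le (h𝔣 : 𝔣 ≠ ⊥) (hI : I ≠ ⊥) (β : K) : ‖hHat χ S h𝔣 hI β‖ ≤ 1 := by
  rw [hHat]
  split_ifs
  · rw [norm_mul, norm_inv, Complex.norm_natCast]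
    have hp : (0 : ℝ) < Ideal.absNorm 𝔣 := absNorm_pos' ⟨𝔣, h𝔣⟩
    rw [inv_mul_le_iff₀ hp, mul_one]
    refine norm_resSum_le h𝔣 hI fun x => ?_
    rw [norm_mul, norm_eTr, mul_one]
    exact norm_hCoef_le χ S x
  · simp

lemma hHat_zero (h𝔣 : 𝔣 ≠ ⊥) (hI : I ≠ ⊥) : hHat χ S h𝔣 hI 0 =
    (Ideal.absNorm 𝔣 : ℂ)⁻¹ * resSum 𝔣 I (hCoef χ S I) := by
  rw [hHat, if_pos (FractionalIdeal.zero_mem _)]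
  simp [eTr_zero]

variable {χ S}

lemma hCoef_mul_eTr_periodic (hS : IsSignSet χ S) (h𝔣 : 𝔣 ≠ ⊥) (hI : I ≠ ⊥) {β : K}
    (hβ : β ∈ (dualUnit (idealUnit (mul_ne_bot h𝔣 hI)) : FractionalIdeal (𝓞 K)⁰ K))
    {x y : 𝓞 K} (hx : x ∈ I) (hxy : y - x ∈ 𝔣 * I) :
    hCoef χ S I (y : K) * eTr (β * y) = hCoef χ S I (x : K) * eTr (β * x) := by
  have h1 : ((y - x : 𝓞 K) : K) = (y : K) - x := map_sub _ _ _
  have h2 : (y : K) = x + ((y - x : 𝓞 K) : K) := by rw [h1]; ring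
  have h3 : eTr (β * ((y - x : 𝓞 K) : K)) = 1 :=
    eTr_mul_eq_one hβ ((mem_idealUnit _).2 ⟨_, hxy, rfl⟩)
  rw [hCoef_periodic hS hI hx hxy, h2, mul_add, eTr_add, h3, mul_one]

lemma hHat_unit_mul (hS : IsSignSet χ S) (h𝔣 : 𝔣 ≠ ⊥) (hI : I ≠ ⊥) (u : (𝓞 K)ˣ) (β : K) :
    hHat χ S h𝔣 hI ((u : K) * β) = sgnS S (u : K) * hHat χ S h𝔣 hI β := by
  have hu1 : ((u⁻¹ : (𝓞 K)ˣ) : K) * ((u : 𝓞 K) : K) = 1 := by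
    have : ((u⁻¹ : (𝓞 K)ˣ) : 𝓞 K) * (u : 𝓞 K) = 1 := by simp
    exact_mod_cast congrArg (algebraMap (𝓞 K) K) this
  set J := dualUnit (idealUnit (mul_ne_bot h𝔣 hI)) with hJ
  by_cases hβ : β ∈ (J : FractionalIdeal (𝓞 K)⁰ K)
  · have hβ2 : (u : K) * β ∈ (J : FractionalIdeal (𝓞 K)⁰ K) := unit_mul_mem J u hβ
    rw [hHat, hHat, if_pos hβ, if_pos hβ2]
    have h := resSum_transfer (h := fun x => hCoef χ S I x * eTr (((u : K) * β) * x))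
      (h' := fun x => hCoef χ S I x * eTr (β * x)) (k := sgnS S (u : K)) h𝔣 hI hI (u : 𝓞 K)
      (fun x hx => I.mul_mem_left _ hx) (fun x hx h => ?_) (fun x hx => ?_)
      (fun x hx y hy hxy => hCoef_mul_eTr_periodic hS h𝔣 hI hβ hx hxy)
    · rw [h]
      have := sgnS_mul_self S (β := (u : K)) (NumberField.Units.coe_ne_zero u)
      linear_combination (-(Ideal.absNorm 𝔣 : ℂ)⁻¹ *
        resSum 𝔣 I (fun x => hCoef χ S I x * eTr (((u : K) * β) * x))) * this
    · exact ((𝔣 * I).unit_mul_mem_iff_mem u.isUnit).1 h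
    · have h3 : ((((u : 𝓞 K) * x : 𝓞 K)) : K) = (u : K) * (x : K) := rfl
      simp only [h3]
      rw [hCoef_unit_mul χ S hI, mul_assoc, ← mul_assoc β, mul_comm β]
  · have hβ2 : (u : K) * β ∉ (J : FractionalIdeal (𝓞 K)⁰ K) := by
      intro h
      apply hβ
      have := unit_mul_mem J u⁻¹ h
      rwa [← mul_assoc, hu1, one_mul] at this
    rw [hHat, hHat, if_neg hβ, if_neg hβ2, mul_zero]

/-- Elements of `I` are uniquely sums of a representative and an element of `𝔣I`. -/
def resEquiv (h𝔣 : 𝔣 ≠ ⊥) (hI : I ≠ ⊥) :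
    ResQ 𝔣 I × {x : K // x ∈ (idealUnit (mul_ne_bot h𝔣 hI) : FractionalIdeal (𝓞 K)⁰ K)} ≃
      {x : K // x ∈ (idealUnit hI : FractionalIdeal (𝓞 K)⁰ K)} :=
  Equiv.ofBijective (fun p => ⟨(resOut p.1 : K) + p.2, by
      obtain ⟨m, hm, hm2⟩ := (mem_idealUnit _).1 p.2.2
      exact (mem_idealUnit hI).2 ⟨resOut p.1 + m, I.add_mem (resOut_mem _) (Ideal.mul_le_right hm), by
        rw [← hm2]; exact map_add _ _ _⟩⟩) (by
    constructor
    · rintro ⟨q, x, hx⟩ ⟨q', x', hx'⟩ h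
      obtain ⟨m, hm, rfl⟩ := (mem_idealUnit _).1 hx
      obtain ⟨m', hm', rfl⟩ := (mem_idealUnit _).1 hx'
      have h1 := congrArg Subtype.val h
      simp only at h1
      have h2 : resOut q + m = resOut q' + m' := by exact_mod_cast h1
      have h3 : q = q' := by
        rw [← resMk_resOut q, ← resMk_resOut q', resMk_eq_iff]
        have : resOut q' - resOut q = m - m' := by linear_combination -h2
        rw [this]
        exact (𝔣 * I).sub_mem hm hm'
      subst h3
      have h4 : m = m' := add_left_cancel h2
      subst h4
      rfl
    · rintro ⟨x, hx⟩
      obtain ⟨α, hα, rfl⟩ := (mem_idealUnit _).1 hx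
      have h1 : α - resOut (resMk 𝔣 hα) ∈ 𝔣 * I := by
        rw [← resMk_eq_iff (resOut_mem _) hα, resMk_resOut]
      refine ⟨⟨resMk 𝔣 hα, ⟨((α - resOut (resMk 𝔣 hα) : 𝓞 K) : K), (mem_idealUnit _).2 ⟨_, h1, rfl⟩⟩⟩, ?_⟩
      refine Subtype.ext ?_
      simp only
      rw [← map_add]
      congr 1
      ring)

lemma resEquiv_apply (h𝔣 : 𝔣 ≠ ⊥) (hI : I ≠ ⊥)
    (p : ResQ 𝔣 I × {x : K // x ∈ (idealUnit (mul_ne_bot h𝔣 hI) : FractionalIdeal (𝓞 K)⁰ K)}) :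
    (resEquiv h𝔣 hI p : K) = (resOut p.1 : K) + p.2 := rfl

end ResidueSums

section ThetaInversion

variable {𝔣 : Ideal (𝓞 K)} {χ : HeckeChar K 𝔣} {S : Finset {w : InfinitePlace K // IsReal w}}
variable {I : Ideal (𝓞 K)}

lemma span_ne_bot {α : 𝓞 K} (hα : α ≠ 0) : Ideal.span {α} ≠ (⊥ : Ideal (𝓞 K)) := by
  simpa using hα

lemma hCoef_span_mul (hI : I ≠ ⊥) {α : 𝓞 K} (hα : α ≠ 0) {x : 𝓞 K} (hx : x ∈ I) :
    hCoef χ S (Ideal.span {α} * I) ((α * x : 𝓞 K) : K) = sgnS S (α : K) * hCoef χ S I (x : K) := by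
  obtain ⟨𝔠, h𝔠⟩ := exists_quot hx
  have h1 : Ideal.span {α * x} = Ideal.span {α} * I * 𝔠 := by
    rw [← Ideal.span_singleton_mul_span_singleton, h𝔠, mul_assoc]
  have h2 : ((α * x : 𝓞 K) : K) = (α : K) * (x : K) := rfl
  rw [hCoef_eq χ S (mul_ne_bot (span_ne_bot hα) hI) h1, hCoef_eq χ S hI h𝔠, h2, sgnS_mul]
  ring

lemma hCoef_of_mul (hI : I ≠ ⊥) {𝔠 : Ideal (𝓞 K)} (h𝔠 : 𝔠 ≠ ⊥) {x : 𝓞 K} (hx : x ∈ 𝔠 * I) :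
    hCoef χ S I (x : K) = χ.toFun 𝔠 * hCoef χ S (𝔠 * I) (x : K) := by
  obtain ⟨𝔟, h𝔟⟩ := exists_quot hx
  have h1 : Ideal.span {x} = I * (𝔠 * 𝔟) := by rw [h𝔟]; ring
  rw [hCoef_eq χ S (mul_ne_bot h𝔠 hI) h𝔟, hCoef_eq χ S hI h1, χ.map_mul']
  ring

lemma resSum_span_mul (hS : IsSignSet χ S) (h𝔣 : 𝔣 ≠ ⊥) (hI : I ≠ ⊥) {α : 𝓞 K} (hα : α ≠ 0) :
    resSum 𝔣 (Ideal.span {α} * I) (hCoef χ S (Ideal.span {α} * I)) =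
      sgnS S (α : K) * resSum 𝔣 I (hCoef χ S I) := by
  have hI' := mul_ne_bot (span_ne_bot hα) hI
  refine resSum_transfer h𝔣 hI hI' α
    (fun x hx => Ideal.mul_mem_mul (Ideal.mem_span_singleton_self α) hx) (fun x hx h => ?_)
    (fun x hx => hCoef_span_mul hI hα hx) (fun x hx y _ hxy => hCoef_periodic hS hI' hx hxy)
  rw [show 𝔣 * (Ideal.span {α} * I) = Ideal.span {α} * (𝔣 * I) by ring,
    Ideal.mem_span_singleton_mul] at h
  obtain ⟨z, hz, hz2⟩ := h
  rwa [← mul_left_cancel₀ hα hz2]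

lemma resSum_mul (hS : IsSignSet χ S) (h𝔣 : 𝔣 ≠ ⊥) (hI : I ≠ ⊥) {𝔠 : Ideal (𝓞 K)} (h𝔠 : 𝔠 ≠ ⊥)
    (hc : IsCoprime 𝔠 𝔣) : resSum 𝔣 I (hCoef χ S I) =
      χ.toFun 𝔠 * resSum 𝔣 (𝔠 * I) (hCoef χ S (𝔠 * I)) := by
  refine resSum_transfer h𝔣 (mul_ne_bot h𝔠 hI) hI 1 (fun x hx => ?_) (fun x hx h => ?_)
    (fun x hx => ?_) (fun x hx y _ hxy => hCoef_periodic hS hI hx hxy)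
  · rw [one_mul]; exact Ideal.mul_le_right hx
  · rw [one_mul] at h
    obtain ⟨μ, hμ, ν, hν, hμν⟩ := Ideal.isCoprime_iff_exists.1 hc
    have hx2 : x = μ * x + ν * x := by rw [← add_mul, hμν, one_mul]
    rw [hx2]
    refine Ideal.add_mem _ ?_ (Ideal.mul_mem_mul hν hx)
    rw [show 𝔣 * (𝔠 * I) = 𝔠 * (𝔣 * I) by ring]
    exact Ideal.mul_mem_mul hμ h
  · rw [one_mul]; exact hCoef_of_mul hI h𝔠 hx

/-- An integral ideal in the given ideal class. -/
def repI (C : ClassGroup (𝓞 K)) : Ideal (𝓞 K) := (ClassGroup.mk0_surjective C).choose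

lemma repI_ne_bot (C : ClassGroup (𝓞 K)) : repI C ≠ ⊥ :=
  nonZeroDivisors.ne_zero (ClassGroup.mk0_surjective C).choose.2

lemma mk0_repI (C : ClassGroup (𝓞 K)) :
    ClassGroup.mk0 ⟨repI C, mem_nonZeroDivisors_of_ne_zero (repI_ne_bot C)⟩ = C :=
  (ClassGroup.mk0_surjective C).choose_spec

lemma resSum_congr_class (hS : IsSignSet χ S) (hS0 : S = ∅) (h𝔣 : 𝔣 ≠ ⊥) {I I' : Ideal (𝓞 K)}
    (hI : I ≠ ⊥) (hI' : I' ≠ ⊥)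
    (h : ClassGroup.mk0 ⟨I, mem_nonZeroDivisors_of_ne_zero hI⟩ =
      ClassGroup.mk0 ⟨I', mem_nonZeroDivisors_of_ne_zero hI'⟩) :
    resSum 𝔣 I (hCoef χ S I) = resSum 𝔣 I' (hCoef χ S I') := by
  obtain ⟨x, y, hx, hy, hxy⟩ := ClassGroup.mk0_eq_mk0_iff.1 h
  have h1 := resSum_span_mul hS h𝔣 hI hx
  have h2 := resSum_span_mul hS h𝔣 hI' hy
  simp only at hxy
  rw [hxy] at h1
  have hs : ∀ z : K, sgnS S z = 1 := fun z => by rw [hS0]; simp [sgnS]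
  rw [hs, one_mul] at h1 h2
  exact h1.symm.trans h2

lemma sum_resSum_eq_zero (hS : IsSignSet χ S) (hS0 : S = ∅) (h𝔣 : 𝔣 ≠ ⊥) (hχ : ¬ IsTrivialChar χ) :
    ∑ C : ClassGroup (𝓞 K), resSum 𝔣 (repI C) (hCoef χ S (repI C)) = 0 := by
  have htop : 𝔣 ≠ ⊤ := fun h => hχ fun 𝔞 _ => χ.apply_of_top h 𝔞
  rw [IsTrivialChar] at hχ
  push Not at hχ
  obtain ⟨𝔠, hc, hc1⟩ := hχ
  have h𝔠 : 𝔠 ≠ ⊥ := by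
    rintro rfl
    rw [Ideal.isCoprime_iff_sup_eq, bot_sup_eq] at hc
    exact htop hc
  set c : ClassGroup (𝓞 K) := ClassGroup.mk0 ⟨𝔠, mem_nonZeroDivisors_of_ne_zero h𝔠⟩ with hcdef
  set M : ClassGroup (𝓞 K) → ℂ := fun C => resSum 𝔣 (repI C) (hCoef χ S (repI C)) with hM
  have h1 : ∀ C, M C = χ.toFun 𝔠 * M (c * C) := by
    intro C
    simp only [hM]
    rw [resSum_mul hS h𝔣 (repI_ne_bot C) h𝔠 hc]
    congr 1
    refine resSum_congr_class hS hS0 h𝔣 (mul_ne_bot h𝔠 (repI_ne_bot C)) (repI_ne_bot _) ?_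
    rw [mk0_repI]
    conv_rhs => rw [hcdef, ← mk0_repI C]
    rw [← map_mul]
    rfl
  have h2 : ∑ C, M C = χ.toFun 𝔠 * ∑ C, M C := by
    conv_lhs => rw [Finset.sum_congr rfl fun C _ => h1 C, ← Finset.mul_sum]
    congr 1
    exact Equiv.sum_comp (Equiv.mulLeft c) M
  have h3 : (1 - χ.toFun 𝔠) * ∑ C, M C = 0 := by rw [sub_mul, one_mul, ← h2, sub_self]
  rcases mul_eq_zero.1 h3 with h | h
  · exact absurd (sub_eq_zero.1 h).symm hc1
  · exact h

lemma absNorm_idealUnit (hI : I ≠ ⊥) :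
    FractionalIdeal.absNorm (idealUnit hI : FractionalIdeal (𝓞 K)⁰ K) = Ideal.absNorm I :=
  FractionalIdeal.coeIdeal_absNorm _

lemma thetaC_inversion (hS : IsSignSet χ S) (h𝔣 : 𝔣 ≠ ⊥) (hI : I ≠ ⊥)
    (p : ℝ × (Fin (rank K) → ℝ)) :
    thetaC (idealUnit hI) S (hCoef χ S I) p = (-Complex.I) ^ S.card *
      ((Real.exp p.1 * Ideal.absNorm I * √(DK K) : ℝ) : ℂ)⁻¹ *
      thetaC (dualUnit (idealUnit (mul_ne_bot h𝔣 hI))) S (hHat χ S h𝔣 hI) (-p) := by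
  have hf := finite_resQ h𝔣 hI
  have hfi := Fintype.ofFinite (ResQ 𝔣 I)
  set J := idealUnit (mul_ne_bot h𝔣 hI) with hJ
  set g : InfinitePlace K → ℝ := fun v => Real.exp (logLin K p v) with hg
  have hg0 : ∀ v, 0 < g v := fun v => Real.exp_pos _
  have hginv : (fun v => (g v)⁻¹) = fun v => Real.exp (logLin K (-p) v) := by
    ext v
    rw [hg, map_neg, Pi.neg_apply, Real.exp_neg]
  have hsc : scNorm g = Real.exp p.1 := by
    rw [hg, scNorm_exp, sum_mult_logLin]
  have hN : (FractionalIdeal.absNorm J.1 : ℝ) = Ideal.absNorm 𝔣 * Ideal.absNorm I := by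
    rw [hJ, absNorm_idealUnit, map_mul]; push_cast; rfl
  have hNf : (Ideal.absNorm 𝔣 : ℂ) ≠ 0 := by
    have := absNorm_pos' ⟨𝔣, h𝔣⟩
    exact_mod_cast this.ne'
  have hsum : Summable fun x : {x : K // x ∈ (idealUnit hI : FractionalIdeal (𝓞 K)⁰ K)} =>
      hCoef χ S I x * testF S g (mixedEmbedding K x) :=
    summable_theta (idealUnit hI) S (norm_hCoef_le χ S) (logLin K p)
  have hsum2 := (resEquiv h𝔣 hI).summable_iff.2 hsum
  have h1 : thetaC (idealUnit hI) S (hCoef χ S I) p = ∑ q : ResQ 𝔣 I, hCoef χ S I (resOut q : K) *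
      ∑' m : {x : K // x ∈ (J : FractionalIdeal (𝓞 K)⁰ K)},
        testF S g (mixedEmbedding K ((resOut q : K) + m)) := by
    rw [thetaC, ← (resEquiv h𝔣 hI).tsum_eq]
    refine (Summable.tsum_prod hsum2).trans ?_
    rw [tsum_fintype]
    refine Finset.sum_congr rfl fun q _ => ?_
    rw [← tsum_mul_left]
    refine tsum_congr fun m => ?_
    rw [Function.comp_apply, resEquiv_apply]
    congr 1
    obtain ⟨α, hα, hα2⟩ := (mem_idealUnit _).1 m.2
    have h2 : ((resOut q : K) + m) = ((resOut q + α : 𝓞 K) : K) := by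
      rw [← hα2]; exact (map_add _ _ _).symm
    simp only
    rw [h2]
    refine hCoef_periodic hS hI (resOut_mem q) ?_
    rw [add_sub_cancel_left]
    exact hα
  have h3 := hasSum_sum (s := (Finset.univ : Finset (ResQ 𝔣 I))) fun q _ =>
    (poisson_ideal J S hg0 (resOut q : K)).mul_left (hCoef χ S I (resOut q : K))
  rw [h1, ← h3.tsum_eq, thetaC, ← tsum_mul_left]
  refine tsum_congr fun β => ?_
  have hβ : (β : K) ∈ (dualUnit J : FractionalIdeal (𝓞 K)⁰ K) := β.2
  rw [hHat, if_pos hβ, resSum, tsum_fintype, hginv, hsc, hN, Finset.mul_sum, Finset.sum_mul,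
    Finset.mul_sum]
  refine Finset.sum_congr rfl fun q _ => ?_
  push_cast
  rw [mul_inv, mul_inv, mul_inv, mul_inv, mul_inv]
  ring

end ThetaInversion

section MellinAvg

variable (J : (FractionalIdeal (𝓞 K)⁰ K)ˣ) (S : Finset {w : InfinitePlace K // IsReal w})
variable {c : K → ℂ} (e : ℤˣ)

lemma mellinConvergent_of_exp {f : ℝ → ℂ} {s : ℂ}
    (h : Integrable fun t : ℝ => cexp (s * t) * f (Real.exp t)) : MellinConvergent f s := by
  have h1 := integrableOn_image_iff_integrableOn_abs_deriv_smul (s := Set.univ) MeasurableSet.univ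
    (f := fun l : ℝ => Real.exp l) (f' := fun l => Real.exp l)
    (fun x _ => (Real.hasDerivAt_exp x).hasDerivWithinAt)
    (Real.exp_injective.injOn) (fun x : ℝ => (x : ℂ) ^ (s - 1) • f x)
  rw [Set.image_univ, Real.range_exp, integrableOn_univ] at h1
  refine h1.2 (h.congr (Eventually.of_forall fun t => ?_))
  simp only [smul_eq_mul, real_smul, abs_of_pos (Real.exp_pos t)]
  have h0 : (Real.exp t : ℂ) ≠ 0 := by exact_mod_cast (Real.exp_pos t).ne'
  have h1 : (Real.exp t : ℂ) ^ s = cexp (s * t) := by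
    rw [Complex.cpow_def_of_ne_zero h0, ← Complex.ofReal_log (Real.exp_pos t).le, Real.log_exp]
    rw [mul_comm]
  rw [Complex.cpow_sub _ _ h0, Complex.cpow_one, h1]
  field_simp

lemma mellinConvergent_avgTheta {s : ℂ}
    (h : IntegrableOn (fun p => cexp (s * (p.1 : ℂ)) * thetaC J S c (flip2 e p)) (strip _)) :
    MellinConvergent (avgTheta J S c e) s := by
  apply mellinConvergent_of_exp
  rw [strip, Measure.volume_eq_prod, IntegrableOn, ← Measure.prod_restrict,
    Measure.restrict_univ] at h
  refine h.integral_prod_left.congr (Eventually.of_forall fun t => ?_)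
  simp only [avgTheta, Real.log_exp]
  exact integral_const_mul _ _

lemma hasMellin_avgTheta (hc : ∀ x, ‖c x‖ ≤ 1) (hc0 : c 0 = 0)
    (hcu : ∀ (u : (𝓞 K)ˣ) (β : K), c (u * β) = sgnS S (u : K) * c β) {s : ℂ} (hs : 1 < s.re)
    {a : ℝ} (ha : 0 < a) :
    HasMellin (fun y => avgTheta J S c e (a * y)) s ((Nat.card (torsion K) : ℂ) * gamS S s *
      ((a * FractionalIdeal.absNorm J.1 : ℝ) : ℂ) ^ (-s) *
      ∑' i : PrincIdx J, c (idxGen J i) * sgnS S (idxGen J i) *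
        (Ideal.absNorm i.1.1 : ℂ) ^ (-s)) := by
  obtain ⟨h1, h2⟩ := mellin_theta J S hc hc0 hcu e (idxGen_ne_zero J) (idxGen_mem J) (exists_idx J)
    (idx_inj J) (by linarith) (summable_idx J hs)
  refine ⟨(MellinConvergent.comp_mul_left ha).2 (mellinConvergent_avgTheta J S e h1), ?_⟩
  rw [mellin_comp_mul_left _ _ ha, mellin_avgTheta J S e h1, ← h2.tsum_eq, ← tsum_mul_left,
    smul_eq_mul, ← tsum_mul_left]
  refine tsum_congr fun i => ?_
  rw [exp_log_norm_idxGen, Complex.ofReal_mul, Complex.mul_cpow_ofReal_nonneg ha.le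
    (by exact_mod_cast (absNorm_unit_pos J).le)]
  ring

lemma princ_iff (𝔟 : NzI K) : (∃ β : K, FractionalIdeal.spanSingleton (𝓞 K)⁰ β =
      (J : FractionalIdeal (𝓞 K)⁰ K) * (𝔟.1 : FractionalIdeal (𝓞 K)⁰ K)) ↔
    ClassGroup.mk (K := K) (J * idealUnit 𝔟.2) = 1 := by
  rw [ClassGroup.mk_eq_one_iff, Submodule.isPrincipal_iff]
  have h : ∀ β : K, FractionalIdeal.spanSingleton (𝓞 K)⁰ β =
      (J : FractionalIdeal (𝓞 K)⁰ K) * (𝔟.1 : FractionalIdeal (𝓞 K)⁰ K) ↔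
      (((J * idealUnit 𝔟.2 : (FractionalIdeal (𝓞 K)⁰ K)ˣ) : FractionalIdeal (𝓞 K)⁰ K) :
        Submodule (𝓞 K) K) = Submodule.span (𝓞 K) {β} := by
    intro β
    rw [eq_comm, ← FractionalIdeal.coeToSubmodule_inj, FractionalIdeal.coe_spanSingleton]
    rfl
  exact exists_congr h

lemma sum_tsum_princIdx {J : ClassGroup (𝓞 K) → (FractionalIdeal (𝓞 K)⁰ K)ˣ}
    (hJ : Function.Bijective fun C => ClassGroup.mk (K := K) (J C)) {h : NzI K → ℂ}
    (hh : Summable h) : ∑ C, ∑' i : PrincIdx (J C), h i.1 = ∑' 𝔟, h 𝔟 := by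
  have hb : Function.Bijective fun p : (Σ C, PrincIdx (J C)) => p.2.1 := by
    constructor
    · rintro ⟨C, i⟩ ⟨C', i'⟩ hi
      simp only at hi
      have h1 := (princ_iff (J C) i.1).1 i.2
      have h2 := (princ_iff (J C') i'.1).1 i'.2
      rw [map_mul] at h1 h2
      have h3 : idealUnit i.1.2 = idealUnit (I := i'.1.1) i'.1.2 := by
        apply Units.ext
        change ((i.1.1 : Ideal (𝓞 K)) : FractionalIdeal (𝓞 K)⁰ K) = (i'.1.1 : Ideal (𝓞 K))
        rw [hi]
      rw [h3, ← h2] at h1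
      obtain rfl := hJ.1 (mul_right_cancel h1)
      exact congrArg (Sigma.mk C) (Subtype.ext hi)
    · intro 𝔟
      obtain ⟨C, hC⟩ := hJ.2 (ClassGroup.mk (K := K) (idealUnit 𝔟.2))⁻¹
      refine ⟨⟨C, 𝔟, (princ_iff _ _).2 ?_⟩, rfl⟩
      simp only at hC
      rw [map_mul, hC, inv_mul_cancel]
  have h1 := (Equiv.ofBijective _ hb).tsum_eq h
  have h2 : Summable fun p : (Σ C, PrincIdx (J C)) => h p.2.1 :=
    (Equiv.ofBijective _ hb).summable_iff.2 hh
  rw [← h1]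
  refine ((Summable.tsum_sigma h2).trans ?_).symm
  rw [tsum_fintype]

lemma mk_idealUnit_repI (C : ClassGroup (𝓞 K)) :
    ClassGroup.mk (K := K) (idealUnit (repI_ne_bot C)) = C := by
  conv_rhs => rw [← mk0_repI C, ← ClassGroup.mk_mk0 K]
  rfl

lemma bijective_mk_dual {𝔣 : Ideal (𝓞 K)} (h𝔣 : 𝔣 ≠ ⊥) : Function.Bijective fun C =>
    ClassGroup.mk (K := K) (dualUnit (idealUnit (mul_ne_bot h𝔣 (repI_ne_bot C)))) := by
  have h : ∀ C, ClassGroup.mk (K := K) (dualUnit (idealUnit (mul_ne_bot h𝔣 (repI_ne_bot C)))) =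
      ClassGroup.mk (K := K) (dualUnit 1) * (ClassGroup.mk (K := K) (idealUnit h𝔣))⁻¹ * C⁻¹ := by
    intro C
    conv_rhs => rw [← mk_idealUnit_repI C]
    rw [← map_inv, ← map_inv, ← map_mul, ← map_mul]
    congr 1
    apply Units.ext
    rw [mul_assoc, ← mul_inv]
    have h1 : idealUnit h𝔣 * idealUnit (repI_ne_bot C) =
        idealUnit (mul_ne_bot h𝔣 (repI_ne_bot C)) := by
      apply Units.ext
      exact (FractionalIdeal.coeIdeal_mul _ _).symm
    rw [h1, Units.val_mul, Units.val_inv_eq_inv_val]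
    exact FractionalIdeal.dual_eq_mul_inv ℤ ℚ _
  simp only [h]
  exact (Equiv.mulLeft (ClassGroup.mk (K := K) (dualUnit 1) *
    (ClassGroup.mk (K := K) (idealUnit h𝔣))⁻¹)).bijective.comp
    (Equiv.inv (ClassGroup (𝓞 K))).bijective

lemma absNorm_dualUnit {𝔣 I : Ideal (𝓞 K)} (h𝔣 : 𝔣 ≠ ⊥) (hI : I ≠ ⊥) :
    (FractionalIdeal.absNorm (dualUnit (idealUnit (mul_ne_bot h𝔣 hI))).1 : ℝ) =
      (Ideal.absNorm 𝔣 * Ideal.absNorm I * DK K : ℝ)⁻¹ := by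
  have h1 : (dualUnit (idealUnit (mul_ne_bot h𝔣 hI))).1 =
      ((differentIdeal ℤ (𝓞 K) : Ideal (𝓞 K)) : FractionalIdeal (𝓞 K)⁰ K)⁻¹ *
        ((𝔣 * I : Ideal (𝓞 K)) : FractionalIdeal (𝓞 K)⁰ K)⁻¹ := by
    have h2 := FractionalIdeal.dual_eq_mul_inv ℤ ℚ
      ((𝔣 * I : Ideal (𝓞 K)) : FractionalIdeal (𝓞 K)⁰ K)
    rw [coeIdeal_differentIdeal (A := ℤ) (K := ℚ) (L := K), inv_inv]
    exact h2
  rw [h1, map_mul, map_inv₀, map_inv₀, FractionalIdeal.coeIdeal_absNorm,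
    FractionalIdeal.coeIdeal_absNorm, NumberField.absNorm_differentIdeal (K := K), map_mul, DK]
  push_cast
  rw [mul_inv, mul_inv, mul_inv]
  ring

end MellinAvg

section HeckeLambda

variable {𝔣 : Ideal (𝓞 K)} {χ : HeckeChar K 𝔣} {S : Finset {w : InfinitePlace K // IsReal w}}

/-- The absolute norm of the chosen representative of an ideal class. -/
def repN (C : ClassGroup (𝓞 K)) : ℝ := Ideal.absNorm (repI C)

lemma repN_pos (C : ClassGroup (𝓞 K)) : 0 < repN C := absNorm_pos' ⟨repI C, repI_ne_bot C⟩

lemma avgTheta_inversion (hS : IsSignSet χ S) (h𝔣 : 𝔣 ≠ ⊥) (C : ClassGroup (𝓞 K)) {x : ℝ}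
    (hx : 0 < x) : avgTheta (idealUnit (repI_ne_bot C)) S (hCoef χ S (repI C)) 1
      ((repN C)⁻¹ * (1 / x)) = (-Complex.I) ^ S.card * ((√(DK K) : ℝ) : ℂ)⁻¹ * x *
    avgTheta (dualUnit (idealUnit (mul_ne_bot h𝔣 (repI_ne_bot C)))) S
      (hHat χ S h𝔣 (repI_ne_bot C)) (-1) (repN C * x) := by
  have hN := repN_pos C
  rw [avgTheta, avgTheta, ← integral_const_mul]
  refine integral_congr_ae (Eventually.of_forall fun u => ?_)
  simp only
  rw [thetaC_inversion hS h𝔣 (repI_ne_bot C)]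
  have h1 : -flip2 1 (Real.log ((repN C)⁻¹ * (1 / x)), u) =
      flip2 (-1) (Real.log (repN C * x), u) := by
    have h2 : (repN C)⁻¹ * (1 / x) = (repN C * x)⁻¹ := by rw [mul_inv, one_div]
    rw [h2]
    ext1
    · rw [flip2, flip2, Prod.fst_neg, Real.log_inv, neg_neg]
    · simp [flip2]
  rw [h1]
  rw [mul_assoc _ _ (x : ℂ)]
  congr 1
  have h3 : Real.exp (flip2 (1 : ℤˣ) (Real.log ((repN C)⁻¹ * (1 / x)), u)).1 =
      (repN C)⁻¹ * (1 / x) := by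
    rw [flip2]; exact Real.exp_log (by positivity)
  rw [h3]
  congr 1
  rw [← Complex.ofReal_inv, ← Complex.ofReal_inv, ← Complex.ofReal_mul]
  congr 1
  change ((repN C)⁻¹ * (1 / x) * repN C * √(DK K))⁻¹ = _
  field_simp

variable (χ S) in
/-- The completed theta function of a Hecke character. -/
def heckeTheta (y : ℝ) : ℂ := ∑ C : ClassGroup (𝓞 K),
  avgTheta (idealUnit (repI_ne_bot C)) S (hCoef χ S (repI C)) 1 ((repN C)⁻¹ * y)

variable (χ S) in
/-- The theta function dual to `heckeTheta`. -/
def heckeThetaDual (h𝔣 : 𝔣 ≠ ⊥) (y : ℝ) : ℂ := ∑ C : ClassGroup (𝓞 K),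
  avgTheta (dualUnit (idealUnit (mul_ne_bot h𝔣 (repI_ne_bot C)))) S
    (hHat χ S h𝔣 (repI_ne_bot C)) (-1) (repN C * y)

lemma locallyIntegrableOn_sum_avgTheta (J : ClassGroup (𝓞 K) → (FractionalIdeal (𝓞 K)⁰ K)ˣ)
    {c : ClassGroup (𝓞 K) → K → ℂ} (hc : ∀ C x, ‖c C x‖ ≤ 1) (e : ℤˣ)
    {a : ClassGroup (𝓞 K) → ℝ} (ha : ∀ C, 0 < a C) :
    LocallyIntegrableOn (fun y => ∑ C, avgTheta (J C) S (c C) e (a C * y)) (Set.Ioi 0) := by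
  refine ContinuousOn.locallyIntegrableOn ?_ measurableSet_Ioi
  refine continuousOn_finsetSum _ fun C _ => ?_
  refine (continuousOn_avgTheta (J C) S e (hc C)).comp (by fun_prop) fun y hy => ?_
  exact mul_pos (ha C) hy

lemma sum_avgTheta_isBigO (J : ClassGroup (𝓞 K) → (FractionalIdeal (𝓞 K)⁰ K)ˣ)
    {c : ClassGroup (𝓞 K) → K → ℂ} (hc : ∀ C x, ‖c C x‖ ≤ 1) (e : ℤˣ)
    {a : ClassGroup (𝓞 K) → ℝ} (ha : ∀ C, 0 < a C) (r : ℝ) :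
    (fun y => ∑ C, avgTheta (J C) S (c C) e (a C * y) -
      ∑ C, c C 0 * (if S = ∅ then 1 else 0)) =O[atTop] fun y => y ^ r := by
  simp_rw [← Finset.sum_sub_distrib]
  refine Asymptotics.IsBigO.fun_sum fun C _ => ?_
  have h1 : (fun y => avgTheta (J C) S (c C) e (a C * y) - c C 0 * (if S = ∅ then 1 else 0)) =
      fun y => avgTheta (J C) S (Function.update (c C) 0 0) e (a C * y) := by
    ext y
    rw [avgTheta_eq_add (J C) S e (hc C)]
    ring
  rw [h1]
  have h2 := (avgTheta_isBigO (J C) S e (c := Function.update (c C) 0 0) (fun x => by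
    rw [Function.update_apply]
    split_ifs
    · simp
    · exact hc C x) (by simp) r).comp_tendsto (tendsto_id.const_mul_atTop (ha C))
  refine h2.trans ?_
  refine Asymptotics.IsBigO.of_bound (a C ^ r) ?_
  filter_upwards [eventually_gt_atTop 0] with y hy
  simp only [Function.comp_apply, id_eq]
  rw [Real.mul_rpow (ha C).le hy.le, norm_mul, Real.norm_of_nonneg (Real.rpow_nonneg (ha C).le _)]

lemma sqrt_DK_pos : 0 < √(DK K : ℝ) := by
  rw [Real.sqrt_pos]
  exact_mod_cast Int.natAbs_pos.2 (NumberField.discr_ne_zero K)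

/-- The functional equation of the Hecke theta function. -/
def heckePair (hS : IsSignSet χ S) (h𝔣 : 𝔣 ≠ ⊥) : WeakFEPair ℂ where
  f := heckeTheta χ S
  g := heckeThetaDual χ S h𝔣
  k := 1
  ε := (-Complex.I) ^ S.card * ((√(DK K) : ℝ) : ℂ)⁻¹
  f₀ := ∑ C : ClassGroup (𝓞 K), hCoef χ S (repI C) 0 * (if S = ∅ then 1 else 0)
  g₀ := ∑ C : ClassGroup (𝓞 K), hHat χ S h𝔣 (repI_ne_bot C) 0 * (if S = ∅ then 1 else 0)
  hf_int := locallyIntegrableOn_sum_avgTheta _ (fun _ => norm_hCoef_le χ S) 1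
    fun C => inv_pos.2 (repN_pos C)
  hg_int := locallyIntegrableOn_sum_avgTheta _ (fun C => norm_hHat_le χ S h𝔣 (repI_ne_bot C)) (-1)
    fun C => repN_pos C
  hk := one_pos
  hε := mul_ne_zero (pow_ne_zero _ (neg_ne_zero.2 Complex.I_ne_zero))
    (inv_ne_zero (by exact_mod_cast (sqrt_DK_pos (K := K)).ne'))
  h_feq := by
    intro x hx
    rw [heckeTheta, heckeThetaDual, smul_eq_mul, Finset.mul_sum]
    refine Finset.sum_congr rfl fun C _ => ?_
    rw [avgTheta_inversion hS h𝔣 C hx, Real.rpow_one]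
  hf_top r := sum_avgTheta_isBigO _ (fun _ => norm_hCoef_le χ S) 1
    (fun C => inv_pos.2 (repN_pos C)) r
  hg_top r := sum_avgTheta_isBigO _ (fun C => norm_hHat_le χ S h𝔣 (repI_ne_bot C)) (-1)
    (fun C => repN_pos C) r

lemma hasMellin_sum_avgTheta (J : ClassGroup (𝓞 K) → (FractionalIdeal (𝓞 K)⁰ K)ˣ)
    {c : ClassGroup (𝓞 K) → K → ℂ} (hc : ∀ C x, ‖c C x‖ ≤ 1) (e : ℤˣ)
    (hcu : ∀ C (u : (𝓞 K)ˣ) (β : K), c C (u * β) = sgnS S (u : K) * c C β)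
    {a : ClassGroup (𝓞 K) → ℝ} (ha : ∀ C, 0 < a C) {s : ℂ} (hs : 1 < s.re) {b : ℝ}
    (hb : ∀ C, a C * FractionalIdeal.absNorm (J C).1 = b) :
    mellin (fun y => ∑ C, avgTheta (J C) S (c C) e (a C * y) -
      ∑ C, c C 0 * (if S = ∅ then 1 else 0)) s =
    (Nat.card (torsion K) : ℂ) * gamS S s * (b : ℂ) ^ (-s) *
      ∑ C, ∑' i : PrincIdx (J C), c C (idxGen (J C) i) * sgnS S (idxGen (J C) i) *
        (Ideal.absNorm i.1.1 : ℂ) ^ (-s) := by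
  have h1 : (fun y => ∑ C, avgTheta (J C) S (c C) e (a C * y) -
      ∑ C, c C 0 * (if S = ∅ then 1 else 0)) =
      fun y => ∑ C, avgTheta (J C) S (Function.update (c C) 0 0) e (a C * y) := by
    ext y
    rw [← Finset.sum_sub_distrib]
    refine Finset.sum_congr rfl fun C _ => ?_
    rw [avgTheta_eq_add (J C) S e (hc C)]
    ring
  have h2 : ∀ C, HasMellin (fun y => avgTheta (J C) S (Function.update (c C) 0 0) e (a C * y)) s
      ((Nat.card (torsion K) : ℂ) * gamS S s * (b : ℂ) ^ (-s) *
        ∑' i : PrincIdx (J C), c C (idxGen (J C) i) * sgnS S (idxGen (J C) i) *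
          (Ideal.absNorm i.1.1 : ℂ) ^ (-s)) := by
    intro C
    have h3 := hasMellin_avgTheta (J C) S e (c := Function.update (c C) 0 0) (fun x => by
      rw [Function.update_apply]
      split_ifs
      · simp
      · exact hc C x) (by simp) (fun u β => by
        rw [Function.update_apply, Function.update_apply]
        by_cases h0 : β = 0
        · simp [h0]
        · rw [if_neg h0, if_neg (mul_ne_zero (NumberField.Units.coe_ne_zero u) h0), hcu]) hs (ha C)
    rw [hb C] at h3
    convert h3 using 6 with i
    rw [Function.update_of_ne (idxGen_ne_zero (J C) i)]
  rw [h1, Finset.mul_sum, mellin]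
  simp_rw [Finset.smul_sum]
  rw [integral_finsetSum _ fun C _ => (h2 C).1]
  exact Finset.sum_congr rfl fun C _ => (h2 C).2

lemma hCoef_idxGen (χ : HeckeChar K 𝔣) (S) {I : Ideal (𝓞 K)} (hI : I ≠ ⊥)
    (i : PrincIdx (idealUnit (K := K) hI)) :
    hCoef χ S I (idxGen _ i) * sgnS S (idxGen _ i) = χ.toFun i.1.1 := by
  obtain ⟨α, hα, h⟩ := (mem_idealUnit hI).1 (idxGen_mem _ i)
  have h1 := idxGen_spec _ i
  have h0 := idxGen_ne_zero _ i
  have h2 : Ideal.span {α} = I * i.1.1 := by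
    apply FractionalIdeal.coeIdeal_injective (K := K)
    simp only
    rw [FractionalIdeal.coeIdeal_span_singleton, FractionalIdeal.coeIdeal_mul]
    rw [← h] at h1
    exact h1
  rw [← h, hCoef_eq χ S hI h2, mul_assoc, sgnS_mul_self S (by rw [h]; exact h0), mul_one]

lemma heckePair_Λ (hS : IsSignSet χ S) (h𝔣 : 𝔣 ≠ ⊥) {s : ℂ} (hs : 1 < s.re) :
    (heckePair hS h𝔣).Λ s = (Nat.card (torsion K) : ℂ) * gamS S s * LSer χ s := by
  rw [← ((heckePair hS h𝔣).hasMellin (s := s) hs).2]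
  have h1 := hasMellin_sum_avgTheta (S := S) (fun C : ClassGroup (𝓞 K) => idealUnit (repI_ne_bot C))
    (c := fun C => hCoef χ S (repI C)) (fun _ => norm_hCoef_le χ S) 1
    (fun C => hCoef_unit_mul χ S (repI_ne_bot C)) (a := fun C => (repN C)⁻¹)
    (fun C => inv_pos.2 (repN_pos C)) hs (b := 1) (fun C => by
      rw [absNorm_idealUnit]
      exact inv_mul_cancel₀ (repN_pos C).ne')
  refine h1.trans ?_
  rw [Complex.ofReal_one, Complex.one_cpow, mul_one]
  congr 1
  have h2 := sum_tsum_princIdx (K := K) (J := fun C => idealUnit (repI_ne_bot C)) (by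
    simp only [mk_idealUnit_repI]; exact Function.bijective_id) (summable_LSer χ hs)
  rw [LSer, ← h2]
  refine Finset.sum_congr rfl fun C _ => tsum_congr fun i => ?_
  rw [hCoef_idxGen]

lemma norm_heckePair_symm_Λ_le (hS : IsSignSet χ S) (h𝔣 : 𝔣 ≠ ⊥) {s : ℂ} (hs : 1 < s.re) :
    ‖(heckePair hS h𝔣).symm.Λ s‖ ≤ Nat.card (torsion K) * ‖gamS S s‖ *
      (Ideal.absNorm 𝔣 * DK K : ℝ) ^ s.re * zetaR K s.re := by
  rw [← ((heckePair hS h𝔣).symm.hasMellin (s := s) hs).2]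
  have hNf := absNorm_pos' ⟨𝔣, h𝔣⟩
  have hD : (0 : ℝ) < DK K := Real.sqrt_pos.1 sqrt_DK_pos
  set J := fun C : ClassGroup (𝓞 K) => dualUnit (idealUnit (mul_ne_bot h𝔣 (repI_ne_bot C))) with hJ
  have h1 := hasMellin_sum_avgTheta (S := S) J
    (c := fun C => hHat χ S h𝔣 (repI_ne_bot C)) (fun C => norm_hHat_le χ S h𝔣 (repI_ne_bot C)) (-1)
    (fun C => hHat_unit_mul hS h𝔣 (repI_ne_bot C)) (a := fun C => repN C)
    (fun C => repN_pos C) hs (b := (Ideal.absNorm 𝔣 * DK K : ℝ)⁻¹) (fun C => by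
      have := (repN_pos C).ne'
      have h9 := absNorm_dualUnit h𝔣 (repI_ne_bot C)
      rw [hJ]
      simp only
      rw [h9, ← repN]
      field_simp)
  refine (congrArg norm h1).trans_le ?_
  rw [norm_mul, norm_mul, norm_mul, Complex.norm_natCast, Complex.norm_cpow_eq_rpow_re_of_pos
    (by positivity), Complex.neg_re, Real.inv_rpow (by positivity), Real.rpow_neg (by positivity),
    inv_inv]
  gcongr
  have hsum : Summable fun 𝔟 : NzI K => (((Ideal.absNorm 𝔟.1 : ℝ) ^ (-s.re) : ℝ) : ℂ) :=
    (Complex.hasSum_ofReal.2 (summable_absNorm K hs).hasSum).summable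
  have h2 := sum_tsum_princIdx (K := K) (J := J) (bijective_mk_dual h𝔣) hsum
  have h3 : (∑ C, ∑' i : PrincIdx (J C), (Ideal.absNorm i.1.1 : ℝ) ^ (-s.re)) = zetaR K s.re := by
    rw [zetaR]
    rw [← Complex.ofReal_inj, Complex.ofReal_tsum, ← h2]
    push_cast
    rfl
  rw [← h3]
  refine (norm_sum_le _ _).trans (Finset.sum_le_sum fun C _ => ?_)
  have h4 : Summable fun i : PrincIdx (J C) => (Ideal.absNorm i.1.1 : ℝ) ^ (-s.re) :=
    (summable_absNorm K hs).comp_injective Subtype.val_injective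
  refine tsum_of_norm_bounded h4.hasSum fun i => ?_
  rw [norm_mul, norm_mul, norm_absNorm_cpow]
  have h5 := norm_hHat_le χ S h𝔣 (repI_ne_bot C) (idxGen _ i)
  have h6 := norm_sgnS_le S (idxGen _ i)
  have h7 : ‖hHat χ S h𝔣 (repI_ne_bot C) (idxGen _ i)‖ * ‖sgnS S (idxGen _ i)‖ ≤ 1 :=
    mul_le_one₀ h5 (norm_nonneg _) h6
  refine mul_le_of_le_one_left (by positivity) h7

lemma heckePair_residues_eq_zero (hS : IsSignSet χ S) (h𝔣 : 𝔣 ≠ ⊥) (hχ : ¬ IsTrivialChar χ) :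
    (heckePair hS h𝔣).f₀ = 0 ∧ (heckePair hS h𝔣).g₀ = 0 := by
  have h𝔣' : 𝔣 ≠ ⊤ := fun h => hχ fun 𝔞 _ => χ.apply_of_top h 𝔞
  constructor
  · refine Finset.sum_eq_zero fun C _ => ?_
    rw [hCoef_zero h𝔣' (repI_ne_bot C), zero_mul]
  · change ∑ C : ClassGroup (𝓞 K), hHat χ S h𝔣 (repI_ne_bot C) 0 * (if S = ∅ then 1 else 0) = 0
    rw [← Finset.sum_mul]
    by_cases hS0 : S = ∅
    · simp_rw [hHat_zero, ← Finset.mul_sum]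
      rw [sum_resSum_eq_zero hS hS0 h𝔣 hχ]
      simp
    · rw [if_neg hS0, mul_zero]

lemma heckePair_differentiable (hS : IsSignSet χ S) (h𝔣 : 𝔣 ≠ ⊥) (hχ : ¬ IsTrivialChar χ) :
    Differentiable ℂ (heckePair hS h𝔣).Λ := fun _ =>
  (heckePair hS h𝔣).differentiableAt_Λ (Or.inr (heckePair_residues_eq_zero hS h𝔣 hχ).1)
    (Or.inr (heckePair_residues_eq_zero hS h𝔣 hχ).2)

lemma norm_heckePair_Λ_left_le (hS : IsSignSet χ S) (h𝔣 : 𝔣 ≠ ⊥) {s : ℂ} (hs : 1 < s.re) :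
    ‖(heckePair hS h𝔣).Λ (1 - s)‖ ≤ Nat.card (torsion K) * ‖gamS S s‖ *
      ((√(DK K))⁻¹ * (Ideal.absNorm 𝔣 * DK K : ℝ) ^ s.re) * zetaR K s.re := by
  have h := (heckePair hS h𝔣).functional_equation s
  have h1 : ((heckePair hS h𝔣).k : ℂ) = 1 := by
    change ((1 : ℝ) : ℂ) = 1
    simp
  have h2 : ‖(heckePair hS h𝔣).ε‖ = (√(DK K))⁻¹ := by
    change ‖(-Complex.I) ^ S.card * ((√(DK K) : ℝ) : ℂ)⁻¹‖ = _
    simp [abs_of_pos (sqrt_DK_pos (K := K))]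
  rw [h1] at h
  rw [h, _root_.norm_smul, h2]
  have h3 := norm_heckePair_symm_Λ_le hS h𝔣 hs
  calc _ ≤ (√(DK K))⁻¹ * (Nat.card (torsion K) * ‖gamS S s‖ *
      (Ideal.absNorm 𝔣 * DK K : ℝ) ^ s.re * zetaR K s.re) := by gcongr
    _ = _ := by ring

/-- `Λ` is bounded on vertical strips away from the real axis. -/
lemma exists_heckePair_Λ_le (hS : IsSignSet χ S) (h𝔣 : 𝔣 ≠ ⊥) (a b : ℝ) :
    ∃ B, ∀ s : ℂ, a ≤ s.re → s.re ≤ b → 1 ≤ |s.im| → ‖(heckePair hS h𝔣).Λ s‖ ≤ B := by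
  set P := heckePair hS h𝔣 with hP
  have hconv : ∀ s, MellinConvergent P.f_modif s := fun s =>
    (P.isStrongFEPair_toStrongFEPair.hasMellin s).1
  refine ⟨(∫ t in Set.Ioi (0 : ℝ), (‖(t : ℂ) ^ ((a : ℂ) - 1) • P.f_modif t‖ +
    ‖(t : ℂ) ^ ((b : ℂ) - 1) • P.f_modif t‖)) + ‖P.f₀‖ + ‖P.ε * P.g₀‖, fun s ha hb him => ?_⟩
  have h0 : P.Λ s = P.Λ₀ s - (1 / s) • P.f₀ - (P.ε / (P.k - s)) • P.g₀ := rfl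
  have h1 : ‖P.Λ₀ s‖ ≤ ∫ t in Set.Ioi (0 : ℝ), (‖(t : ℂ) ^ ((a : ℂ) - 1) • P.f_modif t‖ +
    ‖(t : ℂ) ^ ((b : ℂ) - 1) • P.f_modif t‖) := by
    refine (norm_integral_le_integral_norm _).trans ?_
    refine setIntegral_mono_on (hconv s).norm ((hconv a).norm.add (hconv b).norm) measurableSet_Ioi
      fun t ht => ?_
    have ht : 0 < t := ht
    simp only [_root_.norm_smul, Complex.norm_cpow_eq_rpow_re_of_pos ht, sub_re, ofReal_re, one_re]
    rw [← add_mul]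
    gcongr
    rcases le_total t 1 with h | h
    · exact (Real.rpow_le_rpow_of_exponent_ge ht h (by linarith)).trans
        (le_add_of_nonneg_right (by positivity))
    · exact (Real.rpow_le_rpow_of_exponent_le h (by linarith)).trans
        (le_add_of_nonneg_left (by positivity))
  have h2 : ‖(1 / s) • P.f₀‖ ≤ ‖P.f₀‖ := by
    rw [_root_.norm_smul, norm_div, norm_one]
    refine mul_le_of_le_one_left (norm_nonneg _) ?_
    rw [div_le_one (by linarith [Complex.abs_im_le_norm s])]
    exact him.trans (Complex.abs_im_le_norm s)
  have h3 : ‖(P.ε / (P.k - s)) • P.g₀‖ ≤ ‖P.ε * P.g₀‖ := by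
    have h4 : 1 ≤ ‖(P.k : ℂ) - s‖ := by
      have := Complex.abs_im_le_norm ((P.k : ℂ) - s)
      simp only [sub_im, ofReal_im, zero_sub, abs_neg] at this
      linarith
    rw [_root_.norm_smul, norm_div, norm_mul]
    refine mul_le_mul_of_nonneg_right (div_le_self (norm_nonneg _) h4) (norm_nonneg _)
  rw [h0]
  calc _ ≤ ‖P.Λ₀ s - (1 / s) • P.f₀‖ + ‖(P.ε / (P.k - s)) • P.g₀‖ := norm_sub_le _ _
    _ ≤ ‖P.Λ₀ s‖ + ‖(1 / s) • P.f₀‖ + ‖(P.ε / (P.k - s)) • P.g₀‖ := by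
      gcongr; exact norm_sub_le _ _
    _ ≤ _ := by gcongr

end HeckeLambda

end HeckeTheta

section GammaBounds

lemma inv_Gamma_eq {z : ℂ} (hz : z.re < 1) :
    (Gamma z)⁻¹ = Gamma (1 - z) * Complex.sin (Real.pi * z) / Real.pi := by
  have h := Complex.Gamma_mul_Gamma_one_sub z
  have h1 : Gamma (1 - z) ≠ 0 := Complex.Gamma_ne_zero_of_re_pos (by simp; linarith)
  have hpi : (Real.pi : ℂ) ≠ 0 := by exact_mod_cast Real.pi_ne_zero
  by_cases hs : Complex.sin (Real.pi * z) = 0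
  · rw [hs, div_zero] at h
    have h2 : Gamma z = 0 := by simpa [h1] using h
    rw [hs, h2]
    simp
  · have h2 : Gamma z ≠ 0 := by
      intro h0
      rw [h0, zero_mul] at h
      exact div_ne_zero hpi hs h.symm
    generalize Complex.sin (Real.pi * z) = w at hs h
    rw [eq_div_iff hs] at h
    rw [inv_eq_iff_eq_inv, inv_div, eq_div_iff (mul_ne_zero h1 hs), ← h, mul_assoc]

lemma norm_Gamma_conj (z : ℂ) : ‖Gamma ((starRingEnd ℂ) z)‖ = ‖Gamma z‖ := by
  rw [Complex.Gamma_conj, Complex.norm_conj]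

lemma norm_sq_Gamma_half (u : ℝ) :
    ‖Gamma (1 / 2 + u * I)‖ ^ 2 * Real.cosh (Real.pi * u) = Real.pi := by
  have h := Complex.Gamma_mul_Gamma_one_sub (1 / 2 + u * I)
  have h1 : (1 : ℂ) - (1 / 2 + u * I) = (starRingEnd ℂ) (1 / 2 + u * I) := by
    apply Complex.ext <;> simp
    norm_num
  have h2 : Complex.sin (Real.pi * (1 / 2 + u * I)) = (Real.cosh (Real.pi * u) : ℝ) := by
    rw [show (Real.pi : ℂ) * (1 / 2 + u * I) = (Real.pi * u : ℝ) * I + Real.pi / 2 by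
      push_cast; ring, Complex.sin_add_pi_div_two, Complex.cos_mul_I, Complex.ofReal_cosh]
  have h3 := congrArg norm h
  rw [h1, h2, norm_mul, norm_Gamma_conj, norm_div, Complex.norm_real, Complex.norm_real,
    Real.norm_of_nonneg Real.pi_pos.le, Real.norm_of_nonneg (Real.cosh_pos _).le,
    eq_div_iff (Real.cosh_pos _).ne'] at h3
  rw [sq]; exact h3

lemma norm_Gamma_le {z : ℂ} (hz : 0 < z.re) : ‖Gamma z‖ ≤ Real.Gamma z.re := by
  rw [Complex.Gamma_eq_integral hz, Real.Gamma_eq_integral hz, Complex.GammaIntegral]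
  refine (MeasureTheory.norm_integral_le_integral_norm _).trans (le_of_eq ?_)
  refine MeasureTheory.setIntegral_congr_fun measurableSet_Ioi fun t ht => ?_
  simp only [norm_mul]
  rw [Complex.norm_cpow_eq_rpow_re_of_pos ht, Complex.norm_real,
    Real.norm_of_nonneg (Real.exp_pos _).le]
  simp

lemma norm_Gamma_one_add_le (u : ℝ) : ‖Gamma (1 + u * I)‖ ≤ 1 := by
  have h := norm_Gamma_le (z := 1 + u * I) (by simp)
  simpa using h

lemma norm_sq_Gamma_one (u : ℝ) :
    ‖Gamma (1 + u * I)‖ ^ 2 * |Real.sinh (Real.pi * u)| = Real.pi * |u| := by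
  by_cases hu : u = 0
  · simp [hu]
  have h := Complex.Gamma_mul_Gamma_one_sub (u * I)
  have hu' : (u : ℂ) * I ≠ 0 := by simp [hu]
  have h1 : (1 : ℂ) - u * I = (starRingEnd ℂ) (1 + u * I) := by
    apply Complex.ext <;> simp
  have h2 : Complex.sin (Real.pi * (u * I)) = (Real.sinh (Real.pi * u) : ℝ) * I := by
    rw [show (Real.pi : ℂ) * (u * I) = (Real.pi * u : ℝ) * I by push_cast; ring,
      Complex.sin_mul_I, Complex.ofReal_sinh]
  have hsn : |Real.sinh (Real.pi * u)| ≠ 0 := by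
    rw [abs_ne_zero, Ne, Real.sinh_eq_zero]
    exact mul_ne_zero Real.pi_ne_zero hu
  have h4 : Gamma (1 + u * I) = u * I * Gamma (u * I) := by
    rw [add_comm, Complex.Gamma_add_one _ hu']
  have h3 := congrArg norm h
  rw [h1, h2, norm_mul, norm_Gamma_conj, norm_div, norm_mul, Complex.norm_real, Complex.norm_real,
    Real.norm_of_nonneg Real.pi_pos.le, Complex.norm_I, mul_one, Real.norm_eq_abs,
    eq_div_iff hsn] at h3
  have h5 : ‖Gamma (1 + u * I)‖ = |u| * ‖Gamma (u * I)‖ := by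
    rw [h4, norm_mul, norm_mul, Complex.norm_real, Complex.norm_I, mul_one, Real.norm_eq_abs]
  rw [h5] at h3 ⊢
  linear_combination |u| * h3

lemma norm_sq_Gamma_one_mul_cosh_le (u : ℝ) :
    ‖Gamma (1 + u * I)‖ ^ 2 * Real.cosh (Real.pi * u) ≤ Real.pi * (1 + |u|) := by
  have h1 : Real.cosh (Real.pi * u) ≤ |Real.sinh (Real.pi * u)| + 1 := by
    have h2 := Real.cosh_sq (Real.pi * u)
    have h3 := abs_nonneg (Real.sinh (Real.pi * u))
    have h4 := sq_abs (Real.sinh (Real.pi * u))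
    nlinarith [Real.cosh_pos (Real.pi * u)]
  have h5 : ‖Gamma (1 + u * I)‖ ^ 2 ≤ 1 := pow_le_one₀ (norm_nonneg _) (norm_Gamma_one_add_le u)
  have h6 := norm_sq_Gamma_one u
  have h7 := Real.pi_gt_three
  calc _ ≤ ‖Gamma (1 + u * I)‖ ^ 2 * (|Real.sinh (Real.pi * u)| + 1) := by gcongr
    _ = Real.pi * |u| + ‖Gamma (1 + u * I)‖ ^ 2 := by rw [mul_add, h6, mul_one]
    _ ≤ _ := by linarith

lemma norm_sq_Gamma_three_half (u : ℝ) :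
    ‖Gamma (3 / 2 + u * I)‖ ^ 2 * Real.cosh (Real.pi * u) = (1 / 4 + u ^ 2) * Real.pi := by
  have h0 : (1 / 2 + u * I : ℂ) ≠ 0 := by
    intro h; have := congrArg Complex.re h; norm_num at this
  have h1 : Gamma (3 / 2 + u * I) = (1 / 2 + u * I) * Gamma (1 / 2 + u * I) := by
    rw [← Complex.Gamma_add_one _ h0]; congr 1; ring
  have h2 : ‖(1 / 2 + u * I : ℂ)‖ ^ 2 = 1 / 4 + u ^ 2 := by
    rw [← Complex.normSq_eq_norm_sq, Complex.normSq_apply]; norm_num; ring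
  rw [h1, norm_mul, mul_pow, h2, mul_assoc, norm_sq_Gamma_half]

/-- Ratio of Gamma factors for a real place with trivial sign character. -/
lemma norm_Gamma_ratio_even (u : ℝ) :
    ‖Gamma (1 - u * I) * (Gamma (-1 / 2 + u * I))⁻¹‖ ^ 2 ≤ (1 + |2 * u|) ^ 3 := by
  have h1 : ‖Gamma (1 - u * I)‖ = ‖Gamma (1 + u * I)‖ := by
    rw [← norm_Gamma_conj]; congr 2; apply Complex.ext <;> simp
  have h2 : ‖Gamma (1 - (-1 / 2 + u * I))‖ = ‖Gamma (3 / 2 + u * I)‖ := by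
    rw [← norm_Gamma_conj]; congr 2
    simp only [map_sub, map_add, map_mul, map_div₀, map_neg, map_one, map_ofNat,
      Complex.conj_ofReal, Complex.conj_I]
    ring
  have h3 : Complex.sin (Real.pi * (-1 / 2 + u * I)) = -(Real.cosh (Real.pi * u) : ℝ) := by
    rw [show (Real.pi : ℂ) * (-1 / 2 + u * I) = (Real.pi * u : ℝ) * I - Real.pi / 2 by
      push_cast; ring, Complex.sin_sub_pi_div_two, Complex.cos_mul_I, Complex.ofReal_cosh]
  rw [inv_Gamma_eq (by norm_num), h3, norm_mul, norm_div, norm_mul, norm_neg, h1, h2,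
    Complex.norm_real, Complex.norm_real, Real.norm_of_nonneg Real.pi_pos.le,
    Real.norm_of_nonneg (Real.cosh_pos _).le]
  have h4 := norm_sq_Gamma_one_mul_cosh_le u
  have h5 := norm_sq_Gamma_three_half u
  have hpi := Real.pi_pos
  have h6 : (‖Gamma (1 + u * I)‖ * (‖Gamma (3 / 2 + u * I)‖ * Real.cosh (Real.pi * u) / Real.pi)) ^ 2 =
      (‖Gamma (1 + u * I)‖ ^ 2 * Real.cosh (Real.pi * u)) *
        (‖Gamma (3 / 2 + u * I)‖ ^ 2 * Real.cosh (Real.pi * u)) / Real.pi ^ 2 := by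
    field_simp
  rw [h6, h5, div_le_iff₀ (by positivity)]
  calc _ ≤ Real.pi * (1 + |u|) * ((1 / 4 + u ^ 2) * Real.pi) := by gcongr
    _ = (1 + |u|) * (1 / 4 + u ^ 2) * Real.pi ^ 2 := by ring
    _ ≤ _ := by
      gcongr
      have ha := abs_nonneg u
      rw [abs_mul, abs_two, ← sq_abs u]
      nlinarith [pow_nonneg ha 2, pow_nonneg ha 3]

/-- Ratio of Gamma factors for a real place with nontrivial sign character. -/
lemma norm_Gamma_ratio_odd (u : ℝ) :
    ‖Gamma (3 / 2 - u * I) * (Gamma (u * I))⁻¹‖ ^ 2 ≤ (1 + |2 * u|) ^ 3 := by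
  have h1 : ‖Gamma (3 / 2 - u * I)‖ = ‖Gamma (3 / 2 + u * I)‖ := by
    rw [← norm_Gamma_conj]; congr 2
    simp only [map_sub, map_mul, map_div₀, map_ofNat, Complex.conj_ofReal, Complex.conj_I]
    ring
  have h2 : ‖Gamma (1 - u * I)‖ = ‖Gamma (1 + u * I)‖ := by
    rw [← norm_Gamma_conj]; congr 2; apply Complex.ext <;> simp
  have h3 : Complex.sin (Real.pi * (u * I)) = (Real.sinh (Real.pi * u) : ℝ) * I := by
    rw [show (Real.pi : ℂ) * (u * I) = (Real.pi * u : ℝ) * I by push_cast; ring,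
      Complex.sin_mul_I, Complex.ofReal_sinh]
  rw [inv_Gamma_eq (by norm_num), h3, norm_mul, norm_div, norm_mul, norm_mul, h1, h2,
    Complex.norm_real, Complex.norm_real, Real.norm_of_nonneg Real.pi_pos.le, Complex.norm_I,
    mul_one, Real.norm_eq_abs]
  have h4 := norm_sq_Gamma_one u
  have h5 := norm_sq_Gamma_three_half u
  have hpi := Real.pi_pos
  have h7 : |Real.sinh (Real.pi * u)| ≤ Real.cosh (Real.pi * u) := by
    rw [abs_le]
    constructor
    · have := Real.exp_pos (Real.pi * u)
      rw [← Real.cosh_add_sinh] at this; linarith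
    · have := Real.exp_pos (-(Real.pi * u))
      rw [← Real.cosh_sub_sinh] at this; linarith
  have h6 : (‖Gamma (3 / 2 + u * I)‖ * (‖Gamma (1 + u * I)‖ * |Real.sinh (Real.pi * u)| / Real.pi)) ^ 2 =
      (‖Gamma (1 + u * I)‖ ^ 2 * |Real.sinh (Real.pi * u)|) *
        (‖Gamma (3 / 2 + u * I)‖ ^ 2 * |Real.sinh (Real.pi * u)|) / Real.pi ^ 2 := by
    field_simp
  rw [h6, h4, div_le_iff₀ (by positivity)]
  calc _ ≤ Real.pi * |u| * (‖Gamma (3 / 2 + u * I)‖ ^ 2 * Real.cosh (Real.pi * u)) := by gcongr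
    _ = |u| * (1 / 4 + u ^ 2) * Real.pi ^ 2 := by rw [h5]; ring
    _ ≤ _ := by
      gcongr
      have ha := abs_nonneg u
      rw [abs_mul, abs_two, ← sq_abs u]
      nlinarith [pow_nonneg ha 2, pow_nonneg ha 3]

/-- Ratio of Gamma factors for a complex place. -/
lemma norm_Gamma_ratio_complex (t : ℝ) :
    ‖Gamma (2 - t * I) * (Gamma (-1 + t * I))⁻¹‖ ≤ (1 + |t|) ^ 3 := by
  have h1 : ‖Gamma (2 - t * I)‖ = ‖Gamma (2 + t * I)‖ := by
    rw [← norm_Gamma_conj]; congr 2; apply Complex.ext <;> simp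
  have h2 : 1 - (-1 + t * I) = 2 - t * I := by ring
  have h0 : (1 + t * I : ℂ) ≠ 0 := by
    intro h; have := congrArg Complex.re h; norm_num at this
  have h8 : ‖Gamma (2 + t * I)‖ ^ 2 = (1 + t ^ 2) * ‖Gamma (1 + t * I)‖ ^ 2 := by
    have : Gamma (2 + t * I) = (1 + t * I) * Gamma (1 + t * I) := by
      rw [← Complex.Gamma_add_one _ h0]; congr 1; ring
    have e1 : (1 + t * I : ℂ).re = 1 := by simp
    have e2 : (1 + t * I : ℂ).im = t := by simp
    rw [this, norm_mul, mul_pow, ← Complex.normSq_eq_norm_sq, Complex.normSq_apply, e1, e2]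
    ring
  have h3 : Complex.sin (Real.pi * (-1 + t * I)) = -((Real.sinh (Real.pi * t) : ℝ) * I) := by
    rw [show (Real.pi : ℂ) * (-1 + t * I) = (Real.pi * t : ℝ) * I - Real.pi by push_cast; ring,
      Complex.sin_sub_pi, Complex.sin_mul_I, Complex.ofReal_sinh]
  rw [inv_Gamma_eq (by norm_num), h2, h3, norm_mul, norm_div, norm_mul, norm_neg, norm_mul, h1,
    Complex.norm_real, Complex.norm_real, Real.norm_of_nonneg Real.pi_pos.le, Complex.norm_I,
    mul_one, Real.norm_eq_abs]
  have h4 := norm_sq_Gamma_one t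
  have hpi := Real.pi_pos
  have h6 : ‖Gamma (2 + t * I)‖ * (‖Gamma (2 + t * I)‖ * |Real.sinh (Real.pi * t)| / Real.pi) =
      (1 + t ^ 2) * (‖Gamma (1 + t * I)‖ ^ 2 * |Real.sinh (Real.pi * t)|) / Real.pi := by
    rw [← mul_assoc, ← h8]; ring
  rw [h6, h4, div_le_iff₀ (by positivity)]
  have ha := abs_nonneg t
  rw [← sq_abs t]
  have : (1 + |t| ^ 2) * |t| ≤ (1 + |t|) ^ 3 := by nlinarith [pow_nonneg ha 2, pow_nonneg ha 3]
  nlinarith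

/-- A crude growth bound for `1/Γ`. -/
lemma exists_norm_inv_Gamma_le : ∃ C : ℝ, 1 ≤ C ∧ ∀ z : ℂ, -1 ≤ z.re → z.re ≤ 2 → 1 ≤ |z.im| →
    ‖(Gamma z)⁻¹‖ ≤ C * Real.exp (Real.pi * |z.im|) := by
  obtain ⟨B, hB⟩ := (isCompact_Icc (a := (1 : ℝ)) (b := 4)).exists_bound_of_continuousOn
    (f := Real.Gamma) (fun x hx => (Real.differentiableAt_Gamma fun m => by
      have := hx.1; have : (0:ℝ) ≤ m := Nat.cast_nonneg m
      intro h; linarith).continuousAt.continuousWithinAt)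
  refine ⟨max B 1, le_max_right _ _, fun z h1 h2 h3 => ?_⟩
  have hz1 : (1 - z) ≠ 0 := by
    intro h; have := congrArg Complex.im h; simp at this; rw [this] at h3; norm_num at h3
  have hz2 : (1 - z + 1) ≠ 0 := by
    intro h; have := congrArg Complex.im h; simp at this; rw [this] at h3; norm_num at h3
  have hsin : Complex.sin (Real.pi * z) ≠ 0 := by
    rw [Complex.sin_ne_zero_iff]
    intro k hk
    have := congrArg Complex.im hk
    simp [Real.pi_ne_zero] at this
    rw [this] at h3; norm_num at h3
  have h4 := Complex.Gamma_mul_Gamma_one_sub z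
  have hpi : (Real.pi : ℂ) ≠ 0 := by exact_mod_cast Real.pi_ne_zero
  have h5 : Gamma (1 - z + 1 + 1) = (1 - z + 1) * ((1 - z) * Gamma (1 - z)) := by
    rw [Complex.Gamma_add_one _ hz2, Complex.Gamma_add_one _ hz1]
  have hG : Gamma z ≠ 0 := by
    intro h0; rw [h0, zero_mul] at h4; exact div_ne_zero hpi hsin h4.symm
  have h6 : (Gamma z)⁻¹ = Gamma (1 - z + 1 + 1) * Complex.sin (Real.pi * z) /
      (Real.pi * ((1 - z + 1) * (1 - z))) := by
    rw [h5]
    generalize Complex.sin (Real.pi * z) = w at hsin h4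
    rw [eq_div_iff hsin] at h4
    rw [← h4]
    have hG1 : Gamma (1 - z) ≠ 0 := by
      intro h0; rw [h0] at h4; simp at h4
      exact hpi h4.symm
    field_simp
  have h7 : ‖Gamma (1 - z + 1 + 1)‖ ≤ max B 1 := by
    have hre : (1 - z + 1 + 1).re = 3 - z.re := by simp; ring
    refine (norm_Gamma_le (by rw [hre]; linarith)).trans ?_
    rw [hre]
    have := hB (3 - z.re) ⟨by linarith, by linarith⟩
    exact (le_abs_self _).trans (this.trans (le_max_left _ _))
  have h8 : ‖Complex.sin (Real.pi * z)‖ ≤ Real.exp (Real.pi * |z.im|) := by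
    rw [Complex.sin, norm_div, norm_mul, Complex.norm_I, mul_one]
    have e1 : ‖cexp (-(Real.pi * z) * I)‖ ≤ Real.exp (Real.pi * |z.im|) := by
      rw [Complex.norm_exp]
      apply Real.exp_le_exp.2
      simp
      exact mul_le_mul_of_nonneg_left (le_abs_self _) Real.pi_pos.le
    have e2 : ‖cexp ((Real.pi * z) * I)‖ ≤ Real.exp (Real.pi * |z.im|) := by
      rw [Complex.norm_exp]
      apply Real.exp_le_exp.2
      simp
      rw [← mul_neg]
      exact mul_le_mul_of_nonneg_left (neg_le_abs _) Real.pi_pos.le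
    have e3 := norm_sub_le (cexp (-(Real.pi * z) * I)) (cexp ((Real.pi * z) * I))
    simp only [Complex.norm_ofNat]
    linarith
  have h9 : ∀ w : ℂ, |w.im| = |z.im| → 1 ≤ ‖w‖ := fun w hw => by
    have := Complex.abs_im_le_norm w; rw [hw] at this; linarith
  rw [h6, norm_div, norm_mul, norm_mul, norm_mul, Complex.norm_real,
    Real.norm_of_nonneg Real.pi_pos.le]
  have h10 : 1 ≤ Real.pi * (‖1 - z + 1‖ * ‖1 - z‖) := by
    have a1 := h9 (1 - z + 1) (by simp)
    have a2 := h9 (1 - z) (by simp)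
    have := one_le_mul_of_one_le_of_one_le a1 a2
    have := Real.pi_gt_three
    nlinarith
  refine (div_le_self (by positivity) h10).trans ?_
  gcongr

end GammaBounds

section GammaInverse
open NumberField.InfinitePlace

variable {K : Type*} [Field K] [NumberField K]
variable (S : Finset {w : InfinitePlace K // IsReal w})

/-- The entire inverse of the Gamma factor. -/
def gamPi (s : ℂ) : ℂ :=
  ∏ v : InfinitePlace K, (2 * (((mult v * Real.pi : ℝ) : ℂ)) ^ wArg S s v * (Gamma (wArg S s v))⁻¹)

lemma differentiable_gamPi : Differentiable ℂ (gamPi S) := by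
  have hw : ∀ v : InfinitePlace K, Differentiable ℂ fun s => wArg S s v := fun v => by
    unfold wArg; fun_prop
  refine Differentiable.fun_finsetProd fun v _ => ?_
  refine Differentiable.mul (Differentiable.mul (differentiable_const _) ?_) ?_
  · refine (hw v).const_cpow (Or.inl ?_)
    exact_mod_cast (mult_mul_pi_pos v).ne'
  · exact Complex.differentiable_one_div_Gamma.comp (hw v)

lemma gamP_mul_gamPi {s : ℂ} (hs : 0 < s.re) : gamP S s * gamPi S s = 1 := by
  rw [gamP, gamPi, ← Finset.prod_mul_distrib]
  refine Finset.prod_eq_one fun v _ => ?_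
  have h1 : Gamma (wArg S s v) ≠ 0 := Complex.Gamma_ne_zero_of_re_pos (wArg_re_pos S hs v)
  have h2 : ((mult v * Real.pi : ℝ) : ℂ) ≠ 0 := by exact_mod_cast (mult_mul_pi_pos v).ne'
  have h3 : ((mult v * Real.pi : ℝ) : ℂ) ^ wArg S s v ≠ 0 := by
    rw [Ne, Complex.cpow_eq_zero_iff]; tauto
  have h4 : (1 / ((mult v * Real.pi : ℝ) : ℂ)) ^ wArg S s v =
      (((mult v * Real.pi : ℝ) : ℂ) ^ wArg S s v)⁻¹ := by
    rw [one_div, Complex.inv_cpow]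
    rw [Complex.arg_ofReal_of_nonneg (mult_mul_pi_pos v).le]
    exact Real.pi_pos.ne
  rw [h4]
  field_simp

lemma norm_gam_ratio_le (t : ℝ) :
    ‖gamP S (2 - t * I) * gamPi S (-1 + t * I)‖ ≤ (1 + |t|) ^ (3 / 2 * (nK K : ℝ)) := by
  have hsum : ((∑ v : InfinitePlace K, mult v : ℕ) : ℝ) = nK K := by
    rw [sum_mult_eq]; rfl
  have h1t : 0 < 1 + |t| := by positivity
  rw [gamP, gamPi, ← Finset.prod_mul_distrib, norm_prod, ← hsum, mul_comm (3 / 2 : ℝ), Nat.cast_sum,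
    Finset.sum_mul, Real.rpow_sum_of_pos h1t]
  refine Finset.prod_le_prod (fun _ _ => norm_nonneg _) fun v _ => ?_
  set a : ℝ := mult v * Real.pi with ha
  have ha0 : 0 < a := mult_mul_pi_pos v
  have ha1 : 1 ≤ a := by
    have : (1 : ℝ) ≤ mult v := by exact_mod_cast (mult_pos : 0 < mult v)
    have := Real.pi_gt_three
    nlinarith
  have h4 : ‖(1 / (a : ℂ)) ^ wArg S (2 - t * I) v * (a : ℂ) ^ wArg S (-1 + t * I) v‖ ≤ 1 := by
    have e1 : (1 / (a : ℂ)) = ((1 / a : ℝ) : ℂ) := by push_cast; rfl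
    rw [norm_mul, e1, Complex.norm_cpow_eq_rpow_re_of_pos (by positivity),
      Complex.norm_cpow_eq_rpow_re_of_pos ha0, one_div, Real.inv_rpow ha0.le,
      ← Real.rpow_neg ha0.le, ← Real.rpow_add ha0]
    refine Real.rpow_le_one_of_one_le_of_nonpos ha1 ?_
    simp only [wArg]
    simp
    ring_nf
    have : (0 : ℝ) ≤ mult v := Nat.cast_nonneg _
    linarith
  have h5 : ‖Gamma (wArg S (2 - t * I) v) * (Gamma (wArg S (-1 + t * I) v))⁻¹‖ ≤
      (1 + |t|) ^ ((mult v : ℝ) * (3 / 2)) := by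
    by_cases hv : IsReal v
    · have hm : mult v = 1 := by rw [mult, if_pos hv]
      have key : ∀ x : ℝ, 0 ≤ x → x ^ 2 ≤ (1 + |2 * (t / 2)|) ^ 3 →
          x ≤ (1 + |t|) ^ (((1 : ℕ) : ℝ) * (3 / 2)) := by
        intro x hx hxx
        refine (pow_le_pow_iff_left₀ hx (by positivity) two_ne_zero).1 ?_
        rw [← Real.rpow_natCast ((1 + |t|) ^ _), ← Real.rpow_mul h1t.le]
        norm_num
        rw [mul_div_cancel₀ _ two_ne_zero] at hxx
        exact_mod_cast hxx
      rw [hm]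
      refine key _ (norm_nonneg _) ?_
      by_cases hS : ⟨v, hv⟩ ∈ S
      · have hb : bInd S v = 1 := by rw [bInd, dif_pos hv, if_pos hS]
        convert norm_Gamma_ratio_odd (t / 2) using 5
        · simp only [wArg, hm, hb]; push_cast; ring_nf
        · simp only [wArg, hm, hb]; push_cast; ring_nf
      · have hb : bInd S v = 0 := by rw [bInd, dif_pos hv, if_neg hS]
        convert norm_Gamma_ratio_even (t / 2) using 5
        · simp only [wArg, hm, hb]; push_cast; ring_nf
        · simp only [wArg, hm, hb]; push_cast; ring_nf
    · have hm : mult v = 2 := by rw [mult, if_neg hv]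
      have hb : bInd S v = 0 := by rw [bInd, dif_neg hv]
      rw [hm]
      have h6 := norm_Gamma_ratio_complex t
      rw [show (((2 : ℕ) : ℝ) * (3 / 2)) = ((3 : ℕ) : ℝ) by norm_num, Real.rpow_natCast]
      convert h6 using 3
      · simp only [wArg, hm, hb]; push_cast; ring_nf
      · simp only [wArg, hm, hb]; push_cast; ring_nf
  calc _ = ‖(1 / (a : ℂ)) ^ wArg S (2 - t * I) v * (a : ℂ) ^ wArg S (-1 + t * I) v‖ *
        ‖Gamma (wArg S (2 - t * I) v) * (Gamma (wArg S (-1 + t * I) v))⁻¹‖ := by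
        rw [← norm_mul]; congr 1; ring
    _ ≤ 1 * (1 + |t|) ^ ((mult v : ℝ) * (3 / 2)) := by gcongr
    _ = _ := one_mul _

lemma exists_norm_gamPi_le : ∃ C A : ℝ, ∀ s : ℂ, -1 ≤ s.re → s.re ≤ 2 → 2 ≤ |s.im| →
    ‖gamPi S s‖ ≤ C * Real.exp (A * |s.im|) := by
  obtain ⟨C, hC, h⟩ := exists_norm_inv_Gamma_le
  refine ⟨∏ v : InfinitePlace K, (2 * (mult v * Real.pi) ^ (2 : ℝ) * C),
    ∑ v : InfinitePlace K, Real.pi, fun s h1 h2 h3 => ?_⟩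
  rw [gamPi, norm_prod, Finset.sum_mul, Real.exp_sum, ← Finset.prod_mul_distrib]
  refine Finset.prod_le_prod (fun _ _ => norm_nonneg _) fun v _ => ?_
  have hm : (mult v = 1 ∧ bInd S v ≤ 1) ∨ (mult v = 2 ∧ bInd S v = 0) := by
    by_cases hv : IsReal v
    · left
      refine ⟨by rw [mult, if_pos hv], ?_⟩
      rw [bInd, dif_pos hv]; split_ifs <;> norm_num
    · right
      exact ⟨by rw [mult, if_neg hv], by rw [bInd, dif_neg hv]⟩
  have hre : (wArg S s v).re = (mult v * s.re + bInd S v) / 2 := by simp [wArg]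
  have him : (wArg S s v).im = (mult v * s.im) / 2 := by simp [wArg]
  have hr : -1 ≤ (wArg S s v).re ∧ (wArg S s v).re ≤ 2 ∧ 1 ≤ |(wArg S s v).im| ∧
      |(wArg S s v).im| ≤ |s.im| := by
    rw [hre, him]
    rcases hm with ⟨hm, hb⟩ | ⟨hm, hb⟩
    · have hb' : (bInd S v : ℝ) ≤ 1 := by exact_mod_cast hb
      have hb0 : (0 : ℝ) ≤ bInd S v := Nat.cast_nonneg _
      rw [hm, Nat.cast_one, one_mul, one_mul, abs_div, abs_two]
      refine ⟨by linarith, by linarith, by linarith, by linarith⟩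
    · rw [hm, hb, Nat.cast_two, Nat.cast_zero, add_zero, mul_div_cancel_left₀ _ two_ne_zero,
        mul_div_cancel_left₀ _ two_ne_zero]
      exact ⟨h1, h2, by linarith, le_rfl⟩
  obtain ⟨r1, r2, r3, r4⟩ := hr
  have ha0 : 0 < (mult v * Real.pi : ℝ) := mult_mul_pi_pos v
  have ha1 : 1 ≤ (mult v * Real.pi : ℝ) := by
    have : (1 : ℝ) ≤ mult v := by exact_mod_cast (mult_pos : 0 < mult v)
    have := Real.pi_gt_three
    nlinarith
  rw [norm_mul, norm_mul, Complex.norm_cpow_eq_rpow_re_of_pos ha0, Complex.norm_ofNat, mul_assoc,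
    mul_assoc, mul_assoc]
  gcongr
  refine (h _ r1 r2 r3).trans ?_
  gcongr

end GammaInverse

section Convexity
open NumberField.InfinitePlace NumberField.Units
open scoped Classical

variable {K : Type*} [Field K] [NumberField K]
variable {𝔣 : Ideal (𝓞 K)} {χ : HeckeChar K 𝔣} {S : Finset {w : InfinitePlace K // IsReal w}}
variable {L : ℂ → ℂ}

lemma isPreconnected_compl_countable {s : Set ℂ} (hs : s.Countable) : IsPreconnected sᶜ :=
  (hs.isConnected_compl_of_one_lt_rank (by simp)).isPreconnected

lemma eqOn_of_eq_of_one_lt_re {f g : ℂ → ℂ} {s : Set ℂ} (hs : s.Finite) (h2 : (2 : ℂ) ∉ s)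
    (hf : ∀ z ∉ s, DifferentiableAt ℂ f z) (hg : ∀ z ∉ s, DifferentiableAt ℂ g z)
    (h : ∀ z : ℂ, 1 < z.re → f z = g z) : ∀ z ∉ s, f z = g z := by
  have ho : IsOpen sᶜ := hs.isClosed.isOpen_compl
  have hf' : AnalyticOnNhd ℂ f sᶜ := DifferentiableOn.analyticOnNhd
    (fun z hz => (hf z hz).differentiableWithinAt) ho
  have hg' : AnalyticOnNhd ℂ g sᶜ := DifferentiableOn.analyticOnNhd
    (fun z hz => (hg z hz).differentiableWithinAt) ho
  refine hf'.eqOn_of_preconnected_of_eventuallyEq hg' (isPreconnected_compl_countable hs.countable)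
    (z₀ := 2) h2 ?_
  have : ∀ᶠ z : ℂ in 𝓝 2, 1 < z.re :=
    (isOpen_lt continuous_const Complex.continuous_re).mem_nhds (by norm_num)
  exact this.mono h

lemma natCard_torsion_pos : 0 < Nat.card (torsion K) := Nat.card_pos

lemma IsLFun.exists_mul_eq (hL : IsLFun χ L) (hS : IsSignSet χ S) (h𝔣 : 𝔣 ≠ ⊥) :
    ∃ κ : ℝ, 0 < κ ∧ (∀ s : ℂ, 0 < s.re → gamS S s = κ * gamP S s) ∧
      ∀ s : ℂ, s ≠ 0 → s ≠ 1 → L s * (Nat.card (torsion K) * κ) = (heckePair hS h𝔣).Λ s * gamPi S s := by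
  obtain ⟨κ, hκ, h⟩ := exists_gamS_eq K
  refine ⟨κ, hκ, fun s hs => (h S s hs).2, fun s h0 h1 => ?_⟩
  refine eqOn_of_eq_of_one_lt_re (f := fun s => L s * (Nat.card (torsion K) * κ))
    (g := fun s => (heckePair hS h𝔣).Λ s * gamPi S s) (s := {0, 1}) (by simp) (by simp) ?_ ?_ ?_ s
    (by simp [h0, h1])
  · intro z hz
    simp only [Set.mem_insert_iff, Set.mem_singleton_iff, not_or] at hz
    exact (hL.1 z hz.2).mul_const _
  · intro z hz
    simp only [Set.mem_insert_iff, Set.mem_singleton_iff, not_or] at hz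
    refine DifferentiableAt.mul ?_ (differentiable_gamPi S z)
    refine (heckePair hS h𝔣).differentiableAt_Λ (Or.inl hz.1) (Or.inl ?_)
    change z ≠ ((1 : ℝ) : ℂ)
    simpa using hz.2
  · intro z hz
    have hz0 : 0 < z.re := zero_lt_one.trans hz
    rw [heckePair_Λ hS h𝔣 hz, (h S z hz0).2, hL.2 z hz]
    linear_combination (-(Nat.card (torsion K) : ℂ) * κ * LSer χ z) * gamP_mul_gamPi S hz0

lemma IsLFun.norm_left_le (hL : IsLFun χ L) (hS : IsSignSet χ S) (h𝔣 : 𝔣 ≠ ⊥) (t : ℝ) :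
    ‖L (-1 + t * I)‖ ≤ (√(DK K))⁻¹ * (Ideal.absNorm 𝔣 * DK K : ℝ) ^ (2 : ℝ) * zetaR K 2 *
      (1 + |t|) ^ (3 / 2 * (nK K : ℝ)) := by
  obtain ⟨κ, hκ, h1, h2⟩ := hL.exists_mul_eq hS h𝔣
  have hW : (0 : ℝ) < Nat.card (torsion K) := by exact_mod_cast natCard_torsion_pos
  have hs0 : (-1 + t * I : ℂ) ≠ 0 := fun h => by
    have := congrArg Complex.re h; norm_num at this
  have hs1 : (-1 + t * I : ℂ) ≠ 1 := fun h => by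
    have := congrArg Complex.re h; norm_num at this
  have h3 := congrArg norm (h2 _ hs0 hs1)
  have hre : (2 - t * I : ℂ).re = 2 := by simp
  have h4 := norm_heckePair_Λ_left_le hS h𝔣 (s := 2 - t * I) (by rw [hre]; norm_num)
  rw [hre, h1 _ (by rw [hre]; norm_num), show (1 - (2 - t * I) : ℂ) = -1 + t * I by ring,
    norm_mul, Complex.norm_real, Real.norm_of_nonneg hκ.le] at h4
  have h5 := norm_gam_ratio_le S t
  rw [norm_mul] at h5
  rw [norm_mul, norm_mul, norm_mul, Complex.norm_real, Real.norm_of_nonneg hκ.le,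
    Complex.norm_natCast] at h3
  have hz : 0 ≤ zetaR K 2 := zero_le_one.trans (one_le_zetaR (by norm_num))
  refine le_of_mul_le_mul_right ?_ (mul_pos hW hκ)
  rw [h3]
  calc _ ≤ (Nat.card (torsion K) * (κ * ‖gamP S (2 - t * I)‖) *
      ((√(DK K))⁻¹ * (Ideal.absNorm 𝔣 * DK K : ℝ) ^ (2 : ℝ)) * zetaR K 2) *
        ‖gamPi S (-1 + t * I)‖ := by gcongr
    _ = (√(DK K))⁻¹ * (Ideal.absNorm 𝔣 * DK K : ℝ) ^ (2 : ℝ) * zetaR K 2 *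
      (‖gamP S (2 - t * I)‖ * ‖gamPi S (-1 + t * I)‖) * (Nat.card (torsion K) * κ) := by ring
    _ ≤ _ := by gcongr

lemma IsLFun.exists_norm_le (hL : IsLFun χ L) (h𝔣 : 𝔣 ≠ ⊥) :
    ∃ C A : ℝ, ∀ s : ℂ, -1 ≤ s.re → s.re ≤ 2 → 2 ≤ |s.im| → ‖L s‖ ≤ C * Real.exp (A * |s.im|) := by
  obtain ⟨S, hS⟩ := χ.exists_signSet h𝔣
  replace hS : IsSignSet χ S := hS
  obtain ⟨κ, hκ, h1, h2⟩ := hL.exists_mul_eq hS h𝔣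
  have hW : (0 : ℝ) < Nat.card (torsion K) := by exact_mod_cast natCard_torsion_pos
  obtain ⟨B, hB⟩ := exists_heckePair_Λ_le hS h𝔣 (-1) 2
  obtain ⟨C, A, hC⟩ := exists_norm_gamPi_le S
  refine ⟨B * C / (Nat.card (torsion K) * κ), A, fun s a1 a2 a3 => ?_⟩
  have hs0 : s ≠ 0 := fun h => by rw [h] at a3; norm_num at a3
  have hs1 : s ≠ 1 := fun h => by rw [h] at a3; norm_num at a3
  have h3 := congrArg norm (h2 _ hs0 hs1)
  rw [norm_mul, norm_mul, norm_mul, Complex.norm_real, Real.norm_of_nonneg hκ.le,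
    Complex.norm_natCast] at h3
  have h4 := hB s a1 a2 (by linarith)
  have h5 := hC s a1 a2 a3
  have hB0 : 0 ≤ B := (norm_nonneg _).trans h4
  rw [div_mul_eq_mul_div, le_div_iff₀ (mul_pos hW hκ), h3, mul_assoc]
  gcongr

/-- The factor removing a possible pole at `s = 1`. -/
def poleFac (χ : HeckeChar K 𝔣) (s : ℂ) : ℂ := if IsTrivialChar χ then (s - 1) / (s + 2) else 1

lemma differentiableAt_poleFac {s : ℂ} (hs : -2 < s.re) : DifferentiableAt ℂ (poleFac χ) s := by
  have h2 : s + 2 ≠ 0 := fun h => by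
    have := congrArg Complex.re h; simp at this; linarith
  unfold poleFac
  split_ifs
  · exact (by fun_prop : DifferentiableAt ℂ (fun s : ℂ => s - 1) s).fun_div (by fun_prop) h2
  · exact differentiableAt_const _

lemma IsLFun.exists_entire (hL : IsLFun χ L) (h𝔣 : 𝔣 ≠ ⊥) : ∃ G : ℂ → ℂ,
    (∀ s : ℂ, -2 < s.re → DifferentiableAt ℂ G s) ∧ ∀ s : ℂ, s ≠ 1 → G s = poleFac χ s * L s := by
  obtain ⟨S, hS⟩ := χ.exists_signSet h𝔣
  replace hS : IsSignSet χ S := hS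
  obtain ⟨κ, hκ, h1, h2⟩ := hL.exists_mul_eq hS h𝔣
  have hW : (0 : ℝ) < Nat.card (torsion K) := by exact_mod_cast natCard_torsion_pos
  set c : ℂ := Nat.card (torsion K) * κ with hc
  have hc0 : c ≠ 0 := mul_ne_zero (by exact_mod_cast hW.ne') (by exact_mod_cast hκ.ne')
  set P := heckePair hS h𝔣 with hP
  obtain ⟨E, hE, hEq⟩ : ∃ E : ℂ → ℂ, DifferentiableAt ℂ E 1 ∧
      ∀ s : ℂ, s ≠ 0 → s ≠ 1 → E s = poleFac χ s * P.Λ s := by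
    by_cases hχ : IsTrivialChar χ
    · refine ⟨fun s => ((s - 1) * P.Λ₀ s - (s - 1) / s * P.f₀ + P.ε * P.g₀) / (s + 2), ?_, ?_⟩
      · have := P.differentiable_Λ₀ 1
        refine DifferentiableAt.fun_div ?_ (by fun_prop) (by norm_num)
        refine DifferentiableAt.fun_add (DifferentiableAt.fun_sub ?_ ?_) (differentiableAt_const _)
        · exact DifferentiableAt.mul (by fun_prop) this
        · refine DifferentiableAt.mul_const ?_ _
          exact DifferentiableAt.fun_div (by fun_prop) (by fun_prop) one_ne_zero
      · intro s s0 s1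
        have h0 : P.Λ s = P.Λ₀ s - (1 / s) • P.f₀ - (P.ε / (((1 : ℝ) : ℂ) - s)) • P.g₀ := rfl
        rw [h0, poleFac, if_pos hχ]
        have s2 : 1 - s ≠ 0 := sub_ne_zero.2 (Ne.symm s1)
        simp only [smul_eq_mul, ofReal_one]
        have h3 : (s - 1) * (P.ε / (1 - s)) = -P.ε := by field_simp; ring
        linear_combination (P.g₀ / (s + 2)) * h3
    · refine ⟨P.Λ, heckePair_differentiable hS h𝔣 hχ 1, fun s _ _ => ?_⟩
      rw [poleFac, if_neg hχ, one_mul]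
  refine ⟨fun s => if s = 1 then E s * gamPi S s / c else poleFac χ s * L s, ?_, ?_⟩
  · intro s hs
    by_cases hs1 : s = 1
    · subst hs1
      have : DifferentiableAt ℂ (fun s => E s * gamPi S s / c) 1 :=
        (hE.mul (differentiable_gamPi S 1)).div_const c
      refine this.congr_of_eventuallyEq ?_
      have hne : ∀ᶠ s : ℂ in 𝓝 1, s ≠ 0 := isOpen_ne.mem_nhds one_ne_zero
      filter_upwards [hne] with s s0
      split_ifs with s1
      · rfl
      · rw [hEq s s0 s1, eq_div_iff hc0, mul_assoc, h2 s s0 s1, mul_assoc]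
    · have : DifferentiableAt ℂ (fun s => poleFac χ s * L s) s :=
        (differentiableAt_poleFac hs).mul (hL.1 s hs1)
      refine this.congr_of_eventuallyEq ?_
      filter_upwards [isOpen_ne.mem_nhds hs1] with z hz
      rw [if_neg hz]
  · intro s hs
    simp only [if_neg hs]

lemma norm_poleFac_le {s : ℂ} (hs : -1 ≤ s.re) : ‖poleFac χ s‖ ≤ 2 := by
  unfold poleFac
  split_ifs
  · have h2 : 0 < ‖s + 2‖ := norm_pos_iff.2 fun h => by
      have := congrArg Complex.re h; simp at this; linarith
    rw [norm_div, div_le_iff₀ h2]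
    refine (pow_le_pow_iff_left₀ (norm_nonneg _) (by positivity) two_ne_zero).1 ?_
    rw [mul_pow, ← Complex.normSq_eq_norm_sq, ← Complex.normSq_eq_norm_sq, Complex.normSq_apply,
      Complex.normSq_apply]
    simp
    nlinarith [sq_nonneg s.im]
  · simp

lemma one_le_nK : 1 ≤ nK K := Module.finrank_pos

lemma one_le_DK : 1 ≤ DK K := Int.natAbs_pos.2 (NumberField.discr_ne_zero K)

/-- The logarithmic analytic conductor governing the convexity bound. -/
def condLog (K : Type*) [Field K] [NumberField K] (𝔣 : Ideal (𝓞 K)) (T : ℝ) : ℝ :=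
  3 / 4 * Real.log (DK K) + Real.log (Ideal.absNorm 𝔣) + 3 / 4 * nK K * Real.log (T + 3)

lemma norm_cexp_gauss (n X : ℝ) (s s₀ : ℂ) :
    ‖cexp (n * (s - s₀) ^ 2 + X * (s - 1.01))‖ =
      Real.exp (n * ((s.re - s₀.re) ^ 2 - (s.im - s₀.im) ^ 2) + X * (s.re - 1.01)) := by
  rw [Complex.norm_exp]
  congr 1
  have h : (1.01 : ℂ) = ((1.01 : ℝ) : ℂ) := by push_cast; rfl
  rw [h, sq]
  simp
  left; ring

/-- The convexity bound. -/
lemma IsLFun.norm_entire_le (hL : IsLFun χ L) (h𝔣 : 𝔣 ≠ ⊥) {G : ℂ → ℂ}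
    (hG : ∀ s : ℂ, -2 < s.re → DifferentiableAt ℂ G s)
    (hGL : ∀ s : ℂ, s ≠ 1 → G s = poleFac χ s * L s) {T : ℝ} (hT : 0 ≤ T) {s : ℂ}
    (h1 : -1 ≤ s.re) (h2 : s.re ≤ 1.01) (h3 : |s.im| ≤ T + 2) :
    ‖G s‖ ≤ Real.exp ((1.01 - s.re) * condLog K 𝔣 T + 12 * nK K) := by
  set X := condLog K 𝔣 T with hX
  set n : ℝ := (nK K : ℝ) with hn
  have hn1 : 1 ≤ n := by rw [hn]; exact_mod_cast one_le_nK
  have hD1 : (1 : ℝ) ≤ DK K := by exact_mod_cast one_le_DK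
  have hN1 : (1 : ℝ) ≤ Ideal.absNorm 𝔣 := by exact_mod_cast one_le_absNorm (⟨𝔣, h𝔣⟩ : NzI K)
  have hT3 : 0 ≤ Real.log (T + 3) := Real.log_nonneg (by linarith)
  obtain ⟨S, hS⟩ := χ.exists_signSet h𝔣
  replace hS : IsSignSet χ S := hS
  have key : ‖G s * cexp (n * (s - s) ^ 2 + X * (s - 1.01))‖ ≤ Real.exp (12 * n) := by
    refine PhragmenLindelof.vertical_strip (a := -1) (b := 1.01)
      (f := fun z => G z * cexp (n * (z - s) ^ 2 + X * (z - 1.01))) ?_ ?_ ?_ ?_ h1 h2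
    · have hcl : closure (re ⁻¹' Set.Ioo (-1 : ℝ) 1.01) ⊆ {z : ℂ | -2 < z.re} := by
        refine (closure_mono (Set.preimage_mono Set.Ioo_subset_Icc_self)).trans ?_
        rw [(isClosed_Icc.preimage Complex.continuous_re).closure_eq]
        intro z hz
        have : -1 ≤ z.re := hz.1
        show -2 < z.re
        linarith
      have : DifferentiableOn ℂ (fun z => G z * cexp (n * (z - s) ^ 2 + X * (z - 1.01)))
          (closure (re ⁻¹' Set.Ioo (-1 : ℝ) 1.01)) := fun z hz =>
        ((hG z (hcl hz)).mul (by fun_prop)).differentiableWithinAt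
      exact this.diffContOnCl
    · obtain ⟨C, A, hCA⟩ := hL.exists_norm_le h𝔣
      refine ⟨1, ?_, |A|, ?_⟩
      · rw [lt_div_iff₀ (by norm_num)]
        have := Real.pi_gt_three
        norm_num; linarith
      · refine Asymptotics.IsBigO.of_bound (2 * C * Real.exp (n * 3 ^ 2)) ?_
        have hev : ∀ᶠ z : ℂ in comap (_root_.abs ∘ im) atTop ⊓ 𝓟 (re ⁻¹' Set.Ioo (-1 : ℝ) 1.01),
            2 ≤ |z.im| ∧ z.re ∈ Set.Ioo (-1 : ℝ) 1.01 := by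
          refine Filter.Eventually.and ?_ ?_
          · exact Filter.mem_inf_of_left ((eventually_ge_atTop 2).comap _)
          · exact Filter.mem_inf_of_right (Filter.mem_principal_self _)
        filter_upwards [hev] with z hz
        obtain ⟨hz1, hz2, hz3⟩ := hz
        have hz4 : z ≠ 1 := fun h => by rw [h] at hz1; norm_num at hz1
        have hb := hCA z hz2.le (hz3.le.trans (by norm_num)) hz1
        have hC0 : 0 ≤ C := by
          by_contra hC
          have := (norm_nonneg _).trans hb
          have h4 := Real.exp_pos (A * |z.im|)
          nlinarith
        have hX0 : 0 ≤ X := by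
          have a1 := Real.log_nonneg hD1
          have a2 := Real.log_nonneg hN1
          rw [hX, condLog]; positivity
        rw [norm_mul, norm_cexp_gauss, hGL z hz4, norm_mul, Real.norm_of_nonneg (Real.exp_pos _).le]
        have e1 : n * ((z.re - s.re) ^ 2 - (z.im - s.im) ^ 2) + X * (z.re - 1.01) ≤ n * 3 ^ 2 := by
          have : (z.re - s.re) ^ 2 ≤ 3 ^ 2 := by
            rw [sq_le_sq, abs_le]
            constructor <;> rw [abs_of_pos (by norm_num : (0:ℝ) < 3)] <;> norm_num at h2 hz3 <;> linarith
          have : X * (z.re - 1.01) ≤ 0 := mul_nonpos_of_nonneg_of_nonpos hX0 (by linarith)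
          nlinarith [sq_nonneg (z.im - s.im)]
        have e2 : A * |z.im| ≤ |A| * Real.exp (1 * |z.im|) := by
          have h5 := Real.add_one_le_exp (1 * |z.im|)
          have h6 := abs_nonneg A
          have h7 := abs_nonneg z.im
          calc A * |z.im| ≤ |A| * |z.im| := by gcongr; exact le_abs_self A
            _ ≤ _ := by gcongr; linarith
        calc _ ≤ 2 * (C * Real.exp (A * |z.im|)) * Real.exp (n * 3 ^ 2) := by
              gcongr
              exact norm_poleFac_le hz2.le
          _ ≤ 2 * (C * Real.exp (|A| * Real.exp (1 * |z.im|))) * Real.exp (n * 3 ^ 2) := by gcongr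
          _ = _ := by ring
    · intro z hz
      have hz1 : z ≠ 1 := fun h => by rw [h] at hz; norm_num at hz
      have hzt : z = -1 + z.im * I := by apply Complex.ext <;> simp [hz]
      have hb := hL.norm_left_le hS h𝔣 z.im
      rw [← hzt] at hb
      have hz2 : zetaR K 2 ≤ Real.exp n := by
        refine (zetaR_le (by norm_num)).trans ?_
        rw [← Real.rpow_natCast, Real.rpow_def_of_pos (by norm_num), ← hn]
        apply Real.exp_le_exp.2
        norm_num
        have := Real.log_two_lt_d9
        nlinarith
      have ht : (1 + |z.im|) ≤ Real.exp (Real.log (T + 3) + |z.im - s.im|) := by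
        rw [Real.exp_add, Real.exp_log (by linarith)]
        have h5 := Real.add_one_le_exp |z.im - s.im|
        have h6 : |z.im| ≤ |z.im - s.im| + |s.im| := by
          have := abs_add_le (z.im - s.im) s.im; simpa using this
        have h7 := abs_nonneg (z.im - s.im)
        nlinarith
      have hpow : (1 + |z.im|) ^ (3 / 2 * n) ≤
          Real.exp ((Real.log (T + 3) + |z.im - s.im|) * (3 / 2 * n)) := by
        rw [Real.exp_mul]
        exact Real.rpow_le_rpow (by positivity) ht (by positivity)
      have hDN : (√(DK K))⁻¹ * (Ideal.absNorm 𝔣 * DK K : ℝ) ^ (2 : ℝ) =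
          Real.exp (3 / 2 * Real.log (DK K) + 2 * Real.log (Ideal.absNorm 𝔣)) := by
        have hD0 : (0 : ℝ) < DK K := by linarith
        have hN0 : (0 : ℝ) < Ideal.absNorm 𝔣 := by linarith
        rw [Real.sqrt_eq_rpow, ← Real.rpow_neg hD0.le, Real.mul_rpow hN0.le hD0.le,
          Real.rpow_def_of_pos hD0, Real.rpow_def_of_pos hD0, Real.rpow_def_of_pos hN0,
          ← Real.exp_add, ← Real.exp_add]
        congr 1; ring
      rw [norm_mul, norm_cexp_gauss, hGL z hz1, norm_mul]
      rw [hDN] at hb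
      have h2e : (2 : ℝ) ≤ Real.exp n := by
        have := Real.add_one_le_exp n; linarith
      calc _ ≤ Real.exp n * (Real.exp (3 / 2 * Real.log (DK K) + 2 * Real.log (Ideal.absNorm 𝔣)) *
            Real.exp n * Real.exp ((Real.log (T + 3) + |z.im - s.im|) * (3 / 2 * n))) *
            Real.exp (n * ((z.re - s.re) ^ 2 - (z.im - s.im) ^ 2) + X * (z.re - 1.01)) := by
            gcongr
            · exact (norm_poleFac_le hz.ge).trans h2e
            · refine hb.trans ?_
              have hz0 : 0 ≤ zetaR K 2 := zero_le_one.trans (one_le_zetaR (by norm_num))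
              gcongr
        _ ≤ _ := by
            rw [← Real.exp_add, ← Real.exp_add, ← Real.exp_add, ← Real.exp_add]
            apply Real.exp_le_exp.2
            rw [hz, hX, condLog, ← hn]
            have a1 := Real.log_nonneg hD1
            have a2 := Real.log_nonneg hN1
            have a3 : (-1 - s.re) ^ 2 ≤ 5 := by norm_num at h2; nlinarith
            have a4 : 3 / 2 * |z.im - s.im| - (z.im - s.im) ^ 2 ≤ 1 := by
              rw [← sq_abs]; nlinarith [sq_nonneg (|z.im - s.im| - 3 / 4)]
            have a5 := mul_nonneg (by linarith : 0 ≤ n) hT3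
            nlinarith
    · intro z hz
      have hz1 : z ≠ 1 := fun h => by rw [h] at hz; norm_num at hz
      rw [norm_mul, norm_cexp_gauss, hGL z hz1, norm_mul, hz, sub_self, mul_zero, add_zero]
      have hLz : ‖L z‖ ≤ Real.exp (5 * n) := by
        rw [hL.2 z (by rw [hz]; norm_num)]
        refine (norm_LSer_le χ (by rw [hz]; norm_num)).trans ((zetaR_le (by rw [hz]; norm_num)).trans ?_)
        rw [hz, mul_comm (5 : ℝ), hn, Real.exp_nat_mul]
        gcongr
        have h5 : Real.exp 5 = Real.exp 1 ^ 5 := by rw [← Real.exp_nat_mul]; norm_num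
        rw [h5]
        calc _ ≤ (2.7 : ℝ) ^ 5 := by norm_num
          _ ≤ _ := by gcongr; have := Real.exp_one_gt_d9; linarith
      have h2e : (2 : ℝ) ≤ Real.exp n := by
        have := Real.add_one_le_exp n; linarith
      calc _ ≤ Real.exp n * Real.exp (5 * n) *
            Real.exp (n * ((1.01 - s.re) ^ 2 - (z.im - s.im) ^ 2)) := by
            gcongr
            exact (norm_poleFac_le (by rw [hz]; norm_num)).trans h2e
        _ ≤ _ := by
            rw [← Real.exp_add, ← Real.exp_add]
            apply Real.exp_le_exp.2
            have a3 : (1.01 - s.re) ^ 2 ≤ 5 := by norm_num at h2; nlinarith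
            nlinarith [sq_nonneg (z.im - s.im)]
  rw [norm_mul, norm_cexp_gauss] at key
  have h4 : Real.exp (12 * n) = Real.exp ((1.01 - s.re) * X + 12 * n) *
      Real.exp (n * ((s.re - s.re) ^ 2 - (s.im - s.im) ^ 2) + X * (s.re - 1.01)) := by
    rw [← Real.exp_add]; congr 1; ring
  rw [h4] at key
  exact le_of_mul_le_mul_right key (Real.exp_pos _)

end Convexity

section DedekindZeta
open NumberField.InfinitePlace NumberField.Units
open scoped Classical

variable (K : Type*) [Field K] [NumberField K]

/-- The trivial Hecke character of modulus one. -/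
def HeckeChar.triv : HeckeChar K (⊤ : Ideal (𝓞 K)) where
  toFun _ := 1
  map_mul' _ _ := (one_mul 1).symm
  eq_zero' 𝔞 h := (h (Ideal.isCoprime_iff_sup_eq.2 (by simp))).elim
  norm_one' _ _ := norm_one
  ray_one' _ _ _ := rfl

lemma LSer_triv (s : ℂ) : LSer (HeckeChar.triv K) s = ∑' a : NzI K, (Ideal.absNorm a.1 : ℂ) ^ (-s) :=
  tsum_congr fun _ => one_mul _

lemma LSer_triv_ofReal {σ : ℝ} : LSer (HeckeChar.triv K) σ = zetaR K σ := by
  rw [LSer_triv, zetaR, Complex.ofReal_tsum]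
  refine tsum_congr fun a => ?_
  rw [Complex.ofReal_cpow (Nat.cast_nonneg _)]
  push_cast; rfl

lemma gamPi_empty_zero : gamPi (∅ : Finset {w : InfinitePlace K // IsReal w}) 0 = 0 := by
  obtain ⟨v⟩ : Nonempty (InfinitePlace K) := inferInstance
  refine Finset.prod_eq_zero (Finset.mem_univ v) ?_
  have : wArg (∅ : Finset {w : InfinitePlace K // IsReal w}) 0 v = 0 := by simp [wArg, bInd]
  rw [this, Complex.Gamma_zero]; simp

/-- Analytic continuation of the Dedekind zeta function. -/
lemma exists_isLFun_triv : ∃ Z : ℂ → ℂ, IsLFun (HeckeChar.triv K) Z := by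
  obtain ⟨S, hS⟩ := (HeckeChar.triv K).exists_signSet top_ne_bot
  replace hS : IsSignSet (HeckeChar.triv K) S := hS
  obtain rfl : S = ∅ := hS.1 rfl
  obtain ⟨κ, hκ, h⟩ := exists_gamS_eq K
  have hW : (0 : ℝ) < Nat.card (torsion K) := by exact_mod_cast natCard_torsion_pos
  set c : ℂ := Nat.card (torsion K) * κ with hc
  have hc0 : c ≠ 0 := mul_ne_zero (by exact_mod_cast hW.ne') (by exact_mod_cast hκ.ne')
  set P := heckePair hS top_ne_bot with hP
  have hd := differentiable_gamPi (∅ : Finset {w : InfinitePlace K // IsReal w})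
  set g := gamPi (∅ : Finset {w : InfinitePlace K // IsReal w}) with hg
  have hds : Differentiable ℂ (dslope g 0) := fun s =>
    ((Complex.differentiableOn_dslope (Filter.univ_mem)).2 hd.differentiableOn).differentiableAt
      Filter.univ_mem
  refine ⟨fun s => ((P.Λ₀ s - P.ε / (1 - s) * P.g₀) * g s - P.f₀ * dslope g 0 s) / c, ?_, ?_⟩
  · intro s hs
    have := P.differentiable_Λ₀ s
    have h1 : 1 - s ≠ 0 := sub_ne_zero.2 hs.symm
    refine DifferentiableAt.div_const ?_ _
    refine DifferentiableAt.fun_sub (DifferentiableAt.fun_mul ?_ (hd s)) ((hds s).const_mul _)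
    refine DifferentiableAt.fun_sub this (DifferentiableAt.mul_const ?_ _)
    exact DifferentiableAt.fun_div (by fun_prop) (by fun_prop) h1
  · intro s hs
    have hs0 : 0 < s.re := by linarith
    have hne : s ≠ 0 := fun h => by rw [h] at hs0; simp at hs0
    have h0 : P.Λ s = P.Λ₀ s - (1 / s) • P.f₀ - (P.ε / (((1 : ℝ) : ℂ) - s)) • P.g₀ := rfl
    have h1 := heckePair_Λ hS top_ne_bot hs
    rw [← hP, (h ∅ s hs0).2, h0] at h1
    have h2 := gamP_mul_gamPi (∅ : Finset {w : InfinitePlace K // IsReal w}) hs0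
    rw [← hg] at h2
    have h3 : dslope g 0 s = g s / s := by
      rw [dslope_of_ne _ hne, slope_def_field, hg, gamPi_empty_zero, sub_zero, sub_zero]
    simp only [smul_eq_mul, ofReal_one] at h1
    beta_reduce
    rw [h3, div_eq_iff hc0, hc]
    linear_combination g s * h1 + (Nat.card (torsion K) * κ * LSer (HeckeChar.triv K) s) * h2

end DedekindZeta

section PowerSums
open Polynomial

variable {ι : Type*} [Fintype ι]

lemma exists_le_prod_abs_sub [Nonempty ι] (x : ι → ℝ) {a : ℝ} (ha : a < 1) :
    ∃ t ∈ Set.Icc a 1, ((1 - a) / 4) ^ Fintype.card ι ≤ ∏ i, |t - x i| := by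
  by_contra! hcon
  set N := Fintype.card ι with hN
  have hN0 : N ≠ 0 := Fintype.card_ne_zero
  set B : ℝ := ((1 - a) / 4) ^ N with hB
  set h : ℝ := (1 - a) / 2 with hh
  have hh0 : 0 < h := by simp only [hh]; linarith
  have hB0 : 0 < B := pow_pos (by linarith) _
  set P : ℝ[X] := C B⁻¹ * ∏ i, (C h * X + C ((1 + a) / 2 - x i)) with hP
  have hlin : ∀ i, (C h * X + C ((1 + a) / 2 - x i)).leadingCoeff = h := fun i =>
    leadingCoeff_linear hh0.ne'
  have hdeg : ∀ i, (C h * X + C ((1 + a) / 2 - x i)).degree = 1 := fun i =>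
    degree_linear hh0.ne'
  have hlead : P.leadingCoeff = B⁻¹ * h ^ N := by
    rw [hP, leadingCoeff_mul, leadingCoeff_C, leadingCoeff_prod, Finset.prod_congr rfl fun i _ => hlin i]
    simp [hN]
  have hPd : P.degree ≤ N := by
    rw [hP, degree_mul, degree_prod, degree_C (inv_ne_zero hB0.ne'), Finset.sum_congr rfl fun i _ => hdeg i]
    simp [hN]
  have hbd : ∀ y ∈ Set.Icc (-1 : ℝ) 1, |P.eval y| ≤ 1 := by
    intro y hy
    have := hcon (h * y + (1 + a) / 2) ⟨by simp only [hh]; nlinarith [hy.1], by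
      simp only [hh]; nlinarith [hy.2]⟩
    rw [hP, eval_mul, eval_prod, abs_mul, Finset.abs_prod, eval_C, abs_of_pos (inv_pos.2 hB0),
      inv_mul_le_iff₀ hB0, mul_one]
    refine le_trans (le_of_eq (Finset.prod_congr rfl fun i _ => ?_)) this.le
    simp only [eval_add, eval_mul, eval_C, eval_X]
    congr 1; ring
  have := Polynomial.Chebyshev.leadingCoeff_le_of_forall_abs_le_one hPd hbd
  rw [hlead, hB, ← inv_pow, ← mul_pow] at this
  have h2 : (((1 - a) / 4)⁻¹ * h) = 2 := by
    have : 1 - a ≠ 0 := by linarith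
    simp only [hh]; field_simp; norm_num
  rw [h2] at this
  exact absurd this (not_le.2 (pow_lt_pow_right₀ (by norm_num) (by omega)))

lemma sum_norm_coeff_prod_le (s : Finset ι) {w : ι → ℂ} (hw : ∀ i, ‖w i‖ ≤ 1) :
    ∑ i ∈ Finset.range (s.card + 1), ‖(∏ j ∈ s, (X - C (w j))).coeff i‖ ≤ 2 ^ s.card := by
  classical
  induction s using Finset.induction_on with
  | empty => simp
  | insert a s ha ih =>
    rw [Finset.prod_insert ha, Finset.card_insert_of_notMem ha]
    set f := ∏ j ∈ s, (X - C (w j)) with hf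
    have hnat : f.natDegree = s.card := by
      rw [hf, natDegree_prod_of_monic _ _ fun j _ => monic_X_sub_C _]; simp
    have htop : f.coeff (s.card + 1) = 0 := coeff_eq_zero_of_natDegree_lt (by omega)
    have hX : ∑ i ∈ Finset.range (s.card + 1 + 1), ‖(X * f).coeff i‖ =
        ∑ i ∈ Finset.range (s.card + 1), ‖f.coeff i‖ := by
      rw [Finset.sum_range_succ']; simp [coeff_X_mul]
    have hC : ∑ i ∈ Finset.range (s.card + 1 + 1), ‖(C (w a) * f).coeff i‖ ≤
        ∑ i ∈ Finset.range (s.card + 1), ‖f.coeff i‖ := by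
      rw [Finset.sum_range_succ]
      simp only [coeff_C_mul, htop, mul_zero, norm_zero, add_zero, norm_mul]
      exact Finset.sum_le_sum fun i _ => mul_le_of_le_one_left (norm_nonneg _) (hw a)
    calc _ ≤ ∑ i ∈ Finset.range (s.card + 1 + 1), (‖(X * f).coeff i‖ + ‖(C (w a) * f).coeff i‖) := by
          refine Finset.sum_le_sum fun i _ => ?_
          rw [sub_mul, coeff_sub]; exact norm_sub_le _ _
      _ ≤ 2 ^ s.card + 2 ^ s.card := by
          rw [Finset.sum_add_distrib, hX]; linarith
      _ = _ := by ring

lemma circleIntegral_inv_pow_mul_inv_sub {t : ℝ} (ht : 0 < t) {a : ℂ} (ha : a ≠ 0) (hat : ‖a‖ ≠ t)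
    (m : ℕ) : (∮ w in C(0, t), w⁻¹ ^ (m + 1) * (w - a)⁻¹) =
      if t < ‖a‖ then -(2 * Real.pi * I) * a⁻¹ ^ (m + 1) else 0 := by
  have hne : ∀ w ∈ Metric.sphere (0 : ℂ) t, w ≠ 0 ∧ w - a ≠ 0 := fun w hw => by
    rw [mem_sphere_zero_iff_norm] at hw
    refine ⟨fun h => ?_, fun h => ?_⟩
    · rw [h] at hw; simp at hw; linarith
    · rw [sub_eq_zero] at h; exact hat (by rw [← h, hw])
  have hci : ∀ n : ℕ, CircleIntegrable (fun w : ℂ => w⁻¹ ^ n * (w - a)⁻¹) 0 t := fun n => by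
    refine ContinuousOn.circleIntegrable ht.le fun w hw => ContinuousAt.continuousWithinAt ?_
    have h1 := (hne w hw).1
    have h2 := (hne w hw).2
    exact ((continuousAt_id.inv₀ h1).pow n).mul ((continuousAt_id.sub continuousAt_const).inv₀ h2)
  have hci' : ∀ n : ℕ, CircleIntegrable (fun w : ℂ => w⁻¹ ^ n) 0 t := fun n => by
    refine ContinuousOn.circleIntegrable ht.le fun w hw => ContinuousAt.continuousWithinAt ?_
    exact (continuousAt_id.inv₀ (hne w hw).1).pow n
  have hstep : ∀ n : ℕ, (∮ w in C(0, t), w⁻¹ ^ (n + 1) * (w - a)⁻¹) =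
      a⁻¹ * ((∮ w in C(0, t), w⁻¹ ^ n * (w - a)⁻¹) - ∮ w in C(0, t), w⁻¹ ^ (n + 1)) := fun n => by
    rw [← circleIntegral.integral_sub (hci n) (hci' (n + 1)), ← circleIntegral.integral_const_mul]
    refine circleIntegral.integral_congr ht.le fun w hw => ?_
    obtain ⟨h1, h2⟩ := hne w hw
    simp only [pow_succ]
    field_simp
    ring
  have h1 : (∮ w in C(0, t), (w : ℂ)⁻¹ ^ 1) = 2 * Real.pi * I := by
    simpa using circleIntegral.integral_sub_center_inv (0 : ℂ) ht.ne'
  have h2 : ∀ n : ℕ, (∮ w in C(0, t), (w : ℂ)⁻¹ ^ (n + 2)) = 0 := fun n => by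
    have := circleIntegral.integral_sub_zpow_of_ne (n := -((n : ℤ) + 2)) (by omega) (0 : ℂ) 0 t
    refine Eq.trans (circleIntegral.integral_congr ht.le fun w hw => ?_) this
    simp only [sub_zero]
    rw [zpow_neg, inv_pow]
    norm_cast
  split_ifs with hlt
  · induction m with
    | zero =>
      rw [hstep]
      have : (∮ w in C(0, t), w⁻¹ ^ 0 * (w - a)⁻¹) = 0 := by
        simp only [pow_zero, one_mul]
        refine DiffContOnCl.circleIntegral_eq_zero ht.le (DifferentiableOn.diffContOnCl ?_)
        rw [closure_ball _ ht.ne']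
        intro w hw
        refine DifferentiableAt.differentiableWithinAt ?_
        have : w - a ≠ 0 := fun h => by
          rw [sub_eq_zero] at h
          rw [h, mem_closedBall_zero_iff] at hw; linarith
        fun_prop (disch := assumption)
      rw [this, h1]; ring
    | succ n ih => rw [hstep, ih, h2 n]; ring
  · have hlt' : ‖a‖ < t := lt_of_le_of_ne (not_lt.1 hlt) hat
    induction m with
    | zero =>
      rw [hstep]
      have : (∮ w in C(0, t), w⁻¹ ^ 0 * (w - a)⁻¹) = 2 * Real.pi * I := by
        simp only [pow_zero, one_mul]
        exact circleIntegral.integral_sub_inv_of_mem_ball (by simpa using hlt')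
      rw [this, h1]; simp
    | succ n ih => rw [hstep, ih, h2 n]; simp

/-- A lower bound for some power sum of `N` nonzero complex numbers of maximal modulus one, over
any `N` consecutive exponents. -/
theorem exists_norm_sum_pow_ge {w : ι → ℂ} (hw0 : ∀ i, w i ≠ 0) (hw : ∀ i, ‖w i‖ ≤ 1)
    (hw1 : ∃ i, ‖w i‖ = 1) {m : ℕ} (hm : 1 ≤ m) :
    ∃ k, m + 1 ≤ k ∧ k ≤ m + Fintype.card ι ∧
      (Fintype.card ι : ℝ)⁻¹ * (Fintype.card ι / (8 * Real.exp 1 * (m + Fintype.card ι))) ^ Fintype.card ι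
        ≤ ‖∑ i, w i ^ k‖ := by
  classical
  obtain ⟨i₀, hi₀⟩ := hw1
  have : Nonempty ι := ⟨i₀⟩
  set N := Fintype.card ι with hN
  have hN0 : 0 < N := Fintype.card_pos
  have hNR : (0 : ℝ) < N := by exact_mod_cast hN0
  have hmR : (0 : ℝ) < m := by exact_mod_cast hm
  set A : ℝ := (N : ℝ)⁻¹ * (N / (8 * Real.exp 1 * (m + N))) ^ N with hA
  have hA0 : 0 < A := by positivity
  by_contra! hcon
  set a : ℝ := m / (m + N) with ha
  have ha0 : 0 < a := by positivity
  have ha1 : a < 1 := by rw [ha, div_lt_one (by positivity)]; linarith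
  have h1a : 1 - a = N / (m + N) := by rw [ha]; field_simp; ring
  obtain ⟨t, ⟨hat, ht1⟩, hprod⟩ := exists_le_prod_abs_sub (fun i => ‖w i‖) ha1
  rw [← hN] at hprod
  have ht0 : 0 < t := ha0.trans_le hat
  set B : ℝ := ((1 - a) / 4) ^ N with hB
  have hB0 : 0 < B := pow_pos (by linarith) _
  have htw : ∀ i, ‖w i‖ ≠ t := fun i h => by
    have : ∏ i, |t - ‖w i‖| = 0 := Finset.prod_eq_zero (Finset.mem_univ i) (by rw [h]; simp)
    linarith
  set f : ℂ[X] := ∏ j, (X - C (w j)) with hf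
  have hfw : ∀ z ∈ Metric.sphere (0 : ℂ) t, B ≤ ‖f.eval z‖ := fun z hz => by
    rw [mem_sphere_zero_iff_norm] at hz
    refine hprod.trans ?_
    rw [hf, eval_prod, norm_prod]
    refine Finset.prod_le_prod (fun _ _ => abs_nonneg _) fun i _ => ?_
    simpa [hz] using abs_norm_sub_norm_le z (w i)
  have hfne : ∀ z ∈ Metric.sphere (0 : ℂ) t, f.eval z ≠ 0 := fun z hz h => by
    have := hfw z hz; rw [h] at this; simp at this; linarith
  have hroot : ∀ i, f.eval (w i) = 0 := fun i => by
    rw [hf, eval_prod]; exact Finset.prod_eq_zero (Finset.mem_univ i) (by simp)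
  have hnat : f.natDegree = N := by
    rw [hf, natDegree_prod_of_monic _ _ fun j _ => monic_X_sub_C _]; simp [hN]
  have hne0 : ∀ z ∈ Metric.sphere (0 : ℂ) t, z ≠ 0 := fun z hz h => by
    rw [mem_sphere_zero_iff_norm, h] at hz; simp at hz; linarith
  set J : ℕ → ℂ := fun l => (2 * Real.pi * I : ℂ)⁻¹ •
    ∮ z in C(0, t), z⁻¹ ^ (m + 1) * (z ^ l * (f.eval z)⁻¹) with hJ
  have hci : ∀ l, CircleIntegrable (fun z : ℂ => z⁻¹ ^ (m + 1) * (z ^ l * (f.eval z)⁻¹)) 0 t := fun l => by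
    refine ContinuousOn.circleIntegrable ht0.le fun z hz => ContinuousAt.continuousWithinAt ?_
    exact ((continuousAt_id.inv₀ (hne0 z hz)).pow _).mul
      ((continuousAt_id.pow l).mul (f.continuous.continuousAt.inv₀ (hfne z hz)))
  have hJn : ∀ l, ‖J l‖ ≤ t⁻¹ ^ m * B⁻¹ := fun l => by
    have : ‖J l‖ ≤ t * (t⁻¹ ^ (m + 1) * B⁻¹) := by
      refine circleIntegral.norm_two_pi_i_inv_smul_integral_le_of_norm_le_const ht0.le fun z hz => ?_
      have hB' := hfw z hz
      rw [mem_sphere_zero_iff_norm] at hz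
      rw [norm_mul, norm_pow, norm_inv, norm_mul, norm_pow, norm_inv, hz]
      gcongr
      have : t ^ l ≤ 1 := pow_le_one₀ ht0.le ht1
      calc t ^ l * ‖f.eval z‖⁻¹ ≤ 1 * B⁻¹ := by gcongr
        _ = _ := one_mul _
    refine this.trans (le_of_eq ?_)
    rw [pow_succ]; field_simp
  -- the interpolation identity
  have hval : ∀ i, ∑ n ∈ Finset.range (N + 1), f.coeff n * ∑ l ∈ Finset.range n,
      J l * w i ^ (m + 1 + (n - 1 - l)) = if t < ‖w i‖ then -1 else 0 := fun i => by
    have h1 : ∑ n ∈ Finset.range (N + 1), f.coeff n * ∑ l ∈ Finset.range n,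
        J l * w i ^ (m + 1 + (n - 1 - l)) = w i ^ (m + 1) * ((2 * Real.pi * I : ℂ)⁻¹ *
          ∮ z in C(0, t), z⁻¹ ^ (m + 1) * (z - w i)⁻¹) := by
      have : (∮ z in C(0, t), z⁻¹ ^ (m + 1) * (z - w i)⁻¹) =
          ∑ n ∈ Finset.range (N + 1), ∑ l ∈ Finset.range n, f.coeff n * (w i ^ (n - 1 - l) *
            ∮ z in C(0, t), z⁻¹ ^ (m + 1) * (z ^ l * (f.eval z)⁻¹)) := by
        simp_rw [← circleIntegral.integral_const_mul]
        have hcc : ∀ n l : ℕ, CircleIntegrable (fun z : ℂ => f.coeff n * (w i ^ (n - 1 - l) *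
            (z⁻¹ ^ (m + 1) * (z ^ l * (f.eval z)⁻¹)))) 0 t := fun n l =>
          ((hci l).const_smul (a := w i ^ (n - 1 - l))).const_smul (a := f.coeff n)
        have hs : ∀ n, (∮ z in C(0, t), ∑ l ∈ Finset.range n, f.coeff n * (w i ^ (n - 1 - l) *
            (z⁻¹ ^ (m + 1) * (z ^ l * (f.eval z)⁻¹)))) = ∑ l ∈ Finset.range n, ∮ z in C(0, t),
              f.coeff n * (w i ^ (n - 1 - l) * (z⁻¹ ^ (m + 1) * (z ^ l * (f.eval z)⁻¹))) := fun n =>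
          circleIntegral.integral_fun_sum fun l _ => hcc n l
        simp_rw [← hs]
        rw [← circleIntegral.integral_fun_sum fun n _ => CircleIntegrable.fun_sum _ fun l _ => hcc n l]
        refine circleIntegral.integral_congr ht0.le fun z hz => ?_
        have hz0 := hfne z hz
        have hzw : z - w i ≠ 0 := fun h => by
          rw [sub_eq_zero] at h; exact hz0 (h ▸ hroot i)
        have hdiv : (∑ n ∈ Finset.range (N + 1), f.coeff n * ∑ l ∈ Finset.range n,
            z ^ l * w i ^ (n - 1 - l)) * (z - w i) = f.eval z := by
          rw [Finset.sum_mul]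
          simp_rw [mul_assoc, Commute.geom_sum₂_mul (Commute.all z (w i)), mul_sub,
            Finset.sum_sub_distrib]
          rw [← hnat, ← eval_eq_sum_range, ← eval_eq_sum_range, hroot, sub_zero]
        have : (z - w i)⁻¹ = (∑ n ∈ Finset.range (N + 1), f.coeff n * ∑ l ∈ Finset.range n,
            z ^ l * w i ^ (n - 1 - l)) * (f.eval z)⁻¹ := by
          rw [← hdiv]; field_simp
          rw [div_self]
          intro h0; rw [h0, zero_mul] at hdiv; exact hz0 hdiv.symm
        simp only [this, Finset.sum_mul, Finset.mul_sum]
        refine Finset.sum_congr rfl fun n _ => Finset.sum_congr rfl fun l _ => by ring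
      rw [this, Finset.mul_sum, Finset.mul_sum]
      refine Finset.sum_congr rfl fun n _ => ?_
      rw [Finset.mul_sum, Finset.mul_sum, Finset.mul_sum]
      refine Finset.sum_congr rfl fun l _ => ?_
      simp only [hJ, smul_eq_mul, pow_add]
      ring
    rw [h1, circleIntegral_inv_pow_mul_inv_sub ht0 (hw0 i) (htw i)]
    split_ifs
    · have := hw0 i
      have h2 : (2 * Real.pi * I : ℂ) ≠ 0 := two_pi_I_ne_zero
      rw [inv_pow]
      field_simp
    · simp
  have hsum : ∑ n ∈ Finset.range (N + 1), f.coeff n * ∑ l ∈ Finset.range n,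
      J l * ∑ i, w i ^ (m + 1 + (n - 1 - l)) = -((Finset.univ.filter fun i => t < ‖w i‖).card : ℂ) := by
    have : ∑ i, (if t < ‖w i‖ then (-1 : ℂ) else 0) =
        -((Finset.univ.filter fun i => t < ‖w i‖).card : ℂ) := by
      rw [Finset.sum_ite]; simp
    rw [← this]
    simp_rw [← hval]
    rw [Finset.sum_comm]
    refine Finset.sum_congr rfl fun n _ => ?_
    rw [← Finset.mul_sum, Finset.sum_comm]
    simp_rw [Finset.mul_sum]
  have hone : (1 : ℝ) ≤ ((Finset.univ.filter fun i => t < ‖w i‖).card : ℝ) := by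
    have : 0 < (Finset.univ.filter fun i => t < ‖w i‖).card := by
      refine Finset.card_pos.2 ⟨i₀, ?_⟩
      simp only [Finset.mem_filter, Finset.mem_univ, true_and]
      exact lt_of_le_of_ne (ht1.trans hi₀.ge) (htw i₀).symm
    exact_mod_cast this
  have hub : ‖∑ n ∈ Finset.range (N + 1), f.coeff n * ∑ l ∈ Finset.range n,
      J l * ∑ i, w i ^ (m + 1 + (n - 1 - l))‖ < 2 ^ N * (N * (t⁻¹ ^ m * B⁻¹ * A)) := by
    have hle : ∀ n ∈ Finset.range (N + 1), ‖f.coeff n * ∑ l ∈ Finset.range n,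
      J l * ∑ i, w i ^ (m + 1 + (n - 1 - l))‖ ≤ ‖f.coeff n‖ * (N * (t⁻¹ ^ m * B⁻¹ * A)) := by
      intro n hn
      rw [Finset.mem_range] at hn
      rw [norm_mul]
      gcongr
      calc _ ≤ ∑ l ∈ Finset.range n, t⁻¹ ^ m * B⁻¹ * A := by
            refine norm_sum_le_of_le _ fun l hl => ?_
            rw [Finset.mem_range] at hl
            rw [norm_mul]
            have := hcon (m + 1 + (n - 1 - l)) (by omega) (by omega)
            gcongr
            exact hJn l
        _ ≤ _ := by
            rw [Finset.sum_const, Finset.card_range, nsmul_eq_mul]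
            gcongr
            omega
    have hlt : ‖f.coeff N * ∑ l ∈ Finset.range N, J l * ∑ i, w i ^ (m + 1 + (N - 1 - l))‖ <
        ‖f.coeff N‖ * (N * (t⁻¹ ^ m * B⁻¹ * A)) := by
      have hmon : f.coeff N = 1 := by
        rw [← hnat]; exact monic_prod_of_monic _ _ fun j _ => monic_X_sub_C _
      rw [hmon]; simp only [one_mul, norm_one]
      calc _ ≤ ∑ l ∈ Finset.range N, ‖J l * ∑ i, w i ^ (m + 1 + (N - 1 - l))‖ := norm_sum_le _ _
        _ < ∑ l ∈ Finset.range N, t⁻¹ ^ m * B⁻¹ * A := by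
            refine Finset.sum_lt_sum_of_nonempty ⟨0, Finset.mem_range.2 hN0⟩ fun l hl => ?_
            rw [Finset.mem_range] at hl
            rw [norm_mul]
            have := hcon (m + 1 + (N - 1 - l)) (by omega) (by omega)
            have hp : 0 < t⁻¹ ^ m * B⁻¹ := by positivity
            calc _ ≤ t⁻¹ ^ m * B⁻¹ * ‖∑ i, w i ^ (m + 1 + (N - 1 - l))‖ := by gcongr; exact hJn l
              _ < _ := by gcongr
        _ = _ := by rw [Finset.sum_const, Finset.card_range, nsmul_eq_mul]
    calc _ ≤ ∑ n ∈ Finset.range (N + 1), ‖f.coeff n * ∑ l ∈ Finset.range n,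
          J l * ∑ i, w i ^ (m + 1 + (n - 1 - l))‖ := norm_sum_le _ _
      _ < ∑ n ∈ Finset.range (N + 1), ‖f.coeff n‖ * (N * (t⁻¹ ^ m * B⁻¹ * A)) :=
          Finset.sum_lt_sum hle ⟨N, Finset.mem_range.2 (Nat.lt_succ_self N), hlt⟩
      _ ≤ _ := by
          rw [← Finset.sum_mul]
          gcongr
          have := sum_norm_coeff_prod_le Finset.univ hw
          rwa [Finset.card_univ] at this
  rw [hsum, norm_neg, Complex.norm_natCast] at hub
  have hfin : 2 ^ N * (N * (t⁻¹ ^ m * B⁻¹ * A)) ≤ 1 := by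
    have h1 : t⁻¹ ^ m ≤ Real.exp 1 ^ N := by
      have h2 : t⁻¹ ≤ Real.exp (N / m) := by
        calc t⁻¹ ≤ a⁻¹ := by gcongr
          _ = N / m + 1 := by rw [ha]; field_simp; ring
          _ ≤ _ := Real.add_one_le_exp _
      calc t⁻¹ ^ m ≤ Real.exp (N / m) ^ m := by gcongr
        _ = _ := by
          rw [← Real.exp_nat_mul, ← Real.exp_nat_mul]; congr 1; field_simp
    have h3 : 2 ^ N * (N * (Real.exp 1 ^ N * B⁻¹ * A)) = 1 := by
      rw [hA, hB, h1a, ← inv_pow]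
      have e : 2 ^ N * ((N : ℝ) * (Real.exp 1 ^ N * (N / (m + N) / 4 : ℝ)⁻¹ ^ N *
          ((N : ℝ)⁻¹ * (N / (8 * Real.exp 1 * (m + N))) ^ N))) =
          (N * (N : ℝ)⁻¹) * (2 * Real.exp 1 * (N / (m + N) / 4 : ℝ)⁻¹ *
            (N / (8 * Real.exp 1 * (m + N)))) ^ N := by
        simp only [mul_pow]; ring
      rw [e, mul_inv_cancel₀ hNR.ne', one_mul]
      have : 2 * Real.exp 1 * (N / (m + N) / 4 : ℝ)⁻¹ * (N / (8 * Real.exp 1 * (m + N))) = 1 := by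
        field_simp; norm_num
      rw [this, one_pow]
    rw [← h3]
    gcongr
  linarith

end PowerSums

section LocalZeros
open Metric

variable {G : ℂ → ℂ} {U : Set ℂ}

lemma finite_zeros (hU : IsOpen U) (hc : IsPreconnected U) (hG : DifferentiableOn ℂ G U)
    (hne : ∃ z ∈ U, G z ≠ 0) {A : Set ℂ} (hA : IsCompact A) (hAU : A ⊆ U) :
    {z ∈ A | G z = 0}.Finite := by
  by_contra hinf
  obtain ⟨x, hxA, hx⟩ := Set.Infinite.exists_accPt_of_subset_isCompact hinf hA (Set.sep_subset _ _)
  obtain ⟨z, hz, hGz⟩ := hne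
  refine hGz ((hG.analyticOnNhd hU).eqOn_zero_of_preconnected_of_frequently_eq_zero hc (hAU hxA) ?_ hz)
  rw [accPt_iff_frequently_nhdsNE] at hx
  exact hx.mono fun y hy => hy.2

lemma exists_prod_mul (hU : IsOpen U) (hc : IsPreconnected U) (hG : DifferentiableOn ℂ G U)
    (hne : ∃ z ∈ U, G z ≠ 0) (Z : Finset ℂ) (hZ : ∀ ρ ∈ Z, ρ ∈ U) :
    ∃ H : ℂ → ℂ, DifferentiableOn ℂ H U ∧ (∀ ρ ∈ Z, H ρ ≠ 0) ∧
      ∀ s ∈ U, G s = (∏ ρ ∈ Z, (s - ρ) ^ analyticOrderNatAt G ρ) * H s := by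
  classical
  have hloc : ∀ ρ ∈ U, ∃ g : ℂ → ℂ, AnalyticAt ℂ g ρ ∧ g ρ ≠ 0 ∧
      ∀ᶠ z in 𝓝 ρ, G z = (z - ρ) ^ analyticOrderNatAt G ρ * g z := fun ρ hρ => by
    have han := hG.analyticAt (hU.mem_nhds hρ)
    refine han.analyticOrderAt_ne_top.1 fun h => ?_
    rw [analyticOrderAt_eq_top] at h
    obtain ⟨z, hz, hGz⟩ := hne
    exact hGz ((hG.analyticOnNhd hU).eqOn_zero_of_preconnected_of_eventuallyEq_zero hc hρ h hz)
  choose! g hgan hgne hg using hloc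
  have hprod : ∀ ρ ∈ Z, ∀ s, (∏ σ ∈ Z, (s - σ) ^ analyticOrderNatAt G σ) =
      (s - ρ) ^ analyticOrderNatAt G ρ * ∏ σ ∈ Z.erase ρ, (s - σ) ^ analyticOrderNatAt G σ :=
    fun ρ hρ s => (Finset.mul_prod_erase Z _ hρ).symm
  have herase : ∀ ρ ∈ Z, (∏ σ ∈ Z.erase ρ, (ρ - σ) ^ analyticOrderNatAt G σ) ≠ 0 := fun ρ hρ =>
    Finset.prod_ne_zero_iff.2 fun σ hσ => pow_ne_zero _
      (sub_ne_zero.2 (Finset.ne_of_mem_erase hσ).symm)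
  have hpne : ∀ s ∉ Z, (∏ σ ∈ Z, (s - σ) ^ analyticOrderNatAt G σ) ≠ 0 := fun s hs =>
    Finset.prod_ne_zero_iff.2 fun σ hσ => pow_ne_zero _ (sub_ne_zero.2 fun h => hs (h ▸ hσ))
  set H : ℂ → ℂ := fun s => if s ∈ Z then
      g s s / ∏ σ ∈ Z.erase s, (s - σ) ^ analyticOrderNatAt G σ
    else G s / ∏ σ ∈ Z, (s - σ) ^ analyticOrderNatAt G σ with hH
  have hZc : ∀ s ∉ Z, ∀ᶠ z in 𝓝 s, z ∉ Z := fun s hs =>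
    (Z.finite_toSet.isClosed.isOpen_compl).mem_nhds hs
  have hnear : ∀ ρ ∈ Z, ∀ᶠ z in 𝓝 ρ, H z = g ρ z / ∏ σ ∈ Z.erase ρ, (z - σ) ^ analyticOrderNatAt G σ := by
    intro ρ hρ
    have h1 : ∀ᶠ z in 𝓝 ρ, z ∉ Z.erase ρ :=
      ((Z.erase ρ).finite_toSet.isClosed.isOpen_compl).mem_nhds (by simp)
    filter_upwards [hg ρ (hZ ρ hρ), h1] with z hz hz1
    by_cases hzρ : z = ρ
    · simp [hH, hzρ, hρ]
    · have hzZ : z ∉ Z := fun h => hz1 (Finset.mem_erase.2 ⟨hzρ, h⟩)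
      simp only [hH, hzZ, if_false]
      rw [hz, hprod ρ hρ z, mul_div_mul_left _ _ (pow_ne_zero _ (sub_ne_zero.2 hzρ))]
  refine ⟨H, fun s hs => DifferentiableAt.differentiableWithinAt ?_, fun ρ hρ => ?_, fun s hs => ?_⟩
  · by_cases hsZ : s ∈ Z
    · refine DifferentiableAt.congr_of_eventuallyEq ?_ (hnear s hsZ)
      exact (hgan s hs).differentiableAt.div (by fun_prop) (herase s hsZ)
    · have : H =ᶠ[𝓝 s] fun s => G s / ∏ σ ∈ Z, (s - σ) ^ analyticOrderNatAt G σ := by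
        filter_upwards [hZc s hsZ] with z hz
        simp [hH, hz]
      refine DifferentiableAt.congr_of_eventuallyEq ?_ this
      exact (hG.differentiableAt (hU.mem_nhds hs)).div (by fun_prop) (hpne s hsZ)
  · simp only [hH, hρ, if_true]
    exact div_ne_zero (hgne ρ (hZ ρ hρ)) (herase ρ hρ)
  · by_cases hsZ : s ∈ Z
    · have := (hg s hs).self_of_nhds
      rw [this, hprod s hsZ]
      simp only [hH, hsZ, if_true]
      have := herase s hsZ
      field_simp
    · simp only [hH, hsZ, if_false]
      rw [mul_div_cancel₀ _ (hpne s hsZ)]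

lemma exists_exp_eq {H : ℂ → ℂ} {c : ℂ} {R : ℝ} (hR : 0 < R) (hH : DifferentiableOn ℂ H (ball c R))
    (hne : ∀ s ∈ ball c R, H s ≠ 0) :
    ∃ g : ℂ → ℂ, DifferentiableOn ℂ g (ball c R) ∧ ∀ s ∈ ball c R, H s = cexp (g s) := by
  have hd : DifferentiableOn ℂ (fun s => deriv H s / H s) (ball c R) :=
    (hH.deriv isOpen_ball).div hH hne
  obtain ⟨g, hgc, hg⟩ := hd.isExactOn_ball.with_val_at c (Complex.log (H c))
  have hc := mem_ball_self (x := c) hR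
  refine ⟨g, fun s hs => (hg s hs).differentiableAt.differentiableWithinAt, fun s hs => ?_⟩
  have hconst : ∀ z ∈ ball c R, HasDerivAt (fun z => H z * cexp (-g z)) 0 z := fun z hz => by
    have h1 := (hH.differentiableAt (isOpen_ball.mem_nhds hz)).hasDerivAt
    have h2 := ((hg z hz).fun_neg).cexp
    refine (h1.mul h2).congr_deriv ?_
    rw [mul_comm (cexp _), ← mul_assoc, mul_neg, mul_div_cancel₀ _ (hne z hz)]
    ring
  have := (convex_ball c R).is_const_of_fderivWithin_eq_zero (𝕜 := ℂ)
    (f := fun z => H z * cexp (-g z))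
    (fun z hz => (hconst z hz).differentiableAt.differentiableWithinAt) (fun z hz => by
      rw [fderivWithin_of_isOpen isOpen_ball hz]
      ext
      simp [(hconst z hz).deriv]) hs hc
  simp only [hgc, Complex.exp_neg, Complex.exp_log (hne c hc)] at this
  rw [mul_inv_cancel₀ (hne c hc)] at this
  have he := Complex.exp_ne_zero (g s)
  field_simp at this
  exact this

lemma re_deriv_eq_integral {g : ℂ → ℂ} {c : ℂ} {R R' : ℝ} (hR : 0 < R) (hRR : R < R')
    (hg : DifferentiableOn ℂ g (ball c R')) :
    (deriv g c).re = (Real.pi * R)⁻¹ * ∫ θ in (0 : ℝ)..2 * Real.pi,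
      (g (circleMap c R θ)).re * Real.cos θ := by
  have hsub : closedBall c R ⊆ ball c R' := closedBall_subset_ball hRR
  have h1 := two_pi_I_inv_smul_circleIntegral_sub_sq_inv_smul_of_differentiable isOpen_ball hsub hg
    (mem_ball_self hR)
  have h2 : (∮ z in C(c, R), g z) = 0 := by
    refine DiffContOnCl.circleIntegral_eq_zero hR.le (DifferentiableOn.diffContOnCl ?_)
    rw [closure_ball _ hR.ne']
    exact hg.mono hsub
  have hcont : Continuous fun θ => g (circleMap c R θ) :=
    hg.continuousOn.comp_continuous (continuous_circleMap c R) fun θ =>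
      hsub (sphere_subset_closedBall (circleMap_mem_sphere c hR.le θ))
  have hRC : (R : ℂ) ≠ 0 := by exact_mod_cast hR.ne'
  have hpi : (Real.pi : ℂ) ≠ 0 := by exact_mod_cast Real.pi_pos.ne'
  have e1 : (∫ θ in (0 : ℝ)..2 * Real.pi, cexp (-(θ * I)) * g (circleMap c R θ)) =
      2 * Real.pi * R * deriv g c := by
    rw [← h1, circleIntegral, smul_eq_mul, ← mul_assoc, ← intervalIntegral.integral_const_mul]
    refine intervalIntegral.integral_congr fun θ _ => ?_
    simp only [deriv_circleMap, circleMap, zero_add, add_sub_cancel_left, smul_eq_mul]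
    rw [Complex.exp_neg]
    have := Complex.exp_ne_zero (θ * I)
    have := I_ne_zero
    field_simp
  have e2 : (∫ θ in (0 : ℝ)..2 * Real.pi, cexp (θ * I) * g (circleMap c R θ)) = 0 := by
    have : (∮ z in C(c, R), g z) = R * I * ∫ θ in (0 : ℝ)..2 * Real.pi, cexp (θ * I) * g (circleMap c R θ) := by
      rw [circleIntegral, ← intervalIntegral.integral_const_mul]
      refine intervalIntegral.integral_congr fun θ _ => ?_
      simp only [deriv_circleMap, circleMap_zero, smul_eq_mul]
      ring
    rw [this] at h2
    simpa [hRC] using h2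
  have e3 : (∫ θ in (0 : ℝ)..2 * Real.pi, (2 : ℂ) * (g (circleMap c R θ) * Real.cos θ)) =
      2 * Real.pi * R * deriv g c := by
    rw [← e1, ← add_zero (∫ θ in (0 : ℝ)..2 * Real.pi, cexp (-(θ * I)) * g (circleMap c R θ)), ← e2,
      ← intervalIntegral.integral_add]
    · refine intervalIntegral.integral_congr fun θ _ => ?_
      simp only [ofReal_cos, Complex.cos]
      rw [neg_mul]
      ring
    · exact (Continuous.mul (by fun_prop) hcont).intervalIntegrable _ _
    · exact (Continuous.mul (by fun_prop) hcont).intervalIntegrable _ _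
  rw [intervalIntegral.integral_const_mul] at e3
  have e4 : (∫ θ in (0 : ℝ)..2 * Real.pi, g (circleMap c R θ) * Real.cos θ) =
      Real.pi * R * deriv g c := by
    have : (2 : ℂ) ≠ 0 := two_ne_zero
    refine mul_left_cancel₀ this ?_
    rw [e3]; ring
  have e5 := Complex.reCLM.intervalIntegral_comp_comm (μ := MeasureTheory.volume)
    (a := 0) (b := 2 * Real.pi) (f := fun θ => g (circleMap c R θ) * Real.cos θ)
    ((Continuous.mul hcont (by fun_prop)).intervalIntegrable _ _)
  rw [e4] at e5
  have e6 : ∀ θ : ℝ, Complex.reCLM (g (circleMap c R θ) * Real.cos θ) =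
      (g (circleMap c R θ)).re * Real.cos θ := fun θ => by
    rw [Complex.reCLM_apply, Complex.re_mul_ofReal]
  simp_rw [e6] at e5
  rw [e5, Complex.reCLM_apply, ← ofReal_mul, Complex.re_ofReal_mul]
  field_simp

lemma integral_negPart_cos_sq : ∫ θ in (0 : ℝ)..2 * Real.pi, (max (-Real.cos θ) 0) ^ 2 = Real.pi / 2 := by
  have h0 : ∫ θ in (0 : ℝ)..2 * Real.pi, Real.cos θ * |Real.cos θ| = 0 := by
    have hIntg : ∀ a b : ℝ, IntervalIntegrable (fun θ : ℝ => Real.cos θ * |Real.cos θ|)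
      MeasureTheory.volume a b := fun a b => (by fun_prop : Continuous _).intervalIntegrable _ _
    rw [← intervalIntegral.integral_add_adjacent_intervals (hIntg 0 Real.pi) (hIntg _ _)]
    have := intervalIntegral.integral_comp_add_right (a := 0) (b := Real.pi)
      (fun θ => Real.cos θ * |Real.cos θ|) Real.pi
    rw [zero_add, ← two_mul] at this
    rw [← this]
    simp [Real.cos_add_pi]
  have h1 : ∀ θ : ℝ, (max (-Real.cos θ) 0) ^ 2 =
      2⁻¹ * Real.cos θ ^ 2 - 2⁻¹ * (Real.cos θ * |Real.cos θ|) := fun θ => by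
    rcases le_total 0 (Real.cos θ) with h | h
    · rw [max_eq_right (by linarith), abs_of_nonneg h]; ring
    · rw [max_eq_left (by linarith), abs_of_nonpos h]; ring
  simp_rw [h1]
  rw [intervalIntegral.integral_sub, intervalIntegral.integral_const_mul,
    intervalIntegral.integral_const_mul, h0, integral_cos_sq]
  · simp; ring
  · exact (by fun_prop : Continuous _).intervalIntegrable _ _
  · exact (by fun_prop : Continuous _).intervalIntegrable _ _

/-- The factor replacing `s - ρ` that has the same modulus on the circle of radius `R` about `s₀`
and does not vanish inside. -/
def reflFac (s₀ : ℂ) (R : ℝ) (ρ s : ℂ) : ℂ :=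
  if ‖s₀ - ρ‖ < R then (R ^ 2 - (starRingEnd ℂ) (ρ - s₀) * (s - s₀)) / R else s - ρ

lemma norm_reflFac {s₀ ρ s : ℂ} {R : ℝ} (hR : 0 < R) (hs : ‖s - s₀‖ = R) :
    ‖reflFac s₀ R ρ s‖ = ‖s - ρ‖ := by
  unfold reflFac
  split_ifs
  · have h1 : (R : ℂ) ^ 2 = (s - s₀) * (starRingEnd ℂ) (s - s₀) := by
      rw [Complex.mul_conj, Complex.normSq_eq_norm_sq, hs]; push_cast; rfl
    have h2 : (R : ℂ) ^ 2 - (starRingEnd ℂ) (ρ - s₀) * (s - s₀) =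
        (s - s₀) * (starRingEnd ℂ) (s - ρ) := by
      rw [h1]; simp only [map_sub]; ring
    rw [h2, norm_div, norm_mul, hs, RCLike.norm_conj, Complex.norm_real, Real.norm_of_nonneg hR.le]
    field_simp
  · rfl

lemma reflFac_ne_zero {s₀ ρ s : ℂ} {R : ℝ} (hR : 0 < R) (hs : ‖s - s₀‖ ≤ R) (hρ : ‖s₀ - ρ‖ ≠ R) :
    reflFac s₀ R ρ s ≠ 0 := by
  unfold reflFac
  split_ifs with h
  · refine div_ne_zero (fun h0 => ?_) (by exact_mod_cast hR.ne')
    rw [sub_eq_zero] at h0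
    have := congrArg norm h0
    rw [norm_pow, norm_mul, RCLike.norm_conj, Complex.norm_real, Real.norm_of_nonneg hR.le,
      norm_sub_rev ρ] at this
    nlinarith [norm_nonneg (s - s₀), norm_nonneg (s₀ - ρ)]
  · have h' : R < ‖s₀ - ρ‖ := lt_of_le_of_ne (not_lt.1 h) hρ.symm
    intro h0
    rw [sub_eq_zero] at h0
    rw [h0, norm_sub_rev] at hs
    linarith

lemma differentiable_reflFac (s₀ : ℂ) (R : ℝ) (ρ : ℂ) : Differentiable ℂ (reflFac s₀ R ρ) := by
  unfold reflFac
  split_ifs <;> fun_prop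

lemma logDeriv_reflFac {s₀ ρ : ℂ} {R : ℝ} (hR : 0 < R) :
    logDeriv (reflFac s₀ R ρ) s₀ =
      if ‖s₀ - ρ‖ < R then -(starRingEnd ℂ) (ρ - s₀) / R ^ 2 else 1 / (s₀ - ρ) := by
  have hRC : (R : ℂ) ≠ 0 := by exact_mod_cast hR.ne'
  unfold logDeriv reflFac
  simp only [Pi.div_apply]
  split_ifs
  · have : HasDerivAt (fun s => (R ^ 2 - (starRingEnd ℂ) (ρ - s₀) * (s - s₀)) / R)
        (-((starRingEnd ℂ) (ρ - s₀)) / R) s₀ := by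
      refine HasDerivAt.div_const ?_ _
      simpa using (((hasDerivAt_id s₀).sub_const s₀).const_mul ((starRingEnd ℂ) (ρ - s₀))).const_sub
        ((R : ℂ) ^ 2)
    rw [this.deriv]
    simp only [sub_self, mul_zero, sub_zero]
    field_simp
  · simp

lemma re_one_div_sub_add {s₀ ρ : ℂ} (R : ℝ) (h : s₀ ≠ ρ) :
    (1 / (s₀ - ρ) - -(starRingEnd ℂ) (ρ - s₀) / R ^ 2).re =
      (1 / (s₀ - ρ)).re * (1 - ‖s₀ - ρ‖ ^ 2 / R ^ 2) := by
  have h0 : s₀ - ρ ≠ 0 := sub_ne_zero.2 h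
  have h1 : (starRingEnd ℂ) (s₀ - ρ) = ((‖s₀ - ρ‖ ^ 2 : ℝ) : ℂ) * (1 / (s₀ - ρ)) := by
    rw [← Complex.normSq_eq_norm_sq, ← Complex.mul_conj]; field_simp
  have h2 : 1 / (s₀ - ρ) - -(starRingEnd ℂ) (ρ - s₀) / R ^ 2 =
      ((1 - ‖s₀ - ρ‖ ^ 2 / R ^ 2 : ℝ) : ℂ) * (1 / (s₀ - ρ)) := by
    have : -(starRingEnd ℂ) (ρ - s₀) = (starRingEnd ℂ) (s₀ - ρ) := by simp
    rw [this, h1]; push_cast; ring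
  rw [h2, Complex.re_ofReal_mul, mul_comm]

theorem sum_zeros_le {s₀ : ℂ} {X B b : ℝ} (hX : 0 ≤ X) (hB : 0 ≤ B) (hb : 0 ≤ b)
    (hG : DifferentiableOn ℂ G (ball s₀ 2))
    (hup : ∀ s ∈ closedBall s₀ 1, ‖G s‖ ≤ Real.exp ((0.01 + max (s₀.re - s.re) 0) * X + B))
    (hlo : ∀ s ∈ closedBall s₀ 1, s₀.re < s.re → Real.exp (-(b / (s.re - s₀.re))) ≤ ‖G s‖)
    (hzero : ∀ s ∈ closedBall s₀ 1, G s = 0 → s.re < s₀.re) (Z : Finset ℂ)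
    (hZ : ∀ ρ ∈ Z, ‖s₀ - ρ‖ ≤ 0.99 ∧ G ρ = 0) :
    ∑ ρ ∈ Z, (analyticOrderNatAt G ρ : ℝ) * ((1 / (s₀ - ρ)).re * (1 - ‖s₀ - ρ‖ ^ 2 / 0.9801)) ≤
      (logDeriv G s₀).re + 0.521 * X + 3 * (b + B) := by
  classical
  have hs₀ : s₀ ∈ closedBall s₀ 1 := mem_closedBall_self (by norm_num)
  have h0 : G s₀ ≠ 0 := fun h => lt_irrefl _ (hzero s₀ hs₀ h)
  have hpre : IsPreconnected (ball s₀ 2) := (convex_ball s₀ 2).isPreconnected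
  have hne : ∃ z ∈ ball s₀ 2, G z ≠ 0 := ⟨s₀, mem_ball_self (by norm_num), h0⟩
  have h12 : closedBall s₀ 1 ⊆ ball s₀ 2 := closedBall_subset_ball (by norm_num)
  have hfin := finite_zeros isOpen_ball hpre hG hne (isCompact_closedBall s₀ 1) h12
  set W : Finset ℂ := hfin.toFinset with hW
  have hmW : ∀ ρ, ρ ∈ W ↔ ρ ∈ closedBall s₀ 1 ∧ G ρ = 0 := fun ρ => by simp [hW]
  obtain ⟨R, ⟨hR1, hR2⟩, hRW⟩ : ∃ R ∈ Set.Ioo (0.99 : ℝ) 1, R ∉ W.image fun ρ => ‖s₀ - ρ‖ := by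
    by_contra! hcon
    exact (Set.Ioo_infinite (by norm_num : (0.99 : ℝ) < 1))
      ((W.image fun ρ => ‖s₀ - ρ‖).finite_toSet.subset fun x hx => Finset.mem_coe.2 (hcon x hx))
  have hR : 0 < R := by linarith
  have hRne : ∀ ρ ∈ W, ‖s₀ - ρ‖ ≠ R := fun ρ hρ h => hRW (Finset.mem_image.2 ⟨ρ, hρ, h⟩)
  obtain ⟨H, hHd, hHne, hGH⟩ := exists_prod_mul isOpen_ball hpre hG hne W
    fun ρ hρ => h12 ((hmW ρ).1 hρ).1
  have hH1 : ∀ s ∈ closedBall s₀ 1, H s ≠ 0 := fun s hs h => by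
    by_cases hsW : s ∈ W
    · exact hHne s hsW h
    · exact hsW ((hmW s).2 ⟨hs, by rw [hGH s (h12 hs), h, mul_zero]⟩)
  set P : ℂ → ℂ := fun s => ∏ ρ ∈ W, reflFac s₀ R ρ s ^ analyticOrderNatAt G ρ with hP
  have hPd : Differentiable ℂ P := Differentiable.fun_finsetProd fun ρ _ => (differentiable_reflFac s₀ R ρ).pow _
  set Φ : ℂ → ℂ := fun s => P s * H s with hΦ
  have hΦd : DifferentiableOn ℂ Φ (ball s₀ 2) := hPd.differentiableOn.mul hHd
  have hR1' : closedBall s₀ R ⊆ closedBall s₀ 1 := closedBall_subset_closedBall hR2.le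
  have hPne : ∀ s ∈ closedBall s₀ R, P s ≠ 0 := fun s hs =>
    Finset.prod_ne_zero_iff.2 fun ρ hρ => pow_ne_zero _
      (reflFac_ne_zero hR (mem_closedBall_iff_norm.1 hs) (hRne ρ hρ))
  have hΦne : ∀ s ∈ closedBall s₀ R, Φ s ≠ 0 := fun s hs => mul_ne_zero (hPne s hs) (hH1 s (hR1' hs))
  have hopen : IsOpen (ball s₀ 2 ∩ Φ ⁻¹' {0}ᶜ) :=
    hΦd.continuousOn.isOpen_inter_preimage isOpen_ball isOpen_compl_singleton
  obtain ⟨δ, hδ, hsub⟩ := (isCompact_closedBall s₀ R).exists_thickening_subset_open hopen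
    fun s hs => ⟨h12 (hR1' hs), hΦne s hs⟩
  rw [thickening_closedBall hδ hR.le] at hsub
  obtain ⟨g, hgd, hg⟩ := exists_exp_eq (by positivity : 0 < δ + R)
    (hΦd.mono fun s hs => (hsub hs).1) fun s hs => (hsub hs).2
  have hnorm : ∀ θ : ℝ, ‖G (circleMap s₀ R θ)‖ = Real.exp (g (circleMap s₀ R θ)).re := fun θ => by
    have hs : circleMap s₀ R θ ∈ closedBall s₀ R := sphere_subset_closedBall (circleMap_mem_sphere _ hR.le _)
    rw [← Complex.norm_exp, ← hg _ (closedBall_subset_ball (by linarith) hs), hGH _ (h12 (hR1' hs)),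
      hΦ, norm_mul, norm_mul, norm_prod, hP, norm_prod]
    congr 1
    refine Finset.prod_congr rfl fun ρ _ => ?_
    rw [norm_pow, norm_pow, norm_reflFac hR (by simp [abs_of_pos hR])]
  have hderiv : deriv g s₀ = logDeriv Φ s₀ := by
    have hs : s₀ ∈ ball s₀ (δ + R) := mem_ball_self (by positivity)
    have he : Φ =ᶠ[𝓝 s₀] fun s => cexp (g s) := by
      filter_upwards [isOpen_ball.mem_nhds hs] with s hs using hg s hs
    have h1 := ((hgd.differentiableAt (isOpen_ball.mem_nhds hs)).hasDerivAt.cexp)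
    rw [logDeriv_apply, he.deriv_eq, h1.deriv, hg s₀ hs]
    have := Complex.exp_ne_zero (g s₀)
    field_simp
  have hneρ : ∀ ρ ∈ W, s₀ ≠ ρ := fun ρ hρ h => h0 (h ▸ ((hmW ρ).1 hρ).2)
  have hHs : DifferentiableAt ℂ H s₀ := hHd.differentiableAt (isOpen_ball.mem_nhds (mem_ball_self (by norm_num)))
  have hlogG : logDeriv G s₀ = ∑ ρ ∈ W, analyticOrderNatAt G ρ * (1 / (s₀ - ρ)) + logDeriv H s₀ := by
    have he : G =ᶠ[𝓝 s₀] fun s => (∏ ρ ∈ W, (s - ρ) ^ analyticOrderNatAt G ρ) * H s := by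
      filter_upwards [isOpen_ball.mem_nhds (mem_ball_self (by norm_num : (0 : ℝ) < 2))] with s hs
        using hGH s hs
    rw [logDeriv_apply, he.deriv_eq, he.eq_of_nhds, ← logDeriv_apply, logDeriv_mul]
    · rw [logDeriv_prod]
      · congr 1
        refine Finset.sum_congr rfl fun ρ hρ => ?_
        rw [logDeriv_fun_pow (by fun_prop)]
        simp [logDeriv_apply]
      · exact fun ρ hρ => pow_ne_zero _ (sub_ne_zero.2 (hneρ ρ hρ))
      · exact fun ρ hρ => by fun_prop
    · exact Finset.prod_ne_zero_iff.2 fun ρ hρ => pow_ne_zero _ (sub_ne_zero.2 (hneρ ρ hρ))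
    · exact hH1 s₀ hs₀
    · fun_prop
    · exact hHs
  have hlogΦ : logDeriv Φ s₀ = ∑ ρ ∈ W, analyticOrderNatAt G ρ * logDeriv (reflFac s₀ R ρ) s₀ +
      logDeriv H s₀ := by
    have hsR : s₀ ∈ closedBall s₀ R := mem_closedBall_self hR.le
    rw [hΦ, logDeriv_mul _ (hPne s₀ hsR) (hH1 s₀ hs₀) (hPd s₀) hHs, hP, logDeriv_prod]
    · congr 1
      refine Finset.sum_congr rfl fun ρ hρ => ?_
      rw [logDeriv_fun_pow (differentiable_reflFac s₀ R ρ s₀)]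
    · exact fun ρ hρ => pow_ne_zero _ (reflFac_ne_zero hR (by simpa using hR.le) (hRne ρ hρ))
    · exact fun ρ hρ => ((differentiable_reflFac s₀ R ρ).pow _) s₀
  have hdiff : (logDeriv G s₀).re - (deriv g s₀).re = ∑ ρ ∈ W, (analyticOrderNatAt G ρ : ℝ) *
      (if ‖s₀ - ρ‖ < R then (1 / (s₀ - ρ)).re * (1 - ‖s₀ - ρ‖ ^ 2 / R ^ 2) else 0) := by
    rw [← Complex.sub_re, hderiv, hlogG, hlogΦ, add_sub_add_right_eq_sub, ← Finset.sum_sub_distrib,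
      Complex.re_sum]
    refine Finset.sum_congr rfl fun ρ hρ => ?_
    rw [← mul_sub, ← Complex.ofReal_natCast, Complex.re_ofReal_mul, logDeriv_reflFac hR]
    split_ifs
    · rw [re_one_div_sub_add R (hneρ ρ hρ)]
    · simp
  have hrepos : ∀ ρ ∈ W, 0 ≤ (1 / (s₀ - ρ)).re := fun ρ hρ => by
    obtain ⟨h1, h2⟩ := (hmW ρ).1 hρ
    rw [one_div, Complex.inv_re, Complex.sub_re]
    have := hzero ρ h1 h2
    exact div_nonneg (by linarith) (Complex.normSq_nonneg _)
  have hRsq : (0.9801 : ℝ) ≤ R ^ 2 := by nlinarith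
  have hZW : Z ⊆ W := fun ρ hρ => (hmW ρ).2 ⟨by
    rw [mem_closedBall_iff_norm, norm_sub_rev]; linarith [(hZ ρ hρ).1], (hZ ρ hρ).2⟩
  have hsum : ∑ ρ ∈ Z, (analyticOrderNatAt G ρ : ℝ) * ((1 / (s₀ - ρ)).re * (1 - ‖s₀ - ρ‖ ^ 2 / 0.9801)) ≤
      (logDeriv G s₀).re - (deriv g s₀).re := by
    rw [hdiff]
    refine le_trans (Finset.sum_le_sum fun ρ hρ => ?_) (Finset.sum_le_sum_of_subset_of_nonneg hZW ?_)
    · have h1 : ‖s₀ - ρ‖ < R := lt_of_le_of_lt (hZ ρ hρ).1 hR1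
      rw [if_pos h1]
      have := hrepos ρ (hZW hρ)
      gcongr
    · intro ρ hρ _
      have := hrepos ρ hρ
      split_ifs with h
      · have : ‖s₀ - ρ‖ ^ 2 / R ^ 2 ≤ 1 := by
          rw [div_le_one (by positivity)]; gcongr
        have : 0 ≤ 1 - ‖s₀ - ρ‖ ^ 2 / R ^ 2 := by linarith
        positivity
      · simp
  have hlow : -(0.521 * X + 3 * (b + B)) ≤ (deriv g s₀).re := by
    rw [re_deriv_eq_integral hR (by linarith : R < δ + R) hgd]
    have hpt : ∀ θ ∈ Set.Icc (0 : ℝ) (2 * Real.pi), -(b / R + B + 0.01 * X) - R * X * (max (-Real.cos θ) 0) ^ 2 ≤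
        (g (circleMap s₀ R θ)).re * Real.cos θ := by
      intro θ _
      have hs : circleMap s₀ R θ ∈ closedBall s₀ 1 :=
        hR1' (sphere_subset_closedBall (circleMap_mem_sphere _ hR.le _))
      have hre : (circleMap s₀ R θ).re = s₀.re + R * Real.cos θ := by
        rw [circleMap, Complex.add_re, Complex.re_ofReal_mul, Complex.exp_ofReal_mul_I_re]
      have hc1 := Real.neg_one_le_cos θ
      have hc2 := Real.cos_le_one θ
      have hbR : 0 ≤ b / R := by positivity
      rcases lt_trichotomy (Real.cos θ) 0 with h | h | h
      · have := hup _ hs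
        rw [hnorm, Real.exp_le_exp, hre, max_eq_left (by nlinarith)] at this
        rw [max_eq_left (by linarith)]
        have h3 := mul_le_mul_of_nonpos_right this h.le
        nlinarith [mul_nonneg hX (by linarith : 0 ≤ 1 + Real.cos θ), mul_nonneg hB (by linarith : 0 ≤ 1 + Real.cos θ)]
      · rw [h]; simp; nlinarith
      · have := hlo _ hs (by rw [hre]; nlinarith [mul_pos hR h])
        rw [hnorm, Real.exp_le_exp, hre, add_sub_cancel_left] at this
        rw [max_eq_right (by linarith)]
        have h3 := mul_le_mul_of_nonneg_right this h.le
        have h4 : -(b / (R * Real.cos θ)) * Real.cos θ = -(b / R) := by field_simp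
        nlinarith
    have hcont : Continuous fun θ => (g (circleMap s₀ R θ)).re * Real.cos θ := by
      refine Continuous.mul (Complex.continuous_re.comp ?_) Real.continuous_cos
      exact hgd.continuousOn.comp_continuous (continuous_circleMap s₀ R) fun θ =>
        closedBall_subset_ball (by linarith) (sphere_subset_closedBall (circleMap_mem_sphere s₀ hR.le θ))
    have hcont2 : Continuous fun θ : ℝ => R * X * (max (-Real.cos θ) 0) ^ 2 := by fun_prop
    have hIntg : ∫ θ in (0 : ℝ)..2 * Real.pi, (-(b / R + B + 0.01 * X) - R * X * (max (-Real.cos θ) 0) ^ 2) ≤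
        ∫ θ in (0 : ℝ)..2 * Real.pi, (g (circleMap s₀ R θ)).re * Real.cos θ :=
      intervalIntegral.integral_mono_on (by positivity : (0 : ℝ) ≤ 2 * Real.pi)
      ((continuous_const.sub hcont2).intervalIntegrable _ _) (hcont.intervalIntegrable _ _) hpt
    rw [intervalIntegral.integral_sub (continuous_const.intervalIntegrable _ _)
      (hcont2.intervalIntegrable _ _), intervalIntegral.integral_const_mul, integral_negPart_cos_sq,
      intervalIntegral.integral_const, sub_zero, smul_eq_mul] at hIntg
    have hpi := Real.pi_pos
    have h5 : -(0.521 * X + 3 * (b + B)) ≤ (Real.pi * R)⁻¹ *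
        (2 * Real.pi * -(b / R + B + 0.01 * X) - R * X * (Real.pi / 2)) := by
      have e : (Real.pi * R)⁻¹ * (2 * Real.pi * -(b / R + B + 0.01 * X) - R * X * (Real.pi / 2)) =
          -(2 * (b * R⁻¹ ^ 2) + 2 * (B * R⁻¹) + 0.02 * (X * R⁻¹) + X / 2) := by
        field_simp; ring
      rw [e]
      have hRi : R⁻¹ ≤ 1.02 := by
        rw [inv_le_comm₀ hR (by norm_num)]; norm_num; linarith
      have hRi0 : 0 ≤ R⁻¹ := by positivity
      have hRi2 : R⁻¹ ^ 2 ≤ 1.5 := by nlinarith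
      nlinarith [mul_le_mul_of_nonneg_left hRi hX, mul_le_mul_of_nonneg_left hRi hB,
        mul_le_mul_of_nonneg_left hRi2 hb]
    exact h5.trans (mul_le_mul_of_nonneg_left hIntg (by positivity))
  linarith

end LocalZeros

section ZeroSums
open Metric
open scoped Classical

variable {K : Type*} [Field K] [NumberField K]
variable {𝔣 : Ideal (𝓞 K)} {χ : HeckeChar K 𝔣} {L G : ℂ → ℂ}

lemma logDeriv_poleFac {s : ℂ} (hs : -2 < s.re) (h1 : s ≠ 1) :
    logDeriv (poleFac χ) s = if IsTrivialChar χ then 1 / (s - 1) - 1 / (s + 2) else 0 := by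
  have h2 : s + 2 ≠ 0 := fun h => by
    have := congrArg Complex.re h; simp at this; linarith
  have h3 : s - 1 ≠ 0 := sub_ne_zero.2 h1
  by_cases hχ : IsTrivialChar χ
  · have e : poleFac χ = fun s => (s - 1) / (s + 2) := by
      funext s; rw [poleFac, if_pos hχ]
    rw [e, if_pos hχ, logDeriv_div s h3 h2 (by fun_prop) (by fun_prop)]
    simp [logDeriv_apply]
  · have e : poleFac χ = fun _ => 1 := by
      funext s; rw [poleFac, if_neg hχ]
    rw [e, if_neg hχ, logDeriv_const]; rfl

lemma poleFac_ne_zero {s : ℂ} (hs : -2 < s.re) (h1 : s ≠ 1) : poleFac χ s ≠ 0 := by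
  have h2 : s + 2 ≠ 0 := fun h => by
    have := congrArg Complex.re h; simp at this; linarith
  unfold poleFac
  split_ifs
  · exact div_ne_zero (sub_ne_zero.2 h1) h2
  · exact one_ne_zero

lemma le_norm_poleFac {s : ℂ} (hs : 1 < s.re) : Real.exp (-(3 / (s.re - 1))) ≤ ‖poleFac χ s‖ := by
  have h0 : 0 < s.re - 1 := by linarith
  unfold poleFac
  split_ifs
  · have h2 : 0 < ‖s + 2‖ := norm_pos_iff.2 fun h => by
      have := congrArg Complex.re h; simp at this; linarith
    have h3 : (s.re - 1) / (s.re + 2) ≤ ‖(s - 1) / (s + 2)‖ := by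
      rw [norm_div, div_le_div_iff₀ (by linarith) h2]
      refine (pow_le_pow_iff_left₀ (by positivity) (by positivity) two_ne_zero).1 ?_
      rw [mul_pow, mul_pow, ← Complex.normSq_eq_norm_sq, ← Complex.normSq_eq_norm_sq,
        Complex.normSq_apply, Complex.normSq_apply]
      simp
      nlinarith [mul_nonneg (mul_self_nonneg s.im) h0.le]
    refine le_trans ?_ h3
    rw [Real.exp_neg, ← inv_div (s.re + 2)]
    refine inv_anti₀ (div_pos (by linarith) h0) ?_
    have := Real.add_one_le_exp (3 / (s.re - 1))
    refine le_trans (le_of_eq ?_) this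
    field_simp; ring
  · rw [norm_one, Real.exp_le_one_iff]
    have : 0 ≤ 3 / (s.re - 1) := by positivity
    linarith

lemma IsLFun.le_norm_entire (hL : IsLFun χ L) (hGL : ∀ s : ℂ, s ≠ 1 → G s = poleFac χ s * L s)
    {s : ℂ} (hs : 1 < s.re) : Real.exp (-((nK K + 3) / (s.re - 1))) ≤ ‖G s‖ := by
  have h0 : 0 < s.re - 1 := by linarith
  have hs1 : s ≠ 1 := fun h => by rw [h] at hs; norm_num at hs
  have hz : 0 < zetaR K s.re := zero_lt_one.trans_le (one_le_zetaR hs)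
  have h1 := one_le_norm_LSer_mul χ hs
  have h2 : zetaR K s.re ≤ Real.exp (nK K / (s.re - 1)) := by
    refine (zetaR_le hs).trans ?_
    rw [div_eq_mul_one_div (nK K : ℝ), Real.exp_nat_mul]
    refine pow_le_pow_left₀ (by positivity) ?_ _
    have := Real.add_one_le_exp (1 / (s.re - 1))
    refine le_trans (le_of_eq ?_) this
    field_simp; ring
  rw [hGL s hs1, norm_mul, hL.2 s hs,
    show -((nK K + 3) / (s.re - 1)) = -(3 / (s.re - 1)) + -(nK K / (s.re - 1)) by ring, Real.exp_add]
  refine mul_le_mul (le_norm_poleFac hs) ?_ (Real.exp_pos _).le (norm_nonneg _)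
  rw [Real.exp_neg, inv_le_iff_one_le_mul₀ (Real.exp_pos _)]
  exact h1.trans (mul_le_mul_of_nonneg_left h2 (norm_nonneg _))

lemma condLog_nonneg (h𝔣 : 𝔣 ≠ ⊥) {T : ℝ} (hT : 0 ≤ T) : 0 ≤ condLog K 𝔣 T := by
  have hD1 : (1 : ℝ) ≤ DK K := by exact_mod_cast one_le_DK
  have hN1 : (1 : ℝ) ≤ Ideal.absNorm 𝔣 := by exact_mod_cast one_le_absNorm (⟨𝔣, h𝔣⟩ : NzI K)
  have hT3 : 0 ≤ Real.log (T + 3) := Real.log_nonneg (by linarith)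
  have a1 := Real.log_nonneg hD1
  have a2 := Real.log_nonneg hN1
  rw [condLog]; positivity

lemma IsLFun.norm_entire_le_max (hL : IsLFun χ L) (h𝔣 : 𝔣 ≠ ⊥)
    (hG : ∀ s : ℂ, -2 < s.re → DifferentiableAt ℂ G s)
    (hGL : ∀ s : ℂ, s ≠ 1 → G s = poleFac χ s * L s) {T : ℝ} (hT : 0 ≤ T) {s : ℂ} {a : ℝ}
    (ha : 1 ≤ a) (h1 : -1 ≤ s.re) (h3 : |s.im| ≤ T + 2) :
    ‖G s‖ ≤ Real.exp ((0.01 + max (a - s.re) 0) * condLog K 𝔣 T + 13 * nK K) := by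
  have hX := condLog_nonneg h𝔣 hT
  have hn : (1 : ℝ) ≤ nK K := by exact_mod_cast one_le_nK
  rcases le_or_gt s.re 1.01 with h2 | h2
  · refine (hL.norm_entire_le h𝔣 hG hGL hT h1 h2 h3).trans (Real.exp_le_exp.2 ?_)
    have := mul_le_mul_of_nonneg_right
      (show 1.01 - s.re ≤ 0.01 + max (a - s.re) 0 by linarith [le_max_left (a - s.re) 0]) hX
    linarith
  · have hs1 : s ≠ 1 := fun h => by rw [h] at h2; norm_num at h2
    have hs : 1 < s.re := lt_trans (by norm_num) h2
    have h4 : zetaR K s.re ≤ Real.exp (5 * nK K) := by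
      refine (zetaR_le hs).trans ?_
      rw [mul_comm, Real.exp_nat_mul]
      refine pow_le_pow_left₀ (div_nonneg (by linarith) (by linarith)) ?_ _
      have h5 : Real.exp 5 = Real.exp 1 ^ 5 := by rw [← Real.exp_nat_mul]; norm_num
      rw [h5, div_le_iff₀ (by linarith)]
      have h6 : (101 : ℝ) ≤ Real.exp 1 ^ 5 := by
        calc (101 : ℝ) ≤ (2.7 : ℝ) ^ 5 := by norm_num
          _ ≤ _ := by gcongr; have := Real.exp_one_gt_d9; linarith
      norm_num at h2
      nlinarith
    have h2e : (2 : ℝ) ≤ Real.exp (nK K) := by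
      have := Real.add_one_le_exp (nK K : ℝ); linarith
    rw [hGL s hs1, norm_mul, hL.2 s hs]
    have hp : 0 ≤ (0.01 + max (a - s.re) 0) * condLog K 𝔣 T :=
      mul_nonneg (add_nonneg (by norm_num) (le_max_right _ _)) hX
    calc _ ≤ Real.exp (nK K) * Real.exp (5 * nK K) := by
          gcongr
          · exact (norm_poleFac_le h1).trans h2e
          · exact (norm_LSer_le χ hs).trans h4
      _ ≤ _ := by
          rw [← Real.exp_add]; apply Real.exp_le_exp.2; linarith

lemma IsLFun.sum_zeros_le_logDeriv (hL : IsLFun χ L) (h𝔣 : 𝔣 ≠ ⊥)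
    (hG : ∀ s : ℂ, -2 < s.re → DifferentiableAt ℂ G s)
    (hGL : ∀ s : ℂ, s ≠ 1 → G s = poleFac χ s * L s) {T : ℝ} (hT : 0 ≤ T) {s₀ : ℂ}
    (h1 : 1 < s₀.re) (h3 : |s₀.im| ≤ T + 1) (Z : Finset ℂ)
    (hZ : ∀ ρ ∈ Z, ‖s₀ - ρ‖ ≤ 0.99 ∧ G ρ = 0) :
    ∑ ρ ∈ Z, (analyticOrderNatAt G ρ : ℝ) * ((1 / (s₀ - ρ)).re * (1 - ‖s₀ - ρ‖ ^ 2 / 0.9801)) ≤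
      (logDeriv G s₀).re + 0.521 * condLog K 𝔣 T + 60 * nK K := by
  have hn : (1 : ℝ) ≤ nK K := by exact_mod_cast one_le_nK
  have hball : ∀ {z : ℂ} {R : ℝ}, ‖z - s₀‖ ≤ R → 1 - R < z.re ∧ |z.im| ≤ T + 1 + R := by
    intro z R hz
    have e1 := Complex.abs_re_le_norm (z - s₀)
    have e2 := Complex.abs_im_le_norm (z - s₀)
    have e3 := abs_le.1 (e1.trans hz)
    have e4 := abs_add_le (z - s₀).im s₀.im
    simp only [Complex.sub_re, Complex.sub_im] at *
    rw [sub_add_cancel] at e4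
    exact ⟨by linarith, by linarith⟩
  have := sum_zeros_le (G := G) (s₀ := s₀) (X := condLog K 𝔣 T) (B := 13 * nK K) (b := nK K + 3)
    (condLog_nonneg h𝔣 hT) (by positivity) (by positivity)
    (fun z hz => (hG z ?_).differentiableWithinAt) ?_ ?_ ?_ Z hZ
  · linarith
  · rw [mem_ball, dist_eq_norm] at hz
    linarith [(hball hz.le).1]
  · intro s hs
    rw [mem_closedBall, dist_eq_norm] at hs
    have := hball hs
    exact hL.norm_entire_le_max h𝔣 hG hGL hT h1.le (by linarith) (by linarith)
  · intro s hs hlt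
    refine le_trans (Real.exp_le_exp.2 (neg_le_neg ?_)) (hL.le_norm_entire hGL (h1.trans hlt))
    exact div_le_div_of_nonneg_left (by positivity) (by linarith) (by linarith)
  · intro s hs h0
    by_contra! hlt
    have := (Real.exp_pos _).trans_le (hL.le_norm_entire hGL (h1.trans_le hlt))
    rw [h0, norm_zero] at this
    exact lt_irrefl _ this

lemma IsLFun.logDeriv_entire (hL : IsLFun χ L) (hGL : ∀ s : ℂ, s ≠ 1 → G s = poleFac χ s * L s)
    {s : ℂ} (hs : -2 < s.re) (h1 : s ≠ 1) (h0 : L s ≠ 0) :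
    logDeriv G s = (if IsTrivialChar χ then 1 / (s - 1) - 1 / (s + 2) else 0) + logDeriv L s := by
  rw [← logDeriv_poleFac hs h1, ← logDeriv_mul s (poleFac_ne_zero hs h1) h0
    (differentiableAt_poleFac hs) (hL.1 s h1)]
  refine Filter.EventuallyEq.eq_of_nhds (logDeriv_congr_nhds ?_)
  filter_upwards [isOpen_ne.mem_nhds h1] with z hz using hGL z hz

lemma re_logDeriv_nonpos {f : ℂ → ℂ} {σ : ℝ} (hf : DifferentiableAt ℂ f σ)
    (hanti : AntitoneOn (fun x : ℝ => ‖f x‖) (Set.Ioi 1)) (hσ : 1 < σ) (h0 : f σ ≠ 0) :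
    (logDeriv f σ).re ≤ 0 := by
  have h1 : HasDerivAt (fun x : ℝ => f x) (deriv f σ) σ := hf.hasDerivAt.comp_ofReal
  have h2 : HasDerivAt (fun x : ℝ => ‖f x‖ ^ 2) (2 * inner ℝ (f σ) (deriv f σ)) σ := h1.norm_sq
  have h3 : AntitoneOn (fun x : ℝ => ‖f x‖ ^ 2) (Set.Ioi 1) := fun x hx y hy hxy =>
    pow_le_pow_left₀ (norm_nonneg _) (hanti hx hy hxy) 2
  have h4 := h2.hasDerivWithinAt.nonpos_of_antitoneOn (s := Set.Ioi 1)
    ((accPt_principal_iff_nhdsWithin).2 ?_) h3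
  · rw [Complex.inner] at h4
    rw [logDeriv_apply, Complex.div_re]
    have h5 : 0 < normSq (f σ) := normSq_pos.2 h0
    rw [← add_div]
    refine div_nonpos_of_nonpos_of_nonneg ?_ h5.le
    simp at h4
    linarith
  · refine NeBot.mono (inferInstance : (𝓝[>] σ).NeBot) ?_
    refine nhdsWithin_mono _ fun x hx => ?_
    have : σ < x := hx
    exact ⟨hσ.trans this, by simpa using this.ne'⟩

lemma IsLFun.re_logDeriv_le (hL : IsLFun χ L) {Z : ℂ → ℂ} (hZ : IsLFun (HeckeChar.triv K) Z)
    {s : ℂ} (hs : 1 < s.re) : (logDeriv L s).re ≤ -(logDeriv Z s.re).re := by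
  set f : ℂ → ℂ := fun z => L (z + s.im * I) * Z z with hf
  have hline : ∀ x : ℝ, (x + s.im * I : ℂ).re = x := fun x => by simp
  have hs1 : s ≠ 1 := fun h => by rw [h] at hs; norm_num at hs
  have hr1 : (s.re : ℂ) ≠ 1 := fun h => by
    have := congrArg Complex.re h; simp at this; linarith
  have hse : (s.re : ℂ) + s.im * I = s := Complex.re_add_im s
  have hd1 : DifferentiableAt ℂ (fun z => L (z + s.im * I)) s.re := by
    refine DifferentiableAt.fun_comp' (s.re : ℂ) ?_ (by fun_prop)
    rw [hse]; exact hL.1 s hs1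
  have hd2 := hZ.1 _ hr1
  have hL0 : L s ≠ 0 := by rw [hL.2 s hs]; exact LSer_ne_zero χ hs
  have hZ0 : Z s.re ≠ 0 := by rw [hZ.2 _ (by simpa using hs)]; exact LSer_ne_zero _ (by simpa using hs)
  have h0 : f s.re ≠ 0 := by rw [hf]; beta_reduce; rw [hse]; exact mul_ne_zero hL0 hZ0
  have hanti : AntitoneOn (fun x : ℝ => ‖f x‖) (Set.Ioi 1) := by
    have e : ∀ x : ℝ, 1 < x → ‖f x‖ = ‖LSer χ (x + s.im * I)‖ * zetaR K (x + s.im * I : ℂ).re := by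
      intro x hx
      rw [hf]; beta_reduce
      rw [norm_mul, hL.2 _ (by rw [hline]; exact hx), hZ.2 _ (by simpa using hx), LSer_triv_ofReal,
        hline, Complex.norm_real, Real.norm_of_nonneg (zero_le_one.trans (one_le_zetaR hx))]
    intro x hx y hy hxy
    beta_reduce
    rw [e x hx, e y hy]
    exact norm_LSer_mul_zetaR_anti χ (by rw [hline]; exact hx) (by rw [hline, hline]; exact hxy) (by simp)
  have h1 := re_logDeriv_nonpos (hd1.fun_mul hd2) hanti hs h0
  rw [logDeriv_mul (s.re : ℂ) (by rw [hse]; exact hL0) hZ0 hd1 hd2] at h1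
  have h2 : logDeriv (fun z => L (z + s.im * I)) s.re = logDeriv L s := by
    rw [logDeriv_apply, logDeriv_apply, deriv_comp_add_const, hse]
  rw [h2, Complex.add_re] at h1
  linarith

/-- Logarithm of the analytic conductor, without the linear term in the degree. -/
def baseLog (K : Type*) [Field K] [NumberField K] (𝔣 : Ideal (𝓞 K)) (T : ℝ) : ℝ :=
  2 * Real.log (DK K) + Real.log (Ideal.absNorm 𝔣) + nK K * Real.log (T + 3)

lemma condLog_add_le {T : ℝ} (hT : 0 ≤ T) :
    condLog K 𝔣 T + condLog K ⊤ 0 ≤ baseLog K 𝔣 T + nK K := by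
  have hD1 : (1 : ℝ) ≤ DK K := by exact_mod_cast one_le_DK
  have hT3 : 0 ≤ Real.log (T + 3) := Real.log_nonneg (by linarith)
  have a1 := Real.log_nonneg hD1
  have h3 : Real.log 3 ≤ 1.2 := by
    rw [Real.log_le_iff_le_exp (by norm_num)]
    have h6 := Real.exp_one_gt_d9
    have h5 : Real.exp 1.2 = Real.exp 1 * Real.exp 0.2 := by rw [← Real.exp_add]; norm_num
    have h7 := Real.add_one_le_exp (0.2 : ℝ)
    rw [h5]; norm_num at h7 h6 ⊢; nlinarith
  have hn : (0 : ℝ) ≤ nK K := by positivity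
  rw [condLog, condLog, baseLog]
  norm_num at h3 ⊢
  nlinarith [mul_nonneg hn hT3]

lemma re_one_div_sub_le {s : ℂ} (hs : 1 < s.re) :
    (if IsTrivialChar χ then 1 / (s - 1) - 1 / (s + 2) else 0 : ℂ).re ≤ 1 / (s.re - 1) := by
  have h0 : 0 < s.re - 1 := by linarith
  split_ifs
  · rw [Complex.sub_re]
    have h1 : (1 / (s - 1)).re ≤ 1 / (s.re - 1) := by
      refine (Complex.re_le_norm _).trans ?_
      rw [norm_div, norm_one]
      refine one_div_le_one_div_of_le h0 ?_
      have := Complex.re_le_norm (s - 1)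
      simpa using this
    have h2 : 0 ≤ (1 / (s + 2)).re := by
      rw [one_div, Complex.inv_re]
      refine div_nonneg ?_ (normSq_nonneg _)
      simp; linarith
    linarith
  · simp; linarith

theorem IsLFun.sum_zeros_le_baseLog (hL : IsLFun χ L) (h𝔣 : 𝔣 ≠ ⊥)
    (hG : ∀ s : ℂ, -2 < s.re → DifferentiableAt ℂ G s)
    (hGL : ∀ s : ℂ, s ≠ 1 → G s = poleFac χ s * L s) {T : ℝ} (hT : 0 ≤ T) {s₀ : ℂ}
    (h1 : 1 < s₀.re) (h3 : |s₀.im| ≤ T + 1) (Z : Finset ℂ)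
    (hZ : ∀ ρ ∈ Z, ‖s₀ - ρ‖ ≤ 0.99 ∧ G ρ = 0) :
    ∑ ρ ∈ Z, (analyticOrderNatAt G ρ : ℝ) * ((1 / (s₀ - ρ)).re * (1 - ‖s₀ - ρ‖ ^ 2 / 0.9801)) ≤
      0.521 * baseLog K 𝔣 T + 121 * nK K + 2 / (s₀.re - 1) := by
  obtain ⟨ζ, hζ⟩ := exists_isLFun_triv K
  obtain ⟨Gζ, hGζ, hGζL⟩ := hζ.exists_entire top_ne_bot
  have hr : (1 : ℝ) < ((s₀.re : ℂ)).re := by simpa using h1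
  have e1 := hζ.sum_zeros_le_logDeriv top_ne_bot hGζ hGζL le_rfl hr (by simp) ∅ (by simp)
  have ne : ∀ s : ℂ, 1 < s.re → s ≠ 1 := fun s hs h => by rw [h] at hs; norm_num at hs
  have hL0 : L s₀ ≠ 0 := by rw [hL.2 _ h1]; exact LSer_ne_zero χ h1
  have hζ0 : ζ s₀.re ≠ 0 := by rw [hζ.2 _ hr]; exact LSer_ne_zero _ hr
  rw [Finset.sum_empty, hζ.logDeriv_entire hGζL (by linarith) (ne _ hr) hζ0, Complex.add_re] at e1
  have e2 := re_one_div_sub_le (χ := HeckeChar.triv K) hr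
  have e3 := hL.sum_zeros_le_logDeriv h𝔣 hG hGL hT h1 h3 Z hZ
  rw [hL.logDeriv_entire hGL (by linarith) (ne _ h1) hL0, Complex.add_re] at e3
  have e4 := re_one_div_sub_le (χ := χ) h1
  have e5 := hL.re_logDeriv_le hζ h1
  have e6 := condLog_add_le (𝔣 := 𝔣) hT
  rw [Complex.ofReal_re] at e2
  have e7 : 2 / (s₀.re - 1) = 1 / (s₀.re - 1) + 1 / (s₀.re - 1) := by ring
  have hn : (1 : ℝ) ≤ nK K := by exact_mod_cast one_le_nK
  norm_num at e1 e3 e6 ⊢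
  rw [e7]
  norm_num at e2 e4 ⊢
  linarith

end ZeroSums

section LocalExpansion
open Metric
variable {G : ℂ → ℂ}

lemma iteratedDeriv_inv_sub (k : ℕ) (ρ c : ℂ) :
    iteratedDeriv k (fun s => (s - ρ)⁻¹) c = (-1) ^ k * k.factorial * ((c - ρ) ^ (k + 1))⁻¹ := by
  have h := congrFun (iter_deriv_inv_linear_sub k (1 : ℂ) ρ) c
  simp only [one_mul, one_pow, mul_one] at h
  rw [iteratedDeriv_eq_iterate, h]
  congr 1
  rw [← zpow_natCast, ← zpow_neg]
  congr 1; push_cast; ring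

lemma norm_iteratedDeriv_log_le {c : ℂ} {A D : ℝ} {g : ℂ → ℂ} (hAD : 0 < A + D)
    (hg : DifferentiableOn ℂ g (ball c (1 / 2))) (hup : ∀ s ∈ ball c (1 / 2), (g s).re ≤ A)
    (hlo : -D ≤ (g c).re) (k : ℕ) :
    ‖iteratedDeriv (k + 1) g c‖ ≤ (k + 1).factorial * (8 * (A + D)) / 0.4 ^ (k + 1) := by
  have hmap : ∀ z ∈ ball (0 : ℂ) (1 / 2), c + z ∈ ball c (1 / 2) := fun z hz => by
    simpa [dist_eq_norm] using hz
  have hBC := fun z (hz : z ∈ ball (0 : ℂ) (1 / 2)) =>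
    Complex.borelCaratheodory_zero (f := fun z => g (c + z) - g c) hAD
      ((hg.comp (by fun_prop) hmap).sub_const _)
      (fun z hz => by
        have := hup _ (hmap z hz)
        simp only [Set.mem_ofPred_eq, Complex.sub_re]; linarith) (by norm_num) hz (by simp)
  have hd : ∀ s ∈ ball c (1 / 2), DifferentiableAt ℂ g s := fun s hs =>
    (hg s hs).differentiableAt (isOpen_ball.mem_nhds hs)
  have hsub : closedBall c 0.4 ⊆ ball c (1 / 2) := closedBall_subset_ball (by norm_num)
  have hk : iteratedDeriv (k + 1) g c = iteratedDeriv (k + 1) (fun s => g s - g c) c := by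
    rw [iteratedDeriv_succ', iteratedDeriv_succ']
    congr 1; funext s; simp
  rw [hk]
  refine Complex.norm_iteratedDeriv_le_of_forall_mem_sphere_norm_le (k + 1) (by norm_num)
    (DifferentiableOn.diffContOnCl ?_) fun z hz => ?_
  · exact ((hg.sub_const _).mono (closure_ball_subset_closedBall.trans hsub))
  · have hz' : ‖z - c‖ = 0.4 := by simpa [dist_eq_norm] using hz
    have := hBC (z - c) (by rw [mem_ball_zero_iff, hz']; norm_num)
    rw [add_sub_cancel, hz'] at this
    refine this.trans (le_of_eq ?_)
    ring_nf

theorem exists_zeros_expansion {c : ℂ} {A D : ℝ} (hG : DifferentiableOn ℂ G (ball c 2))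
    (hup : ∀ s ∈ closedBall c 1, ‖G s‖ ≤ Real.exp A) (hlo : Real.exp (-D) ≤ ‖G c‖)
    (hAD : 0 < A + D) :
    ∃ Z : Finset ℂ, (∀ ρ, ρ ∈ Z ↔ ‖c - ρ‖ ≤ 1 / 2 ∧ G ρ = 0) ∧
      ∀ k : ℕ, ContDiffAt ℂ k (logDeriv G) c ∧ ∃ e : ℂ,
        ‖e‖ ≤ (k + 1).factorial * (8 * (A + D)) / 0.4 ^ (k + 1) ∧
        iteratedDeriv k (logDeriv G) c = ∑ ρ ∈ Z, (analyticOrderNatAt G ρ : ℂ) *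
          ((-1) ^ k * k.factorial * ((c - ρ) ^ (k + 1))⁻¹) + e := by
  have hc2 : c ∈ ball c 2 := mem_ball_self (by norm_num)
  have hGc : G c ≠ 0 := fun h => by
    rw [h, norm_zero] at hlo; exact absurd hlo (not_le.2 (Real.exp_pos _))
  have hconn : IsPreconnected (ball c 2) := (convex_ball c 2).isPreconnected
  have hfin := finite_zeros isOpen_ball hconn hG ⟨c, hc2, hGc⟩
    (isCompact_closedBall c (1 / 2)) (closedBall_subset_ball (by norm_num))
  set Z := hfin.toFinset with hZdef
  have hZ : ∀ ρ, ρ ∈ Z ↔ ‖c - ρ‖ ≤ 1 / 2 ∧ G ρ = 0 := fun ρ => by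
    rw [hZdef, Set.Finite.mem_toFinset, Set.mem_ofPred_eq, mem_closedBall, dist_comm,
      dist_eq_norm]
  have hZ2 : ∀ ρ ∈ Z, ρ ∈ ball c 2 := fun ρ hρ => by
    rw [mem_ball, dist_comm, dist_eq_norm]; linarith [((hZ ρ).1 hρ).1]
  obtain ⟨H, hH, hHρ, hGH⟩ := exists_prod_mul isOpen_ball hconn hG ⟨c, hc2, hGc⟩ Z hZ2
  have hcρ : ∀ ρ ∈ Z, c - ρ ≠ 0 := fun ρ hρ h => hGc (by
    rw [sub_eq_zero.1 h]; exact ((hZ ρ).1 hρ).2)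
  set P : ℂ := ∏ ρ ∈ Z, (c - ρ) ^ analyticOrderNatAt G ρ with hP
  have hP0 : P ≠ 0 := Finset.prod_ne_zero_iff.2 fun ρ hρ => pow_ne_zero _ (hcρ ρ hρ)
  have hHne : ∀ s ∈ ball c (1 / 2), P * H s ≠ 0 := fun s hs h => by
    have h0 : H s = 0 := (mul_eq_zero.1 h).resolve_left hP0
    have hs2 : s ∈ ball c 2 := ball_subset_ball (by norm_num) hs
    have hGs : G s = 0 := by rw [hGH s hs2, h0, mul_zero]
    refine hHρ s ((hZ s).2 ⟨?_, hGs⟩) h0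
    rw [mem_ball, dist_comm, dist_eq_norm] at hs; exact hs.le
  have hmax : ∀ s ∈ closedBall c 1, ‖P * H s‖ ≤ Real.exp A := by
    intro s hs
    refine Complex.norm_le_of_forall_mem_frontier_norm_le (U := ball c 1) isBounded_ball
      (DifferentiableOn.diffContOnCl ((hH.const_mul P).mono
        (closure_ball_subset_closedBall.trans (closedBall_subset_ball (by norm_num)))))
      (fun z hz => ?_) (by rwa [closure_ball c one_ne_zero])
    rw [frontier_ball c one_ne_zero] at hz
    have hz1 : ‖z - c‖ = 1 := by simpa [dist_eq_norm] using hz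
    have hz2 : z ∈ ball c 2 := by rw [mem_ball, dist_eq_norm, hz1]; norm_num
    refine le_trans ?_ (hup z (sphere_subset_closedBall hz))
    rw [hGH z hz2, norm_mul, norm_mul, hP, norm_prod, norm_prod]
    refine mul_le_mul_of_nonneg_right (Finset.prod_le_prod (fun _ _ => norm_nonneg _)
      fun ρ hρ => ?_) (norm_nonneg _)
    rw [norm_pow, norm_pow]
    refine pow_le_pow_left₀ (norm_nonneg _) ?_ _
    have h1 := ((hZ ρ).1 hρ).1
    have h2 := norm_sub_norm_le (z - c) (ρ - c)
    rw [sub_sub_sub_cancel_right, hz1, norm_sub_rev ρ c] at h2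
    linarith
  have hball : ball c (1 / 2) ⊆ ball c 2 := ball_subset_ball (by norm_num)
  obtain ⟨g, hg, hgH⟩ := exists_exp_eq (by norm_num : (0 : ℝ) < 1 / 2)
    ((hH.const_mul P).mono hball) hHne
  have hg1 := norm_iteratedDeriv_log_le hAD hg (fun s hs => by
      have := hmax s (ball_subset_closedBall (ball_subset_ball (by norm_num) hs))
      rwa [hgH s hs, Complex.norm_exp, Real.exp_le_exp] at this) (by
      rw [← Real.exp_le_exp, ← Complex.norm_exp, ← hgH c (mem_ball_self (by norm_num)), hP,
        ← hGH c hc2]; exact hlo)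
  have hgan : AnalyticAt ℂ g c := hg.analyticAt (ball_mem_nhds c (by norm_num))
  have hev : logDeriv G =ᶠ[𝓝 c] fun s =>
      (∑ ρ ∈ Z, (analyticOrderNatAt G ρ : ℂ) * (s - ρ)⁻¹) + deriv g s := by
    have h1 : ∀ᶠ s in 𝓝 c, s ∉ Z := (Z.finite_toSet.isClosed.isOpen_compl).mem_nhds fun h =>
      hcρ c h (sub_self c)
    filter_upwards [h1, ball_mem_nhds c (show (0 : ℝ) < 1 / 2 by norm_num)] with s hs hsb
    have hsρ : ∀ ρ ∈ Z, s - ρ ≠ 0 := fun ρ hρ h => hs (sub_eq_zero.1 h ▸ hρ)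
    have he : G =ᶠ[𝓝 s] fun s => (∏ ρ ∈ Z, (s - ρ) ^ analyticOrderNatAt G ρ) *
        (P⁻¹ * cexp (g s)) := by
      filter_upwards [isOpen_ball.mem_nhds hsb] with z hz
      rw [hGH z (hball hz), ← hgH z hz, inv_mul_cancel_left₀ hP0]
    have hgs : DifferentiableAt ℂ g s := (hg s hsb).differentiableAt (isOpen_ball.mem_nhds hsb)
    rw [(logDeriv_congr_nhds he).eq_of_nhds, logDeriv_mul
      (f := fun s => ∏ ρ ∈ Z, (s - ρ) ^ analyticOrderNatAt G ρ) (g := fun s => P⁻¹ * cexp (g s)) s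
      (Finset.prod_ne_zero_iff.2 fun ρ hρ => pow_ne_zero _ (hsρ ρ hρ))
      (mul_ne_zero (inv_ne_zero hP0) (Complex.exp_ne_zero _))
      (by fun_prop) (by fun_prop), logDeriv_prod (f := fun ρ s => (s - ρ) ^ analyticOrderNatAt G ρ) (fun ρ hρ => pow_ne_zero _ (hsρ ρ hρ))
      (fun ρ _ => by fun_prop)]
    congr 1
    · refine Finset.sum_congr rfl fun ρ hρ => ?_
      rw [logDeriv_fun_pow (f := fun s => s - ρ) (by fun_prop)]
      simp [logDeriv_apply]
    · rw [logDeriv_const_mul s _ (inv_ne_zero hP0), logDeriv_apply]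
      rw [(hgs.hasDerivAt.cexp).deriv]
      field_simp
  have hcd : ∀ (k : ℕ) (ρ : ℂ), ρ ∈ Z →
      ContDiffAt ℂ k (fun s => (analyticOrderNatAt G ρ : ℂ) * (s - ρ)⁻¹) c := fun k ρ hρ =>
    contDiffAt_const.mul ((contDiffAt_id.sub contDiffAt_const).inv (hcρ ρ hρ))
  have hcs : ∀ k : ℕ, ContDiffAt ℂ k
      (fun s => ∑ ρ ∈ Z, (analyticOrderNatAt G ρ : ℂ) * (s - ρ)⁻¹) c := fun k =>
    ContDiffAt.sum (hcd k)
  have hcg : ∀ k : ℕ, ContDiffAt ℂ k (deriv g) c := fun k => hgan.deriv.contDiffAt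
  refine ⟨Z, hZ, fun k => ⟨((hcs k).add (hcg k)).congr_of_eventuallyEq hev,
    iteratedDeriv (k + 1) g c, hg1 k, ?_⟩⟩
  rw [hev.iteratedDeriv_eq, iteratedDeriv_fun_add (hcs k) (hcg k), iteratedDeriv_fun_sum (hcd k),
    ← iteratedDeriv_succ']
  congr 1
  refine Finset.sum_congr rfl fun ρ hρ => ?_
  rw [iteratedDeriv_const_mul_field, iteratedDeriv_inv_sub]

end LocalExpansion

section CountZeros
open Metric

lemma re_pair_poly {u w : ℝ} (hu : 1.3 ≤ u) (hw : 0 ≤ w) (h : (u - 0.3) ^ 2 + w ≤ 14.44) :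
    0.187 * ((u ^ 2 + w + 4.84) ^ 2 - 19.36 * w) ≤ u * (u ^ 2 + w + 4.84) := by
  have hu4 : u ≤ 4.1 := by nlinarith
  have hb : 0 ≤ (u - 1.3) * (4.1 - u) := mul_nonneg (by linarith) (by linarith)
  have h0 : 0 ≤ (u ^ 2 + 4.84) * (u - 0.187 * (u ^ 2 + 4.84)) :=
    mul_nonneg (by positivity) (by nlinarith)
  set c := u - 0.374 * (u ^ 2 + 4.84) + 0.187 * 19.36 with hc
  have e1 : u * (u ^ 2 + w + 4.84) - 0.187 * ((u ^ 2 + w + 4.84) ^ 2 - 19.36 * w) =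
      (u ^ 2 + 4.84) * (u - 0.187 * (u ^ 2 + 4.84)) + w * (c - 0.187 * w) := by
    rw [hc]; ring
  rcases le_total (0.187 * w) c with h1 | h1
  · have := mul_nonneg hw (sub_nonneg.2 h1)
    linarith
  · set W := 14.44 - (u - 0.3) ^ 2 with hW
    have hwW : 0 ≤ W - w := by rw [hW]; linarith
    have e2 : (u ^ 2 + 4.84) * (u - 0.187 * (u ^ 2 + 4.84)) + w * (c - 0.187 * w) =
        (u * (19.19 + 0.6 * u) - 0.187 * ((19.19 + 0.6 * u) ^ 2 -
          19.36 * (14.35 + 0.6 * u - u ^ 2))) + (W - w) * (0.187 * (w + W) - c) := by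
      rw [hW, hc]; ring
    have h2 : 0 ≤ (W - w) * (0.187 * (w + W) - c) := mul_nonneg hwW (by linarith)
    nlinarith

lemma re_pair_ge {r : ℝ} (hr : 0 < r) {z : ℂ} (hz : r ≤ z.re) (hz' : ‖z‖ ≤ 3.8 * r) :
    0.374 / r ≤ (1 / (z + ((0.3 * r : ℝ) + (2.2 * r : ℝ) * I))).re +
      (1 / (z + ((0.3 * r : ℝ) - (2.2 * r : ℝ) * I))).re := by
  obtain ⟨u, hu⟩ : ∃ u, z.re = r * (u - 0.3) := ⟨z.re / r + 0.3, by field_simp; ring⟩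
  obtain ⟨y, hy⟩ : ∃ y, z.im = r * y := ⟨z.im / r, by field_simp⟩
  have hu1 : 1.3 ≤ u := by
    rw [hu] at hz
    by_contra hlt
    nlinarith [mul_lt_mul_of_pos_left (show u - 0.3 < 1 by linarith) hr]
  have hn : (u - 0.3) ^ 2 + y ^ 2 ≤ 14.44 := by
    have h1 : ‖z‖ ^ 2 ≤ (3.8 * r) ^ 2 := pow_le_pow_left₀ (norm_nonneg _) hz' 2
    rw [Complex.sq_norm, Complex.normSq_apply, hu, hy] at h1
    have h2 : r ^ 2 * ((u - 0.3) ^ 2 + y ^ 2) ≤ r ^ 2 * 14.44 := by nlinarith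
    exact le_of_mul_le_mul_left h2 (by positivity)
  have hp := re_pair_poly hu1 (sq_nonneg y) hn
  have hu0 : 0 < u := by linarith
  have key : ∀ (w : ℂ) (v : ℝ), w.re = r * u → w.im = r * v →
      (1 / w).re = u / (r * (u ^ 2 + v ^ 2)) := fun w v h1 h2 => by
    rw [one_div, Complex.inv_re, Complex.normSq_apply, h1, h2]
    have : 0 < u ^ 2 + v ^ 2 := by positivity
    have h3 : r * u * (r * u) + r * v * (r * v) = r * (r * (u ^ 2 + v ^ 2)) := by ring
    rw [h3, mul_div_mul_left _ _ hr.ne']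
  have e1 := key (z + ((0.3 * r : ℝ) + (2.2 * r : ℝ) * I)) (y + 2.2)
    (by simp [hu]; ring) (by simp [hy]; ring)
  have e2 := key (z + ((0.3 * r : ℝ) - (2.2 * r : ℝ) * I)) (y - 2.2)
    (by simp [hu]; ring) (by simp [hy]; ring)
  have hd1 : 0 < u ^ 2 + (y + 2.2) ^ 2 := by positivity
  have hd2 : 0 < u ^ 2 + (y - 2.2) ^ 2 := by positivity
  rw [e1, e2, div_add_div _ _ (by positivity) (by positivity), div_le_div_iff₀ hr (by positivity)]
  have hprod : (u ^ 2 + (y + 2.2) ^ 2) * (u ^ 2 + (y - 2.2) ^ 2) =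
      (u ^ 2 + y ^ 2 + 4.84) ^ 2 - 19.36 * y ^ 2 := by ring
  have : 0.374 * (r * (u ^ 2 + (y + 2.2) ^ 2) * (r * (u ^ 2 + (y - 2.2) ^ 2))) =
      r ^ 2 * (2 * (0.187 * ((u ^ 2 + y ^ 2 + 4.84) ^ 2 - 19.36 * y ^ 2))) := by
    rw [← hprod]; ring
  rw [this]
  have h3 : (u * (r * (u ^ 2 + (y - 2.2) ^ 2)) + r * (u ^ 2 + (y + 2.2) ^ 2) * u) * r =
      r ^ 2 * (2 * (u * (u ^ 2 + y ^ 2 + 4.84))) := by ring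
  rw [h3]
  exact mul_le_mul_of_nonneg_left (by linarith) (by positivity)

variable {K : Type*} [Field K] [NumberField K]
variable {𝔣 : Ideal (𝓞 K)} {χ : HeckeChar K 𝔣} {L G : ℂ → ℂ}

lemma IsLFun.re_zero_le (hL : IsLFun χ L) (hGL : ∀ s : ℂ, s ≠ 1 → G s = poleFac χ s * L s)
    {ρ : ℂ} (hρ : G ρ = 0) : ρ.re ≤ 1 := by
  by_contra h
  have := hL.le_norm_entire hGL (not_le.1 h)
  rw [hρ, norm_zero] at this
  exact absurd this (not_le.2 (Real.exp_pos _))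

theorem IsLFun.card_zeros_le (hL : IsLFun χ L) (h𝔣 : 𝔣 ≠ ⊥)
    (hG : ∀ s : ℂ, -2 < s.re → DifferentiableAt ℂ G s)
    (hGL : ∀ s : ℂ, s ≠ 1 → G s = poleFac χ s * L s) {T r : ℝ} (hT : 0 ≤ T) (hr : 0 < r)
    (hr' : r < 1 / 16) {ξ : ℂ} (h1 : ξ.re = 1 + r) (h2 : |ξ.im| ≤ T) (Z : Finset ℂ)
    (hZ : ∀ ρ ∈ Z, ‖ξ - ρ‖ ≤ 3.8 * r ∧ G ρ = 0) :
    (∑ ρ ∈ Z, (analyticOrderNatAt G ρ : ℝ)) * (0.187 * (1 - 37 * r ^ 2)) ≤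
      r * (0.521 * baseLog K 𝔣 T + 121 * nK K) + 2 := by
  have key : ∀ t : ℝ, |t| = 2.2 * r → ∀ s : ℂ, s = ξ + ((0.3 * r : ℝ) + (t : ℝ) * I) →
      ∑ ρ ∈ Z, (analyticOrderNatAt G ρ : ℝ) * ((1 / (s - ρ)).re * (1 - 37 * r ^ 2)) ≤
      0.521 * baseLog K 𝔣 T + 121 * nK K + 2 / (1.3 * r) := by
    intro t ht s hs
    have hsre : s.re = 1 + 1.3 * r := by rw [hs]; simp [h1]; ring
    have hsim : s.im = ξ.im + t := by rw [hs]; simp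
    have hdist : ∀ ρ ∈ Z, ‖s - ρ‖ ≤ 6.0206 * r := fun ρ hρ => by
      have h3 : s - ρ = (ξ - ρ) + ((0.3 * r : ℝ) + (t : ℝ) * I) := by rw [hs]; ring
      have h4 : ‖((0.3 * r : ℝ) : ℂ) + (t : ℝ) * I‖ ≤ 2.2206 * r := by
        rw [Complex.norm_add_mul_I]
        refine Real.sqrt_le_iff.2 ⟨by positivity, ?_⟩
        rw [← sq_abs t, ht]; nlinarith [mul_pos hr hr]
      rw [h3]
      exact (norm_add_le _ _).trans (by linarith [(hZ ρ hρ).1])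
    have := hL.sum_zeros_le_baseLog h𝔣 hG hGL hT (s₀ := s) (by rw [hsre]; linarith) (by
      rw [hsim]; refine (abs_add_le _ _).trans ?_; rw [ht]; linarith) Z fun ρ hρ =>
        ⟨(hdist ρ hρ).trans (by linarith), (hZ ρ hρ).2⟩
    rw [hsre, add_sub_cancel_left] at this
    refine le_trans (Finset.sum_le_sum fun ρ hρ => ?_) this
    refine mul_le_mul_of_nonneg_left (mul_le_mul_of_nonneg_left ?_ ?_) (Nat.cast_nonneg _)
    · have := pow_le_pow_left₀ (norm_nonneg _) (hdist ρ hρ) 2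
      have : ‖s - ρ‖ ^ 2 / 0.9801 ≤ 37 * r ^ 2 := by
        rw [div_le_iff₀ (by norm_num)]; nlinarith [mul_pos hr hr]
      linarith
    · rw [one_div, Complex.inv_re]
      refine div_nonneg ?_ (normSq_nonneg _)
      rw [Complex.sub_re, hsre]; linarith [hL.re_zero_le hGL (hZ ρ hρ).2]
  have ka := key (2.2 * r) (abs_of_pos (by positivity)) _ rfl
  have kb := key (-(2.2 * r)) (by rw [abs_neg]; exact abs_of_pos (by positivity)) _ rfl
  have hq : 0 ≤ 1 - 37 * r ^ 2 := by nlinarith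
  have hsum : (∑ ρ ∈ Z, (analyticOrderNatAt G ρ : ℝ)) * (0.374 / r * (1 - 37 * r ^ 2)) ≤
      2 * (0.521 * baseLog K 𝔣 T + 121 * nK K + 2 / (1.3 * r)) := by
    refine le_trans ?_ ((add_le_add ka kb).trans_eq (two_mul _).symm)
    rw [Finset.sum_mul, ← Finset.sum_add_distrib]
    refine Finset.sum_le_sum fun ρ hρ => ?_
    rw [← mul_add, ← add_mul]
    refine mul_le_mul_of_nonneg_left (mul_le_mul_of_nonneg_right ?_ hq) (Nat.cast_nonneg _)
    have hre : r ≤ (ξ - ρ).re := by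
      rw [Complex.sub_re, h1]; linarith [hL.re_zero_le hGL (hZ ρ hρ).2]
    refine (re_pair_ge hr hre (hZ ρ hρ).1).trans_eq ?_
    congr 3 <;> push_cast <;> ring_nf
  have h3 := mul_le_mul_of_nonneg_left hsum (show 0 ≤ r / 2 by positivity)
  have h4 : r / 2 * ((∑ ρ ∈ Z, (analyticOrderNatAt G ρ : ℝ)) * (0.374 / r * (1 - 37 * r ^ 2))) =
      (∑ ρ ∈ Z, (analyticOrderNatAt G ρ : ℝ)) * (0.187 * (1 - 37 * r ^ 2)) := by
    field_simp; ring
  have h5 : r / 2 * (2 * (0.521 * baseLog K 𝔣 T + 121 * nK K + 2 / (1.3 * r))) =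
      r * (0.521 * baseLog K 𝔣 T + 121 * nK K) + 2 / 1.3 := by
    field_simp
  rw [h4, h5] at h3
  norm_num at h3 ⊢
  linarith

theorem IsLFun.sum_inv_sq_le (hL : IsLFun χ L) (h𝔣 : 𝔣 ≠ ⊥)
    (hG : ∀ s : ℂ, -2 < s.re → DifferentiableAt ℂ G s)
    (hGL : ∀ s : ℂ, s ≠ 1 → G s = poleFac χ s * L s) {T r : ℝ} (hT : 0 ≤ T) (hr : 0 < r)
    {ξ : ℂ} (h1 : ξ.re = 1 + r) (h2 : |ξ.im| ≤ T) (Z : Finset ℂ)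
    (hZ : ∀ ρ ∈ Z, ‖ξ - ρ‖ ≤ 1 / 2 ∧ G ρ = 0) :
    0.74 * ∑ ρ ∈ Z, (analyticOrderNatAt G ρ : ℝ) * ‖(r : ℂ) / (ξ - ρ)‖ ^ 2 ≤
      r * (0.521 * baseLog K 𝔣 T + 121 * nK K) + 2 := by
  have := hL.sum_zeros_le_baseLog h𝔣 hG hGL hT (s₀ := ξ) (by rw [h1]; linarith) (by linarith)
    Z fun ρ hρ => ⟨(hZ ρ hρ).1.trans (by norm_num), (hZ ρ hρ).2⟩
  rw [h1, add_sub_cancel_left] at this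
  have h3 := mul_le_mul_of_nonneg_left this hr.le
  have h4 : r * (0.521 * baseLog K 𝔣 T + 121 * nK K + 2 / r) =
      r * (0.521 * baseLog K 𝔣 T + 121 * nK K) + 2 := by field_simp
  rw [h4] at h3
  refine le_trans ?_ h3
  rw [Finset.mul_sum, Finset.mul_sum]
  refine Finset.sum_le_sum fun ρ hρ => ?_
  have hre : r ≤ (ξ - ρ).re := by
    rw [Complex.sub_re, h1]; linarith [hL.re_zero_le hGL (hZ ρ hρ).2]
  have hd : 0 < ‖ξ - ρ‖ := lt_of_lt_of_le (hr.trans_le hre) (Complex.re_le_norm _)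
  have e1 : (1 / (ξ - ρ)).re = (ξ - ρ).re / ‖ξ - ρ‖ ^ 2 := by
    rw [one_div, Complex.inv_re, Complex.sq_norm]
  have e2 : ‖(r : ℂ) / (ξ - ρ)‖ ^ 2 = r * (r / ‖ξ - ρ‖ ^ 2) := by
    rw [norm_div, Complex.norm_of_nonneg hr.le]; ring
  have h5 : 0.74 ≤ 1 - ‖ξ - ρ‖ ^ 2 / 0.9801 := by
    have h6 := pow_le_pow_left₀ hd.le (hZ ρ hρ).1 2
    have : ‖ξ - ρ‖ ^ 2 / 0.9801 ≤ 0.26 := by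
      rw [div_le_iff₀ (by norm_num)]; norm_num at h6 ⊢; linarith
    linarith
  have h7 : r / ‖ξ - ρ‖ ^ 2 ≤ (ξ - ρ).re / ‖ξ - ρ‖ ^ 2 :=
    div_le_div_of_nonneg_right hre (by positivity)
  have h8 : r / ‖ξ - ρ‖ ^ 2 * 0.74 ≤ (1 / (ξ - ρ)).re * (1 - ‖ξ - ρ‖ ^ 2 / 0.9801) := by
    rw [e1]; exact mul_le_mul h7 h5 (by norm_num) ((by positivity : (0 : ℝ) ≤ r / ‖ξ - ρ‖ ^ 2).trans h7)
  have h9 := mul_le_mul_of_nonneg_left h8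
    (show 0 ≤ r * (analyticOrderNatAt G ρ : ℝ) by positivity)
  rw [e2]
  nlinarith

end CountZeros

section PowerSums

theorem exists_norm_weighted_sum_pow_ge {Z : Finset ℂ} {m : ℂ → ℕ} {z : ℂ → ℂ}
    (hz : ∀ ρ ∈ Z, z ρ ≠ 0) (hm : ∃ ρ ∈ Z, 1 ≤ m ρ ∧ 1 / 2 ≤ ‖z ρ‖) {M N : ℕ} (hM : 1 ≤ M)
    (hN : N = ∑ ρ ∈ Z, m ρ) :
    ∃ k, M + 1 ≤ k ∧ k ≤ M + N ∧
      (1 / 2 : ℝ) ^ k * ((N : ℝ)⁻¹ * (N / (8 * Real.exp 1 * (M + N))) ^ N) ≤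
        ‖∑ ρ ∈ Z, (m ρ : ℂ) * z ρ ^ k‖ := by
  classical
  obtain ⟨ρ₁, hρ₁, hm₁, hz₁⟩ := hm
  obtain ⟨ρ₀, hρ₀, hmax⟩ := (Z.filter fun ρ => 1 ≤ m ρ).exists_max_image (fun ρ => ‖z ρ‖)
    ⟨ρ₁, Finset.mem_filter.2 ⟨hρ₁, hm₁⟩⟩
  have hq : 1 / 2 ≤ ‖z ρ₀‖ := hz₁.trans (hmax ρ₁ (Finset.mem_filter.2 ⟨hρ₁, hm₁⟩))
  have hq0 : 0 < ‖z ρ₀‖ := by linarith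
  have hqc : (‖z ρ₀‖ : ℂ) ≠ 0 := by exact_mod_cast hq0.ne'
  rw [Finset.mem_filter] at hρ₀
  have hcard : Fintype.card (Σ ρ : Z, Fin (m ρ)) = N := by
    rw [Fintype.card_sigma, hN, ← Finset.sum_coe_sort Z]
    simp
  obtain ⟨k, h1, h2, h3⟩ := exists_norm_sum_pow_ge (ι := Σ ρ : Z, Fin (m ρ))
    (w := fun i => z i.1 / (‖z ρ₀‖ : ℂ)) (fun i => div_ne_zero (hz _ i.1.2) hqc)
    (fun i => by
      rw [norm_div, Complex.norm_real, norm_norm]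
      exact div_le_one_of_le₀ (hmax _ (Finset.mem_filter.2 ⟨i.1.2, i.2.pos⟩)) hq0.le)
    ⟨⟨⟨ρ₀, hρ₀.1⟩, ⟨0, hρ₀.2⟩⟩, by
      rw [norm_div, Complex.norm_real, norm_norm]; exact div_self hq0.ne'⟩ hM
  rw [hcard] at h2 h3
  refine ⟨k, h1, h2, ?_⟩
  have e : ∑ ρ ∈ Z, (m ρ : ℂ) * z ρ ^ k =
      (‖z ρ₀‖ : ℂ) ^ k * ∑ i : (Σ ρ : Z, Fin (m ρ)), (z i.1 / (‖z ρ₀‖ : ℂ)) ^ k := by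
    rw [Fintype.sum_sigma, Finset.mul_sum, ← Finset.sum_coe_sort Z]
    refine Finset.sum_congr rfl fun ρ _ => ?_
    simp only [Finset.sum_const, Finset.card_univ, Fintype.card_fin, nsmul_eq_mul, div_pow]
    field_simp
  rw [e, norm_mul, norm_pow, Complex.norm_real, norm_norm]
  exact mul_le_mul (pow_le_pow_left₀ (by norm_num) hq k) h3 (by positivity) (by positivity)

lemma exp_neg_le_turan {y : ℝ} (hy : 4000 ≤ y) {N M : ℕ} (hN : 1 ≤ N) (hNy : (N : ℝ) ≤ 2.8 * y)
    (hM : (M : ℝ) ≤ 25 * y + 1) :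
    Real.exp (-(15.2 * y)) ≤ (N : ℝ)⁻¹ * (N / (8 * Real.exp 1 * (M + N))) ^ N := by
  have hN0 : (0 : ℝ) < N := by exact_mod_cast hN
  have hN1 : (1 : ℝ) ≤ N := by exact_mod_cast hN
  have hM0 : (0 : ℝ) ≤ M := Nat.cast_nonneg M
  have hE : 8 * 27.81 ≤ Real.exp 4.4 * 2.8 := by
    have h1 := Real.exp_one_gt_d9
    have h2 := Real.quadratic_le_exp_of_nonneg (show (0 : ℝ) ≤ 0.4 by norm_num)
    have h3 : Real.exp 4.4 = Real.exp 1 ^ 4 * Real.exp 0.4 := by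
      rw [← Real.exp_nat_mul, ← Real.exp_add]; norm_num
    have h4 : (2.718 : ℝ) ^ 4 ≤ Real.exp 1 ^ 4 :=
      pow_le_pow_left₀ (by norm_num) (by linarith) 4
    rw [h3]
    norm_num at h2 h4 ⊢
    nlinarith
  have hbase : Real.exp (-(4.4 + 2.8 * y / N)) ≤ N / (8 * Real.exp 1 * (M + N)) := by
    rw [Real.exp_neg, inv_le_comm₀ (Real.exp_pos _) (by positivity), inv_div,
      div_le_iff₀ hN0]
    have h1 : Real.exp (4.4 + 2.8 * y / N) =
        Real.exp 4.4 * (Real.exp 1 * Real.exp (2.8 * y / N - 1)) := by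
      rw [← Real.exp_add, ← Real.exp_add]; congr 1; ring
    have h2 : 2.8 * y / N ≤ Real.exp (2.8 * y / N - 1) := by
      linarith [Real.add_one_le_exp (2.8 * y / N - 1)]
    have h3 : 2.8 * y ≤ Real.exp (2.8 * y / N - 1) * N := (div_le_iff₀ hN0).1 h2
    rw [h1]
    have h4 : Real.exp 4.4 * (2.8 * y) ≤ Real.exp 4.4 * (Real.exp (2.8 * y / N - 1) * N) :=
      mul_le_mul_of_nonneg_left h3 (Real.exp_pos _).le
    have h5 : 8 * ((M : ℝ) + N) ≤ Real.exp 4.4 * (2.8 * y) := by nlinarith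
    calc 8 * Real.exp 1 * ((M : ℝ) + N) = Real.exp 1 * (8 * ((M : ℝ) + N)) := by ring
      _ ≤ Real.exp 1 * (Real.exp 4.4 * (Real.exp (2.8 * y / N - 1) * N)) :=
        mul_le_mul_of_nonneg_left (h5.trans h4) (Real.exp_pos _).le
      _ = _ := by ring
  have hpow := pow_le_pow_left₀ (Real.exp_pos _).le hbase N
  rw [← Real.exp_nat_mul] at hpow
  have hinv : Real.exp (-(0.05 * y)) ≤ (N : ℝ)⁻¹ := by
    rw [Real.exp_neg]
    refine inv_anti₀ hN0 ?_
    have := Real.quadratic_le_exp_of_nonneg (show 0 ≤ 0.05 * y by positivity)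
    nlinarith
  calc Real.exp (-(15.2 * y)) ≤ Real.exp (-(0.05 * y)) * Real.exp (N * -(4.4 + 2.8 * y / N)) := by
        rw [← Real.exp_add, Real.exp_le_exp]
        have : (N : ℝ) * -(4.4 + 2.8 * y / N) = -(4.4 * N + 2.8 * y) := by field_simp
        rw [this]; linarith
    _ ≤ _ := mul_le_mul hinv hpow (Real.exp_pos _).le (by positivity)

lemma tail_le {y : ℝ} (hy : 4000 ≤ y) {k : ℕ} (hk : 25 * y ≤ k) :
    6000 * y ^ 2 * (1 / 3.8) ^ (k + 1) ≤ 1 / 2 * Real.exp (-(15.2 * y)) * (1 / 2) ^ (k + 1) := by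
  have h1 : (1 / 3.8 : ℝ) ^ (k + 1) = (1 / 1.9) ^ (k + 1) * (1 / 2) ^ (k + 1) := by
    rw [← mul_pow]; norm_num
  rw [h1, ← mul_assoc]
  refine mul_le_mul_of_nonneg_right ?_ (by positivity)
  have h2 : (1 / 1.9 : ℝ) ≤ Real.exp (-0.63) := by
    rw [Real.exp_neg, one_div]
    refine inv_anti₀ (Real.exp_pos _) ?_
    have h5 : Real.exp 0.63 = Real.exp 0.21 ^ 3 := by rw [← Real.exp_nat_mul]; norm_num
    have h6 : Real.exp 0.21 ≤ 1.2338 := by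

      have h7 := Real.exp_bound' (show (0 : ℝ) ≤ 0.21 by norm_num) (by norm_num)
        (show 0 < 4 by norm_num)
      norm_num [Finset.sum_range_succ, Nat.factorial] at h7 ⊢
      linarith
    rw [h5]
    exact (pow_le_pow_left₀ (Real.exp_pos _).le h6 3).trans (by norm_num)
  have h3 : (1 / 1.9 : ℝ) ^ (k + 1) ≤ Real.exp (-(15.75 * y)) := by
    refine (pow_le_pow_left₀ (by norm_num) h2 _).trans ?_
    rw [← Real.exp_nat_mul, Real.exp_le_exp]
    push_cast; norm_num; linarith
  have h4 : 12000 * y ^ 2 ≤ Real.exp (0.55 * y) := by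
    have h5 := Real.pow_div_factorial_le_exp (0.55 * y) (by positivity) 4
    refine le_trans ?_ h5
    rw [le_div_iff₀ (by positivity)]
    norm_num [Nat.factorial]
    have : (4000 : ℝ) ^ 2 ≤ y ^ 2 := pow_le_pow_left₀ (by norm_num) hy 2
    nlinarith [mul_le_mul_of_nonneg_left this (sq_nonneg y)]
  calc 6000 * y ^ 2 * (1 / 1.9) ^ (k + 1) ≤ 6000 * y ^ 2 * Real.exp (-(15.75 * y)) :=
        mul_le_mul_of_nonneg_left h3 (by positivity)
    _ ≤ (1 / 2 * Real.exp (0.55 * y)) * Real.exp (-(15.75 * y)) :=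
        mul_le_mul_of_nonneg_right (by linarith) (Real.exp_pos _).le
    _ = 1 / 2 * Real.exp (-(15.2 * y)) := by
        rw [mul_assoc, ← Real.exp_add]; congr 2; ring

end PowerSums

section LargeDerivative
open Metric
open scoped Classical

variable {K : Type*} [Field K] [NumberField K]
variable {𝔣 : Ideal (𝓞 K)} {χ : HeckeChar K 𝔣} {L G : ℂ → ℂ}

lemma iteratedDeriv_poleTerm {c : ℂ} (h1 : c ≠ 1) (h2 : c ≠ -2) (k : ℕ) :
    iteratedDeriv k (fun s => if IsTrivialChar χ then 1 / (s - 1) - 1 / (s + 2) else 0 : ℂ → ℂ) c =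
      (-1) ^ k * k.factorial *
        (if IsTrivialChar χ then ((c - 1) ^ (k + 1))⁻¹ - ((c + 2) ^ (k + 1))⁻¹ else 0) ∧
    ContDiffAt ℂ k (fun s => if IsTrivialChar χ then 1 / (s - 1) - 1 / (s + 2) else 0 : ℂ → ℂ) c := by
  split_ifs
  · have e : (fun s : ℂ => 1 / (s - 1) - 1 / (s + 2)) = fun s => (s - 1)⁻¹ - (s - (-2))⁻¹ := by
      funext s; rw [sub_neg_eq_add, one_div, one_div]
    have d1 : ContDiffAt ℂ k (fun s : ℂ => (s - 1)⁻¹) c :=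
      (contDiffAt_id.sub contDiffAt_const).inv (sub_ne_zero.2 h1)
    have d2 : ContDiffAt ℂ k (fun s : ℂ => (s - (-2))⁻¹) c :=
      (contDiffAt_id.sub contDiffAt_const).inv (sub_ne_zero.2 h2)
    rw [e]
    refine ⟨?_, d1.sub d2⟩
    rw [iteratedDeriv_fun_sub d1 d2, iteratedDeriv_inv_sub, iteratedDeriv_inv_sub,
      sub_neg_eq_add]
    ring
  · refine ⟨?_, contDiffAt_const⟩
    rw [iteratedDeriv_const]; split_ifs <;> simp

lemma norm_poleTerm_le {r : ℝ} (hr : 0 < r) (hr' : r < 1 / 16) {ξ : ℂ} (h1 : ξ.re = 1 + r)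
    (h2 : IsTrivialChar χ → 4 * r ≤ |ξ.im|) (k : ℕ) :
    ‖(r : ℂ) ^ (k + 1) * (if IsTrivialChar χ then ((ξ - 1) ^ (k + 1))⁻¹ - ((ξ + 2) ^ (k + 1))⁻¹
      else 0)‖ ≤ 2 * (1 / 3.8) ^ (k + 1) := by
  split_ifs with hχ
  · have key : ∀ z : ℂ, 3.8 * r ≤ ‖z‖ → ‖(r : ℂ) ^ (k + 1) * (z ^ (k + 1))⁻¹‖ ≤
        (1 / 3.8) ^ (k + 1) := fun z hz => by
      rw [← div_eq_mul_inv, ← div_pow, norm_pow, norm_div, Complex.norm_of_nonneg hr.le]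
      refine pow_le_pow_left₀ (by positivity) ?_ _
      rw [div_le_div_iff₀ (lt_of_lt_of_le (by positivity) hz) (by norm_num)]; linarith
    rw [mul_sub, two_mul]
    refine (norm_sub_le _ _).trans (add_le_add (key _ ?_) (key _ ?_))
    · refine le_trans ?_ (Complex.abs_im_le_norm _)
      simp only [Complex.sub_im, Complex.one_im, sub_zero]; linarith [h2 hχ]
    · refine le_trans ?_ (Complex.re_le_norm _)
      rw [Complex.add_re, h1, Complex.re_ofNat]; linarith
  · rw [mul_zero, norm_zero]; positivity

theorem IsLFun.scaled_expansion (hL : IsLFun χ L) (h𝔣 : 𝔣 ≠ ⊥)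
    (hG : ∀ s : ℂ, -2 < s.re → DifferentiableAt ℂ G s)
    (hGL : ∀ s : ℂ, s ≠ 1 → G s = poleFac χ s * L s) {T r : ℝ} (hT : 0 ≤ T) (hr : 0 < r)
    (hr' : r < 1 / 16) {ξ : ℂ} (h1 : ξ.re = 1 + r) (h2 : |ξ.im| ≤ T)
    (h3 : IsTrivialChar χ → 4 * r ≤ |ξ.im|) :
    ∃ Z : Finset ℂ, (∀ ρ, ρ ∈ Z ↔ ‖ξ - ρ‖ ≤ 1 / 2 ∧ G ρ = 0) ∧
      ∀ k : ℕ, ‖((-1) ^ k * (r : ℂ) ^ (k + 1) / k.factorial) * iteratedDeriv k (logDeriv L) ξ -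
        ∑ ρ ∈ Z, (analyticOrderNatAt G ρ : ℂ) * ((r : ℂ) / (ξ - ρ)) ^ (k + 1)‖ ≤
        8 * (k + 1) * (1.01 * baseLog K 𝔣 T + 15 * nK K + (nK K + 3) / r) * (r / 0.4) ^ (k + 1) +
          2 * (1 / 3.8) ^ (k + 1) := by
  have hn : (1 : ℝ) ≤ nK K := by exact_mod_cast one_le_nK
  have hξ : 1 < ξ.re := by rw [h1]; linarith
  have hX := condLog_nonneg h𝔣 hT
  have hX0 := condLog_nonneg (K := K) (𝔣 := ⊤) top_ne_bot le_rfl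
  have hXb := condLog_add_le (𝔣 := 𝔣) hT
  have hre : ∀ s ∈ ball ξ 2, -2 < s.re := fun s hs => by
    rw [mem_ball, dist_eq_norm] at hs
    have := (abs_le.1 ((Complex.abs_re_le_norm _).trans hs.le)).1
    rw [Complex.sub_re] at this; linarith
  have hup : ∀ s ∈ closedBall ξ 1, ‖G s‖ ≤ Real.exp (1.01 * condLog K 𝔣 T + 13 * nK K) := by
    intro s hs
    rw [mem_closedBall, dist_eq_norm] at hs
    have e1 := abs_le.1 ((Complex.abs_re_le_norm _).trans hs)
    have e2 := (Complex.abs_im_le_norm _).trans hs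
    rw [Complex.sub_re] at e1; rw [Complex.sub_im] at e2
    have e3 := abs_sub_abs_le_abs_sub s.im ξ.im
    refine (hL.norm_entire_le_max h𝔣 hG hGL hT (a := ξ.re) hξ.le (by linarith [e1.1])
      (by linarith)).trans (Real.exp_le_exp.2 ?_)
    have e4 : max (ξ.re - s.re) 0 ≤ 1 := max_le (by linarith [e1.1]) zero_le_one
    have := mul_le_mul_of_nonneg_right (add_le_add_right e4 0.01) hX
    norm_num at this ⊢
    linarith
  have hlo := hL.le_norm_entire hGL hξ
  rw [h1, add_sub_cancel_left] at hlo
  obtain ⟨Z, hZ, hexp⟩ := exists_zeros_expansion (c := ξ)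
    (fun s hs => (hG s (hre s hs)).differentiableWithinAt) hup hlo (by positivity)
  refine ⟨Z, hZ, fun k => ?_⟩
  obtain ⟨hcd, e, he, hk⟩ := hexp k
  have hξ1 : ξ ≠ 1 := fun h => by rw [h] at hξ; norm_num at hξ
  have hξ2 : ξ ≠ -2 := fun h => by rw [h] at hξ; norm_num at hξ
  obtain ⟨hp, hpc⟩ := iteratedDeriv_poleTerm (χ := χ) hξ1 hξ2 k
  have hev : logDeriv L =ᶠ[𝓝 ξ] fun s => logDeriv G s -
      (if IsTrivialChar χ then 1 / (s - 1) - 1 / (s + 2) else 0) := by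
    filter_upwards [(continuous_re.isOpen_preimage _ isOpen_Ioi).mem_nhds hξ] with s hs
    have hs : 1 < s.re := hs
    have hs1 : s ≠ 1 := fun h => by rw [h] at hs; norm_num at hs
    rw [hL.logDeriv_entire hGL (by linarith) hs1 (by rw [hL.2 _ hs]; exact LSer_ne_zero χ hs)]
    ring
  rw [hev.iteratedDeriv_eq, iteratedDeriv_fun_sub hcd hpc, hk, hp]
  have hfac : (k.factorial : ℂ) ≠ 0 := by exact_mod_cast k.factorial_ne_zero
  have hsq : ((-1 : ℂ) ^ k) * (-1) ^ k = 1 := by rw [← mul_pow]; simp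
  have hmain : ((-1) ^ k * (r : ℂ) ^ (k + 1) / k.factorial) *
      ∑ ρ ∈ Z, (analyticOrderNatAt G ρ : ℂ) * ((-1) ^ k * k.factorial * ((ξ - ρ) ^ (k + 1))⁻¹) =
      ∑ ρ ∈ Z, (analyticOrderNatAt G ρ : ℂ) * ((r : ℂ) / (ξ - ρ)) ^ (k + 1) := by
    rw [Finset.mul_sum]
    refine Finset.sum_congr rfl fun ρ _ => ?_
    rw [div_pow, div_eq_mul_inv _ ((ξ - ρ) ^ (k + 1))]
    generalize ((ξ - ρ) ^ (k + 1))⁻¹ = v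
    field_simp
    linear_combination ((r : ℂ) ^ (k + 1) * v * (analyticOrderNatAt G ρ : ℂ)) * hsq
  set q : ℂ := if IsTrivialChar χ then ((ξ - 1) ^ (k + 1))⁻¹ - ((ξ + 2) ^ (k + 1))⁻¹ else 0 with hq
  have hpole : ((-1) ^ k * (r : ℂ) ^ (k + 1) / k.factorial) * ((-1) ^ k * k.factorial * q) =
      (r : ℂ) ^ (k + 1) * q := by
    field_simp
    linear_combination ((r : ℂ) ^ (k + 1) * q) * hsq
  rw [mul_sub, mul_add, hmain, hpole, add_sub_assoc, add_sub_cancel_left]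
  refine (norm_sub_le _ _).trans (add_le_add ?_ (norm_poleTerm_le hr hr' h1 h3 k))
  rw [norm_mul, norm_div, norm_mul, norm_pow, norm_neg, norm_one, one_pow, one_mul, norm_pow,
    Complex.norm_of_nonneg hr.le, Complex.norm_natCast]
  have hf : (0 : ℝ) < k.factorial := by exact_mod_cast k.factorial_pos
  calc r ^ (k + 1) / k.factorial * ‖e‖ ≤ r ^ (k + 1) / k.factorial * ((k + 1).factorial *
        (8 * (1.01 * condLog K 𝔣 T + 13 * nK K + (nK K + 3) / r)) / 0.4 ^ (k + 1)) :=
        mul_le_mul_of_nonneg_left he (by positivity)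
    _ = 8 * (k + 1) * (1.01 * condLog K 𝔣 T + 13 * nK K + (nK K + 3) / r) *
        (r / 0.4) ^ (k + 1) := by
        rw [Nat.factorial_succ, div_pow]; push_cast
        field_simp
    _ ≤ _ := by
        refine mul_le_mul_of_nonneg_right (mul_le_mul_of_nonneg_left ?_ (by positivity))
          (by positivity)
        norm_num; linarith

lemma baseLog_nonneg {T : ℝ} (hT : 0 ≤ T) : 0 ≤ baseLog K 𝔣 T := by
  have h1 := Real.log_natCast_nonneg (DK K)
  have h2 := Real.log_natCast_nonneg (Ideal.absNorm 𝔣)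
  have h3 : 0 ≤ Real.log (T + 3) := Real.log_nonneg (by linarith)
  rw [baseLog]; positivity

lemma IsLFun.one_le_order (hL : IsLFun χ L) (hG : ∀ s : ℂ, -2 < s.re → DifferentiableAt ℂ G s)
    (hGL : ∀ s : ℂ, s ≠ 1 → G s = poleFac χ s * L s) {ρ : ℂ} (hρ : -2 < ρ.re) (h0 : G ρ = 0) :
    1 ≤ analyticOrderNatAt G ρ := by
  have h2 : G 2 ≠ 0 := fun h => by
    have := hL.le_norm_entire hGL (s := 2) (by norm_num)
    rw [h, norm_zero] at this
    exact absurd this (not_le.2 (Real.exp_pos _))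
  obtain ⟨H, -, hH, hGH⟩ := exists_prod_mul (isOpen_Ioi.preimage continuous_re)
    (convex_halfSpace_re_gt (-2)).isPreconnected
    (fun s hs => (hG s hs).differentiableWithinAt) ⟨2, by norm_num, h2⟩ {ρ} (by simpa using hρ)
  by_contra hlt
  have e := hGH ρ hρ
  rw [Finset.prod_singleton, Nat.lt_one_iff.1 (not_le.1 hlt), pow_zero, one_mul, h0] at e
  exact hH ρ (Finset.mem_singleton_self ρ) e.symm

lemma remainder_le {X n r ℒ y : ℝ} (hr : 0 < r) (hr' : r < 1 / 16) (hX : 0 ≤ X) (hn : 1 ≤ n)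
    (hℒ : X + 240 * n ≤ ℒ) (hy : r * ℒ ≤ y) {k : ℕ} (hk1 : 1 ≤ k) (hk : (k : ℝ) + 1 ≤ 28.8 * y) :
    8 * ((k : ℝ) + 1) * (1.01 * X + 15 * n + (n + 3) / r) * (r / 0.4) ^ (k + 1) ≤
      1700 * y ^ 2 * (1 / 3.8) ^ (k + 1) := by
  have hk0 : (0 : ℝ) ≤ k := Nat.cast_nonneg k
  have h1 : (1.01 * X + 15 * n + (n + 3) / r) * r ^ 2 ≤ 0.08 * y := by
    have e : (1.01 * X + 15 * n + (n + 3) / r) * r ^ 2 =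
        r * (r * (1.01 * X + 15 * n) + (n + 3)) := by field_simp
    rw [e]
    have h2 : r * (1.01 * X + 15 * n) + (n + 3) ≤ 0.08 * ℒ := by
      have := mul_le_mul_of_nonneg_right hr'.le (show 0 ≤ 1.01 * X + 15 * n by positivity)
      norm_num at this ⊢
      linarith
    nlinarith [mul_le_mul_of_nonneg_left h2 hr.le]
  obtain ⟨j, rfl⟩ : ∃ j, k = j + 1 := ⟨k - 1, by omega⟩
  have h2 : (r / 0.4) ^ (j + 1 + 1) ≤ r ^ 2 * (91 * (1 / 3.8) ^ (j + 1 + 1)) := by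
    have h3 : (r / 0.4) ^ j ≤ (1 / 3.8) ^ j :=
      pow_le_pow_left₀ (by positivity) (by rw [div_le_div_iff₀] <;> norm_num; linarith) j
    calc (r / 0.4) ^ (j + 1 + 1) = 6.25 * r ^ 2 * (r / 0.4) ^ j := by
          rw [pow_succ, pow_succ]; ring
      _ ≤ 6.25 * r ^ 2 * (1 / 3.8) ^ j := mul_le_mul_of_nonneg_left h3 (by positivity)
      _ ≤ _ := by
        have : (1 / 3.8 : ℝ) ^ j = 14.44 * (1 / 3.8) ^ (j + 1 + 1) := by
          rw [pow_succ, pow_succ]; ring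
        rw [this]
        generalize hQ : (1 / 3.8 : ℝ) ^ (j + 1 + 1) = Q
        have hQ0 : 0 ≤ Q := hQ ▸ by positivity
        nlinarith [mul_nonneg (sq_nonneg r) hQ0]
  have hy0 : 0 ≤ y := by linarith
  set P := (1 / 3.8 : ℝ) ^ (j + 1 + 1) with hP
  have hP0 : 0 ≤ P := by positivity
  calc 8 * (((j + 1 : ℕ) : ℝ) + 1) * (1.01 * X + 15 * n + (n + 3) / r) * (r / 0.4) ^ (j + 1 + 1)
      ≤ 8 * (((j + 1 : ℕ) : ℝ) + 1) * (1.01 * X + 15 * n + (n + 3) / r) * (r ^ 2 * (91 * P)) :=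
        mul_le_mul_of_nonneg_left h2 (by positivity)
    _ = 8 * (((j + 1 : ℕ) : ℝ) + 1) * (((1.01 * X + 15 * n + (n + 3) / r) * r ^ 2) * (91 * P)) := by
        ring
    _ ≤ 8 * (28.8 * y) * ((0.08 * y) * (91 * P)) := by gcongr
    _ ≤ 1700 * y ^ 2 * P := by nlinarith [mul_nonneg (sq_nonneg y) hP0]

theorem IsLFun.exists_large_derivative (hL : IsLFun χ L) (h𝔣 : 𝔣 ≠ ⊥) {T r ℒ φ : ℝ} (hT : 0 ≤ T)
    (hr : 0 < r) (hr' : r < 1 / 16) {ξ : ℂ} (h1 : ξ.re = 1 + r) (h2 : |ξ.im| ≤ T)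
    (h3 : IsTrivialChar χ → 4 * r ≤ |ξ.im|) (hℒ : baseLog K 𝔣 T + 240 * nK K ≤ ℒ)
    (hR : 4000 ≤ r * ℒ) (hφ : 1 + 231 * r ^ 2 ≤ φ) {ρ : ℂ} (hρ : L ρ = 0) (hρ1 : ρ ≠ 1)
    (hρr : ‖ξ - ρ‖ ≤ 2 * r) :
    ∃ k : ℕ, 25 * (φ * r * ℒ) ≤ k ∧ (k : ℝ) ≤ 28.8 * (φ * r * ℒ) ∧
      1 / 2 * Real.exp (-(15.2 * (φ * r * ℒ))) * (1 / 2) ^ (k + 1) ≤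
        ‖((-1) ^ k * (r : ℂ) ^ (k + 1) / k.factorial) * iteratedDeriv k (logDeriv L) ξ‖ := by
  obtain ⟨G, hG, hGL⟩ := hL.exists_entire h𝔣
  have hn : (1 : ℝ) ≤ nK K := by exact_mod_cast one_le_nK
  have hX := baseLog_nonneg (K := K) (𝔣 := 𝔣) hT
  have hyR : r * ℒ ≤ φ * r * ℒ := by nlinarith [sq_nonneg r]
  set y := φ * r * ℒ with hy
  have hy4 : 4000 ≤ y := hR.trans hyR
  obtain ⟨Z, hZ, hexp⟩ := hL.scaled_expansion h𝔣 hG hGL hT hr hr' h1 h2 h3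
  set z : ℂ → ℂ := fun ρ => (r : ℂ) / (ξ - ρ) with hz
  set Z₁ := Z.filter fun ρ => ‖ξ - ρ‖ ≤ 3.8 * r with hZ₁
  set Z₂ := Z.filter fun ρ => ¬ ‖ξ - ρ‖ ≤ 3.8 * r with hZ₂
  have hmem₁ : ∀ σ ∈ Z₁, ‖ξ - σ‖ ≤ 3.8 * r ∧ G σ = 0 := fun σ hσ =>
    ⟨(Finset.mem_filter.1 hσ).2, ((hZ σ).1 (Finset.mem_filter.1 hσ).1).2⟩
  have hre : ∀ σ, G σ = 0 → r ≤ (ξ - σ).re := fun σ hσ => by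
    rw [Complex.sub_re, h1]; linarith [hL.re_zero_le hGL hσ]
  have hΛ : r * (0.521 * baseLog K 𝔣 T + 121 * nK K) + 2 ≤ 0.522 * (r * ℒ) := by
    have h4 : 0.521 * baseLog K 𝔣 T + 121 * nK K ≤ 0.521 * ℒ := by linarith
    nlinarith [mul_le_mul_of_nonneg_left h4 hr.le]
  have hGρ : G ρ = 0 := by rw [hGL ρ hρ1, hρ, mul_zero]
  have hρZ : ρ ∈ Z₁ := Finset.mem_filter.2 ⟨(hZ ρ).2 ⟨by linarith, hGρ⟩, by linarith⟩
  have hdρ : 0 < ‖ξ - ρ‖ := lt_of_lt_of_le (hr.trans_le (hre ρ hGρ)) (Complex.re_le_norm _)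
  have hmρ : 1 ≤ analyticOrderNatAt G ρ := hL.one_le_order hG hGL (by
    have := (Complex.re_le_norm _).trans hρr
    rw [Complex.sub_re] at this; linarith) hGρ
  have hzρ : 1 / 2 ≤ ‖z ρ‖ := by
    rw [hz]; simp only [norm_div, Complex.norm_of_nonneg hr.le]
    rw [div_le_div_iff₀ (by norm_num) hdρ]; linarith
  set N := ∑ σ ∈ Z₁, analyticOrderNatAt G σ with hN
  have hN1 : 1 ≤ N := hmρ.trans
    (Finset.single_le_sum (f := fun σ => analyticOrderNatAt G σ) (fun _ _ => Nat.zero_le _) hρZ)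
  have hr2 : r ^ 2 ≤ 1 / 256 := by nlinarith
  have hNy : (N : ℝ) ≤ 2.8 * y := by
    have h4 := (hL.card_zeros_le h𝔣 hG hGL hT hr hr' h1 h2 Z₁ hmem₁).trans hΛ
    rw [← Nat.cast_sum, ← hN] at h4
    have h5 : 1 ≤ φ * (1 - 37 * r ^ 2) := by
      have h7 := mul_le_mul_of_nonneg_right hφ (show 0 ≤ 1 - 37 * r ^ 2 by linarith)
      nlinarith [mul_nonneg (sq_nonneg r) (show 0 ≤ 1 / 256 - r ^ 2 by linarith)]
    have h6 : 0 ≤ φ := by nlinarith [sq_nonneg r]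
    have h8 := mul_le_mul_of_nonneg_left h4 h6
    have h9 := mul_le_mul_of_nonneg_left h5 (Nat.cast_nonneg (α := ℝ) N)
    have h10 : φ * (0.522 * (r * ℒ)) = 0.522 * y := by rw [hy]; ring
    norm_num at h8 h9 h10 ⊢
    nlinarith
  set M := ⌈25 * y⌉₊ with hM
  have hM1 : 25 * y ≤ M := Nat.le_ceil _
  have hM2 : (M : ℝ) ≤ 25 * y + 1 := (Nat.ceil_lt_add_one (by linarith)).le
  have hM3 : 1 ≤ M := Nat.one_le_cast.1 (by linarith : (1 : ℝ) ≤ M)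
  obtain ⟨j, hj1, hj2, hj⟩ := exists_norm_weighted_sum_pow_ge (z := z)
    (fun σ hσ => div_ne_zero (by exact_mod_cast hr.ne') fun h => by
      have := hre σ (hmem₁ σ hσ).2
      rw [h, Complex.zero_re] at this; linarith) ⟨ρ, hρZ, hmρ, hzρ⟩ hM3 hN
  obtain ⟨k, rfl⟩ : ∃ k, j = k + 1 := ⟨j - 1, by omega⟩
  have hMk : (M : ℝ) ≤ k := by exact_mod_cast (by omega : M ≤ k)
  have hk1 : 25 * y ≤ k := hM1.trans hMk
  have hk2 : (k : ℝ) + 1 ≤ M + N := by exact_mod_cast hj2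
  refine ⟨k, hk1, by linarith, ?_⟩
  have hT1 := (mul_le_mul_of_nonneg_left (exp_neg_le_turan hy4 hN1 hNy hM2)
    (by positivity : (0 : ℝ) ≤ (1 / 2) ^ (k + 1))).trans hj
  have hk1' : 1 ≤ k := Nat.one_le_cast.1 (by linarith : (1 : ℝ) ≤ k)
  have hrem := remainder_le hr hr' hX hn hℒ hyR hk1' (by linarith)
  have htail : ‖∑ σ ∈ Z₂, (analyticOrderNatAt G σ : ℂ) * z σ ^ (k + 1)‖ ≤
      11 * y * (1 / 3.8) ^ (k + 1) := by
    have h4 := (hL.sum_inv_sq_le h𝔣 hG hGL hT hr h1 h2 Z₂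
      fun σ hσ => (hZ σ).1 (Finset.mem_filter.1 hσ).1).trans hΛ
    have h5 : ‖∑ σ ∈ Z₂, (analyticOrderNatAt G σ : ℂ) * z σ ^ (k + 1)‖ ≤
        (1 / 3.8) ^ (k - 1) * ∑ σ ∈ Z₂, (analyticOrderNatAt G σ : ℝ) * ‖(r : ℂ) / (ξ - σ)‖ ^ 2 := by
      rw [Finset.mul_sum]
      refine (norm_sum_le _ _).trans (Finset.sum_le_sum fun σ hσ => ?_)
      have hd := not_le.1 (Finset.mem_filter.1 hσ).2
      have hzσ : ‖z σ‖ ≤ 1 / 3.8 := by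
        rw [hz]; simp only [norm_div, Complex.norm_of_nonneg hr.le]
        rw [div_le_div_iff₀ (lt_of_le_of_lt (by positivity) hd) (by norm_num)]; linarith
      have hk3 : k + 1 = (k - 1) + 2 := by omega
      rw [norm_mul, Complex.norm_natCast, norm_pow, hk3, pow_add, mul_left_comm]
      exact mul_le_mul_of_nonneg_right (pow_le_pow_left₀ (norm_nonneg _) hzσ _) (by positivity)
    have h6 : (1 / 3.8 : ℝ) ^ (k - 1) = 14.44 * (1 / 3.8) ^ (k + 1) := by
      obtain ⟨i, rfl⟩ : ∃ i, k = i + 1 := ⟨k - 1, by omega⟩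
      rw [Nat.add_sub_cancel, pow_succ, pow_succ]; ring
    rw [h6] at h5
    refine h5.trans ?_
    have hP : 0 ≤ (1 / 3.8 : ℝ) ^ (k + 1) := by positivity
    rw [mul_right_comm]
    refine mul_le_mul_of_nonneg_right ?_ hP
    norm_num at h4 ⊢
    linarith
  have hmain : ∑ σ ∈ Z, (analyticOrderNatAt G σ : ℂ) * z σ ^ (k + 1) =
      ∑ σ ∈ Z₁, (analyticOrderNatAt G σ : ℂ) * z σ ^ (k + 1) +
      ∑ σ ∈ Z₂, (analyticOrderNatAt G σ : ℂ) * z σ ^ (k + 1) :=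
    (Finset.sum_filter_add_sum_filter_not Z _ _).symm
  have hE := hexp k
  rw [hmain] at hE
  set S₁ := ∑ σ ∈ Z₁, (analyticOrderNatAt G σ : ℂ) * z σ ^ (k + 1)
  set S₂ := ∑ σ ∈ Z₂, (analyticOrderNatAt G σ : ℂ) * z σ ^ (k + 1)
  set W := ((-1) ^ k * (r : ℂ) ^ (k + 1) / k.factorial) * iteratedDeriv k (logDeriv L) ξ
  have htri : ‖S₁‖ ≤ ‖W‖ + ‖W - (S₁ + S₂)‖ + ‖S₂‖ := by
    have e : S₁ = W - (W - (S₁ + S₂)) - S₂ := by ring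
    calc ‖S₁‖ = ‖W - (W - (S₁ + S₂)) - S₂‖ := by rw [← e]
      _ ≤ _ := (norm_sub_le _ _).trans (add_le_add_left (norm_sub_le _ _) _)
  have hfin := tail_le hy4 hk1
  have hP : 0 ≤ (1 / 3.8 : ℝ) ^ (k + 1) := by positivity
  have hpoly : 1700 * y ^ 2 * (1 / 3.8) ^ (k + 1) + 2 * (1 / 3.8) ^ (k + 1) +
      11 * y * (1 / 3.8) ^ (k + 1) ≤ 6000 * y ^ 2 * (1 / 3.8) ^ (k + 1) := by
    rw [← add_mul, ← add_mul]
    exact mul_le_mul_of_nonneg_right (by nlinarith) hP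
  linarith

end LargeDerivative

section Reduction
open IsDedekindDomain
open scoped Classical

variable {K : Type*} [Field K] [NumberField K]
variable {𝔮 𝔣 : Ideal (𝓞 K)} {χ : HeckeChar K 𝔮} {χ' : HeckeChar K 𝔣} {L L' : ℂ → ℂ}

lemma not_isCoprime_iff (h𝔮 : 𝔮 ≠ ⊥) {𝔞 : Ideal (𝓞 K)} :
    ¬ IsCoprime 𝔞 𝔮 ↔ ∃ p : HeightOneSpectrum (𝓞 K), p.asIdeal ∣ 𝔮 ∧ p.asIdeal ∣ 𝔞 := by
  simp only [Ideal.isCoprime_iff_sup_eq, Ideal.dvd_iff_le]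
  constructor
  · intro h
    obtain ⟨M, hM, h1⟩ := Ideal.exists_le_maximal _ h
    have h2 := le_sup_right.trans h1
    exact ⟨⟨M, hM.isPrime, ne_bot_of_le_ne_bot h𝔮 h2⟩, h2, le_sup_left.trans h1⟩
  · rintro ⟨p, h1, h2⟩ h
    exact p.isPrime.ne_top (top_le_iff.1 (h ▸ sup_le h2 h1))

lemma Induces.prod_mul_LSer (h : Induces χ' χ) (h𝔮 : 𝔮 ≠ ⊥) {s : ℂ} (hs : 1 < s.re) :
    (∏ p ∈ (Ideal.finite_factors h𝔮).toFinset,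
      (1 - χ'.toFun p.asIdeal * (Ideal.absNorm p.asIdeal : ℂ) ^ (-s))) * LSer χ' s = LSer χ s := by
  refine (tsum_sieve (h := fun 𝔞 => χ'.toFun 𝔞 * (Ideal.absNorm 𝔞 : ℂ) ^ (-s))
    (LSer_term_mul χ' s) (summable_LSer χ' hs) _).trans (tsum_congr fun a => ?_)
  by_cases ha : IsCoprime a.1 𝔮
  · rw [if_pos, h.2 _ ha]
    intro p hp hpa
    exact (not_isCoprime_iff h𝔮).2 ⟨p, by simpa using hp, hpa⟩ ha
  · obtain ⟨p, hp, hpa⟩ := (not_isCoprime_iff h𝔮).1 ha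
    rw [if_neg, χ.eq_zero' _ ha, zero_mul]
    intro h1
    exact h1 p (by simpa using hp) hpa

lemma Induces.zero_of_zero (h : Induces χ' χ) (h𝔮 : 𝔮 ≠ ⊥) (hL : IsLFun χ L)
    (hL' : IsLFun χ' L') {ρ : ℂ} (h0 : L ρ = 0) (h1 : 0 < ρ.re) (h2 : ρ.re < 1) : L' ρ = 0 := by
  have hN : ∀ p : HeightOneSpectrum (𝓞 K), (Ideal.absNorm p.asIdeal : ℂ) ≠ 0 := fun p => by
    have := two_le_absNorm p
    exact_mod_cast (by omega : Ideal.absNorm p.asIdeal ≠ 0)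
  have hρ : ρ ≠ 1 := fun e => by simp [e] at h2
  have key := eqOn_of_eq_of_one_lt_re (f := fun s => (∏ p ∈ (Ideal.finite_factors h𝔮).toFinset,
      (1 - χ'.toFun p.asIdeal * (Ideal.absNorm p.asIdeal : ℂ) ^ (-s))) * L' s) (g := L)
    (s := {1}) (Set.finite_singleton _) (by simp) (fun z hz => by
      refine DifferentiableAt.fun_mul ?_ (hL'.1 z hz)
      refine (Differentiable.fun_finsetProd fun p _ => ?_) z
      refine Differentiable.const_sub (Differentiable.const_mul ?_ _) _
      exact (differentiable_id.neg).const_cpow (Or.inl (hN p))) (fun z hz => hL.1 z hz)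
    (fun z hz => by
      rw [hL'.2 z hz, hL.2 z hz, h.prod_mul_LSer h𝔮 hz]) ρ hρ
  rw [h0, mul_eq_zero] at key
  refine key.resolve_left (Finset.prod_ne_zero_iff.2 fun p _ e => ?_)
  have h3 := norm_LSer_term_le χ' ⟨p.asIdeal, p.ne_bot⟩ ρ
  dsimp only at h3
  rw [← sub_eq_zero.1 e, norm_one] at h3
  have h4 : (1 : ℝ) < Ideal.absNorm p.asIdeal := by exact_mod_cast two_le_absNorm p
  linarith [Real.rpow_lt_one_of_one_lt_of_neg h4 (neg_lt_zero.2 h1)]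

lemma IsLFun.ne_zero_of_bot (h𝔮 : 𝔮 = ⊥) (hL : IsLFun χ L) {s : ℂ} (hs : s ≠ 1) : L s ≠ 0 := by
  have h := eqOn_of_eq_of_one_lt_re (f := L) (g := fun _ => 1) (s := {1}) (Set.finite_singleton _)
    (by simp) (fun z hz => hL.1 z hz) (fun z _ => differentiableAt_const _) (fun z hz => by
      rw [hL.2 z hz, LSer, tsum_eq_single ⟨⊤, top_ne_bot⟩]
      · simp [χ.apply_top]
      · intro a ha
        rw [χ.eq_zero', zero_mul]
        intro hc
        rw [h𝔮, Ideal.isCoprime_iff_sup_eq, sup_bot_eq] at hc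
        exact ha (Subtype.ext hc)) s hs
  rw [h]; exact one_ne_zero

lemma absNorm_le_QH (h𝔮 : 𝔮 ≠ ⊥) {H : CongClassGroup K 𝔮} (hχ : CharTrivOn χ H)
    (hc : IsConductor χ 𝔣) : Ideal.absNorm 𝔣 ≤ QH H := by
  refine le_csSup ⟨Ideal.absNorm 𝔮, ?_⟩ ⟨χ, 𝔣, hχ, hc, rfl⟩
  rintro n ⟨ψ, 𝔤, -, ⟨⟨ψ', h⟩, -⟩, rfl⟩
  exact Nat.le_of_dvd (Nat.pos_of_ne_zero (by rwa [Ne, Ideal.absNorm_eq_zero_iff]))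
    (Ideal.absNorm_dvd_absNorm_of_le h.1)

lemma Induces.isTrivialChar (h : Induces χ' χ) (ht : IsTrivialChar χ') : IsTrivialChar χ := by
  intro a ha
  rw [h.2 a ha]
  refine ht a ?_
  rw [Ideal.isCoprime_iff_sup_eq] at ha ⊢
  exact top_le_iff.1 (ha ▸ sup_le_sup_left h.1 a)

end Reduction

/-- **A large derivative** (Lemma 5.2). With `F(s) = L'/L(s,χ*)`, `ξ = 1+r+iτ`: if `χ(H)=1`
is induced by the primitive `χ* (mod 𝔣_χ)`, `T ≥ 1`, `R` sufficiently large, `0 < r₀ < 1/16`,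
`R/ℒ ≤ r < r₀`, `|τ| ≤ T`, `L(s,χ)` has a non-trivial zero `ρ` with `|1+iτ-ρ| ≤ r`,
`ε ∈ (0,1/4)` and `r₀ < ε/3.8`, then
`δ(χ) 1_{|τ|<4r} + |(-1)^k r^{k+1}/k! ⬝ F^{(k)}(ξ)| ≫ e^{-16.6 φ r ℒ}/2^{k+1}`
for some integer `k` with `25.0 φ r ℒ ≤ k ≤ 28.8 φ r ℒ`, where `φ = 1+(4/π)ε+16ε²`. -/
theorem big_derivative :
    ∃ Θ R₀ c : ℝ, 1 ≤ Θ ∧ 1 ≤ R₀ ∧ 0 < c ∧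
      ∀ (K : Type) [Field K] [NumberField K] (𝔮 𝔣 : Ideal (𝓞 K))
        (H : CongClassGroup K 𝔮) (χ : HeckeChar K 𝔮) (χstar : HeckeChar K 𝔣)
        (Lχ Lstar : ℂ → ℂ) (ε r r₀ τ T : ℝ) (ρ : ℂ),
        CharTrivOn χ H → IsConductor χ 𝔣 → Induces χstar χ → IsPrimitiveChar χstar →
        IsLFun χ Lχ → IsLFun χstar Lstar →
        1 ≤ T → 0 < r₀ → r₀ < 1 / 16 → 0 < ε → ε < 1 / 4 → r₀ < ε / 3.8 →
        let ℒ : ℝ := 2 * Real.log (DK K : ℝ) + Real.log (QH H : ℝ) +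
          (nK K : ℝ) * Real.log (T + 3) + Θ * (nK K : ℝ);
        let φ : ℝ := 1 + (4 / Real.pi) * ε + 16 * ε ^ 2;
        R₀ / ℒ ≤ r → r < r₀ → |τ| ≤ T →
        Lχ ρ = 0 → 0 < ρ.re → ρ.re < 1 →
        ‖1 + Complex.I * (τ : ℂ) - ρ‖ ≤ r →
        ∃ k : ℕ, 25.0 * φ * r * ℒ ≤ (k : ℝ) ∧ (k : ℝ) ≤ 28.8 * φ * r * ℒ ∧
          c * Real.exp (-16.6 * φ * r * ℒ) / 2 ^ (k + 1) ≤
            delta χ * (if |τ| < 4 * r then (1 : ℝ) else 0) +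
            ‖((-1) ^ k * (r : ℂ) ^ (k + 1) / (k.factorial : ℂ)) *
              iteratedDeriv k (logDeriv Lstar) (1 + (r : ℂ) + Complex.I * (τ : ℂ))‖ := by
  refine ⟨240, 4000, 1 / 2, by norm_num, by norm_num, by norm_num, ?_⟩
  intro K _ _ 𝔮 𝔣 H χ χstar Lχ Lstar ε r r₀ τ T ρ hχH hcond hind _ hLχ hLs hT hr₀ hr₀' hε hε' hrε
    ℒ φ hrℒ hrr₀ hτ h0 hρ0 hρ1 hρr
  have hρ : ρ ≠ 1 := fun e => by simp [e] at hρ1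
  have h𝔮 : 𝔮 ≠ ⊥ := fun e => hLχ.ne_zero_of_bot e hρ h0
  have h𝔣 : 𝔣 ≠ ⊥ := ne_bot_of_le_ne_bot h𝔮 hind.1
  have hN𝔣 : (0 : ℝ) < Ideal.absNorm 𝔣 := by
    exact_mod_cast Nat.pos_of_ne_zero (by rwa [Ne, Ideal.absNorm_eq_zero_iff])
  have hbase : baseLog K 𝔣 T + 240 * nK K ≤ ℒ := by
    have := Real.log_le_log hN𝔣 (Nat.cast_le.2 (absNorm_le_QH h𝔮 hχH hcond))
    simp only [ℒ, baseLog]; linarith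
  have hn : (1 : ℝ) ≤ nK K := by exact_mod_cast one_le_nK
  have hℒ0 : 0 < ℒ := by linarith [baseLog_nonneg (K := K) (𝔣 := 𝔣) (zero_le_one.trans hT)]
  have hrl : 4000 ≤ r * ℒ := (div_le_iff₀ hℒ0).1 hrℒ
  have hr : 0 < r := (div_pos (by norm_num) hℒ0).trans_le hrℒ
  have hφ : 1 + 231 * r ^ 2 ≤ φ := by
    have h1 : 0 ≤ 4 / Real.pi * ε := by positivity
    have h2 : 3.8 * r ≤ ε := by
      have := (lt_div_iff₀ (by norm_num)).1 (hrr₀.trans hrε); linarith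
    have h3 : (3.8 * r) ^ 2 ≤ ε ^ 2 := by gcongr
    simp only [φ]; nlinarith [sq_nonneg r]
  obtain ⟨y, hy⟩ : ∃ y, y = φ * r * ℒ := ⟨_, rfl⟩
  have hy4 : 4000 ≤ y := by
    rw [hy, mul_assoc]; nlinarith [sq_nonneg r]
  have e1 : 25.0 * φ * r * ℒ = 25 * y := by rw [hy]; norm_num; ring
  have e2 : 28.8 * φ * r * ℒ = 28.8 * y := by rw [hy]; ring
  have e3 : -16.6 * φ * r * ℒ = -16.6 * y := by rw [hy]; ring
  rw [e1, e2, e3]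
  have hδ : 0 ≤ delta χ * (if |τ| < 4 * r then (1 : ℝ) else 0) := by
    rw [delta]; split_ifs <;> simp
  by_cases hc : IsTrivialChar χstar ∧ |τ| < 4 * r
  · refine ⟨⌈25 * y⌉₊, Nat.le_ceil _, ?_, ?_⟩
    · have := Nat.ceil_lt_add_one (by linarith : 0 ≤ 25 * y)
      linarith
    · rw [delta, if_pos (hind.isTrivialChar hc.1), if_pos hc.2, mul_one]
      refine le_add_of_le_of_nonneg ?_ (norm_nonneg _)
      refine div_le_one_of_le₀ ?_ (by positivity)
      have h1 : Real.exp (-16.6 * y) ≤ 1 := Real.exp_le_one_iff.2 (by linarith)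
      have h2 : (1 : ℝ) ≤ 2 ^ (⌈25 * y⌉₊ + 1) := one_le_pow₀ (by norm_num)
      linarith
  · have him : (1 + (r : ℂ) + Complex.I * (τ : ℂ)).im = τ := by simp
    obtain ⟨k, hk1, hk2, hk⟩ := hLs.exists_large_derivative h𝔣 (T := T) (r := r) (ℒ := ℒ) (φ := φ)
      (ξ := 1 + (r : ℂ) + Complex.I * (τ : ℂ)) (ρ := ρ) (by linarith) hr (by linarith)
      (by simp) (by rwa [him])
      (fun ht => by rw [him]; exact not_lt.1 fun h => hc ⟨ht, h⟩) hbase hrl hφ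
      (hind.zero_of_zero h𝔮 hLχ hLs h0 hρ0 hρ1) hρ (by
        calc _ = ‖(r : ℂ) + (1 + Complex.I * (τ : ℂ) - ρ)‖ := by congr 1; ring
          _ ≤ ‖(r : ℂ)‖ + ‖1 + Complex.I * (τ : ℂ) - ρ‖ := norm_add_le _ _
          _ ≤ _ := by rw [Complex.norm_of_nonneg hr.le]; linarith)
    rw [← hy] at hk1 hk2 hk
    refine ⟨k, hk1, hk2, le_add_of_nonneg_of_le hδ (le_trans ?_ hk)⟩
    rw [one_div_pow, div_eq_mul_one_div]
    gcongr
    linarith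


end RTZ
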